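/- Let (u, p) be a weak solution of the HHMO model with u* < Ψ(α). Assume p satisfies condition (P) and that for almost every η ≥ 0 the limit V(η) = lim_{t→∞} u(η√t, t) exists. Then the limits γ = lim_{x→∞} (1/x)·∫₀ˣ ξ²·p*(ξ) dξ and lim_{x→∞} x·∫_x^∞ p*(ξ) dξ exist and are equal, V(η) = Φ_γ(η) for almost every η ≥ 0, and u converges uniformly to Φ_γ. Furthermore, Φ_γ(α) = u* if γ > 0, and 0 < Φ_γ(α) ≤ u* if γ = 0. -/

import Mathlib

open MeasureTheory Filter Set

noncomputable section

/-- The precipitation-free self-similar solution `ψ(x,t)`. -/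
def psi (α β x t : ℝ) : ℝ :=
  if 0 < t then
    (α * β / 2) * Real.exp (α ^ 2 / 4) *
      ∫ ζ in Set.Ioi (max (|x| / Real.sqrt t) α), Real.exp (-ζ ^ 2 / 4)
  else 0

/-- The profile `Ψ(η)` in similarity coordinates. -/
def PsiP (α β η : ℝ) : ℝ :=
  (α * β / 2) * Real.exp (α ^ 2 / 4) * ∫ ζ in Set.Ioi (max η α), Real.exp (-ζ ^ 2 / 4)

/-- Regularity of a weak solution: `w` is the spatial derivative of `u - ψ`;
both are continuous on `ℝ × [0,∞)` and bounded on `ℝ × [0,T]` for every `T > 0`. -/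
def AuxReg (α β : ℝ) (u w : ℝ → ℝ → ℝ) : Prop :=
  (∀ t ∈ Set.Ici (0:ℝ), ∀ x : ℝ, HasDerivAt (fun y => u y t - psi α β y t) (w x t) x) ∧
  ContinuousOn (fun q : ℝ × ℝ => u q.1 q.2 - psi α β q.1 q.2) (Set.univ ×ˢ Set.Ici 0) ∧
  ContinuousOn (fun q : ℝ × ℝ => w q.1 q.2) (Set.univ ×ˢ Set.Ici 0) ∧
  ∀ T > (0:ℝ), ∃ C : ℝ, ∀ x : ℝ, ∀ t ∈ Set.Icc (0:ℝ) T,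
    |u x t - psi α β x t| ≤ C ∧ |w x t| ≤ C

/-- A test function of class `C^{1,1}(ℝ × [0,T])`, vanishing for large `|x|` and at `t = T`,
together with its partial derivatives `φt`, `φx`. -/
def IsTestFun (T : ℝ) (φ φt φx : ℝ → ℝ → ℝ) : Prop :=
  (∀ x : ℝ, ∀ t ∈ Set.Icc (0:ℝ) T,
    HasDerivWithinAt (fun s => φ x s) (φt x t) (Set.Icc 0 T) t) ∧
  (∀ x : ℝ, ∀ t ∈ Set.Icc (0:ℝ) T, HasDerivAt (fun y => φ y t) (φx x t) x) ∧
  ContinuousOn (fun q : ℝ × ℝ => φ q.1 q.2) (Set.univ ×ˢ Set.Icc 0 T) ∧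
  ContinuousOn (fun q : ℝ × ℝ => φt q.1 q.2) (Set.univ ×ˢ Set.Icc 0 T) ∧
  ContinuousOn (fun q : ℝ × ℝ => φx q.1 q.2) (Set.univ ×ˢ Set.Icc 0 T) ∧
  (∃ R : ℝ, ∀ x : ℝ, ∀ t ∈ Set.Icc (0:ℝ) T, R ≤ |x| → φ x t = 0) ∧
  (∀ x : ℝ, φ x T = 0)

/-- The weak form of the equation, relative to a given precipitation function `p` and
the spatial derivative `w` of `u - ψ`. -/
def WeakForm (α β : ℝ) (u p w : ℝ → ℝ → ℝ) : Prop :=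
  ∀ T > (0:ℝ), ∀ φ φt φx : ℝ → ℝ → ℝ, IsTestFun T φ φt φx →
    (∫ t in Set.Ioc (0:ℝ) T, ∫ x : ℝ, φt x t * (u x t - psi α β x t))
      = ∫ t in Set.Ioc (0:ℝ) T, ∫ x : ℝ, (φx x t * w x t + p x t * u x t * φ x t)

/-- A weak solution of the linear auxiliary problem with given precipitation function `p`. -/
def IsAuxSolution (α β : ℝ) (p u : ℝ → ℝ → ℝ) : Prop :=
  (∀ x t : ℝ, u (-x) t = u x t) ∧
  ∃ w : ℝ → ℝ → ℝ, AuxReg α β u w ∧ WeakForm α β u p w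

/-- A weak solution `(u, p)` of the HHMO model. -/
def IsWeakSolution (α β ustar : ℝ) (u p : ℝ → ℝ → ℝ) : Prop :=
  (∀ x t : ℝ, u (-x) t = u x t) ∧
  (∀ x t : ℝ, p (-x) t = p x t) ∧
  Measurable (fun q : ℝ × ℝ => p q.1 q.2) ∧
  (∀ x : ℝ, ∀ t ∈ Set.Ici (0:ℝ),
    (sSup ((fun s => u x s) '' Set.Icc 0 t) < ustar → p x t = 0) ∧
    (sSup ((fun s => u x s) '' Set.Icc 0 t) = ustar → p x t ∈ Set.Icc (0:ℝ) 1) ∧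
    (ustar < sSup ((fun s => u x s) '' Set.Icc 0 t) → p x t = 1)) ∧
  (∀ x : ℝ, MonotoneOn (fun t => p x t) (Set.Ici (0:ℝ))) ∧
  ∃ w : ℝ → ℝ → ℝ, AuxReg α β u w ∧ WeakForm α β u p w

/-- Condition (P): the precipitation function depends only on `x` beyond the parabola
`t = x²/α²`. -/
def CondP (α : ℝ) (p : ℝ → ℝ → ℝ) (pstar : ℝ → ℝ) : Prop :=
  Measurable pstar ∧
  ∀ᵐ x ∂(volume.restrict (Set.Ioi (0:ℝ))), ∀ t : ℝ, x ^ 2 / α ^ 2 < t → p x t = pstar x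

/-- The admissible class `𝒜` of precipitation functions. -/
def IsAdmissible (p : ℝ → ℝ → ℝ) : Prop :=
  (∀ x t : ℝ, p (-x) t = p x t) ∧
  MeasureTheory.LocallyIntegrableOn (fun q : ℝ × ℝ => p q.1 q.2) (Set.Ioi 0 ×ˢ Set.Ici 0) ∧
  ∀ T > (0:ℝ), ∃ R : ℝ, ∀ x ≥ R, ∀ t ∈ Set.Icc (0:ℝ) T, p x t = 0

/-- `u` converges uniformly, in parabolic similarity coordinates, to the profile `Φ`. -/
def ConvUnif (u : ℝ → ℝ → ℝ) (Φ : ℝ → ℝ) : Prop :=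
  ∀ ε > (0:ℝ), ∃ T : ℝ, ∀ t ≥ T, ∀ η ≥ (0:ℝ), |u (η * Real.sqrt t) t - Φ η| < ε

/-- The error function. -/
def erf (x : ℝ) : ℝ := (2 / Real.sqrt Real.pi) * ∫ s in (0:ℝ)..x, Real.exp (-s ^ 2)

/-- The complementary error function. -/
def erfc (x : ℝ) : ℝ := (2 / Real.sqrt Real.pi) * ∫ s in Set.Ioi x, Real.exp (-s ^ 2)

/-- Kummer's confluent hypergeometric function `M(a,b,z)` (real arguments). -/
def kummerM (a b z : ℝ) : ℝ :=
  ∑' n : ℕ, (Polynomial.eval a (ascPochhammer ℝ n) / Polynomial.eval b (ascPochhammer ℝ n))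
    * z ^ n / (n.factorial : ℝ)

/-- `κ = (1 + √(4γ+1))/2`, the positive root of `κ(κ-1) = γ`. -/
def kappaOf (γ : ℝ) : ℝ := (1 + Real.sqrt (4 * γ + 1)) / 2

/-- The value `u*_γ` determined by the derivative matching condition. -/
def ustarGamma (α β γ : ℝ) : ℝ :=
  (α * β / 2) *
    (kappaOf γ * kummerM (kappaOf γ / 2 + 1) (kappaOf γ + 1 / 2) (-α ^ 2 / 4) /
        (α * kummerM (kappaOf γ / 2) (kappaOf γ + 1 / 2) (-α ^ 2 / 4)) +
      Real.exp (-α ^ 2 / 4) / (Real.sqrt Real.pi * erfc (α / 2)))⁻¹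

/-- The self-similar profile `Φ_γ`. -/
def Phi (α β γ η : ℝ) : ℝ :=
  if η < α then
    ustarGamma α β γ * η ^ kappaOf γ *
      kummerM (kappaOf γ / 2) (kappaOf γ + 1 / 2) (-η ^ 2 / 4) /
      (α ^ kappaOf γ * kummerM (kappaOf γ / 2) (kappaOf γ + 1 / 2) (-α ^ 2 / 4))
  else ustarGamma α β γ * erfc (η / 2) / erfc (α / 2)

open Topology

/-- A smooth step from `0` (for `x ≤ 0`) to `1` (for `1 ≤ x`). -/
abbrev stepFn : ℝ → ℝ := Real.smoothTransition

lemma stepFn_contDiff {n : ℕ∞} : ContDiff ℝ n stepFn := Real.smoothTransition.contDiff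

lemma stepFn_mem (x : ℝ) : stepFn x ∈ Icc (0 : ℝ) 1 :=
  ⟨Real.smoothTransition.nonneg x, Real.smoothTransition.le_one x⟩

lemma stepFn_zero {x : ℝ} (h : x ≤ 0) : stepFn x = 0 := Real.smoothTransition.zero_of_nonpos h

lemma stepFn_one {x : ℝ} (h : 1 ≤ x) : stepFn x = 1 := Real.smoothTransition.one_of_one_le h

lemma stepFn_differentiable : Differentiable ℝ stepFn :=
  (stepFn_contDiff (n := 1)).differentiable (by simp)

lemma stepFn_hasDerivAt (x : ℝ) : HasDerivAt stepFn (deriv stepFn x) x :=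
  (stepFn_differentiable x).hasDerivAt

lemma stepFn_deriv_continuous : Continuous (deriv stepFn) :=
  (stepFn_contDiff (n := 1)).continuous_deriv (by simp)

lemma stepFn_deriv_eq_zero {x : ℝ} (h : x ∉ Ioo (0 : ℝ) 1) : deriv stepFn x = 0 := by
  have hx : x ≤ 0 ∨ 1 ≤ x := by
    by_contra hc
    push Not at hc
    exact h ⟨hc.1, hc.2⟩
  have : IsLocalExtr stepFn x := by
    rcases hx with hx | hx
    · left
      exact Eventually.of_forall fun y => by rw [stepFn_zero hx]; exact (stepFn_mem y).1
    · right
      exact Eventually.of_forall fun y => by rw [stepFn_one hx]; exact (stepFn_mem y).2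
  exact this.deriv_eq_zero

lemma stepFn_integral_deriv : ∫ x in (0 : ℝ)..1, deriv stepFn x = 1 := by
  rw [intervalIntegral.integral_deriv_eq_sub (fun x _ => stepFn_differentiable x)
    (stepFn_deriv_continuous.intervalIntegrable _ _)]
  rw [stepFn_one le_rfl, stepFn_zero le_rfl]; norm_num

lemma stepFn_scaled_hasDerivAt (c s x : ℝ) :
    HasDerivAt (fun y => stepFn ((y - c) / s)) (deriv stepFn ((x - c) / s) / s) x := by
  have h1 : HasDerivAt (fun y : ℝ => (y - c) / s) (1 / s) x :=
    ((hasDerivAt_id x).sub_const c).div_const s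
  have := (stepFn_hasDerivAt ((x - c) / s)).comp x h1
  simpa [div_eq_mul_inv, Function.comp_def] using this

lemma stepFn_scaled_integral {D : ℝ → ℝ} {c s : ℝ} (hs : 0 < s) :
    ∫ x, deriv stepFn ((x - c) / s) / s * D x = ∫ y in (0 : ℝ)..1, deriv stepFn y * D (c + s * y) := by
  rw [intervalIntegral.integral_of_le zero_le_one, ← integral_Icc_eq_integral_Ioc,
    setIntegral_eq_integral_of_forall_compl_eq_zero]
  · have h := Measure.integral_comp_mul_left (fun x => deriv stepFn ((x - c) / s) / s * D x) s
    have h2 := integral_add_left_eq_self (μ := (volume : Measure ℝ))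
      (fun x => deriv stepFn ((x - c) / s) / s * D x) c
    have h3 := Measure.integral_comp_mul_left
      (fun x => deriv stepFn ((c + x - c) / s) / s * D (c + x)) s
    rw [← h2]
    rw [abs_of_pos (inv_pos.2 hs), smul_eq_mul] at h3
    have h4 : ∫ y, deriv stepFn y * D (c + s * y)
        = s * ∫ x, deriv stepFn ((c + s * x - c) / s) / s * D (c + s * x) := by
      rw [← integral_const_mul]
      congr 1; ext y
      have : (c + s * y - c) / s = y := by field_simp; ring
      rw [this]; field_simp
    rw [h4, h3]; field_simp
  · intro x hx
    rw [stepFn_deriv_eq_zero (fun h => hx (Ioo_subset_Icc_self h)), zero_mul]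

lemma stepFn_scaled_tendsto {D : ℝ → ℝ} (hD : Continuous D) (c : ℝ) :
    Tendsto (fun s => ∫ x, deriv stepFn ((x - c) / s) / s * D x) (𝓝[>] 0) (𝓝 (D c)) := by
  have hc : Continuous fun s : ℝ => ∫ y in (0 : ℝ)..1, deriv stepFn y * D (c + s * y) := by
    apply intervalIntegral.continuous_parametric_intervalIntegral_of_continuous'
    have := stepFn_deriv_continuous
    fun_prop
  have h0 := (hc.tendsto 0).mono_left (nhdsWithin_le_nhds (s := Ioi 0))
  have hv : ∫ y in (0 : ℝ)..1, deriv stepFn y * D (c + 0 * y) = D c := by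
    simp [intervalIntegral.integral_mul_const, stepFn_integral_deriv]
  rw [hv] at h0
  refine h0.congr' ?_
  filter_upwards [self_mem_nhdsWithin] with s hs
  exact (stepFn_scaled_integral hs).symm

lemma stepFn_scaled_lim (c x : ℝ) :
    Tendsto (fun s => stepFn ((x - c) / s)) (𝓝[>] 0) (𝓝 (if c < x then 1 else 0)) := by
  split_ifs with h
  · refine tendsto_const_nhds.congr' ?_
    have : Ioo (0 : ℝ) (x - c) ∈ 𝓝[>] (0 : ℝ) := Ioo_mem_nhdsGT (by linarith)
    filter_upwards [this] with s hs
    rw [stepFn_one]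
    rw [le_div_iff₀ hs.1]; linarith [hs.2]
  · refine tendsto_const_nhds.congr' ?_
    filter_upwards [self_mem_nhdsWithin] with s hs
    rw [stepFn_zero]
    exact div_nonpos_of_nonpos_of_nonneg (by linarith) (le_of_lt hs)

lemma stepFn_scaled_contDiff (c s : ℝ) {n : ℕ∞} : ContDiff ℝ n fun x => stepFn ((x - c) / s) :=
  stepFn_contDiff.comp ((contDiff_id.sub contDiff_const).div_const s)

/-- One-sided du Bois-Reymond lemma. -/
lemma duBoisReymond_left {D F : ℝ → ℝ} (hD : Continuous D) {t ε : ℝ} (ht : 0 < t) (hε : 0 < ε)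
    (hF : IntegrableOn F (Ioc 0 (t + ε)))
    (h : ∀ a a' : ℝ → ℝ, (∀ x, HasDerivAt a (a' x) x) → Continuous a' →
      (∀ x, t + ε / 2 ≤ x → a x = 0) →
      ∫ x in Ioc 0 (t + ε), a' x * D x = - ∫ x in Ioc 0 (t + ε), a x * F x) :
    D t = ∫ x in Ioc 0 t, F x := by
  have hev : Ioo (0 : ℝ) (ε / 2) ∈ 𝓝[>] (0 : ℝ) := Ioo_mem_nhdsGT (by linarith)
  have h1 : Tendsto (fun s => ∫ x in Ioc 0 (t + ε), (1 - stepFn ((x - t) / s)) * F x) (𝓝[>] 0)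
      (𝓝 (∫ x in Ioc 0 (t + ε), (1 - if t < x then 1 else 0) * F x)) := by
    apply tendsto_integral_filter_of_dominated_convergence (fun x => ‖F x‖)
    · refine Eventually.of_forall fun s => ?_
      refine AEStronglyMeasurable.mul ?_ hF.1
      have := (stepFn_scaled_contDiff t s (n := 0)).continuous
      exact (continuous_const.sub this).aestronglyMeasurable
    · refine Eventually.of_forall fun s => Eventually.of_forall fun x => ?_
      rw [norm_mul]
      have := stepFn_mem ((x - t) / s)
      refine mul_le_of_le_one_left (norm_nonneg _) ?_
      rw [Real.norm_eq_abs, abs_le]; constructor <;> linarith [this.1, this.2]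
    · exact hF.norm
    · refine Eventually.of_forall fun x => ?_
      exact ((tendsto_const_nhds.sub (stepFn_scaled_lim t x))).mul_const _
  have h2 : ∫ x in Ioc 0 (t + ε), (1 - if t < x then 1 else 0) * F x = ∫ x in Ioc 0 t, F x := by
    have hsub : Ioc 0 t ⊆ Ioc 0 (t + ε) := Ioc_subset_Ioc_right (by linarith)
    rw [← integral_indicator measurableSet_Ioc, ← integral_indicator measurableSet_Ioc]
    congr 1; ext x
    by_cases hx : x ∈ Ioc 0 t
    · rw [indicator_of_mem (hsub hx), indicator_of_mem hx, if_neg (not_lt.2 hx.2)]; simp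
    · rw [indicator_of_notMem hx]
      by_cases hx2 : x ∈ Ioc 0 (t + ε)
      · rw [indicator_of_mem hx2, if_pos]
        · simp
        · by_contra hc; exact hx ⟨hx2.1, not_lt.1 hc⟩
      · rw [indicator_of_notMem hx2]
  rw [h2] at h1
  refine tendsto_nhds_unique (stepFn_scaled_tendsto hD t) (h1.congr' ?_)
  filter_upwards [hev] with s hs
  have hd : ∀ x, HasDerivAt (fun y => 1 - stepFn ((y - t) / s)) (- (deriv stepFn ((x - t) / s) / s)) x :=
    fun x => by simpa using (stepFn_scaled_hasDerivAt t s x).const_sub 1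
  have key := h (fun y => 1 - stepFn ((y - t) / s)) _ hd
    (by have := stepFn_deriv_continuous; fun_prop)
    (by
      intro x hx
      rw [stepFn_one]; · ring
      rw [le_div_iff₀ hs.1]; linarith [hs.2])
  have e1 : ∫ x in Ioc 0 (t + ε), -(deriv stepFn ((x - t) / s) / s) * D x
      = - ∫ x, deriv stepFn ((x - t) / s) / s * D x := by
    rw [setIntegral_eq_integral_of_forall_compl_eq_zero]
    · rw [← integral_neg]; congr 1; ext x; ring
    · intro x hx
      rw [stepFn_deriv_eq_zero]; · simp
      rintro ⟨h3, h4⟩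
      apply hx
      rw [div_lt_one hs.1] at h4
      have h5 : 0 < x - t := by
        by_contra hc
        exact absurd h3 (not_lt.2 (div_nonpos_of_nonpos_of_nonneg (by linarith) hs.1.le))
      exact ⟨by linarith, by linarith [hs.2]⟩
  rw [e1] at key
  linarith

/-- Two-sided du Bois-Reymond lemma. -/
lemma duBoisReymond {D F : ℝ → ℝ} (hD : Continuous D) (hF : LocallyIntegrable F)
    (h : ∀ a a' : ℝ → ℝ, (∀ x, HasDerivAt a (a' x) x) → ContDiff ℝ 2 a →
      (∃ R, ∀ x, R ≤ |x| → a x = 0 ∧ a' x = 0) →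
      ∫ x, a' x * D x = - ∫ x, a x * F x) {x₁ x₂ : ℝ} (h12 : x₁ ≤ x₂) :
    D x₂ - D x₁ = ∫ x in x₁..x₂, F x := by
  have hev : Ioo (0 : ℝ) 1 ∈ 𝓝[>] (0 : ℝ) := Ioo_mem_nhdsGT (by linarith)
  have hFi : IntegrableOn F (Icc x₁ (x₂ + 1)) := hF.integrableOn_isCompact isCompact_Icc
  have hz : ∀ s ∈ Ioo (0 : ℝ) 1, ∀ x ∉ Icc x₁ (x₂ + 1),
      stepFn ((x - x₁) / s) - stepFn ((x - x₂) / s) = 0 ∧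
      deriv stepFn ((x - x₁) / s) / s - deriv stepFn ((x - x₂) / s) / s = 0 := by
    intro s hs x hx
    have : x < x₁ ∨ x₂ + 1 < x := by
      by_contra hc; push Not at hc; exact hx hc
    rcases this with h3 | h3
    · have e1 : (x - x₁) / s ≤ 0 := div_nonpos_of_nonpos_of_nonneg (by linarith) hs.1.le
      have e2 : (x - x₂) / s ≤ 0 := div_nonpos_of_nonpos_of_nonneg (by linarith) hs.1.le
      rw [stepFn_zero e1, stepFn_zero e2, stepFn_deriv_eq_zero (fun h => absurd h.1 (not_lt.2 e1)),
        stepFn_deriv_eq_zero (fun h => absurd h.1 (not_lt.2 e2))]; simp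
    · have e1 : 1 ≤ (x - x₁) / s := by rw [le_div_iff₀ hs.1]; linarith [hs.2]
      have e2 : 1 ≤ (x - x₂) / s := by rw [le_div_iff₀ hs.1]; linarith [hs.2]
      rw [stepFn_one e1, stepFn_one e2, stepFn_deriv_eq_zero (fun h => absurd h.2 (not_lt.2 e1)),
        stepFn_deriv_eq_zero (fun h => absurd h.2 (not_lt.2 e2))]; simp
  have h1 : Tendsto (fun s => ∫ x in Icc x₁ (x₂ + 1),
      (stepFn ((x - x₁) / s) - stepFn ((x - x₂) / s)) * F x) (𝓝[>] 0)
      (𝓝 (∫ x in Icc x₁ (x₂ + 1), ((if x₁ < x then 1 else 0) - if x₂ < x then 1 else 0) * F x)) := by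
    apply tendsto_integral_filter_of_dominated_convergence (fun x => ‖F x‖)
    · refine Eventually.of_forall fun s => ?_
      refine AEStronglyMeasurable.mul ?_ hFi.1
      exact ((stepFn_scaled_contDiff x₁ s (n := 0)).continuous.sub
        (stepFn_scaled_contDiff x₂ s (n := 0)).continuous).aestronglyMeasurable
    · refine Eventually.of_forall fun s => Eventually.of_forall fun x => ?_
      rw [norm_mul]
      have := stepFn_mem ((x - x₁) / s)
      have h3 := stepFn_mem ((x - x₂) / s)
      refine mul_le_of_le_one_left (norm_nonneg _) ?_
      rw [Real.norm_eq_abs, abs_le]; constructor <;> linarith [this.1, this.2, h3.1, h3.2]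
    · exact hFi.norm
    · refine Eventually.of_forall fun x => ?_
      exact ((stepFn_scaled_lim x₁ x).sub (stepFn_scaled_lim x₂ x)).mul_const _
  have h2 : ∫ x in Icc x₁ (x₂ + 1), ((if x₁ < x then 1 else 0) - if x₂ < x then 1 else 0) * F x
      = ∫ x in x₁..x₂, F x := by
    rw [intervalIntegral.integral_of_le h12]
    have hsub : Ioc x₁ x₂ ⊆ Icc x₁ (x₂ + 1) := fun x hx => ⟨hx.1.le, by linarith [hx.2]⟩
    rw [← integral_indicator measurableSet_Icc, ← integral_indicator measurableSet_Ioc]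
    congr 1; ext x
    by_cases hx : x ∈ Ioc x₁ x₂
    · rw [indicator_of_mem (hsub hx), indicator_of_mem hx, if_neg (not_lt.2 hx.2), if_pos hx.1]; simp
    · rw [indicator_of_notMem hx]
      by_cases hx2 : x ∈ Icc x₁ (x₂ + 1)
      · rw [indicator_of_mem hx2]
        by_cases h4 : x₁ < x
        · rw [if_pos h4, if_pos]
          · simp
          · by_contra hc; exact hx ⟨h4, not_lt.1 hc⟩
        · rw [if_neg h4, if_neg]
          · simp
          · linarith
      · rw [indicator_of_notMem hx2]
  rw [h2] at h1
  have h3 := (stepFn_scaled_tendsto hD x₁).sub (stepFn_scaled_tendsto hD x₂)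
  have h4 : Tendsto (fun s => ∫ x in Icc x₁ (x₂ + 1),
      (stepFn ((x - x₁) / s) - stepFn ((x - x₂) / s)) * F x) (𝓝[>] 0) (𝓝 (-(D x₁ - D x₂))) := by
    refine h3.neg.congr' ?_
    filter_upwards [hev] with s hs
    have key := h (fun x => stepFn ((x - x₁) / s) - stepFn ((x - x₂) / s)) _
      (fun x => (stepFn_scaled_hasDerivAt x₁ s x).sub (stepFn_scaled_hasDerivAt x₂ s x))
      (by
        exact (stepFn_scaled_contDiff x₁ s (n := 2)).sub (stepFn_scaled_contDiff x₂ s (n := 2)))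
      ⟨|x₁| + |x₂ + 1| + 1, fun x hx => hz s hs x (fun hxm => by
        have := abs_le_max_abs_abs hxm.1 hxm.2
        have h5 : max |x₁| |x₂ + 1| ≤ |x₁| + |x₂ + 1| :=
          max_le (by linarith [abs_nonneg (x₂ + 1)]) (by linarith [abs_nonneg x₁])
        linarith)⟩
    have hi : ∀ c, Integrable fun x => deriv stepFn ((x - c) / s) / s * D x := by
      intro c
      apply Continuous.integrable_of_hasCompactSupport
      · have := stepFn_deriv_continuous
        fun_prop
      · apply HasCompactSupport.of_support_subset_isCompact (isCompact_Icc (a := c) (b := c + s))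
        intro x hx
        by_contra hc
        apply hx
        simp only
        rw [stepFn_deriv_eq_zero]; · simp
        rintro ⟨h5, h6⟩
        rw [div_lt_one hs.1] at h6
        have : 0 < x - c := by
          by_contra hc
          exact absurd h5 (not_lt.2 (div_nonpos_of_nonpos_of_nonneg (by linarith) hs.1.le))
        exact hc ⟨by linarith, by linarith⟩
    rw [← integral_sub (hi x₁) (hi x₂)]
    rw [setIntegral_eq_integral_of_forall_compl_eq_zero (fun x hx => by rw [(hz s hs x hx).1, zero_mul])]
    rw [← neg_eq_iff_eq_neg.2 key]
    congr 2; ext x; ring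
  have := tendsto_nhds_unique h4 h1
  linarith

/-- The heat kernel. -/
def hk (z σ : ℝ) : ℝ := (Real.sqrt (4 * Real.pi * σ))⁻¹ * Real.exp (-z ^ 2 / (4 * σ))

lemma hk_nonneg (z σ : ℝ) : 0 ≤ hk z σ := by unfold hk; positivity

lemma hk_neg (z σ : ℝ) : hk (-z) σ = hk z σ := by simp [hk]

lemma hk_eq_gaussian (z : ℝ) {σ : ℝ} (hσ : 0 < σ) :
    hk z σ = ProbabilityTheory.gaussianPDFReal 0 (2 * σ).toNNReal z := by
  unfold hk ProbabilityTheory.gaussianPDFReal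
  rw [Real.coe_toNNReal _ (by positivity : (0:ℝ) ≤ 2 * σ), sub_zero]
  congr 2
  · congr 1; ring
  · congr 1; ring

lemma hk_integrable {σ : ℝ} (hσ : 0 < σ) : Integrable fun z => hk z σ := by
  simp only [hk_eq_gaussian _ hσ]
  exact ProbabilityTheory.integrable_gaussianPDFReal _ _

lemma hk_integral {σ : ℝ} (hσ : 0 < σ) : ∫ z, hk z σ = 1 := by
  simp only [hk_eq_gaussian _ hσ]
  apply ProbabilityTheory.integral_gaussianPDFReal_eq_one
  intro h
  rw [Real.toNNReal_eq_zero] at h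
  linarith

lemma hk_sub_integrable {σ : ℝ} (hσ : 0 < σ) (x : ℝ) : Integrable fun y => hk (x - y) σ :=
  (hk_integrable hσ).comp_sub_left x

lemma hk_sub_integral {σ : ℝ} (hσ : 0 < σ) (x : ℝ) : ∫ y, hk (x - y) σ = 1 := by
  rw [integral_sub_left_eq_self (fun y => hk y σ)]; exact hk_integral hσ

lemma hk_continuous (σ : ℝ) : Continuous fun z => hk z σ := by
  unfold hk; fun_prop

lemma hk_hasDerivAt (z σ : ℝ) : HasDerivAt (fun z => hk z σ) (-z / (2 * σ) * hk z σ) z := by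
  unfold hk
  have h1 : HasDerivAt (fun z : ℝ => -z ^ 2 / (4 * σ)) (-(2 * z) / (4 * σ)) z := by
    have := ((hasDerivAt_pow 2 z).neg.div_const (4 * σ))
    simpa using this
  have := (h1.exp.const_mul (Real.sqrt (4 * Real.pi * σ))⁻¹)
  refine this.congr_deriv ?_
  rcases eq_or_ne σ 0 with rfl | h
  · simp
  · field_simp; ring

/-- The second space derivative (and time derivative) of the heat kernel. -/
def hkzz (z σ : ℝ) : ℝ := (z ^ 2 / (4 * σ ^ 2) - 1 / (2 * σ)) * hk z σ

lemma hkz_hasDerivAt (z : ℝ) {σ : ℝ} (hσ : 0 < σ) :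
    HasDerivAt (fun z => -z / (2 * σ) * hk z σ) (hkzz z σ) z := by
  have h1 : HasDerivAt (fun z : ℝ => -z / (2 * σ)) (-1 / (2 * σ)) z :=
    (hasDerivAt_id z).neg.div_const _
  refine (h1.mul (hk_hasDerivAt z σ)).congr_deriv ?_
  unfold hkzz
  field_simp; ring

lemma hk_hasDerivAt_time (z : ℝ) {σ : ℝ} (hσ : 0 < σ) :
    HasDerivAt (fun s => hk z s) (hkzz z σ) σ := by
  have hpi := Real.pi_pos
  have h1 : HasDerivAt (fun s : ℝ => Real.sqrt (4 * Real.pi * s))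
      (4 * Real.pi / (2 * Real.sqrt (4 * Real.pi * σ))) σ := by
    have : HasDerivAt (fun s : ℝ => 4 * Real.pi * s) (4 * Real.pi) σ := by
      simpa using (hasDerivAt_id σ).const_mul (4 * Real.pi)
    exact this.sqrt (by positivity)
  have hs : 0 < Real.sqrt (4 * Real.pi * σ) := Real.sqrt_pos.2 (by positivity)
  have h2 := h1.inv hs.ne'
  have h3 : HasDerivAt (fun s : ℝ => -z ^ 2 / (4 * s)) (z ^ 2 / (4 * σ ^ 2)) σ := by
    have := ((hasDerivAt_id σ).const_mul 4).inv (by simpa using hσ.ne')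
    have := this.const_mul (-z ^ 2)
    refine (this.congr_deriv ?_)
    simp; field_simp
  have h4 := h2.mul h3.exp
  unfold hkzz
  refine h4.congr_deriv ?_
  have hsq : Real.sqrt (4 * Real.pi * σ) ^ 2 = 4 * Real.pi * σ := Real.sq_sqrt (by positivity)
  rw [hsq]
  simp only [hk, Pi.inv_apply]
  field_simp
  ring

lemma hk_scale (z : ℝ) {σ : ℝ} (hσ : 0 < σ) :
    hk (Real.sqrt σ * z) σ = (Real.sqrt σ)⁻¹ * hk z 1 := by
  unfold hk
  rw [mul_pow, Real.sq_sqrt hσ.le, Real.sqrt_mul (by positivity), mul_one, mul_inv]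
  have : -(σ * z ^ 2) / (4 * σ) = -z ^ 2 / (4 * 1) := by field_simp
  rw [this]; ring

lemma hk_integral_mul (f : ℝ → ℝ) {σ : ℝ} (hσ : 0 < σ) :
    ∫ z, hk z σ * f z = ∫ z, hk z 1 * f (Real.sqrt σ * z) := by
  have hs : 0 < Real.sqrt σ := Real.sqrt_pos.2 hσ
  have := Measure.integral_comp_mul_left (fun z => hk z σ * f z) (Real.sqrt σ)
  simp only [hk_scale _ hσ, smul_eq_mul] at this
  rw [abs_of_pos (inv_pos.2 hs)] at this
  simp only [mul_assoc] at this
  rw [integral_const_mul] at this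
  exact (mul_left_cancel₀ (inv_pos.2 hs).ne' this).symm

lemma hk_conv_eq (f : ℝ → ℝ) (x : ℝ) {σ : ℝ} (hσ : 0 < σ) :
    ∫ y, hk (x - y) σ * f y = ∫ z, hk z 1 * f (x - Real.sqrt σ * z) := by
  rw [← hk_integral_mul (fun z => f (x - z)) hσ,
    ← integral_sub_left_eq_self (fun y => hk y σ * f (x - y)) _ x]
  simp

lemma hk_mul_integrable {f : ℝ → ℝ} {σ : ℝ} (hσ : 0 < σ) (x : ℝ) (hf : AEStronglyMeasurable f)
    {C : ℝ} (hC : ∀ y, |f y| ≤ C) : Integrable fun y => hk (x - y) σ * f y :=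
  (hk_sub_integrable hσ x).mul_bdd hf (Eventually.of_forall hC)

/-- Approximate identity property of the heat kernel. -/
lemma hk_tendsto {f : ℝ → ℝ} (hf : AEStronglyMeasurable f) {C : ℝ} (hC : ∀ y, |f y| ≤ C)
    {x : ℝ} (hx : ContinuousAt f x) :
    Tendsto (fun δ => ∫ y, hk (x - y) δ * f y) (𝓝[>] 0) (𝓝 (f x)) := by
  have h1 : Tendsto (fun δ => ∫ z, hk z 1 * f (x - Real.sqrt δ * z)) (𝓝[>] 0)
      (𝓝 (∫ z, hk z 1 * f x)) := by
    apply tendsto_integral_filter_of_dominated_convergence (fun z => hk z 1 * C)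
    · filter_upwards [self_mem_nhdsWithin] with δ hδ
      have hδ : 0 < Real.sqrt δ := Real.sqrt_pos.2 hδ
      refine (hk_continuous 1).aestronglyMeasurable.mul ?_
      refine hf.comp_quasiMeasurePreserving ?_
      have h2 := (quasiMeasurePreserving_sub_left (volume : Measure ℝ) x)
      refine h2.comp ?_
      exact ⟨by fun_prop, by
        rw [Real.map_volume_mul_left hδ.ne']
        exact Measure.smul_absolutelyContinuous⟩
    · refine Eventually.of_forall fun δ => Eventually.of_forall fun z => ?_
      rw [norm_mul, Real.norm_eq_abs, abs_of_nonneg (hk_nonneg _ _)]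
      exact mul_le_mul_of_nonneg_left (hC _) (hk_nonneg _ _)
    · exact (hk_integrable one_pos).mul_const C
    · refine Eventually.of_forall fun z => ?_
      refine Tendsto.const_mul _ ?_
      refine hx.tendsto.comp ?_
      have : Tendsto (fun δ : ℝ => x - Real.sqrt δ * z) (𝓝 0) (𝓝 (x - Real.sqrt 0 * z)) :=
        Continuous.tendsto (by fun_prop) 0
      simp at this
      exact this.mono_left nhdsWithin_le_nhds
  rw [integral_mul_const, hk_integral one_pos, one_mul] at h1
  refine h1.congr' ?_
  filter_upwards [self_mem_nhdsWithin] with δ hδ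
  exact (hk_conv_eq f x hδ).symm

/-- First absolute moment of the heat kernel at time one. -/
def hkMoment : ℝ := ∫ z, hk z 1 * |z|

lemma hk_poly_integrable (n : ℕ) {σ : ℝ} (hσ : 0 < σ) : Integrable fun z => |z| ^ n * hk z σ := by
  unfold hk
  have h := integrable_rpow_mul_exp_neg_mul_sq (b := 1 / (4 * σ)) (by positivity)
    (s := n) (by have : (0:ℝ) ≤ n := Nat.cast_nonneg n; linarith)
  have := (h.norm).mul_const (Real.sqrt (4 * Real.pi * σ))⁻¹
  refine this.congr (Eventually.of_forall fun z => ?_)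
  simp only [norm_mul, Real.norm_eq_abs, Real.rpow_natCast, abs_pow, Real.abs_exp]
  have : -(1 / (4 * σ)) * z ^ 2 = -z ^ 2 / (4 * σ) := by ring
  rw [this]; ring

lemma hkMoment_nonneg : 0 ≤ hkMoment :=
  integral_nonneg fun _ => mul_nonneg (hk_nonneg _ _) (abs_nonneg _)

lemma hk_abs_integral (x : ℝ) {σ : ℝ} (hσ : 0 < σ) :
    ∫ y, hk (x - y) σ * |x - y| = hkMoment * Real.sqrt σ := by
  rw [hk_conv_eq (fun y => |x - y|) x hσ, hkMoment, ← integral_mul_const]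
  congr 1; ext z
  simp only [sub_sub_cancel, abs_mul, abs_of_nonneg (Real.sqrt_nonneg σ)]
  ring

lemma hk_abs_integrable (x : ℝ) {σ : ℝ} (hσ : 0 < σ) :
    Integrable fun y => hk (x - y) σ * |x - y| := by
  have := (hk_poly_integrable 1 hσ).comp_sub_left x
  simpa [mul_comm] using this

lemma hk_le (z : ℝ) {σ : ℝ} (hσ : 0 < σ) : hk z σ ≤ (Real.sqrt σ)⁻¹ := by
  unfold hk
  have h1 : Real.exp (-z ^ 2 / (4 * σ)) ≤ 1 := by
    rw [Real.exp_le_one_iff, neg_div]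
    have : 0 ≤ z ^ 2 / (4 * σ) := by positivity
    linarith
  have h2 : (Real.sqrt (4 * Real.pi * σ))⁻¹ ≤ (Real.sqrt σ)⁻¹ := by
    apply inv_anti₀ (Real.sqrt_pos.2 hσ)
    apply Real.sqrt_le_sqrt
    have := Real.pi_gt_three
    nlinarith
  calc _ ≤ (Real.sqrt (4 * Real.pi * σ))⁻¹ * 1 := by gcongr
    _ ≤ _ := by rw [mul_one]; exact h2

lemma hk_le' {z : ℝ} (hz : z ≠ 0) {σ : ℝ} (hσ : 0 < σ) : hk z σ ≤ 4 * Real.sqrt σ / z ^ 2 := by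
  unfold hk
  have hz2 : 0 < z ^ 2 := by positivity
  have h1 : Real.exp (-z ^ 2 / (4 * σ)) ≤ 4 * σ / z ^ 2 := by
    have h3 : z ^ 2 / (4 * σ) ≤ Real.exp (z ^ 2 / (4 * σ)) := by
      have := Real.add_one_le_exp (z ^ 2 / (4 * σ)); linarith
    rw [neg_div, Real.exp_neg, ← inv_div (z ^ 2)]
    exact inv_anti₀ (by positivity) h3
  have h2 : (Real.sqrt (4 * Real.pi * σ))⁻¹ ≤ (Real.sqrt σ)⁻¹ := by
    apply inv_anti₀ (Real.sqrt_pos.2 hσ)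
    apply Real.sqrt_le_sqrt
    have := Real.pi_gt_three
    nlinarith
  calc _ ≤ (Real.sqrt σ)⁻¹ * (4 * σ / z ^ 2) := by gcongr
    _ = _ := by
      have h4 : Real.sqrt σ ^ 2 = σ := Real.sq_sqrt hσ.le
      have h5 := Real.sqrt_pos.2 hσ
      field_simp
      rw [h4]

/-- Gaussian majorant of the heat kernel and its derivatives for times in `[a, b]`. -/
def hkDom (a b z : ℝ) : ℝ :=
  (1 + 1 / (2 * a) + 1 / (4 * a ^ 2)) * (Real.sqrt b / Real.sqrt a) * ((1 + |z| ^ 2) * hk z b)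

lemma hkDom_integrable (a : ℝ) {b : ℝ} (hb : 0 < b) : Integrable fun z => hkDom a b z := by
  unfold hkDom
  refine Integrable.const_mul ?_ _
  simp only [add_mul, one_mul]
  exact (hk_integrable hb).add (hk_poly_integrable 2 hb)

lemma hkDom_nonneg {a : ℝ} (ha : 0 < a) (b z : ℝ) : 0 ≤ hkDom a b z := by
  unfold hkDom
  have := hk_nonneg z b
  positivity

lemma hk_dom_aux {a b σ z : ℝ} (ha : 0 < a) (h1 : a ≤ σ) (h2 : σ ≤ b) :
    hk z σ ≤ (Real.sqrt b / Real.sqrt a) * hk z b := by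
  have hσ : 0 < σ := by linarith
  have hb : 0 < b := by linarith
  unfold hk
  rw [Real.sqrt_mul (by positivity : 0 ≤ 4 * Real.pi) σ, Real.sqrt_mul (by positivity : 0 ≤ 4 * Real.pi) b]
  have e1 : Real.exp (-z ^ 2 / (4 * σ)) ≤ Real.exp (-z ^ 2 / (4 * b)) := by
    apply Real.exp_le_exp.2
    rw [neg_div, neg_div, neg_le_neg_iff]
    gcongr
  have e2 : Real.sqrt a ≤ Real.sqrt σ := Real.sqrt_le_sqrt h1
  have ea := Real.sqrt_pos.2 ha
  have eb := Real.sqrt_pos.2 hb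
  have epi : 0 < Real.sqrt (4 * Real.pi) := Real.sqrt_pos.2 (by positivity)
  calc _ ≤ (Real.sqrt (4 * Real.pi) * Real.sqrt a)⁻¹ * Real.exp (-z ^ 2 / (4 * b)) := by gcongr
    _ = _ := by field_simp

lemma hk_bounds {a b σ z : ℝ} (ha : 0 < a) (h1 : a ≤ σ) (h2 : σ ≤ b) :
    |hk z σ| ≤ hkDom a b z ∧ |-z / (2 * σ) * hk z σ| ≤ hkDom a b z ∧ |hkzz z σ| ≤ hkDom a b z := by
  have hσ : 0 < σ := by linarith
  have hb : 0 < b := by linarith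
  have h0 := hk_dom_aux (z := z) ha h1 h2
  have hn := hk_nonneg z σ
  have hA : 0 ≤ 1 / (2 * a) := by positivity
  have hB : 0 ≤ 1 / (4 * a ^ 2) := by positivity
  have hz : |z| ≤ 1 + |z| ^ 2 := by nlinarith [sq_nonneg (|z| - 1)]
  have key : ∀ k : ℝ, |k| ≤ (1 + 1 / (2 * a) + 1 / (4 * a ^ 2)) * (1 + |z| ^ 2) →
      |k * hk z σ| ≤ hkDom a b z := by
    intro k hk'
    rw [abs_mul, abs_of_nonneg hn]
    calc _ ≤ ((1 + 1 / (2 * a) + 1 / (4 * a ^ 2)) * (1 + |z| ^ 2))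
          * ((Real.sqrt b / Real.sqrt a) * hk z b) := by gcongr
      _ = _ := by unfold hkDom; ring
  have hs : 1 / (2 * σ) ≤ 1 / (2 * a) := by gcongr
  have hs2 : 1 / (4 * σ ^ 2) ≤ 1 / (4 * a ^ 2) := by gcongr
  have hs' : 0 ≤ 1 / (2 * σ) := by positivity
  have hs2' : 0 ≤ 1 / (4 * σ ^ 2) := by positivity
  have hzz := sq_nonneg (|z|)
  refine ⟨?_, key _ ?_, key _ ?_⟩
  · have := key 1 (by rw [abs_one]; nlinarith [mul_nonneg hA hzz, mul_nonneg hB hzz])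
    simpa using this
  · have e : |-z / (2 * σ)| = |z| * (1 / (2 * σ)) := by
      rw [abs_div, abs_neg, abs_of_pos (by positivity : 0 < 2 * σ)]; ring
    rw [e]
    calc _ ≤ (1 + |z| ^ 2) * (1 / (2 * a)) := by gcongr
      _ ≤ _ := by nlinarith [mul_nonneg hB hzz]
  · have e : |z ^ 2 / (4 * σ ^ 2) - 1 / (2 * σ)| ≤ |z| ^ 2 * (1 / (4 * σ ^ 2)) + 1 / (2 * σ) := by
      refine (abs_sub _ _).trans ?_
      rw [abs_of_nonneg hs', abs_of_nonneg (by positivity : 0 ≤ z ^ 2 / (4 * σ ^ 2)), sq_abs]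
      apply le_of_eq; ring
    refine e.trans ?_
    have : |z| ^ 2 * (1 / (4 * σ ^ 2)) ≤ |z| ^ 2 * (1 / (4 * a ^ 2)) := by gcongr
    nlinarith [mul_nonneg hA hzz]

lemma hk_continuousOn : ContinuousOn (fun q : ℝ × ℝ => hk q.1 q.2) {q | 0 < q.2} := by
  unfold hk
  apply ContinuousOn.mul
  · apply ContinuousOn.inv₀ (by fun_prop)
    intro q hq
    have : 0 < q.2 := hq
    exact (Real.sqrt_pos.2 (by positivity)).ne'
  · apply ContinuousOn.rexp
    apply ContinuousOn.div (by fun_prop) (by fun_prop)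
    intro q hq
    have : 0 < q.2 := hq
    positivity

lemma hk_measurable : Measurable (fun q : ℝ × ℝ => hk q.1 q.2) := by
  unfold hk; fun_prop

/-- The linear forced heat equation in weak form with vanishing initial data; `w` is the spatial
derivative of `v`. -/
structure HeatSys (v w F : ℝ → ℝ → ℝ) : Prop where
  v_cont : Continuous fun q : ℝ × ℝ => v q.1 q.2
  w_cont : Continuous fun q : ℝ × ℝ => w q.1 q.2
  deriv : ∀ t x, HasDerivAt (fun y => v y t) (w x t) x
  F_meas : Measurable fun q : ℝ × ℝ => F q.1 q.2
  bdd : ∀ T, ∃ C, ∀ x t, t ≤ T → |v x t| ≤ C ∧ |w x t| ≤ C ∧ |F x t| ≤ C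
  weak : ∀ T > (0 : ℝ), ∀ φ φt φx : ℝ → ℝ → ℝ, IsTestFun T φ φt φx →
    (∫ t in Ioc (0 : ℝ) T, ∫ x : ℝ, φt x t * v x t)
      = ∫ t in Ioc (0 : ℝ) T, ∫ x : ℝ, (φx x t * w x t + F x t * φ x t)

/-- Space-time measure on the strip `(0, T] × ℝ`. -/
abbrev stripMeasure (T : ℝ) : Measure (ℝ × ℝ) := (volume.restrict (Ioc (0 : ℝ) T)).prod volume

lemma stripMeasure_eq (T : ℝ) :
    stripMeasure T = (volume : Measure (ℝ × ℝ)).restrict (Ioc 0 T ×ˢ univ) := by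
  rw [stripMeasure, Measure.volume_eq_prod, ← Measure.prod_restrict, Measure.restrict_univ]

lemma strip_ae (T : ℝ) : ∀ᵐ q ∂(stripMeasure T), q.1 ∈ Ioc 0 T := by
  rw [stripMeasure_eq, ae_restrict_iff' (measurableSet_Ioc.prod MeasurableSet.univ)]
  exact Eventually.of_forall fun q hq => hq.1

lemma strip_aesm {T : ℝ} {f : ℝ → ℝ → ℝ}
    (hf : ContinuousOn (fun q : ℝ × ℝ => f q.1 q.2) (univ ×ˢ Icc 0 T)) :
    AEStronglyMeasurable (fun q : ℝ × ℝ => f q.2 q.1) (stripMeasure T) := by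
  rw [stripMeasure_eq]
  refine ContinuousOn.aestronglyMeasurable ?_ (measurableSet_Ioc.prod MeasurableSet.univ)
  refine hf.comp (continuous_swap.continuousOn) ?_
  rintro ⟨t, x⟩ ⟨h1, -⟩
  exact ⟨mem_univ _, h1.1.le, h1.2⟩

lemma strip_dom_integrable {T : ℝ} {H : ℝ → ℝ} (hH : Integrable H) :
    Integrable (fun q : ℝ × ℝ => H q.2) (stripMeasure T) := hH.comp_snd _

lemma strip_integrable {T : ℝ} {f : ℝ → ℝ → ℝ}
    (hf : ContinuousOn (fun q : ℝ × ℝ => f q.1 q.2) (univ ×ˢ Icc 0 T))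
    {H : ℝ → ℝ} (hH : Integrable H) (hb : ∀ x, ∀ t ∈ Icc 0 T, |f x t| ≤ H x)
    {g : ℝ → ℝ → ℝ} (hg : Measurable fun q : ℝ × ℝ => g q.1 q.2) {C : ℝ}
    (hC : ∀ x t, t ≤ T → |g x t| ≤ C) :
    Integrable (fun q : ℝ × ℝ => f q.2 q.1 * g q.2 q.1) (stripMeasure T) := by
  refine Integrable.mono' ((strip_dom_integrable hH (T := T)).mul_const C)
    ((strip_aesm hf).mul (hg.comp measurable_swap).aestronglyMeasurable) ?_
  filter_upwards [strip_ae T] with q hq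
  rw [norm_mul]
  exact mul_le_mul (hb _ _ ⟨hq.1.le, hq.2⟩) (hC _ _ hq.2) (norm_nonneg _)
    ((abs_nonneg _).trans (hb _ _ ⟨hq.1.le, hq.2⟩))

/-- A smooth cutoff, one near the origin and vanishing for `2 ≤ x ^ 2`. -/
def cutoff (x : ℝ) : ℝ := 1 - stepFn (x ^ 2 - 1)

/-- The derivative of `cutoff`. -/
def cutoff' (x : ℝ) : ℝ := -(deriv stepFn (x ^ 2 - 1) * (2 * x))

lemma cutoff_hasDerivAt (x : ℝ) : HasDerivAt cutoff (cutoff' x) x := by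
  have h1 : HasDerivAt (fun x : ℝ => x ^ 2 - 1) (2 * x) x := by
    simpa using (hasDerivAt_pow 2 x).sub_const 1
  exact ((stepFn_hasDerivAt (x ^ 2 - 1)).comp x h1).const_sub 1

lemma cutoff'_continuous : Continuous cutoff' := by
  have := stepFn_deriv_continuous
  unfold cutoff'; fun_prop

lemma cutoff_continuous : Continuous cutoff :=
  continuous_iff_continuousAt.2 fun x => (cutoff_hasDerivAt x).continuousAt

lemma cutoff_mem (x : ℝ) : cutoff x ∈ Icc (0 : ℝ) 1 := by
  have := stepFn_mem (x ^ 2 - 1)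
  unfold cutoff
  exact ⟨by linarith [this.2], by linarith [this.1]⟩

lemma cutoff_eq_zero {x : ℝ} (h : 2 ≤ |x|) : cutoff x = 0 := by
  unfold cutoff
  rw [stepFn_one]; · simp
  rw [← sq_abs]; nlinarith

lemma cutoff'_eq_zero {x : ℝ} (h : 2 ≤ |x|) : cutoff' x = 0 := by
  unfold cutoff'
  rw [stepFn_deriv_eq_zero]; · simp
  rintro ⟨-, h2⟩
  rw [← sq_abs] at h2; nlinarith

lemma cutoff_zero : cutoff 0 = 1 := by
  unfold cutoff; rw [stepFn_zero (by norm_num)]; norm_num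

lemma cutoff'_bdd : ∃ B, 0 ≤ B ∧ ∀ x, |cutoff' x| ≤ B := by
  obtain ⟨B, hB⟩ := (isCompact_Icc (a := (-2:ℝ)) (b := 2)).exists_bound_of_continuousOn
    cutoff'_continuous.continuousOn
  refine ⟨max B 0, le_max_right _ _, fun x => ?_⟩
  by_cases h : 2 ≤ |x|
  · rw [cutoff'_eq_zero h]; simp
  · push Not at h
    exact (hB x (abs_le.1 h.le)).trans (le_max_left _ _)

namespace HeatSys
variable {v w F : ℝ → ℝ → ℝ}

lemma weak_dom (h : HeatSys v w F) {T : ℝ} (hT : 0 < T) {φ φt φx : ℝ → ℝ → ℝ}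
    (h1 : ∀ x : ℝ, ∀ t ∈ Icc (0:ℝ) T, HasDerivWithinAt (fun s => φ x s) (φt x t) (Icc 0 T) t)
    (h2 : ∀ x : ℝ, ∀ t ∈ Icc (0:ℝ) T, HasDerivAt (fun y => φ y t) (φx x t) x)
    (c0 : ContinuousOn (fun q : ℝ × ℝ => φ q.1 q.2) (univ ×ˢ Icc 0 T))
    (c1 : ContinuousOn (fun q : ℝ × ℝ => φt q.1 q.2) (univ ×ˢ Icc 0 T))
    (c2 : ContinuousOn (fun q : ℝ × ℝ => φx q.1 q.2) (univ ×ˢ Icc 0 T))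
    {H : ℝ → ℝ} (hH : Integrable H)
    (hb : ∀ x, ∀ t ∈ Icc (0:ℝ) T, |φ x t| ≤ H x ∧ |φt x t| ≤ H x ∧ |φx x t| ≤ H x)
    (h3 : ∀ x, φ x T = 0) :
    ∫ q, φt q.2 q.1 * v q.2 q.1 ∂(stripMeasure T)
      = ∫ q, (φx q.2 q.1 * w q.2 q.1 + F q.2 q.1 * φ q.2 q.1) ∂(stripMeasure T) := by
  obtain ⟨C, hC⟩ := h.bdd T
  obtain ⟨B, hB0, hB⟩ := cutoff'_bdd
  have i1 := strip_integrable c1 hH (fun x t ht => (hb x t ht).2.1) h.v_cont.measurable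
    (fun x t ht => (hC x t ht).1)
  have i2 := strip_integrable c2 hH (fun x t ht => (hb x t ht).2.2) h.w_cont.measurable
    (fun x t ht => (hC x t ht).2.1)
  have i3 := strip_integrable c0 hH (fun x t ht => (hb x t ht).1) h.F_meas
    (fun x t ht => (hC x t ht).2.2)
  have i4 := strip_integrable c0 hH (fun x t ht => (hb x t ht).1) h.w_cont.measurable
    (fun x t ht => (hC x t ht).2.1)
  let χ : ℕ → ℝ → ℝ := fun n x => cutoff (x / (n + 1))
  let χ' : ℕ → ℝ → ℝ := fun n x => cutoff' (x / (n + 1)) / (n + 1)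
  have hχd : ∀ n x, HasDerivAt (χ n) (χ' n x) x := by
    intro n x
    have h1 : HasDerivAt (fun y : ℝ => y / ((n:ℝ) + 1)) (1 / ((n:ℝ) + 1)) x :=
      (hasDerivAt_id x).div_const _
    have := (cutoff_hasDerivAt (x / (n + 1))).comp x h1
    refine this.congr_deriv ?_
    simp only [χ']; ring
  have hχc : ∀ n, Continuous (χ n) := fun n => by
    have := cutoff_continuous; simp only [χ]; fun_prop
  have hχ'c : ∀ n, Continuous (χ' n) := fun n => by
    have := cutoff'_continuous; simp only [χ']; fun_prop
  have hχb : ∀ n x, |χ n x| ≤ 1 := fun n x => by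
    rw [abs_of_nonneg (cutoff_mem _).1]; exact (cutoff_mem _).2
  have hχ'b : ∀ n x, |χ' n x| ≤ B := fun n x => by
    simp only [χ']
    rw [abs_div, abs_of_pos (by positivity : (0:ℝ) < n + 1)]
    refine (div_le_self (abs_nonneg _) (by linarith [(Nat.cast_nonneg n : (0:ℝ) ≤ n)])).trans (hB _)
  have hχl : ∀ x, Tendsto (fun n => χ n x) atTop (𝓝 1) := by
    intro x
    have : Tendsto (fun n : ℕ => x / ((n : ℝ) + 1)) atTop (𝓝 0) :=
      Tendsto.div_atTop tendsto_const_nhds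
        (tendsto_atTop_add_const_right _ _ tendsto_natCast_atTop_atTop)
    have h5 := (cutoff_continuous.tendsto 0).comp this
    rwa [cutoff_zero] at h5
  have hχ'l : ∀ x, Tendsto (fun n => χ' n x) atTop (𝓝 0) := by
    intro x
    refine squeeze_zero_norm (a := fun n : ℕ => B / ((n:ℝ) + 1)) (fun n => ?_) ?_
    · simp only [χ', norm_div, Real.norm_eq_abs]
      rw [abs_of_pos (by positivity : (0:ℝ) < n + 1)]
      gcongr; exact hB _
    · exact Tendsto.div_atTop tendsto_const_nhds
        (tendsto_atTop_add_const_right _ _ tendsto_natCast_atTop_atTop)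
  have key : ∀ n, ∫ q, χ n q.2 * (φt q.2 q.1 * v q.2 q.1) ∂(stripMeasure T)
      = ∫ q, (χ n q.2 * (φx q.2 q.1 * w q.2 q.1 + F q.2 q.1 * φ q.2 q.1)
          + χ' n q.2 * (φ q.2 q.1 * w q.2 q.1)) ∂(stripMeasure T) := by
    intro n
    have hw := h.weak T hT (fun x t => χ n x * φ x t) (fun x t => χ n x * φt x t)
      (fun x t => χ' n x * φ x t + χ n x * φx x t) ⟨fun x t ht => (h1 x t ht).const_mul _,
        fun x t ht => (hχd n x).mul (h2 x t ht),
        ((hχc n).comp continuous_fst).continuousOn.mul c0,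
        ((hχc n).comp continuous_fst).continuousOn.mul c1,
        (((hχ'c n).comp continuous_fst).continuousOn.mul c0).add
          (((hχc n).comp continuous_fst).continuousOn.mul c2),
        ⟨2 * (n + 1), fun x t _ hx => by
          simp only [χ]
          rw [cutoff_eq_zero, zero_mul]
          rw [abs_div, abs_of_pos (by positivity : (0:ℝ) < n + 1), le_div_iff₀ (by positivity)]
          exact hx⟩,
        fun x => by simp [h3 x]⟩
    have e1 : Integrable (fun q : ℝ × ℝ => χ n q.2 * (φt q.2 q.1 * v q.2 q.1)) (stripMeasure T) :=
      i1.bdd_mul ((hχc n).comp continuous_snd).aestronglyMeasurable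
        (Eventually.of_forall fun q => hχb n q.2)
    have e2 : Integrable (fun q : ℝ × ℝ => χ n q.2 * (φx q.2 q.1 * w q.2 q.1 + F q.2 q.1 * φ q.2 q.1)
        + χ' n q.2 * (φ q.2 q.1 * w q.2 q.1)) (stripMeasure T) := by
      refine Integrable.add ?_ ?_
      · refine Integrable.bdd_mul (c := 1) ?_ ((hχc n).comp continuous_snd).aestronglyMeasurable
          (Eventually.of_forall fun q => hχb n q.2)
        refine i2.add (i3.congr (Eventually.of_forall fun q => ?_))
        simp only; ring
      · exact i4.bdd_mul ((hχ'c n).comp continuous_snd).aestronglyMeasurable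
          (Eventually.of_forall fun q => hχ'b n q.2)
    rw [integral_prod _ e1, integral_prod _ e2]
    convert hw using 1
    · refine integral_congr_ae (Eventually.of_forall fun t => ?_)
      simp only; congr 1; ext x; ring
    · refine integral_congr_ae (Eventually.of_forall fun t => ?_)
      simp only; congr 1; ext x; ring
  have i3' : Integrable (fun q : ℝ × ℝ => F q.2 q.1 * φ q.2 q.1) (stripMeasure T) :=
    i3.congr (Eventually.of_forall fun q => by simp only; ring)
  have l1 : Tendsto (fun n => ∫ q, χ n q.2 * (φt q.2 q.1 * v q.2 q.1) ∂(stripMeasure T)) atTop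
      (𝓝 (∫ q, 1 * (φt q.2 q.1 * v q.2 q.1) ∂(stripMeasure T))) := by
    refine tendsto_integral_of_dominated_convergence (fun q => ‖φt q.2 q.1 * v q.2 q.1‖)
      (fun n => ((hχc n).comp continuous_snd).aestronglyMeasurable.mul i1.1) i1.norm ?_ ?_
    · exact fun n => Eventually.of_forall fun q => by
        rw [norm_mul]; exact mul_le_of_le_one_left (norm_nonneg _) (hχb n q.2)
    · exact Eventually.of_forall fun q => (hχl q.2).mul_const _
  have l2 : Tendsto (fun n => ∫ q, (χ n q.2 * (φx q.2 q.1 * w q.2 q.1 + F q.2 q.1 * φ q.2 q.1)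
          + χ' n q.2 * (φ q.2 q.1 * w q.2 q.1)) ∂(stripMeasure T)) atTop
      (𝓝 (∫ q, (1 * (φx q.2 q.1 * w q.2 q.1 + F q.2 q.1 * φ q.2 q.1)
          + 0 * (φ q.2 q.1 * w q.2 q.1)) ∂(stripMeasure T))) := by
    refine tendsto_integral_of_dominated_convergence
      (fun q => ‖φx q.2 q.1 * w q.2 q.1 + F q.2 q.1 * φ q.2 q.1‖ + B * ‖φ q.2 q.1 * w q.2 q.1‖)
      (fun n => (((hχc n).comp continuous_snd).aestronglyMeasurable.mul (i2.add i3').1).add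
        (((hχ'c n).comp continuous_snd).aestronglyMeasurable.mul i4.1))
      ((i2.add i3').norm.add (i4.norm.const_mul B)) ?_ ?_
    · refine fun n => Eventually.of_forall fun q => ?_
      refine (norm_add_le _ _).trans (add_le_add ?_ ?_)
      · rw [norm_mul]; exact mul_le_of_le_one_left (norm_nonneg _) (hχb n q.2)
      · rw [norm_mul]; exact mul_le_mul_of_nonneg_right (hχ'b n q.2) (norm_nonneg _)
    · exact Eventually.of_forall fun q => ((hχl q.2).mul_const _).add ((hχ'l q.2).mul_const _)
  simp only [one_mul, zero_mul, add_zero] at l1 l2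
  simp only [key] at l1
  exact tendsto_nhds_unique l1 l2

end HeatSys

namespace HeatSys
variable {v w F : ℝ → ℝ → ℝ}

lemma slice_integrable {T s : ℝ} (hs : s ∈ Icc 0 T) {f : ℝ → ℝ → ℝ}
    (hf : ContinuousOn (fun q : ℝ × ℝ => f q.1 q.2) (univ ×ˢ Icc 0 T))
    {H : ℝ → ℝ} (hH : Integrable H) (hb : ∀ x, ∀ t ∈ Icc 0 T, |f x t| ≤ H x)
    {g : ℝ → ℝ} (hg : Measurable g) {C : ℝ} (hC : ∀ x, |g x| ≤ C) :
    Integrable fun x => f x s * g x := by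
  have hc : Continuous fun x => f x s := by
    rw [← continuousOn_univ]
    exact hf.comp (f := fun x => (x, s)) (by fun_prop) (fun x _ => ⟨mem_univ _, hs⟩)
  exact (hH.mono' hc.aestronglyMeasurable (Eventually.of_forall fun x => hb x s hs)).mul_bdd
    hg.aestronglyMeasurable (Eventually.of_forall hC)

/-- Balance of a weighted integral of `v` in time. -/
lemma time_balance (h : HeatSys v w F) {t ε : ℝ} (ht : 0 < t) (hε : 0 < ε)
    {G Gt Gx Gxx : ℝ → ℝ → ℝ}
    (h1 : ∀ x : ℝ, ∀ s ∈ Icc (0:ℝ) (t + ε), HasDerivAt (fun s => G x s) (Gt x s) s)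
    (h2 : ∀ x : ℝ, ∀ s ∈ Icc (0:ℝ) (t + ε), HasDerivAt (fun y => G y s) (Gx x s) x)
    (h3 : ∀ x : ℝ, ∀ s ∈ Icc (0:ℝ) (t + ε), HasDerivAt (fun y => Gx y s) (Gxx x s) x)
    (c0 : ContinuousOn (fun q : ℝ × ℝ => G q.1 q.2) (univ ×ˢ Icc 0 (t + ε)))
    (c1 : ContinuousOn (fun q : ℝ × ℝ => Gt q.1 q.2) (univ ×ˢ Icc 0 (t + ε)))
    (c2 : ContinuousOn (fun q : ℝ × ℝ => Gx q.1 q.2) (univ ×ˢ Icc 0 (t + ε)))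
    (c3 : ContinuousOn (fun q : ℝ × ℝ => Gxx q.1 q.2) (univ ×ˢ Icc 0 (t + ε)))
    {H : ℝ → ℝ} (hH : Integrable H)
    (hb : ∀ x, ∀ s ∈ Icc (0:ℝ) (t + ε), |G x s| ≤ H x ∧ |Gt x s| ≤ H x ∧ |Gx x s| ≤ H x
      ∧ |Gxx x s| ≤ H x) :
    ∫ x, G x t * v x t
      = ∫ s in Ioc 0 t, ∫ x, ((Gt x s + Gxx x s) * v x s - F x s * G x s) := by
  set T := t + ε with hTdef
  have hT : 0 < T := by linarith
  obtain ⟨C, hC⟩ := h.bdd T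
  have hv := h.v_cont.measurable
  have hw := h.w_cont.measurable
  have jt := strip_integrable c1 hH (fun x s hs => (hb x s hs).2.1) hv (fun x t ht => (hC x t ht).1)
  have jxx := strip_integrable c3 hH (fun x s hs => (hb x s hs).2.2.2) hv
    (fun x t ht => (hC x t ht).1)
  have jF := strip_integrable c0 hH (fun x s hs => (hb x s hs).1) h.F_meas
    (fun x t ht => (hC x t ht).2.2)
  have j0 := strip_integrable c0 hH (fun x s hs => (hb x s hs).1) hv (fun x t ht => (hC x t ht).1)
  have jx := strip_integrable c2 hH (fun x s hs => (hb x s hs).2.2.1) hw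
    (fun x t ht => (hC x t ht).2.1)
  have mv : ∀ s, Measurable fun x => v x s := fun s => hv.comp (by fun_prop : Measurable fun x => (x, s))
  have mw : ∀ s, Measurable fun x => w x s := fun s => hw.comp (by fun_prop : Measurable fun x => (x, s))
  have mF : ∀ s, Measurable fun x => F x s :=
    fun s => h.F_meas.comp (by fun_prop : Measurable fun x => (x, s))
  have s0 : ∀ s ∈ Icc 0 T, Integrable fun x => G x s * v x s := fun s hs =>
    slice_integrable hs c0 hH (fun x s hs => (hb x s hs).1) (mv s) (fun x => (hC x s hs.2).1)
  have st : ∀ s ∈ Icc 0 T, Integrable fun x => Gt x s * v x s := fun s hs =>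
    slice_integrable hs c1 hH (fun x s hs => (hb x s hs).2.1) (mv s) (fun x => (hC x s hs.2).1)
  have sxx : ∀ s ∈ Icc 0 T, Integrable fun x => Gxx x s * v x s := fun s hs =>
    slice_integrable hs c3 hH (fun x s hs => (hb x s hs).2.2.2) (mv s) (fun x => (hC x s hs.2).1)
  have sF : ∀ s ∈ Icc 0 T, Integrable fun x => G x s * F x s := fun s hs =>
    slice_integrable hs c0 hH (fun x s hs => (hb x s hs).1) (mF s) (fun x => (hC x s hs.2).2.2)
  have sxw : ∀ s ∈ Icc 0 T, Integrable fun x => Gx x s * w x s := fun s hs =>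
    slice_integrable hs c2 hH (fun x s hs => (hb x s hs).2.2.1) (mw s) (fun x => (hC x s hs.2).2.1)
  have sxv : ∀ s ∈ Icc 0 T, Integrable fun x => Gx x s * v x s := fun s hs =>
    slice_integrable hs c2 hH (fun x s hs => (hb x s hs).2.2.1) (mv s) (fun x => (hC x s hs.2).1)
  have ibp : ∀ s ∈ Icc 0 T, ∫ x, Gx x s * w x s = - ∫ x, Gxx x s * v x s := fun s hs =>
    integral_mul_deriv_eq_deriv_mul_of_integrable (fun x _ => h3 x s hs) (fun x _ => h.deriv s x)
      (sxw s hs) (sxx s hs) (sxv s hs)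
  let N : ℝ → ℝ := fun s => ∫ x, ((Gt x s + Gxx x s) * v x s - F x s * G x s)
  have hN : IntegrableOn N (Ioc 0 T) := by
    have := ((jt.add jxx).sub jF).integral_prod_left
    refine this.congr (Eventually.of_forall fun s => ?_)
    simp only [N, Pi.sub_apply, Pi.add_apply]
    congr 1; ext x; ring
  let pr : ℝ → ℝ := fun s => max 0 (min s T)
  have prm : ∀ s, pr s ∈ Icc 0 T := fun s => ⟨le_max_left _ _, max_le hT.le (min_le_right _ _)⟩
  have pre : ∀ s ∈ Icc 0 T, pr s = s := fun s hs => by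
    simp only [pr, min_eq_left hs.2, max_eq_right hs.1]
  let m : ℝ → ℝ := fun s => ∫ x, G x (pr s) * v x (pr s)
  have hm : Continuous m := by
    refine continuous_of_dominated (bound := fun x => H x * C) (fun s => (s0 _ (prm s)).1)
      (fun s => Eventually.of_forall fun x => ?_) (hH.mul_const C)
      (Eventually.of_forall fun x => ?_)
    · rw [norm_mul]
      exact mul_le_mul (hb _ _ (prm s)).1 (hC _ _ (prm s).2).1 (norm_nonneg _)
        ((abs_nonneg _).trans (hb _ _ (prm s)).1)
    · have hpc : Continuous pr := by simp only [pr]; fun_prop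
      refine Continuous.mul ?_ (h.v_cont.comp (by fun_prop : Continuous fun s => (x, pr s)))
      rw [← continuousOn_univ]
      exact c0.comp (f := fun s => (x, pr s)) (by fun_prop) (fun s _ => ⟨mem_univ _, prm s⟩)
  have main : m t = ∫ s in Ioc 0 t, N s := by
    refine duBoisReymond_left hm ht hε hN ?_
    intro a a' ha ha'c haz
    have hac : Continuous a := continuous_iff_continuousAt.2 fun x => (ha x).continuousAt
    obtain ⟨A, hA⟩ := (isCompact_Icc (a := (0:ℝ)) (b := T)).exists_bound_of_continuousOn
      hac.continuousOn
    obtain ⟨A', hA'⟩ := (isCompact_Icc (a := (0:ℝ)) (b := T)).exists_bound_of_continuousOn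
      ha'c.continuousOn
    have hT0 : (0:ℝ) ∈ Icc 0 T := ⟨le_rfl, hT.le⟩
    have hA0 : 0 ≤ A := (norm_nonneg _).trans (hA 0 hT0)
    have hA'0 : 0 ≤ A' := (norm_nonneg _).trans (hA' 0 hT0)
    have hH0 : ∀ x, 0 ≤ H x := fun x => (abs_nonneg _).trans (hb x 0 hT0).1
    have key := h.weak_dom hT (φ := fun x s => a s * G x s)
      (φt := fun x s => a' s * G x s + a s * Gt x s) (φx := fun x s => a s * Gx x s)
      (fun x s hs => ((ha s).mul (h1 x s hs)).hasDerivWithinAt)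
      (fun x s hs => (h2 x s hs).const_mul _)
      ((hac.comp continuous_snd).continuousOn.mul c0)
      (((ha'c.comp continuous_snd).continuousOn.mul c0).add
        ((hac.comp continuous_snd).continuousOn.mul c1))
      ((hac.comp continuous_snd).continuousOn.mul c2)
      (hH.const_mul (A' + A))
      (by
        intro x s hs
        have b1 := hA s hs
        have b2 := hA' s hs
        rw [Real.norm_eq_abs] at b1 b2
        obtain ⟨e0, e1, e2, -⟩ := hb x s hs
        have hx := hH0 x
        refine ⟨?_, ?_, ?_⟩
        · rw [abs_mul]
          calc _ ≤ A * H x := by gcongr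
            _ ≤ _ := by nlinarith
        · refine (abs_add_le _ _).trans ?_
          rw [abs_mul, abs_mul]
          calc _ ≤ A' * H x + A * H x := by gcongr
            _ = _ := by ring
        · rw [abs_mul]
          calc _ ≤ A * H x := by gcongr
            _ ≤ _ := by nlinarith)
      (fun x => by rw [haz T (by rw [hTdef]; linarith), zero_mul])
    have bA : ∀ᵐ q ∂(stripMeasure T), ‖a q.1‖ ≤ A := by
      filter_upwards [strip_ae T] with q hq using hA _ ⟨hq.1.le, hq.2⟩
    have bA' : ∀ᵐ q ∂(stripMeasure T), ‖a' q.1‖ ≤ A' := by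
      filter_upwards [strip_ae T] with q hq using hA' _ ⟨hq.1.le, hq.2⟩
    have ma : AEStronglyMeasurable (fun q : ℝ × ℝ => a q.1) (stripMeasure T) :=
      (hac.comp continuous_fst).aestronglyMeasurable
    have ma' : AEStronglyMeasurable (fun q : ℝ × ℝ => a' q.1) (stripMeasure T) :=
      (ha'c.comp continuous_fst).aestronglyMeasurable
    have k1 : Integrable (fun q : ℝ × ℝ => (a' q.1 * G q.2 q.1 + a q.1 * Gt q.2 q.1) * v q.2 q.1)
        (stripMeasure T) := by
      refine ((j0.bdd_mul ma' bA').add (jt.bdd_mul ma bA)).congr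
        (Eventually.of_forall fun q => ?_)
      simp only [Pi.add_apply]; ring
    have k2 : Integrable (fun q : ℝ × ℝ => a q.1 * Gx q.2 q.1 * w q.2 q.1
        + F q.2 q.1 * (a q.1 * G q.2 q.1)) (stripMeasure T) := by
      refine ((jx.bdd_mul ma bA).add (jF.bdd_mul ma bA)).congr
        (Eventually.of_forall fun q => ?_)
      simp only [Pi.add_apply]; ring
    rw [integral_prod _ k1, integral_prod _ k2] at key
    have e1 : ∫ s in Ioc 0 T, ∫ x, (a' s * G x s + a s * Gt x s) * v x s
        = ∫ s in Ioc 0 T, (a' s * m s + a s * ∫ x, Gt x s * v x s) := by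
      refine setIntegral_congr_fun measurableSet_Ioc fun s hs => ?_
      have hs' : s ∈ Icc 0 T := ⟨hs.1.le, hs.2⟩
      simp only [m, pre s hs']
      rw [← integral_const_mul, ← integral_const_mul, ← integral_add ((s0 s hs').const_mul _)
        ((st s hs').const_mul _)]
      congr 1; ext x; ring
    have e2 : ∫ s in Ioc 0 T, ∫ x, (a s * Gx x s * w x s + F x s * (a s * G x s))
        = ∫ s in Ioc 0 T, (a s * ∫ x, Gt x s * v x s) - a s * N s := by
      refine setIntegral_congr_fun measurableSet_Ioc fun s hs => ?_
      have hs' : s ∈ Icc 0 T := ⟨hs.1.le, hs.2⟩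
      have hNs : N s = (∫ x, Gt x s * v x s) + (∫ x, Gxx x s * v x s) - ∫ x, G x s * F x s := by
        simp only [N]
        have hadd : Integrable fun x => Gt x s * v x s + Gxx x s * v x s := (st s hs').add (sxx s hs')
        rw [← integral_add (st s hs') (sxx s hs'), ← integral_sub hadd (sF s hs')]
        congr 1; ext x; ring
      have : ∫ x, (a s * Gx x s * w x s + F x s * (a s * G x s))
          = a s * ((∫ x, Gx x s * w x s) + ∫ x, G x s * F x s) := by
        rw [← integral_add (sxw s hs') (sF s hs'), ← integral_const_mul]
        congr 1; ext x; ring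
      rw [this, ibp s hs', hNs]; ring
    have i1 : IntegrableOn (fun s => a' s * m s) (Ioc 0 T) :=
      (ha'c.mul hm).integrableOn_Ioc
    have iN : IntegrableOn (fun s => a s * N s) (Ioc 0 T) := by
      refine Integrable.bdd_mul (c := A) hN hac.aestronglyMeasurable ?_
      filter_upwards [ae_restrict_mem measurableSet_Ioc] with s hs using hA s ⟨hs.1.le, hs.2⟩
    have it : IntegrableOn (fun s => a s * ∫ x, Gt x s * v x s) (Ioc 0 T) := by
      refine Integrable.bdd_mul (c := A) jt.integral_prod_left hac.aestronglyMeasurable ?_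
      filter_upwards [ae_restrict_mem measurableSet_Ioc] with s hs using hA s ⟨hs.1.le, hs.2⟩
    have key2 : ∫ s in Ioc 0 T, (a' s * m s + a s * ∫ x, Gt x s * v x s)
        = ∫ s in Ioc 0 T, (a s * ∫ x, Gt x s * v x s) - a s * N s := by
      rw [← e1, ← e2]; exact key
    rw [integral_add i1 it, integral_sub it iN] at key2
    linarith
  have : m t = ∫ x, G x t * v x t := by
    simp only [m, pre t ⟨ht.le, by rw [hTdef]; linarith⟩]
  rw [← this, main]

/-- Gaussian Duhamel identity with exponential weight. -/
lemma duhamel (h : HeatSys v w F) (c : ℝ) {t δ : ℝ} (ht : 0 < t) (hδ : 0 < δ) (x : ℝ) :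
    Real.exp (c * t) * ∫ y, hk (x - y) δ * v y t
      = ∫ s in Ioc 0 t, ∫ y, Real.exp (c * s) * hk (x - y) (t - s + δ) * (c * v y s - F y s) := by
  have hε : 0 < δ / 2 := by positivity
  set T := t + δ / 2 with hT
  have hpos : ∀ s ∈ Icc 0 T, δ / 2 ≤ t + δ - s ∧ t + δ - s ≤ t + δ := fun s hs =>
    ⟨by linarith [hs.2], by linarith [hs.1]⟩
  let E := max 1 (Real.exp (|c| * T))
  have hE1 : (1:ℝ) ≤ E := le_max_left _ _
  have hE : ∀ s ∈ Icc 0 T, Real.exp (c * s) ≤ E := fun s hs => by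
    refine le_trans ?_ (le_max_right _ _)
    apply Real.exp_le_exp.2
    calc c * s ≤ |c| * s := by gcongr; exacts [hs.1, le_abs_self c]
      _ ≤ |c| * T := by gcongr; exact hs.2
  let H : ℝ → ℝ := fun y => (1 + |c|) * E * hkDom (δ / 2) (t + δ) (x - y)
  have hH : Integrable H := ((hkDom_integrable (δ / 2) (by positivity)).comp_sub_left x).const_mul _
  have cs : ContinuousOn (fun q : ℝ × ℝ => hk (x - q.1) (t + δ - q.2)) (univ ×ˢ Icc 0 T) := by
    refine hk_continuousOn.comp (f := fun q : ℝ × ℝ => (x - q.1, t + δ - q.2)) (by fun_prop) ?_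
    rintro ⟨y, s⟩ ⟨-, hs⟩
    have := hpos s hs
    change 0 < t + δ - s
    linarith [this.1]
  have nz : ∀ q ∈ (univ : Set ℝ) ×ˢ Icc 0 T, t + δ - q.2 ≠ 0 := fun q hq => by
    have := hpos q.2 hq.2; linarith [this.1]
  have cx : ContinuousOn (fun q : ℝ × ℝ => (x - q.1) / (2 * (t + δ - q.2)) * hk (x - q.1) (t + δ - q.2))
      (univ ×ˢ Icc 0 T) := by
    refine ContinuousOn.mul (ContinuousOn.div (by fun_prop) (by fun_prop) ?_) cs
    intro q hq; have := nz q hq; positivity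
  have czz : ContinuousOn (fun q : ℝ × ℝ => hkzz (x - q.1) (t + δ - q.2)) (univ ×ˢ Icc 0 T) := by
    unfold hkzz
    refine ContinuousOn.mul (ContinuousOn.sub (ContinuousOn.div (by fun_prop) (by fun_prop) ?_)
      (ContinuousOn.div (by fun_prop) (by fun_prop) ?_)) cs
    · intro q hq; have := nz q hq; positivity
    · intro q hq; have := nz q hq; positivity
  have ce : ContinuousOn (fun q : ℝ × ℝ => Real.exp (c * q.2)) (univ ×ˢ Icc 0 T) := by fun_prop
  have key := h.time_balance ht hε
    (G := fun y s => Real.exp (c * s) * hk (x - y) (t + δ - s))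
    (Gt := fun y s => c * (Real.exp (c * s) * hk (x - y) (t + δ - s))
      - Real.exp (c * s) * hkzz (x - y) (t + δ - s))
    (Gx := fun y s => Real.exp (c * s) * ((x - y) / (2 * (t + δ - s)) * hk (x - y) (t + δ - s)))
    (Gxx := fun y s => Real.exp (c * s) * hkzz (x - y) (t + δ - s))
    (fun y s hs => by
      have hp := hpos s hs
      have e1 : HasDerivAt (fun s : ℝ => t + δ - s) (-1) s := by
        simpa using (hasDerivAt_id s).const_sub (t + δ)
      have e2 := (hk_hasDerivAt_time (x - y) (by linarith [hp.1] : 0 < t + δ - s)).comp s e1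
      have e3 : HasDerivAt (fun s : ℝ => Real.exp (c * s)) (Real.exp (c * s) * c) s := by
        simpa using ((hasDerivAt_id s).const_mul c).exp
      refine (e3.mul e2).congr_deriv ?_
      simp only [Function.comp_apply]; ring)
    (fun y s hs => by
      have e1 : HasDerivAt (fun y : ℝ => x - y) (-1) y := by
        simpa using (hasDerivAt_id y).const_sub x
      have e2 := (hk_hasDerivAt (x - y) (t + δ - s)).comp y e1
      refine (e2.const_mul _).congr_deriv ?_
      ring)
    (fun y s hs => by
      have hp := hpos s hs
      have e1 : HasDerivAt (fun y : ℝ => x - y) (-1) y := by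
        simpa using (hasDerivAt_id y).const_sub x
      have e2 := ((hkz_hasDerivAt (x - y) (by linarith [hp.1] : 0 < t + δ - s)).comp y e1).neg
      refine (HasDerivAt.const_mul (Real.exp (c * s)) (e2.congr_of_eventuallyEq ?_)).congr_deriv ?_
      · exact Eventually.of_forall fun z => by
          simp only [Pi.neg_apply, Function.comp_apply]; ring
      · ring)
    (ce.mul cs) ((continuousOn_const.mul (ce.mul cs)).sub (ce.mul czz)) (ce.mul cx) (ce.mul czz)
    hH
    (by
      intro y s hs
      have hp := hpos s hs
      obtain ⟨b1, b2, b3⟩ := hk_bounds (z := x - y) hε hp.1 hp.2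
      have hd := hkDom_nonneg hε (t + δ) (x - y)
      set d := hkDom (δ / 2) (t + δ) (x - y) with hdd
      have he := hE s hs
      have he0 : |Real.exp (c * s)| = Real.exp (c * s) := abs_of_pos (Real.exp_pos _)
      have hep := Real.exp_pos (c * s)
      have hED : 0 ≤ E * d := mul_nonneg (by linarith) hd
      have hcE : 0 ≤ |c| * (E * d) := mul_nonneg (abs_nonneg c) hED
      have hHy : H y = E * d + |c| * (E * d) := by simp only [H]; ring
      have f1 : |Real.exp (c * s) * hk (x - y) (t + δ - s)| ≤ E * d := by
        rw [abs_mul, he0]; gcongr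
      have f3 : |Real.exp (c * s) * hkzz (x - y) (t + δ - s)| ≤ E * d := by
        rw [abs_mul, he0]; gcongr
      have f2 : |Real.exp (c * s) * ((x - y) / (2 * (t + δ - s)) * hk (x - y) (t + δ - s))| ≤ E * d := by
        rw [abs_mul, he0]
        have : |(x - y) / (2 * (t + δ - s)) * hk (x - y) (t + δ - s)| ≤ d := by
          rw [← abs_neg]; convert b2 using 2; ring
        gcongr
      rw [hHy]
      refine ⟨by linarith, ?_, by linarith, by linarith⟩
      refine (abs_sub _ _).trans ?_
      rw [abs_mul c]
      have := mul_le_mul_of_nonneg_left f1 (abs_nonneg c)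
      linarith)
  rw [← integral_const_mul]
  have e1 : ∫ y, Real.exp (c * t) * (hk (x - y) δ * v y t)
      = ∫ y, Real.exp (c * t) * hk (x - y) (t + δ - t) * v y t := by
    congr 1; ext y; rw [show t + δ - t = δ by ring]; ring
  rw [e1, key]
  refine setIntegral_congr_fun measurableSet_Ioc fun s _ => ?_
  congr 1; ext y
  rw [show t - s + δ = t + δ - s by ring]
  ring

end HeatSys

lemma compact_support_bound {a : ℝ → ℝ} (ha : Continuous a) {R : ℝ} (hR : ∀ x, R ≤ |x| → a x = 0) :
    ∃ M, 0 ≤ M ∧ ∀ x, |a x| ≤ M ∧ |a x| ≤ (Icc (-R) R).indicator (fun _ => M) x := by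
  obtain ⟨M, hM⟩ := (isCompact_Icc (a := -R) (b := R)).exists_bound_of_continuousOn ha.continuousOn
  have h0 : ∀ x ∉ Icc (-R) R, a x = 0 := fun x hx => by
    apply hR
    by_contra hc
    push Not at hc
    exact hx (abs_le.1 hc.le)
  refine ⟨max M 0, le_max_right _ _, fun x => ?_⟩
  by_cases hx : x ∈ Icc (-R) R
  · have := (hM x hx).trans (le_max_left M 0)
    rw [indicator_of_mem hx]; exact ⟨this, this⟩
  · rw [indicator_of_notMem hx, h0 x hx]; simp

lemma indicator_const_integrable (R M : ℝ) :
    Integrable ((Icc (-R) R).indicator (fun _ : ℝ => M)) :=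
  (integrable_indicator_iff measurableSet_Icc).2
    (integrableOn_const (by simp [Real.volume_Icc]))

lemma compact_support_integrable {a : ℝ → ℝ} (ha : Continuous a) {R : ℝ}
    (hR : ∀ x, R ≤ |x| → a x = 0) : Integrable a := by
  obtain ⟨M, -, hM⟩ := compact_support_bound ha hR
  exact (indicator_const_integrable R M).mono' ha.aestronglyMeasurable
    (Eventually.of_forall fun x => (hM x).2)

lemma eq_deriv_of_contDiff {a a' : ℝ → ℝ} (h : ∀ x, HasDerivAt a (a' x) x) (hc : ContDiff ℝ 2 a) :
    Continuous a' := by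
  have : a' = deriv a := funext fun x => (h x).deriv.symm
  rw [this]; exact hc.continuous_deriv (by norm_num)

namespace HeatSys
variable {v w F : ℝ → ℝ → ℝ}

/-- Integrability of `c(x) k(t) g(x,t)` on a strip. -/
lemma strip_integrable_mul {T : ℝ} {c k : ℝ → ℝ} (hc : Integrable c)
    (hk : AEStronglyMeasurable k (volume.restrict (Ioc 0 T))) {K : ℝ} (hkK : ∀ t ∈ Ioc 0 T, |k t| ≤ K)
    {g : ℝ → ℝ → ℝ} (hg : Measurable fun q : ℝ × ℝ => g q.1 q.2) {C : ℝ}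
    (hC : ∀ x t, t ≤ T → |g x t| ≤ C) :
    Integrable (fun q : ℝ × ℝ => c q.2 * (k q.1 * g q.2 q.1)) (stripMeasure T) := by
  refine Integrable.mono' ((strip_dom_integrable hc.norm (T := T)).mul_const (K * C))
    ((hc.1.comp_snd).mul (hk.comp_fst.mul (hg.comp measurable_swap).aestronglyMeasurable)) ?_
  filter_upwards [strip_ae T] with q hq
  rw [norm_mul, norm_mul]
  have := hkK _ hq
  exact mul_le_mul_of_nonneg_left (mul_le_mul this (hC _ _ hq.2) (norm_nonneg _)
    ((abs_nonneg _).trans this)) (norm_nonneg _)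

lemma strip_swap {T : ℝ} {c k : ℝ → ℝ} (hc : Integrable c)
    (hk : AEStronglyMeasurable k (volume.restrict (Ioc 0 T))) {K : ℝ} (hkK : ∀ t ∈ Ioc 0 T, |k t| ≤ K)
    {g : ℝ → ℝ → ℝ} (hg : Measurable fun q : ℝ × ℝ => g q.1 q.2) {C : ℝ}
    (hC : ∀ x t, t ≤ T → |g x t| ≤ C) :
    ∫ q, c q.2 * (k q.1 * g q.2 q.1) ∂(stripMeasure T)
      = ∫ x, c x * ∫ t in Ioc 0 T, k t * g x t := by
  rw [integral_prod_symm _ (strip_integrable_mul hc hk hkK hg hC)]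
  congr 1; ext x
  rw [← integral_const_mul]

lemma timeAvg_bound {T : ℝ} (hT : 0 ≤ T) {k : ℝ → ℝ} {K : ℝ} (hkK : ∀ t ∈ Ioc 0 T, |k t| ≤ K)
    {g : ℝ → ℝ → ℝ} {C : ℝ} (hC : ∀ x t, t ≤ T → |g x t| ≤ C) (x : ℝ) :
    |∫ t in Ioc 0 T, k t * g x t| ≤ K * C * T := by
  have := norm_setIntegral_le_of_norm_le_const (μ := volume) (s := Ioc 0 T)
    (f := fun t => k t * g x t) (C := K * C) (by simp) (fun t ht => by
      rw [norm_mul]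
      exact mul_le_mul (hkK t ht) (hC _ _ ht.2) (norm_nonneg _) ((abs_nonneg _).trans (hkK t ht)))
  simpa [hT, Measure.real] using this

lemma timeAvg_measurable {T : ℝ} {k : ℝ → ℝ}
    (hk : AEStronglyMeasurable k (volume.restrict (Ioc 0 T)))
    {g : ℝ → ℝ → ℝ} (hg : Measurable fun q : ℝ × ℝ => g q.1 q.2) :
    AEStronglyMeasurable (fun x => ∫ t in Ioc 0 T, k t * g x t) := by
  have : AEStronglyMeasurable (fun q : ℝ × ℝ => k q.2 * g q.1 q.2)
      ((volume : Measure ℝ).prod (volume.restrict (Ioc 0 T))) :=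
    hk.comp_snd.mul hg.aestronglyMeasurable
  exact this.integral_prod_right'

lemma timeAvg_continuous {T : ℝ} {k : ℝ → ℝ}
    (hk : AEStronglyMeasurable k (volume.restrict (Ioc 0 T))) {K : ℝ}
    (hkK : ∀ t ∈ Ioc 0 T, |k t| ≤ K)
    {g : ℝ → ℝ → ℝ} (hg : Continuous fun q : ℝ × ℝ => g q.1 q.2) {C : ℝ}
    (hC : ∀ x t, t ≤ T → |g x t| ≤ C) :
    Continuous fun x => ∫ t in Ioc 0 T, k t * g x t := by
  refine continuous_of_dominated (bound := fun _ => K * C) (fun x => ?_) (fun x => ?_) ?_ ?_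
  · exact hk.mul (hg.comp (by fun_prop : Continuous fun t => (x, t))).aestronglyMeasurable
  · filter_upwards [ae_restrict_mem measurableSet_Ioc] with t ht
    rw [norm_mul]
    exact mul_le_mul (hkK t ht) (hC _ _ ht.2) (norm_nonneg _) ((abs_nonneg _).trans (hkK t ht))
  · exact integrableOn_const (by simp)
  · exact Eventually.of_forall fun t =>
      continuous_const.mul (hg.comp (by fun_prop : Continuous fun x => (x, t)))

lemma timeAvg_hasDerivAt {T : ℝ} {k : ℝ → ℝ}
    (hk : AEStronglyMeasurable k (volume.restrict (Ioc 0 T))) {K : ℝ}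
    (hkK : ∀ t ∈ Ioc 0 T, |k t| ≤ K)
    {g g' : ℝ → ℝ → ℝ} (hg : Continuous fun q : ℝ × ℝ => g q.1 q.2)
    (hg' : Continuous fun q : ℝ × ℝ => g' q.1 q.2) {C : ℝ}
    (hC : ∀ x t, t ≤ T → |g x t| ≤ C ∧ |g' x t| ≤ C)
    (hd : ∀ t x, HasDerivAt (fun y => g y t) (g' x t) x) (x : ℝ) :
    HasDerivAt (fun x => ∫ t in Ioc 0 T, k t * g x t) (∫ t in Ioc 0 T, k t * g' x t) x := by
  have meas : ∀ {g : ℝ → ℝ → ℝ} (_ : Continuous fun q : ℝ × ℝ => g q.1 q.2) (x : ℝ),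
      AEStronglyMeasurable (fun t => k t * g x t) (volume.restrict (Ioc 0 T)) := fun hg x =>
    hk.mul (hg.comp (by fun_prop : Continuous fun t => (x, t))).aestronglyMeasurable
  have bd : ∀ x, ∀ t ∈ Ioc 0 T, ‖k t * g x t‖ ≤ K * C ∧ ‖k t * g' x t‖ ≤ K * C := by
    intro x t ht
    rw [norm_mul, norm_mul]
    have hK0 := (abs_nonneg _).trans (hkK t ht)
    exact ⟨mul_le_mul (hkK t ht) (hC _ _ ht.2).1 (norm_nonneg _) hK0,
      mul_le_mul (hkK t ht) (hC _ _ ht.2).2 (norm_nonneg _) hK0⟩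
  refine (hasDerivAt_integral_of_dominated_loc_of_deriv_le (bound := fun _ => K * C)
    (F' := fun x t => k t * g' x t) (Metric.ball_mem_nhds x one_pos) ?_ ?_ ?_ ?_ ?_ ?_).2
  · exact Eventually.of_forall fun x => meas hg x
  · refine Integrable.mono' (integrableOn_const (C := K * C) (by simp)) (meas hg x) ?_
    filter_upwards [ae_restrict_mem measurableSet_Ioc] with t ht using (bd x t ht).1
  · exact meas hg' x
  · filter_upwards [ae_restrict_mem measurableSet_Ioc] with t ht
    exact fun y _ => (bd y t ht).2
  · exact integrableOn_const (by simp)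
  · exact Eventually.of_forall fun t y _ => (hd t y).const_mul _

lemma exp_locallyIntegrable_mul {c f : ℝ → ℝ} (hc : Continuous c) (hf : AEStronglyMeasurable f) {M : ℝ}
    (hM : ∀ x, |f x| ≤ M) : LocallyIntegrable fun x => c x * f x := by
  have : LocallyIntegrable c := hc.locallyIntegrable
  rw [locallyIntegrable_iff] at this ⊢
  intro K hK
  exact (this K hK).mul_bdd hf.restrict (Eventually.of_forall hM)

/-- Equation for the time average of the flux at fixed `x`. -/
lemma flux_balance (h : HeatSys v w F) {T : ℝ} (hT : 0 < T) {χ χ' : ℝ → ℝ}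
    (hχ : ∀ t, HasDerivAt χ (χ' t) t) (hχ' : Continuous χ') (hχT : χ T = 0)
    {x₁ x₂ : ℝ} (h12 : x₁ ≤ x₂) :
    (∫ t in Ioc 0 T, χ t * w x₂ t) - (∫ t in Ioc 0 T, χ t * w x₁ t)
      = ∫ x in x₁..x₂, ((∫ t in Ioc 0 T, χ t * F x t) - ∫ t in Ioc 0 T, χ' t * v x t) := by
  obtain ⟨C, hC⟩ := h.bdd T
  have hχc : Continuous χ := continuous_iff_continuousAt.2 fun x => (hχ x).continuousAt
  obtain ⟨K, hK⟩ := (isCompact_Icc (a := (0:ℝ)) (b := T)).exists_bound_of_continuousOn hχc.continuousOn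
  obtain ⟨K', hK'⟩ := (isCompact_Icc (a := (0:ℝ)) (b := T)).exists_bound_of_continuousOn
    hχ'.continuousOn
  have hKI : ∀ t ∈ Ioc 0 T, |χ t| ≤ K := fun t ht => hK t ⟨ht.1.le, ht.2⟩
  have hKI' : ∀ t ∈ Ioc 0 T, |χ' t| ≤ K' := fun t ht => hK' t ⟨ht.1.le, ht.2⟩
  have hK0 : 0 ≤ K := (norm_nonneg _).trans (hK 0 ⟨le_rfl, hT.le⟩)
  have hK'0 : 0 ≤ K' := (norm_nonneg _).trans (hK' 0 ⟨le_rfl, hT.le⟩)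
  have mχ := hχc.aestronglyMeasurable (μ := volume.restrict (Ioc 0 T))
  have mχ' := hχ'.aestronglyMeasurable (μ := volume.restrict (Ioc 0 T))
  have CF := fun x t ht => (hC x t ht).2.2
  have Cv := fun x t ht => (hC x t ht).1
  have Cw := fun x t ht => (hC x t ht).2.1
  refine duBoisReymond (D := fun x => ∫ t in Ioc 0 T, χ t * w x t)
    (timeAvg_continuous mχ hKI h.w_cont Cw) ?_ ?_ h12
  · have := exp_locallyIntegrable_mul (c := fun _ => 1) continuous_const
      ((timeAvg_measurable mχ h.F_meas).sub (timeAvg_measurable mχ' h.v_cont.measurable))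
      (M := K * C * T + K' * C * T) (fun x => (abs_sub _ _).trans
        (add_le_add (timeAvg_bound hT.le hKI CF x) (timeAvg_bound hT.le hKI' Cv x)))
    simpa using this
  · intro a a' ha hac ⟨R, hR⟩
    have ha'c := eq_deriv_of_contDiff ha hac
    obtain ⟨M, hM0, hM⟩ := compact_support_bound hac.continuous (fun x hx => (hR x hx).1)
    obtain ⟨M', hM'0, hM'⟩ := compact_support_bound ha'c (fun x hx => (hR x hx).2)
    have ia := compact_support_integrable hac.continuous (fun x hx => (hR x hx).1)
    have ia' := compact_support_integrable ha'c (fun x hx => (hR x hx).2)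
    have key := h.weak_dom hT (φ := fun x t => χ t * a x) (φt := fun x t => χ' t * a x)
      (φx := fun x t => χ t * a' x)
      (fun x t _ => ((hχ t).mul_const _).hasDerivWithinAt)
      (fun x t _ => (ha x).const_mul _)
      ((hχc.comp continuous_snd).mul (hac.continuous.comp continuous_fst)).continuousOn
      ((hχ'.comp continuous_snd).mul (hac.continuous.comp continuous_fst)).continuousOn
      ((hχc.comp continuous_snd).mul (ha'c.comp continuous_fst)).continuousOn
      (H := fun x => (K + K') * |a x| + K * |a' x|)
      ((ia.norm.const_mul _).add (ia'.norm.const_mul _))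
      (fun x t ht => by
        have b1 := hK t ht
        have b2 := hK' t ht
        rw [Real.norm_eq_abs] at b1 b2
        have p1 := mul_nonneg hK0 (abs_nonneg (a x))
        have p2 := mul_nonneg hK'0 (abs_nonneg (a x))
        have p3 := mul_nonneg hK0 (abs_nonneg (a' x))
        simp only [abs_mul]
        have q1 := mul_le_mul_of_nonneg_right b1 (abs_nonneg (a x))
        have q2 := mul_le_mul_of_nonneg_right b2 (abs_nonneg (a x))
        have q3 := mul_le_mul_of_nonneg_right b1 (abs_nonneg (a' x))
        exact ⟨by linarith, by linarith, by linarith⟩)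
      (fun x => by rw [hχT, zero_mul])
    have e1 : ∫ q, χ' q.1 * a q.2 * v q.2 q.1 ∂(stripMeasure T)
        = ∫ x, a x * ∫ t in Ioc 0 T, χ' t * v x t := by
      rw [← strip_swap ia mχ' hKI' h.v_cont.measurable Cv]
      congr 1; ext q; ring
    have e2 : ∫ q, (χ q.1 * a' q.2 * w q.2 q.1 + F q.2 q.1 * (χ q.1 * a q.2)) ∂(stripMeasure T)
        = (∫ x, a' x * ∫ t in Ioc 0 T, χ t * w x t) + ∫ x, a x * ∫ t in Ioc 0 T, χ t * F x t := by
      rw [← strip_swap ia mχ hKI h.F_meas CF, ← strip_swap ia' mχ hKI h.w_cont.measurable Cw,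
        ← integral_add (strip_integrable_mul ia' mχ hKI h.w_cont.measurable Cw)
          (strip_integrable_mul ia mχ hKI h.F_meas CF)]
      congr 1; ext q; ring
    rw [e1, e2] at key
    have i1 := ia.mul_bdd (timeAvg_measurable mχ' h.v_cont.measurable)
      (Eventually.of_forall (timeAvg_bound hT.le hKI' Cv))
    have i2 := ia.mul_bdd (timeAvg_measurable mχ h.F_meas)
      (Eventually.of_forall (timeAvg_bound hT.le hKI CF))
    have : ∫ x, a x * ((∫ t in Ioc 0 T, χ t * F x t) - ∫ t in Ioc 0 T, χ' t * v x t)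
        = (∫ x, a x * ∫ t in Ioc 0 T, χ t * F x t) - ∫ x, a x * ∫ t in Ioc 0 T, χ' t * v x t := by
      rw [← integral_sub i2 i1]
      congr 1; ext x; ring
    rw [this]; linarith

/-- Bounds for the weights occurring in similarity averages. -/
lemma weight_bounds {T t₀ : ℝ} (ht0 : 0 < t₀) (hT : t₀ < T) {ϑ : ℝ → ℝ}
    (hϑc : Continuous ϑ) (hϑ0 : ∀ t ≤ t₀, ϑ t = 0) :
    ∃ K, 0 ≤ K ∧ (∀ t ∈ Ioc 0 T, |ϑ t| ≤ K) ∧ (∀ t ∈ Ioc 0 T, |ϑ t / t| ≤ K / t₀) ∧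
      ∀ t ∈ Ioc 0 T, |ϑ t / Real.sqrt t| ≤ K / Real.sqrt t₀ := by
  obtain ⟨K, hK⟩ := (isCompact_Icc (a := (0:ℝ)) (b := T)).exists_bound_of_continuousOn hϑc.continuousOn
  have hKI : ∀ t ∈ Ioc 0 T, |ϑ t| ≤ K := fun t ht => hK t ⟨ht.1.le, ht.2⟩
  have hK0 : 0 ≤ K := (norm_nonneg _).trans (hK 0 ⟨le_rfl, (ht0.trans hT).le⟩)
  refine ⟨K, hK0, hKI, fun t ht => ?_, fun t ht => ?_⟩
  · rcases le_or_gt t t₀ with h1 | h1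
    · rw [hϑ0 t h1]; simp; positivity
    · rw [abs_div, abs_of_pos ht.1]
      exact div_le_div₀ hK0 (hKI t ht) ht0 h1.le
  · rcases le_or_gt t t₀ with h1 | h1
    · rw [hϑ0 t h1]; simp; positivity
    · rw [abs_div, abs_of_pos (Real.sqrt_pos.2 ht.1)]
      exact div_le_div₀ hK0 (hKI t ht) (Real.sqrt_pos.2 ht0) (Real.sqrt_le_sqrt h1.le)

lemma similarityAvg_hasDerivAt (h : HeatSys v w F) {T t₀ : ℝ} (ht0 : 0 < t₀) (hT : t₀ < T)
    {ϑ : ℝ → ℝ} (hϑc : Continuous ϑ) (hϑ0 : ∀ t ≤ t₀, ϑ t = 0) (x : ℝ) :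
    HasDerivAt (fun x => ∫ t in Ioc 0 T, ϑ t / t * v (x * Real.sqrt t) t)
      (∫ t in Ioc 0 T, ϑ t / Real.sqrt t * w (x * Real.sqrt t) t) x := by
  obtain ⟨C, hC⟩ := h.bdd T
  obtain ⟨K, hK0, -, hKt, -⟩ := weight_bounds ht0 hT hϑc hϑ0
  have mt : AEStronglyMeasurable (fun t => ϑ t / t) (volume.restrict (Ioc 0 T)) :=
    (hϑc.measurable.div measurable_id).aestronglyMeasurable
  have hsc : Continuous fun q : ℝ × ℝ => (q.1 * Real.sqrt q.2, q.2) := by fun_prop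
  have cv₁ : Continuous fun q : ℝ × ℝ => v (q.1 * Real.sqrt q.2) q.2 := h.v_cont.comp hsc
  have cw₁ : Continuous fun q : ℝ × ℝ => w (q.1 * Real.sqrt q.2) q.2 := h.w_cont.comp hsc
  have hS' := timeAvg_hasDerivAt mt hKt (g := fun x t => v (x * Real.sqrt t) t)
    (g' := fun x t => Real.sqrt t * w (x * Real.sqrt t) t) cv₁
    ((Real.continuous_sqrt.comp continuous_snd).mul cw₁) (C := max C (Real.sqrt T * C)) (fun x t ht =>
      ⟨((hC _ t ht).1).trans (le_max_left _ _), by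
        rw [abs_mul, abs_of_nonneg (Real.sqrt_nonneg _)]
        refine le_trans ?_ (le_max_right _ _)
        gcongr
        exact (hC _ t ht).2.1⟩)
    (fun t y => by
      have e1 : HasDerivAt (fun y : ℝ => y * Real.sqrt t) (Real.sqrt t) y := by
        simpa using (hasDerivAt_id y).mul_const (Real.sqrt t)
      refine ((h.deriv t (y * Real.sqrt t)).comp y e1).congr_deriv ?_
      ring) x
  refine hS'.congr_deriv ?_
  refine setIntegral_congr_fun measurableSet_Ioc fun t ht => ?_
  have e2 : Real.sqrt t * Real.sqrt t = t := Real.mul_self_sqrt ht.1.le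
  have e3 := Real.sqrt_pos.2 ht.1
  have e4 : ϑ t / t = ϑ t / Real.sqrt t / Real.sqrt t := by rw [div_div, e2]
  rw [e4]; field_simp

/-- The substitution `x = η √t` on a strip. -/
lemma strip_rescale {T : ℝ} {f g : ℝ → ℝ → ℝ}
    (hf : Integrable (fun q : ℝ × ℝ => f q.2 q.1) (stripMeasure T))
    (hg : Integrable (fun q : ℝ × ℝ => g q.2 q.1) (stripMeasure T))
    (hfg : ∀ t ∈ Ioc 0 T, ∀ x, Real.sqrt t * f (x * Real.sqrt t) t = g x t) :
    ∫ q, f q.2 q.1 ∂(stripMeasure T) = ∫ q, g q.2 q.1 ∂(stripMeasure T) := by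
  rw [integral_prod _ hf, integral_prod _ hg]
  refine setIntegral_congr_fun measurableSet_Ioc fun t ht => ?_
  have hsp := Real.sqrt_pos.2 ht.1
  have : ∫ x, g x t = ∫ x, Real.sqrt t * f (x * Real.sqrt t) t := by
    congr 1; ext x; rw [hfg t ht x]
  simp only [this]
  rw [integral_const_mul, Measure.integral_comp_mul_right (fun x => f x t), abs_of_pos (inv_pos.2 hsp),
    smul_eq_mul, ← mul_assoc, mul_inv_cancel₀ hsp.ne', one_mul]

/-- Equation for the time average of the flux at fixed `x / √t`. -/
lemma similarity_balance (h : HeatSys v w F) {T t₀ : ℝ} (ht0 : 0 < t₀) (hT : t₀ < T) {ϑ ϑ' : ℝ → ℝ}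
    (hϑ : ∀ t, HasDerivAt ϑ (ϑ' t) t) (hϑ' : Continuous ϑ') (hϑ0 : ∀ t ≤ t₀, ϑ t = 0)
    (hϑT : ϑ T = 0) {x₁ x₂ : ℝ} (h12 : x₁ ≤ x₂) :
    Real.exp (x₂ ^ 2 / 4) * (∫ t in Ioc 0 T, ϑ t / Real.sqrt t * w (x₂ * Real.sqrt t) t)
      - Real.exp (x₁ ^ 2 / 4) * (∫ t in Ioc 0 T, ϑ t / Real.sqrt t * w (x₁ * Real.sqrt t) t)
      = ∫ x in x₁..x₂, Real.exp (x ^ 2 / 4) * ((∫ t in Ioc 0 T, ϑ t * F (x * Real.sqrt t) t)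
          - ∫ t in Ioc 0 T, ϑ' t * v (x * Real.sqrt t) t) := by
  have hT0 : 0 < T := ht0.trans hT
  obtain ⟨C, hC⟩ := h.bdd T
  have hϑc : Continuous ϑ := continuous_iff_continuousAt.2 fun x => (hϑ x).continuousAt
  have hϑ'0 : ∀ t < t₀, ϑ' t = 0 := fun t ht => by
    have : ϑ =ᶠ[𝓝 t] fun _ => 0 := by
      filter_upwards [Iio_mem_nhds ht] with s hs using hϑ0 s (le_of_lt hs)
    have h2 := (hasDerivAt_const t (0:ℝ)).congr_of_eventuallyEq this
    exact (hϑ t).unique h2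
  obtain ⟨K, hK⟩ := (isCompact_Icc (a := (0:ℝ)) (b := T)).exists_bound_of_continuousOn hϑc.continuousOn
  obtain ⟨K', hK'⟩ := (isCompact_Icc (a := (0:ℝ)) (b := T)).exists_bound_of_continuousOn
    hϑ'.continuousOn
  have hKI : ∀ t ∈ Ioc 0 T, |ϑ t| ≤ K := fun t ht => hK t ⟨ht.1.le, ht.2⟩
  have hKI' : ∀ t ∈ Ioc 0 T, |ϑ' t| ≤ K' := fun t ht => hK' t ⟨ht.1.le, ht.2⟩
  have hK0 : 0 ≤ K := (norm_nonneg _).trans (hK 0 ⟨le_rfl, hT0.le⟩)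
  have hKt : ∀ t ∈ Ioc 0 T, |ϑ t / t| ≤ K / t₀ := fun t ht => by
    rcases le_or_gt t t₀ with h1 | h1
    · rw [hϑ0 t h1]; simp; positivity
    · rw [abs_div, abs_of_pos ht.1]
      exact div_le_div₀ hK0 (hKI t ht) ht0 h1.le
  have hKs : ∀ t ∈ Ioc 0 T, |ϑ t / Real.sqrt t| ≤ K / Real.sqrt t₀ := fun t ht => by
    rcases le_or_gt t t₀ with h1 | h1
    · rw [hϑ0 t h1]; simp; positivity
    · rw [abs_div, abs_of_pos (Real.sqrt_pos.2 ht.1)]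
      exact div_le_div₀ hK0 (hKI t ht) (Real.sqrt_pos.2 ht0) (Real.sqrt_le_sqrt h1.le)
  have mϑ := hϑc.aestronglyMeasurable (μ := volume.restrict (Ioc 0 T))
  have mϑ' := hϑ'.aestronglyMeasurable (μ := volume.restrict (Ioc 0 T))
  have mt : AEStronglyMeasurable (fun t => ϑ t / t) (volume.restrict (Ioc 0 T)) :=
    (hϑc.measurable.div measurable_id).aestronglyMeasurable
  have ms : AEStronglyMeasurable (fun t => ϑ t / Real.sqrt t) (volume.restrict (Ioc 0 T)) :=
    (hϑc.measurable.div Real.continuous_sqrt.measurable).aestronglyMeasurable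
  let v₁ : ℝ → ℝ → ℝ := fun x t => v (x * Real.sqrt t) t
  let w₁ : ℝ → ℝ → ℝ := fun x t => w (x * Real.sqrt t) t
  let F₁ : ℝ → ℝ → ℝ := fun x t => F (x * Real.sqrt t) t
  have hsc : Continuous fun q : ℝ × ℝ => (q.1 * Real.sqrt q.2, q.2) := by fun_prop
  have cv₁ : Continuous fun q : ℝ × ℝ => v₁ q.1 q.2 := h.v_cont.comp hsc
  have cw₁ : Continuous fun q : ℝ × ℝ => w₁ q.1 q.2 := h.w_cont.comp hsc
  have mF₁ : Measurable fun q : ℝ × ℝ => F₁ q.1 q.2 := h.F_meas.comp hsc.measurable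
  have CF : ∀ x t, t ≤ T → |F₁ x t| ≤ C := fun x t ht => (hC _ t ht).2.2
  have Cv : ∀ x t, t ≤ T → |v₁ x t| ≤ C := fun x t ht => (hC _ t ht).1
  have Cw : ∀ x t, t ≤ T → |w₁ x t| ≤ C := fun x t ht => (hC _ t ht).2.1
  let S : ℝ → ℝ := fun x => ∫ t in Ioc 0 T, ϑ t / t * v₁ x t
  let Dv : ℝ → ℝ := fun x => ∫ t in Ioc 0 T, ϑ t / Real.sqrt t * w₁ x t
  let P : ℝ → ℝ := fun x => ∫ t in Ioc 0 T, ϑ' t * v₁ x t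
  let Q : ℝ → ℝ := fun x => ∫ t in Ioc 0 T, ϑ t * F₁ x t
  have hDc : Continuous Dv := timeAvg_continuous ms hKs cw₁ Cw
  have hS : ∀ x, HasDerivAt S (Dv x) x := fun x => h.similarityAvg_hasDerivAt ht0 hT hϑc hϑ0 x
  have hexp : Continuous fun x : ℝ => Real.exp (x ^ 2 / 4) := by fun_prop
  have hexpd : ∀ x : ℝ, HasDerivAt (fun x : ℝ => Real.exp (x ^ 2 / 4))
      (Real.exp (x ^ 2 / 4) * (x / 2)) x := fun x => by
    have : HasDerivAt (fun x : ℝ => x ^ 2 / 4) (x / 2) x :=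
      ((hasDerivAt_pow 2 x).div_const 4).congr_deriv (by norm_num; ring)
    exact this.exp
  refine duBoisReymond (D := fun x => Real.exp (x ^ 2 / 4) * Dv x)
    (F := fun x => Real.exp (x ^ 2 / 4) * (Q x - P x)) (hexp.mul hDc) ?_ ?_ h12
  · exact exp_locallyIntegrable_mul hexp
      ((timeAvg_measurable mϑ mF₁).sub (timeAvg_measurable mϑ' cv₁.measurable))
      (M := K * C * T + K' * C * T) (fun x => (abs_sub _ _).trans
        (add_le_add (timeAvg_bound hT0.le hKI CF x) (timeAvg_bound hT0.le hKI' Cv x)))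
  · intro a a' ha hac ⟨R, hR⟩
    have ha'c := eq_deriv_of_contDiff ha hac
    let b : ℝ → ℝ := fun x => Real.exp (x ^ 2 / 4) * a x
    let b' : ℝ → ℝ := fun x => Real.exp (x ^ 2 / 4) * (x / 2) * a x + Real.exp (x ^ 2 / 4) * a' x
    have hb : ∀ x, HasDerivAt b (b' x) x := fun x => (hexpd x).mul (ha x)
    have hbc : Continuous b := hexp.mul hac.continuous
    have hb'c : Continuous b' := by
      have := hac.continuous
      simp only [b']; fun_prop
    have hbR : ∀ x, R ≤ |x| → b x = 0 ∧ b' x = 0 := fun x hx => by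
      simp [b, b', (hR x hx).1, (hR x hx).2]
    have ib := compact_support_integrable hbc (fun x hx => (hbR x hx).1)
    have ib' := compact_support_integrable hb'c (fun x hx => (hbR x hx).2)
    obtain ⟨M, hM0, hM⟩ := compact_support_bound hbc (fun x hx => (hbR x hx).1)
    obtain ⟨M', hM'0, hM'⟩ := compact_support_bound hb'c (fun x hx => (hbR x hx).2)
    let d : ℝ → ℝ := fun x => x * b' x + b x
    have hdc : Continuous d := by simp only [d]; fun_prop
    have hdR : ∀ x, R ≤ |x| → d x = 0 := fun x hx => by simp [d, (hbR x hx).1, (hbR x hx).2]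
    have id' := compact_support_integrable hdc hdR
    obtain ⟨Md, hMd0, hMd⟩ := compact_support_bound hdc hdR
    -- the test function `b (x / √t) ϑ(t) / √t`
    let φ : ℝ → ℝ → ℝ := fun x t => b (x / Real.sqrt t) * (ϑ t / Real.sqrt t)
    let φt : ℝ → ℝ → ℝ := fun x t => (ϑ' t * b (x / Real.sqrt t)
      - d (x / Real.sqrt t) * (ϑ t / t) / 2) / Real.sqrt t
    let φx : ℝ → ℝ → ℝ := fun x t => b' (x / Real.sqrt t) * (ϑ t / t)
    have z0 : ∀ x, ∀ t < t₀, φ x t = 0 ∧ φt x t = 0 ∧ φx x t = 0 := fun x t ht => by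
      simp [φ, φt, φx, hϑ0 t ht.le, hϑ'0 t ht]
    have nearz : ∀ {f : ℝ → ℝ → ℝ}, (∀ x, ∀ t < t₀, f x t = 0) →
        ContinuousOn (fun q : ℝ × ℝ => f q.1 q.2) {q | 0 < q.2} →
        ContinuousOn (fun q : ℝ × ℝ => f q.1 q.2) (univ ×ˢ Icc 0 T) := by
      intro f hf hfc q hq
      by_cases hq2 : 0 < q.2
      · have hopen : IsOpen {q : ℝ × ℝ | 0 < q.2} := isOpen_lt continuous_const continuous_snd
        exact (hfc.continuousAt (hopen.mem_nhds hq2)).continuousWithinAt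
      · have hopen : IsOpen {q : ℝ × ℝ | q.2 < t₀} := isOpen_lt continuous_snd continuous_const
        have hmem : {q : ℝ × ℝ | q.2 < t₀} ∈ 𝓝 q := hopen.mem_nhds (by
          change q.2 < t₀; linarith)
        have : (fun q : ℝ × ℝ => f q.1 q.2) =ᶠ[𝓝 q] fun _ => 0 := by
          filter_upwards [hmem] with r hr using hf _ _ hr
        exact (continuousAt_const.congr this.symm).continuousWithinAt
    have csq : ContinuousOn (fun q : ℝ × ℝ => q.1 / Real.sqrt q.2) {q | 0 < q.2} := by
      refine ContinuousOn.div (by fun_prop) (by fun_prop) fun q hq => ?_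
      have : 0 < q.2 := hq
      exact (Real.sqrt_pos.2 this).ne'
    have cs2 : ContinuousOn (fun q : ℝ × ℝ => ϑ q.2 / Real.sqrt q.2) {q | 0 < q.2} := by
      refine ContinuousOn.div (by fun_prop) (by fun_prop) fun q hq => ?_
      have : 0 < q.2 := hq
      exact (Real.sqrt_pos.2 this).ne'
    have cs3 : ContinuousOn (fun q : ℝ × ℝ => ϑ q.2 / q.2) {q | 0 < q.2} := by
      refine ContinuousOn.div (by fun_prop) (by fun_prop) fun q hq => ?_
      have : 0 < q.2 := hq
      exact this.ne'
    have cbq := hbc.comp_continuousOn csq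
    have cb'q := hb'c.comp_continuousOn csq
    have cdq := hdc.comp_continuousOn csq
    have c0 := nearz (fun x t ht => (z0 x t ht).1) (cbq.mul cs2)
    have c1 : ContinuousOn (fun q : ℝ × ℝ => φt q.1 q.2) (univ ×ˢ Icc 0 T) := by
      refine nearz (fun x t ht => (z0 x t ht).2.1) ?_
      refine ContinuousOn.div ((ContinuousOn.mul (by fun_prop) cbq).sub
        ((cdq.mul cs3).div_const 2)) (by fun_prop) fun q hq => ?_
      have : 0 < q.2 := hq
      exact (Real.sqrt_pos.2 this).ne'
    have c2 := nearz (fun x t ht => (z0 x t ht).2.2) (cb'q.mul cs3)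
    have hφt : ∀ x : ℝ, ∀ t ∈ Icc (0:ℝ) T, HasDerivWithinAt (fun s => φ x s) (φt x t) (Icc 0 T) t := by
      intro x t ht
      rcases lt_or_ge t t₀ with h1 | h1
      · have : (fun s => φ x s) =ᶠ[𝓝 t] fun _ => 0 := by
          filter_upwards [Iio_mem_nhds h1] with s hs using (z0 x s hs).1
        rw [(z0 x t h1).2.1]
        exact ((hasDerivAt_const t (0:ℝ)).congr_of_eventuallyEq this).hasDerivWithinAt
      · have htp : 0 < t := by linarith
        have hsp := Real.sqrt_pos.2 htp
        have hsd : HasDerivAt Real.sqrt (1 / (2 * Real.sqrt t)) t := Real.hasDerivAt_sqrt htp.ne'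
        have e1 : HasDerivAt (fun s => x / Real.sqrt s)
            (-(x / Real.sqrt t) / (2 * t)) t := by
          refine ((hasDerivAt_const t x).div hsd hsp.ne').congr_deriv ?_
          have hsq : Real.sqrt t ^ 2 = t := Real.sq_sqrt htp.le
          rw [hsq]
          field_simp
          ring
        have e2 := ((hb (x / Real.sqrt t)).comp t e1).mul ((hϑ t).div hsd hsp.ne')
        refine (e2.congr_deriv ?_).hasDerivWithinAt
        simp only [φt, d, Function.comp_apply, Pi.div_apply]
        have hsq : Real.sqrt t ^ 2 = t := Real.sq_sqrt htp.le
        rw [hsq]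
        field_simp
        rw [hsq]
        ring
    have hφx : ∀ x : ℝ, ∀ t ∈ Icc (0:ℝ) T, HasDerivAt (fun y => φ y t) (φx x t) x := by
      intro x t ht
      have e1 : HasDerivAt (fun y : ℝ => y / Real.sqrt t) (1 / Real.sqrt t) x :=
        (hasDerivAt_id x).div_const _
      refine (((hb (x / Real.sqrt t)).comp x e1).mul_const _).congr_deriv ?_
      simp only [φx]
      rcases ht.1.eq_or_lt with h1 | h1
      · rw [← h1]; simp
      · have e2 : Real.sqrt t * Real.sqrt t = t := Real.mul_self_sqrt h1.le
        have e3 : ϑ t / t = ϑ t / Real.sqrt t / Real.sqrt t := by rw [div_div, e2]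
        rw [e3]
        have := Real.sqrt_pos.2 h1
        field_simp
    have far : ∀ x, ∀ t ∈ Icc 0 T, x ∉ Icc (-(|R| * Real.sqrt T)) (|R| * Real.sqrt T) → t₀ ≤ t →
        b (x / Real.sqrt t) = 0 ∧ b' (x / Real.sqrt t) = 0 ∧ d (x / Real.sqrt t) = 0 := by
      intro x t ht hx h1
      have htp : 0 < t := by linarith
      have hsp := Real.sqrt_pos.2 htp
      have : R ≤ |x / Real.sqrt t| := by
        rw [abs_div, abs_of_pos hsp, le_div_iff₀ hsp]
        by_contra hc
        push Not at hc
        apply hx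
        rw [mem_Icc, ← abs_le]
        have h5 : |x| < |R| * Real.sqrt t := hc.trans_le (by gcongr; exact le_abs_self R)
        refine h5.le.trans ?_
        gcongr
        exact ht.2
      exact ⟨(hbR _ this).1, (hbR _ this).2, hdR _ this⟩
    have hK'0 : 0 ≤ K' := (norm_nonneg _).trans (hK' 0 ⟨le_rfl, hT0.le⟩)
    have hst0 := Real.sqrt_pos.2 ht0
    let B := M * (K / Real.sqrt t₀) + (K' * M + Md * (K / t₀) / 2) / Real.sqrt t₀ + M' * (K / t₀)
    have B1 : 0 ≤ M * (K / Real.sqrt t₀) := by positivity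
    have B2 : 0 ≤ (K' * M + Md * (K / t₀) / 2) / Real.sqrt t₀ := by positivity
    have B3 : 0 ≤ M' * (K / t₀) := by positivity
    have hbd : ∀ x, ∀ t ∈ Icc (0:ℝ) T,
        |φ x t| ≤ (Icc (-(|R| * Real.sqrt T)) (|R| * Real.sqrt T)).indicator (fun _ => B) x ∧
        |φt x t| ≤ (Icc (-(|R| * Real.sqrt T)) (|R| * Real.sqrt T)).indicator (fun _ => B) x ∧
        |φx x t| ≤ (Icc (-(|R| * Real.sqrt T)) (|R| * Real.sqrt T)).indicator (fun _ => B) x := by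
      intro x t ht
      have hBi : 0 ≤ (Icc (-(|R| * Real.sqrt T)) (|R| * Real.sqrt T)).indicator (fun _ => B) x :=
        indicator_nonneg (fun _ _ => by simp only [B]; positivity) x
      rcases lt_or_ge t t₀ with h1 | h1
      · obtain ⟨y1, y2, y3⟩ := z0 x t h1
        rw [y1, y2, y3, abs_zero]
        exact ⟨hBi, hBi, hBi⟩
      · have htp : 0 < t := by linarith
        have htI : t ∈ Ioc 0 T := ⟨htp, ht.2⟩
        by_cases hx : x ∈ Icc (-(|R| * Real.sqrt T)) (|R| * Real.sqrt T)
        · rw [indicator_of_mem hx]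
          have hsp := Real.sqrt_pos.2 htp
          have f1 : |φ x t| ≤ M * (K / Real.sqrt t₀) := by
            simp only [φ]; rw [abs_mul]
            exact mul_le_mul (hM _).1 (hKs t htI) (abs_nonneg _) hM0
          have f2 : |φt x t| ≤ (K' * M + Md * (K / t₀) / 2) / Real.sqrt t₀ := by
            simp only [φt]; rw [abs_div, abs_of_pos hsp]
            refine div_le_div₀ (by positivity) ?_ hst0 (Real.sqrt_le_sqrt h1)
            refine (abs_sub _ _).trans (add_le_add ?_ ?_)
            · rw [abs_mul]; exact mul_le_mul (hKI' t htI) (hM _).1 (abs_nonneg _) hK'0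
            · rw [abs_div, abs_mul, abs_of_pos (by norm_num : (0:ℝ) < 2)]
              exact div_le_div_of_nonneg_right
                (mul_le_mul (hMd _).1 (hKt t htI) (abs_nonneg _) hMd0) (by norm_num)
          have f3 : |φx x t| ≤ M' * (K / t₀) := by
            simp only [φx]; rw [abs_mul]
            exact mul_le_mul (hM' _).1 (hKt t htI) (abs_nonneg _) hM'0
          simp only [B]
          exact ⟨by linarith, by linarith, by linarith⟩
        · obtain ⟨y1, y2, y3⟩ := far x t ht hx h1
          have g1 : φ x t = 0 := by simp [φ, y1]
          have g2 : φt x t = 0 := by simp [φt, y1, y3]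
          have g3 : φx x t = 0 := by simp [φx, y2]
          rw [g1, g2, g3, abs_zero]
          exact ⟨hBi, hBi, hBi⟩
    have intH := indicator_const_integrable (|R| * Real.sqrt T) B
    have key := h.weak_dom hT0 hφt hφx c0 c1 c2 intH hbd (fun x => by simp [φ, hϑT])
    have j1 := strip_integrable c1 intH (fun x t ht => (hbd x t ht).2.1) h.v_cont.measurable
      (fun x t ht => (hC x t ht).1)
    have j2 := strip_integrable c2 intH (fun x t ht => (hbd x t ht).2.2) h.w_cont.measurable
      (fun x t ht => (hC x t ht).2.1)
    have j3 := strip_integrable c0 intH (fun x t ht => (hbd x t ht).1) h.F_meas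
      (fun x t ht => (hC x t ht).2.2)
    have l1 := strip_integrable_mul ib mϑ' hKI' cv₁.measurable Cv
    have l1' := strip_integrable_mul id' mt hKt cv₁.measurable Cv
    have l2 := strip_integrable_mul ib' ms hKs cw₁.measurable Cw
    have l3 := strip_integrable_mul ib mϑ hKI mF₁ CF
    have cancel : ∀ t : ℝ, 0 < t → ∀ x : ℝ, x * Real.sqrt t / Real.sqrt t = x := fun t ht x =>
      mul_div_cancel_right₀ x (Real.sqrt_pos.2 ht).ne'
    have r1 := strip_rescale (f := fun x t => φt x t * v x t)
      (g := fun x t => b x * (ϑ' t * v₁ x t) - (1 / 2) * (d x * (ϑ t / t * v₁ x t))) j1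
      (l1.sub (l1'.const_mul _)) (fun t ht x => by
        simp only [φt, v₁]
        rw [cancel t ht.1]
        have := Real.sqrt_pos.2 ht.1
        field_simp)
    have r2 := strip_rescale (f := fun x t => φx x t * w x t)
      (g := fun x t => b' x * (ϑ t / Real.sqrt t * w₁ x t)) j2 l2 (fun t ht x => by
        simp only [φx, w₁]
        rw [cancel t ht.1]
        have e2 : Real.sqrt t * Real.sqrt t = t := Real.mul_self_sqrt ht.1.le
        have e3 : ϑ t / t = ϑ t / Real.sqrt t / Real.sqrt t := by rw [div_div, e2]
        have := Real.sqrt_pos.2 ht.1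
        rw [e3]
        field_simp)
    have r3 := strip_rescale (f := fun x t => φ x t * F x t)
      (g := fun x t => b x * (ϑ t * F₁ x t)) j3 l3 (fun t ht x => by
        simp only [φ, F₁]
        rw [cancel t ht.1]
        have := Real.sqrt_pos.2 ht.1
        field_simp)
    have key2 : ∫ q, (φx q.2 q.1 * w q.2 q.1 + F q.2 q.1 * φ q.2 q.1) ∂(stripMeasure T)
        = (∫ q, φx q.2 q.1 * w q.2 q.1 ∂(stripMeasure T))
          + ∫ q, φ q.2 q.1 * F q.2 q.1 ∂(stripMeasure T) := by
      rw [← integral_add j2 j3]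
      congr 1; ext q; ring
    rw [key2, r1, r2, r3, integral_sub l1 (l1'.const_mul _), integral_const_mul,
      strip_swap ib mϑ' hKI' cv₁.measurable Cv, strip_swap id' mt hKt cv₁.measurable Cv,
      strip_swap ib' ms hKs cw₁.measurable Cw, strip_swap ib mϑ hKI mF₁ CF] at key
    have hSc : Continuous S := continuous_iff_continuousAt.2 fun x => (hS x).continuousAt
    have hcomp : ∀ {f g : ℝ → ℝ}, Continuous f → (∀ x, R ≤ |x| → f x = 0) → Continuous g →
        Integrable fun x => f x * g x := fun hf hfR hg =>
      compact_support_integrable (hf.mul hg) (R := R) fun x hx => by simp [hfR x hx]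
    have xb0 : ∀ x, R ≤ |x| → x * b x = 0 := fun x hx => by simp [(hbR x hx).1]
    have xbc : Continuous fun x => x * b x := continuous_id.mul hbc
    have ibp : ∫ x, x * b x * Dv x = -∫ x, d x * S x :=
      integral_mul_deriv_eq_deriv_mul_of_integrable
        (fun x _ => (((hasDerivAt_id x).mul (hb x)).congr_deriv (by simp only [d, id]; ring)))
        (fun x _ => hS x) (hcomp xbc xb0 hDc) (hcomp hdc hdR hSc) (hcomp xbc xb0 hSc)
    have bQ := (compact_support_bound hbc (fun x hx => (hbR x hx).1))
    have i1 : Integrable fun x => b x * P x := ib.mul_bdd (timeAvg_measurable mϑ' cv₁.measurable)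
      (Eventually.of_forall (timeAvg_bound hT0.le hKI' Cv))
    have i2 : Integrable fun x => b x * Q x := ib.mul_bdd (timeAvg_measurable mϑ mF₁)
      (Eventually.of_forall (timeAvg_bound hT0.le hKI CF))
    have e1 : ∫ x, a' x * (Real.exp (x ^ 2 / 4) * Dv x)
        = (∫ x, b' x * Dv x) - (1 / 2) * ∫ x, x * b x * Dv x := by
      rw [← integral_const_mul, ← integral_sub (hcomp hb'c (fun x hx => (hbR x hx).2) hDc)
        ((hcomp xbc xb0 hDc).const_mul _)]
      congr 1; ext x; simp only [b', b]; ring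
    have e2 : ∫ x, a x * (Real.exp (x ^ 2 / 4) * (Q x - P x)) = (∫ x, b x * Q x) - ∫ x, b x * P x := by
      rw [← integral_sub i2 i1]
      congr 1; ext x; simp only [b]; ring
    rw [e1, e2, ibp]
    change (∫ x, b x * P x) - (1 / 2) * (∫ x, d x * S x) = (∫ x, b' x * Dv x) + ∫ x, b x * Q x at key
    linarith
end HeatSys

/-! ### Gaussian tails -/

/-- The tail integral of `exp (-ζ² / 4)`. -/
def gtail (x : ℝ) : ℝ := ∫ ζ in Ioi x, Real.exp (-ζ ^ 2 / 4)

lemma gexp_continuous : Continuous fun ζ : ℝ => Real.exp (-ζ ^ 2 / 4) := by fun_prop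

lemma gexp_integrable : Integrable fun ζ : ℝ => Real.exp (-ζ ^ 2 / 4) := by
  have := integrable_exp_neg_mul_sq (b := 1 / 4) (by norm_num)
  refine this.congr (Eventually.of_forall fun x => ?_)
  simp only; congr 1; ring

lemma gtail_eq (x : ℝ) : gtail x = gtail 0 - ∫ ζ in (0:ℝ)..x, Real.exp (-ζ ^ 2 / 4) := by
  have := intervalIntegral.integral_interval_add_Ioi (a := (0:ℝ)) (b := x)
    (gexp_integrable.integrableOn) (gexp_integrable.integrableOn)
  unfold gtail; linarith

lemma gtail_hasDerivAt (x : ℝ) : HasDerivAt gtail (-Real.exp (-x ^ 2 / 4)) x := by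
  have h := (gexp_continuous.integral_hasStrictDerivAt 0 x).hasDerivAt
  have := (hasDerivAt_const x (gtail 0)).sub h
  rw [zero_sub] at this
  exact this.congr_of_eventuallyEq (Eventually.of_forall gtail_eq)

lemma gtail_continuous : Continuous gtail :=
  continuous_iff_continuousAt.2 fun x => (gtail_hasDerivAt x).continuousAt

lemma gtail_strictAnti : StrictAnti gtail :=
  strictAnti_of_deriv_neg fun x => by
    rw [(gtail_hasDerivAt x).deriv]; exact neg_neg_of_pos (Real.exp_pos _)

lemma gtail_nonneg (x : ℝ) : 0 ≤ gtail x :=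
  setIntegral_nonneg measurableSet_Ioi fun _ _ => (Real.exp_pos _).le

lemma gtail_pos (x : ℝ) : 0 < gtail x :=
  (gtail_nonneg (x + 1)).trans_lt (gtail_strictAnti (by linarith))

lemma gtail_tendsto : Tendsto gtail atTop (𝓝 0) := by
  have h := intervalIntegral_tendsto_integral_Ioi (μ := volume) 0 gexp_integrable.integrableOn tendsto_id
  have h2 := (tendsto_const_nhds (x := gtail 0)).sub h
  have e : gtail 0 - ∫ x in Ioi (0:ℝ), Real.exp (-x ^ 2 / 4) = 0 := sub_self _
  rw [e] at h2
  exact h2.congr fun x => (gtail_eq x).symm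

lemma gtail_lipschitz (x y : ℝ) : |gtail x - gtail y| ≤ |x - y| := by
  have := Convex.norm_image_sub_le_of_norm_hasDerivWithin_le (f := gtail) (s := univ) (C := 1)
    (fun x _ => (gtail_hasDerivAt x).hasDerivWithinAt) (fun x _ => by
      rw [norm_neg, Real.norm_eq_abs, abs_of_pos (Real.exp_pos _)]
      exact Real.exp_le_one_iff.2 (by nlinarith [sq_nonneg x])) convex_univ (mem_univ y) (mem_univ x)
  simpa using this

lemma erfc_half (x : ℝ) : erfc (x / 2) = (Real.sqrt Real.pi)⁻¹ * gtail x := by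
  have h := integral_comp_mul_left_Ioi (fun s => Real.exp (-s ^ 2)) x (b := 1 / 2) (by norm_num)
  have e : gtail x = ∫ s in Ioi x, Real.exp (-(1 / 2 * s) ^ 2) := by
    unfold gtail; congr 1; ext s; congr 1; ring
  unfold erfc
  rw [e, h, show (1:ℝ) / 2 * x = x / 2 by ring, smul_eq_mul]
  ring

/-- The normalising constant of the profile `Ψ`. -/
def psiC (α β : ℝ) : ℝ := α * β / 2 * Real.exp (α ^ 2 / 4)

lemma PsiP_eq (α β η : ℝ) : PsiP α β η = psiC α β * gtail (max η α) := rfl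

section
variable {α β : ℝ}

lemma psiC_pos (hα : 0 < α) (hβ : 0 < β) : 0 < psiC α β := by unfold psiC; positivity

lemma PsiP_pos (hα : 0 < α) (hβ : 0 < β) (η : ℝ) : 0 < PsiP α β η :=
  mul_pos (psiC_pos hα hβ) (gtail_pos _)

lemma PsiP_antitone (hα : 0 < α) (hβ : 0 < β) : Antitone (PsiP α β) := fun x y hxy => by
  rw [PsiP_eq, PsiP_eq]
  have := psiC_pos hα hβ
  exact mul_le_mul_of_nonneg_left (gtail_strictAnti.antitone (max_le_max_right α hxy)) this.le

lemma PsiP_of_le {η : ℝ} (h : η ≤ α) : PsiP α β η = PsiP α β α := by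
  rw [PsiP_eq, PsiP_eq, max_eq_right h, max_self]

lemma PsiP_of_ge {η : ℝ} (h : α ≤ η) : PsiP α β η = psiC α β * gtail η := by
  rw [PsiP_eq, max_eq_left h]

lemma PsiP_le (hα : 0 < α) (hβ : 0 < β) (η : ℝ) : PsiP α β η ≤ PsiP α β α := by
  rcases le_total η α with h | h
  · exact (PsiP_of_le h).le
  · exact PsiP_antitone hα hβ h

lemma PsiP_continuous : Continuous (PsiP α β) := by
  have : PsiP α β = fun η => psiC α β * gtail (max η α) := rfl
  rw [this]
  have := gtail_continuous
  fun_prop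

lemma PsiP_lipschitz (hα : 0 < α) (hβ : 0 < β) (x y : ℝ) :
    |PsiP α β x - PsiP α β y| ≤ psiC α β * |x - y| := by
  have hC := psiC_pos hα hβ
  rw [PsiP_eq, PsiP_eq, ← mul_sub, abs_mul, abs_of_pos hC]
  refine mul_le_mul_of_nonneg_left ((gtail_lipschitz _ _).trans ?_) hC.le
  exact abs_max_sub_max_le_abs x y α

lemma PsiP_tendsto : Tendsto (PsiP α β) atTop (𝓝 0) := by
  have h : Tendsto (fun η : ℝ => max η α) atTop atTop :=
    tendsto_atTop_mono (fun η => le_max_left _ _) tendsto_id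
  have := (gtail_tendsto.comp h).const_mul (psiC α β)
  rw [mul_zero] at this
  exact this

lemma psi_eq {t : ℝ} (ht : 0 < t) (x : ℝ) : psi α β x t = PsiP α β (|x| / Real.sqrt t) := by
  simp only [psi, if_pos ht, PsiP]

lemma psi_of_nonpos {t : ℝ} (ht : t ≤ 0) (x : ℝ) : psi α β x t = 0 := by
  simp only [psi, if_neg ht.not_gt]

lemma psi_nonneg (hα : 0 < α) (hβ : 0 < β) (x t : ℝ) : 0 ≤ psi α β x t := by
  rcases le_or_gt t 0 with h | h
  · rw [psi_of_nonpos h]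
  · rw [psi_eq h]; exact (PsiP_pos hα hβ _).le

lemma psi_le (hα : 0 < α) (hβ : 0 < β) (x t : ℝ) : psi α β x t ≤ PsiP α β α := by
  rcases le_or_gt t 0 with h | h
  · rw [psi_of_nonpos h]; exact (PsiP_pos hα hβ _).le
  · rw [psi_eq h]; exact PsiP_le hα hβ _

lemma psi_abs_le (hα : 0 < α) (hβ : 0 < β) (x t : ℝ) : |psi α β x t| ≤ PsiP α β α := by
  rw [abs_of_nonneg (psi_nonneg hα hβ x t)]; exact psi_le hα hβ x t

lemma psi_even (x t : ℝ) : psi α β (-x) t = psi α β x t := by simp [psi]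

lemma psi_scale {l : ℝ} (hl : 0 < l) (x t : ℝ) : psi α β (l * x) (l ^ 2 * t) = psi α β x t := by
  rcases le_or_gt t 0 with h | h
  · rw [psi_of_nonpos h, psi_of_nonpos (mul_nonpos_of_nonneg_of_nonpos (by positivity) h)]
  · rw [psi_eq h, psi_eq (by positivity), Real.sqrt_mul (by positivity), Real.sqrt_sq hl.le, abs_mul,
      abs_of_pos hl, mul_div_mul_left _ _ hl.ne']

lemma psi_measurable : Measurable fun q : ℝ × ℝ => psi α β q.1 q.2 := by
  have : (fun q : ℝ × ℝ => psi α β q.1 q.2)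
      = fun q => if 0 < q.2 then PsiP α β (|q.1| / Real.sqrt q.2) else 0 := by
    ext q
    split_ifs with h
    · exact psi_eq h _
    · exact psi_of_nonpos (not_lt.1 h) _
  rw [this]
  refine Measurable.ite (measurableSet_lt measurable_const measurable_snd) ?_ measurable_const
  exact PsiP_continuous.measurable.comp
    ((measurable_fst.abs).div (Real.continuous_sqrt.measurable.comp measurable_snd))

lemma psi_slice_continuous (t : ℝ) : Continuous fun x => psi α β x t := by
  rcases le_or_gt t 0 with h | h
  · simp only [psi_of_nonpos h]; exact continuous_const
  · simp only [psi_eq h]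
    exact PsiP_continuous.comp (by fun_prop)

lemma psi_time_continuousAt {t : ℝ} (ht : 0 < t) (x : ℝ) : ContinuousAt (fun s => psi α β x s) t := by
  have : ContinuousAt (fun s => PsiP α β (|x| / Real.sqrt s)) t :=
    PsiP_continuous.continuousAt.comp
      (continuousAt_const.div Real.continuous_sqrt.continuousAt (Real.sqrt_pos.2 ht).ne')
  refine this.congr ?_
  filter_upwards [Ioi_mem_nhds ht] with s hs using (psi_eq hs x).symm

/-! ### The heat flow of Gaussian tails -/

lemma hk_Ioi_integral (a : ℝ) {s : ℝ} (hs : 0 < s) :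
    ∫ z in Ioi a, hk z s = (Real.sqrt (4 * Real.pi))⁻¹ * gtail (a / Real.sqrt s) := by
  have hp := Real.sqrt_pos.2 hs
  have h := integral_comp_mul_left_Ioi (fun z => hk z s) (a / Real.sqrt s) hp
  rw [mul_div_cancel₀ _ hp.ne'] at h
  have e : ∀ z, hk (Real.sqrt s * z) s
      = (Real.sqrt (4 * Real.pi) * Real.sqrt s)⁻¹ * Real.exp (-z ^ 2 / 4) := fun z => by
    unfold hk
    rw [Real.sqrt_mul (by positivity), mul_pow, Real.sq_sqrt hs.le]
    congr 2
    field_simp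
  simp only [e] at h
  rw [integral_const_mul, smul_eq_mul] at h
  unfold gtail
  field_simp at h ⊢
  linarith

lemma gaussian_integral_hk (f : ℝ → ℝ) {σ : ℝ} (hσ : 0 < σ) :
    ∫ z, f z ∂(ProbabilityTheory.gaussianReal 0 (2 * σ).toNNReal) = ∫ z, hk z σ * f z := by
  rw [ProbabilityTheory.integral_gaussianReal_eq_integral_smul
    (by simp only [ne_eq, Real.toNNReal_eq_zero, not_le]; positivity)]
  congr 1; ext z
  rw [hk_eq_gaussian z hσ, smul_eq_mul]

lemma hk_conv_gtail (x : ℝ) {s σ : ℝ} (hs : 0 < s) (hσ : 0 < σ) :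
    ∫ y, hk (x - y) σ * gtail (y / Real.sqrt s) = gtail (x / Real.sqrt (s + σ)) := by
  have hc := ProbabilityTheory.gaussianReal_conv_gaussianReal (m₁ := 0) (m₂ := 0)
    (v₁ := (2 * σ).toNNReal) (v₂ := (2 * s).toNNReal)
  rw [add_zero, ← Real.toNNReal_add (by positivity) (by positivity),
    show 2 * σ + 2 * s = 2 * (s + σ) by ring] at hc
  have hf : Integrable ((Ioi x).indicator (fun _ => (1:ℝ)))
      (ProbabilityTheory.gaussianReal 0 (2 * (s + σ)).toNNReal) :=
    (integrable_const 1).indicator measurableSet_Ioi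
  have h1 : ∀ (a : ℝ) {s : ℝ}, 0 < s → ∫ z, (Ioi a).indicator (fun _ => (1:ℝ)) z
      ∂(ProbabilityTheory.gaussianReal 0 (2 * s).toNNReal)
      = (Real.sqrt (4 * Real.pi))⁻¹ * gtail (a / Real.sqrt s) := fun a s hs => by
    rw [gaussian_integral_hk _ hs, ← hk_Ioi_integral a hs, ← integral_indicator measurableSet_Ioi]
    congr 1; ext z
    by_cases hz : z ∈ Ioi a <;> simp [hz]
  have h2 := h1 x (s := s + σ) (by positivity)
  rw [← hc, integral_conv (by rw [hc]; exact hf)] at h2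
  have h3 : ∀ y, ∫ z, (Ioi x).indicator (fun _ => (1:ℝ)) (y + z)
      ∂(ProbabilityTheory.gaussianReal 0 (2 * s).toNNReal)
      = (Real.sqrt (4 * Real.pi))⁻¹ * gtail ((x - y) / Real.sqrt s) := fun y => by
    rw [← h1 (x - y) hs]
    congr 1; ext z
    simp only [indicator, mem_Ioi, sub_lt_iff_lt_add']
  simp only [h3] at h2
  rw [integral_const_mul, gaussian_integral_hk _ hσ] at h2
  have h4 : (Real.sqrt (4 * Real.pi))⁻¹ ≠ 0 := by positivity
  have h5 := mul_left_cancel₀ h4 h2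
  rw [← h5, ← integral_sub_left_eq_self _ _ x]
  congr 1; ext y; rw [sub_sub_cancel]

lemma gtail_abs_le (x : ℝ) : |gtail x| ≤ ∫ ζ, Real.exp (-ζ ^ 2 / 4) := by
  rw [abs_of_nonneg (gtail_nonneg x)]
  exact setIntegral_le_integral gexp_integrable (Eventually.of_forall fun _ => (Real.exp_pos _).le)

lemma conv_le_of_le {f : ℝ → ℝ} {σ : ℝ} (hσ : 0 < σ) (x : ℝ) (hf : AEStronglyMeasurable f)
    {B C : ℝ} (hB : ∀ y, |f y| ≤ B) (hC : ∀ y, f y ≤ C) : ∫ y, hk (x - y) σ * f y ≤ C := by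
  calc ∫ y, hk (x - y) σ * f y ≤ ∫ y, hk (x - y) σ * C :=
        integral_mono (hk_mul_integrable hσ x hf hB) ((hk_sub_integrable hσ x).mul_const C)
          fun y => mul_le_mul_of_nonneg_left (hC y) (hk_nonneg _ _)
    _ = C := by rw [integral_mul_const, hk_sub_integral hσ, one_mul]

lemma conv_abs_le {f : ℝ → ℝ} {σ : ℝ} (hσ : 0 < σ) (x : ℝ)
    {C : ℝ} (hC : ∀ y, |f y| ≤ C) : |∫ y, hk (x - y) σ * f y| ≤ C := by
  have := norm_integral_le_of_norm_le (f := fun y => hk (x - y) σ * f y)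
    ((hk_sub_integrable hσ x).mul_const C) (Eventually.of_forall fun y => by
      rw [norm_mul, Real.norm_eq_abs, abs_of_nonneg (hk_nonneg _ _)]
      exact mul_le_mul_of_nonneg_left (hC y) (hk_nonneg _ _))
  rwa [integral_mul_const, hk_sub_integral hσ, one_mul] at this

lemma hk_conv_psi_le_of_pos (hα : 0 < α) (hβ : 0 < β) {x : ℝ} (hx : 0 ≤ x) {s σ : ℝ} (hs : 0 < s)
    (hσ : 0 < σ) : ∫ y, hk (x - y) σ * psi α β y s ≤ psi α β x (s + σ) := by
  have hC := psiC_pos hα hβ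
  have hm : AEStronglyMeasurable (fun y => psi α β y s) :=
    (psi_slice_continuous s).aestronglyMeasurable
  rw [psi_eq (by positivity : 0 < s + σ), abs_of_nonneg hx]
  rcases le_total (x / Real.sqrt (s + σ)) α with h | h
  · rw [PsiP_of_le h]
    exact conv_le_of_le hσ x hm (psi_abs_le hα hβ · s) (psi_le hα hβ · s)
  · rw [PsiP_of_ge h, ← hk_conv_gtail x hs hσ, ← integral_const_mul]
    have hgi : Integrable fun y => hk (x - y) σ * gtail (y / Real.sqrt s) :=
      hk_mul_integrable hσ x (gtail_continuous.comp (by fun_prop)).aestronglyMeasurable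
        (fun y => gtail_abs_le _)
    refine integral_mono (hk_mul_integrable hσ x hm (psi_abs_le hα hβ · s)) (hgi.const_mul _)
      fun y => ?_
    simp only
    rw [psi_eq hs, PsiP_eq, mul_left_comm]
    refine mul_le_mul_of_nonneg_left (mul_le_mul_of_nonneg_left (gtail_strictAnti.antitone ?_)
      (hk_nonneg _ _)) hC.le
    refine le_trans ?_ (le_max_left _ _)
    exact div_le_div_of_nonneg_right (le_abs_self y) (Real.sqrt_nonneg _)

/-- `ψ` is a supersolution of the heat equation. -/
lemma hk_conv_psi_le (hα : 0 < α) (hβ : 0 < β) (x : ℝ) {s σ : ℝ} (hs : 0 < s) (hσ : 0 < σ) :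
    ∫ y, hk (x - y) σ * psi α β y s ≤ psi α β x (s + σ) := by
  rcases le_total 0 x with h | h
  · exact hk_conv_psi_le_of_pos hα hβ h hs hσ
  · have := hk_conv_psi_le_of_pos hα hβ (x := -x) (by linarith) hs hσ
    rw [psi_even, ← integral_neg_eq_self] at this
    refine le_trans (le_of_eq ?_) this
    congr 1; ext y
    rw [psi_even, ← hk_neg]; congr 2; ring

end

namespace HeatSys
variable {v w F : ℝ → ℝ → ℝ}

lemma integral_Ioc_rescale (g : ℝ → ℝ) {c : ℝ} (hc : 0 < c) {T : ℝ} (hT : 0 ≤ T) :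
    ∫ t in Ioc 0 (c * T), g t = c * ∫ t in Ioc 0 T, g (c * t) := by
  rw [← intervalIntegral.integral_of_le hT, ← intervalIntegral.integral_of_le (by positivity),
    intervalIntegral.mul_integral_comp_mul_left, mul_zero]

lemma integral_rescale (g : ℝ → ℝ) {c : ℝ} (hc : 0 < c) : ∫ x, g x = c * ∫ x, g (c * x) := by
  rw [Measure.integral_comp_mul_left, abs_of_pos (inv_pos.2 hc), smul_eq_mul, ← mul_assoc,
    mul_inv_cancel₀ hc.ne', one_mul]

/-- Parabolic rescaling. -/
lemma scale (h : HeatSys v w F) {l : ℝ} (hl : 0 < l) :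
    HeatSys (fun x t => v (l * x) (l ^ 2 * t)) (fun x t => l * w (l * x) (l ^ 2 * t))
      (fun x t => l ^ 2 * F (l * x) (l ^ 2 * t)) := by
  have hc : Continuous fun q : ℝ × ℝ => (l * q.1, l ^ 2 * q.2) := by fun_prop
  have hl2 : 0 < l ^ 2 := by positivity
  refine ⟨h.v_cont.comp hc, continuous_const.mul (h.w_cont.comp hc), fun t x => ?_,
    (h.F_meas.comp hc.measurable).const_mul _, fun T => ?_, ?_⟩
  · refine ((h.deriv (l ^ 2 * t) (l * x)).comp x ((hasDerivAt_id x).const_mul l)).congr_deriv ?_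
    ring
  · obtain ⟨C, hC⟩ := h.bdd (l ^ 2 * T)
    refine ⟨max C (max (l * C) (l ^ 2 * C)), fun x t ht => ?_⟩
    obtain ⟨h1, h2, h3⟩ := hC (l * x) (l ^ 2 * t) (mul_le_mul_of_nonneg_left ht hl2.le)
    refine ⟨h1.trans (le_max_left _ _), ?_, ?_⟩
    · rw [abs_mul, abs_of_pos hl]
      exact (mul_le_mul_of_nonneg_left h2 hl.le).trans ((le_max_left _ _).trans (le_max_right _ _))
    · rw [abs_mul, abs_of_pos hl2]
      exact (mul_le_mul_of_nonneg_left h3 hl2.le).trans ((le_max_right _ _).trans (le_max_right _ _))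
  · intro T hT φ φt φx ⟨t1, t2, t3, t4, t5, ⟨R, t6⟩, t7⟩
    have hmap : ∀ t ∈ Icc 0 (l ^ 2 * T), t / l ^ 2 ∈ Icc 0 T := fun t ht =>
      ⟨div_nonneg ht.1 hl2.le, (div_le_iff₀ hl2).2 (by linarith [ht.2])⟩
    have hmap' : MapsTo (fun q : ℝ × ℝ => (q.1 / l, q.2 / l ^ 2)) (univ ×ˢ Icc 0 (l ^ 2 * T))
        (univ ×ˢ Icc 0 T) := fun q hq => ⟨mem_univ _, hmap _ hq.2⟩
    have hcc : ContinuousOn (fun q : ℝ × ℝ => (q.1 / l, q.2 / l ^ 2)) (univ ×ˢ Icc 0 (l ^ 2 * T)) := by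
      fun_prop
    have key := h.weak (l ^ 2 * T) (by positivity) (fun x t => φ (x / l) (t / l ^ 2))
      (fun x t => φt (x / l) (t / l ^ 2) * (1 / l ^ 2)) (fun x t => φx (x / l) (t / l ^ 2) * (1 / l))
      ⟨fun x t ht => (t1 (x / l) _ (hmap t ht)).comp t
          ((hasDerivAt_id t).div_const _).hasDerivWithinAt hmap,
        fun x t ht => HasDerivAt.comp (h₂ := fun y => φ y (t / l ^ 2)) x (t2 (x / l) _ (hmap t ht))
          ((hasDerivAt_id x).div_const l),
        t3.comp hcc hmap', (t4.comp hcc hmap').mul continuousOn_const,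
        (t5.comp hcc hmap').mul continuousOn_const,
        ⟨l * R, fun x t ht hx => t6 _ _ (hmap t ht) (by
          rw [abs_div, abs_of_pos hl, le_div_iff₀ hl]; linarith)⟩,
        fun x => by simp only [mul_div_cancel_left₀ _ hl2.ne']; exact t7 _⟩
    rw [integral_Ioc_rescale _ hl2 hT.le, integral_Ioc_rescale _ hl2 hT.le] at key
    have key2 := mul_left_cancel₀ hl2.ne' key
    have e1 : ∀ t, (∫ x, φt (x / l) (l ^ 2 * t / l ^ 2) * (1 / l ^ 2) * v x (l ^ 2 * t))
        = (1 / l) * ∫ x, φt x t * v (l * x) (l ^ 2 * t) := fun t => by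
      rw [integral_rescale _ hl, ← integral_const_mul, ← integral_const_mul]
      congr 1; ext x
      rw [mul_div_cancel_left₀ _ hl2.ne', mul_div_cancel_left₀ _ hl.ne']
      field_simp
    have e2 : ∀ t, (∫ x, (φx (x / l) (l ^ 2 * t / l ^ 2) * (1 / l) * w x (l ^ 2 * t)
          + F x (l ^ 2 * t) * φ (x / l) (l ^ 2 * t / l ^ 2)))
        = (1 / l) * ∫ x, (φx x t * (l * w (l * x) (l ^ 2 * t))
          + l ^ 2 * F (l * x) (l ^ 2 * t) * φ x t) := fun t => by
      rw [integral_rescale _ hl, ← integral_const_mul, ← integral_const_mul]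
      congr 1; ext x
      rw [mul_div_cancel_left₀ _ hl2.ne', mul_div_cancel_left₀ _ hl.ne']
      field_simp
    simp only [e1, e2] at key2
    rw [integral_const_mul, integral_const_mul] at key2
    exact mul_left_cancel₀ (by positivity) key2

lemma conv_time_measurable (hF : Measurable fun q : ℝ × ℝ => F q.1 q.2) (x σ : ℝ) :
    Measurable fun s => ∫ y, hk (x - y) (σ - s) * F y s := by
  have hm : Measurable fun q : ℝ × ℝ => hk (x - q.2) (σ - q.1) * F q.2 q.1 := by
    refine Measurable.mul ?_ (hF.comp measurable_swap)
    exact hk_measurable.comp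
      ((measurable_const.sub measurable_snd).prodMk (measurable_const.sub measurable_fst))
  exact (hm.stronglyMeasurable.integral_prod_right' (ν := volume)).measurable

lemma conv_time_integrable (hF : Measurable fun q : ℝ × ℝ => F q.1 q.2) (x : ℝ) {σ a b C : ℝ}
    (hb : b < σ) (hC : ∀ y, ∀ s ∈ Ioc a b, |F y s| ≤ C) :
    IntegrableOn (fun s => ∫ y, hk (x - y) (σ - s) * F y s) (Ioc a b) := by
  refine Integrable.mono' (g := fun _ => C) (integrableOn_const (by simp))
    (conv_time_measurable hF x σ).aestronglyMeasurable ?_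
  filter_upwards [ae_restrict_mem measurableSet_Ioc] with s hs
  exact conv_abs_le (by linarith [hs.2]) x fun y => hC y s hs

lemma duhamel_zero (h : HeatSys v w F) {t δ : ℝ} (ht : 0 < t) (hδ : 0 < δ) (x : ℝ) :
    ∫ y, hk (x - y) δ * v y t = -∫ s in Ioc 0 t, ∫ y, hk (x - y) (t + δ - s) * F y s := by
  have := h.duhamel 0 ht hδ x
  simp only [zero_mul, Real.exp_zero, one_mul, zero_sub, mul_neg, integral_neg] at this
  rw [this]
  congr 1
  refine setIntegral_congr_fun measurableSet_Ioc fun s _ => ?_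
  congr 1; ext y; congr 2; ring

/-- Duhamel's formula between two positive times. -/
lemma duhamel_between (h : HeatSys v w F) {t₁ t₂ δ : ℝ} (h1 : 0 < t₁) (h2 : t₁ ≤ t₂) (hδ : 0 < δ)
    (x : ℝ) : (∫ y, hk (x - y) δ * v y t₂) - ∫ y, hk (x - y) (t₂ - t₁ + δ) * v y t₁
      = -∫ s in Ioc t₁ t₂, ∫ y, hk (x - y) (t₂ + δ - s) * F y s := by
  obtain ⟨C, hC⟩ := h.bdd t₂
  rw [h.duhamel_zero (h1.trans_le h2) hδ, h.duhamel_zero h1 (by linarith : 0 < t₂ - t₁ + δ)]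
  rw [show t₁ + (t₂ - t₁ + δ) = t₂ + δ by ring, ← Ioc_union_Ioc_eq_Ioc h1.le h2,
    setIntegral_union (Ioc_disjoint_Ioc_of_le le_rfl) measurableSet_Ioc
      (conv_time_integrable h.F_meas x (C := C) (by linarith) fun y s hs => (hC y s (hs.2.trans h2)).2.2)
      (conv_time_integrable h.F_meas x (C := C) (by linarith) fun y s hs => (hC y s hs.2).2.2)]
  ring

end HeatSys

namespace HeatSys
variable {v w F : ℝ → ℝ → ℝ} {α β : ℝ}

lemma slice_aesm (h : HeatSys v w F) (t : ℝ) : AEStronglyMeasurable fun y => v y t :=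
  (h.v_cont.comp (by fun_prop : Continuous fun y : ℝ => (y, t))).aestronglyMeasurable

lemma slice_continuous (h : HeatSys v w F) (t : ℝ) : Continuous fun y => v y t :=
  h.v_cont.comp (by fun_prop : Continuous fun y : ℝ => (y, t))

lemma conv_tendsto (h : HeatSys v w F) (x t : ℝ) :
    Tendsto (fun δ => ∫ y, hk (x - y) δ * v y t) (𝓝[>] 0) (𝓝 (v x t)) := by
  obtain ⟨C, hC⟩ := h.bdd t
  exact hk_tendsto (h.slice_aesm t) (fun y => (hC y t le_rfl).1)
    (h.slice_continuous t).continuousAt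

lemma abs_le_mul_time (h : HeatSys v w F) {T C : ℝ} (hC : ∀ x t, t ≤ T → |F x t| ≤ C) (x : ℝ) {t : ℝ}
    (ht : 0 < t) (htT : t ≤ T) : |v x t| ≤ C * t := by
  refine le_of_tendsto (h.conv_tendsto x t).abs ?_
  filter_upwards [self_mem_nhdsWithin] with δ hδ
  have hδ : 0 < δ := hδ
  rw [h.duhamel_zero ht hδ, abs_neg]
  have := norm_setIntegral_le_of_norm_le_const (μ := volume) (s := Ioc 0 t)
    (f := fun s => ∫ y, hk (x - y) (t + δ - s) * F y s) (C := C) (by simp)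
    (fun s hs => conv_abs_le (by linarith [hs.2]) x fun y => hC y s (hs.2.trans htT))
  simpa [Measure.real, ht.le] using this

lemma initial_zero (h : HeatSys v w F) (x : ℝ) : v x 0 = 0 := by
  obtain ⟨C, hC⟩ := h.bdd 1
  have h1 : Tendsto (fun t => v x t) (𝓝[>] 0) (𝓝 (v x 0)) :=
    ((h.v_cont.comp (by fun_prop : Continuous fun t : ℝ => (x, t))).tendsto 0).mono_left
      nhdsWithin_le_nhds
  have h2 : Tendsto (fun t : ℝ => C * t) (𝓝[>] 0) (𝓝 0) := by
    have : Tendsto (fun t : ℝ => C * t) (𝓝 0) (𝓝 (C * 0)) := by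
      exact (continuous_const.mul continuous_id).tendsto 0
    rw [mul_zero] at this
    exact this.mono_left nhdsWithin_le_nhds
  refine tendsto_nhds_unique h1 (squeeze_zero_norm' ?_ h2)
  filter_upwards [Ioc_mem_nhdsGT (one_pos : (0:ℝ) < 1)] with t ht
  exact h.abs_le_mul_time (fun x t ht => (hC x t ht).2.2) x ht.1 ht.2

lemma nonneg_step (hα : 0 < α) (hβ : 0 < β) (h : HeatSys v w F) {p : ℝ → ℝ → ℝ}
    (hF : ∀ x t, F x t = p x t * (v x t + psi α β x t)) (hp : ∀ x t, 0 ≤ p x t ∧ p x t ≤ 1)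
    {B T : ℝ} (hB0 : 0 ≤ B) (hB : ∀ x t, 0 < t → t ≤ T → -B ≤ v x t + psi α β x t)
    (x : ℝ) {t : ℝ} (ht : 0 < t) (htT : t ≤ T) :
    -(B * (1 - Real.exp (-T))) ≤ v x t + psi α β x t := by
  obtain ⟨C, hC⟩ := h.bdd t
  have hC0 : 0 ≤ C := (abs_nonneg _).trans (hC 0 t le_rfl).1
  have main : -((B + psi α β x t) * (Real.exp t - 1)) ≤ Real.exp t * v x t := by
    have l1 := (h.conv_tendsto x t).const_mul (Real.exp t)
    have l2 : Tendsto (fun δ => -((B + psi α β x (t + δ)) * (Real.exp t - 1))) (𝓝[>] 0)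
        (𝓝 (-((B + psi α β x t) * (Real.exp t - 1)))) := by
      have e : Tendsto (fun δ => psi α β x (t + δ)) (𝓝[>] 0) (𝓝 (psi α β x t)) := by
        have : Tendsto (fun δ : ℝ => t + δ) (𝓝 0) (𝓝 t) := by
          simpa using (continuous_const.add continuous_id).tendsto (0:ℝ) (f := fun δ : ℝ => t + δ)
        exact ((psi_time_continuousAt ht x).tendsto.comp this).mono_left nhdsWithin_le_nhds
      exact ((tendsto_const_nhds.add e).mul tendsto_const_nhds).neg
    refine le_of_tendsto_of_tendsto l2 l1 ?_
    filter_upwards [self_mem_nhdsWithin] with δ hδ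
    have hδ : 0 < δ := hδ
    have hd := h.duhamel 1 ht hδ x
    simp only [one_mul] at hd
    rw [hd]
    have e1 : ∀ s, ∫ y, Real.exp s * hk (x - y) (t - s + δ) * (v y s - F y s)
        = ∫ y, hk (x - y) (t + δ - s) * (Real.exp s * (v y s - F y s)) := fun s => by
      congr 1; ext y
      rw [show t - s + δ = t + δ - s by ring]; ring
    simp only [e1]
    have hm : Measurable fun q : ℝ × ℝ => Real.exp q.2 * (v q.1 q.2 - F q.1 q.2) :=
      ((Real.measurable_exp.comp measurable_snd).mul (h.v_cont.measurable.sub h.F_meas))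
    have hbd : ∀ y, ∀ s ∈ Ioc 0 t, |Real.exp s * (v y s - F y s)| ≤ Real.exp t * (C + C) := by
      intro y s hs
      rw [abs_mul, abs_of_pos (Real.exp_pos s)]
      refine mul_le_mul (Real.exp_le_exp.2 hs.2) ?_ (abs_nonneg _) (Real.exp_pos _).le
      exact (abs_sub _ _).trans (add_le_add (hC y s hs.2).1 (hC y s hs.2).2.2)
    have hitg := conv_time_integrable hm x (σ := t + δ) (a := 0) (b := t) (by linarith) hbd
    have e2 : -((B + psi α β x (t + δ)) * (Real.exp t - 1))
        = ∫ s in Ioc 0 t, Real.exp s * -(B + psi α β x (t + δ)) := by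
      rw [integral_mul_const, ← intervalIntegral.integral_of_le ht.le, integral_exp, Real.exp_zero]
      ring
    rw [e2]
    refine setIntegral_mono_on ?_ hitg measurableSet_Ioc fun s hs => ?_
    · exact ((Real.continuous_exp.integrableOn_Icc.mono_set Ioc_subset_Icc_self).mul_const _)
    · have hσ : 0 < t + δ - s := by linarith [hs.2]
      have hψ := hk_conv_psi_le hα hβ x hs.1 hσ
      rw [show s + (t + δ - s) = t + δ by ring] at hψ
      have i1 := hk_mul_integrable hσ x (psi_slice_continuous (α := α) (β := β) s).aestronglyMeasurable
        (psi_abs_le hα hβ · s)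
      have i2 := (hk_sub_integrable hσ x).mul_const B
      have hms : Measurable fun y => Real.exp s * (v y s - F y s) :=
        hm.comp (measurable_id.prodMk measurable_const)
      have i3 := hk_mul_integrable hσ x hms.aestronglyMeasurable fun y => hbd y s hs
      calc Real.exp s * -(B + psi α β x (t + δ))
          ≤ Real.exp s * -((∫ y, hk (x - y) (t + δ - s) * B)
            + ∫ y, hk (x - y) (t + δ - s) * psi α β y s) := by
            rw [integral_mul_const, hk_sub_integral hσ, one_mul]
            exact mul_le_mul_of_nonneg_left (by linarith) (Real.exp_pos s).le
        _ = ∫ y, Real.exp s * -(hk (x - y) (t + δ - s) * B + hk (x - y) (t + δ - s) * psi α β y s) := by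
            rw [← integral_add i2 i1, ← integral_neg, ← integral_const_mul]
        _ ≤ _ := by
            refine integral_mono (((i2.add i1).neg).const_mul _) i3 fun y => ?_
            simp only
            have hk0 := hk_nonneg (x - y) (t + δ - s)
            have hE := Real.exp_pos s
            have hb := hB y s hs.1 (hs.2.trans htT)
            obtain ⟨p0, p1⟩ := hp y s
            have : -(B + psi α β y s) ≤ v y s - F y s := by
              rw [hF]
              nlinarith
            calc _ = Real.exp s * hk (x - y) (t + δ - s) * -(B + psi α β y s) := by ring
              _ ≤ Real.exp s * hk (x - y) (t + δ - s) * (v y s - F y s) :=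
                mul_le_mul_of_nonneg_left this (by positivity)
              _ = _ := by ring
  have hψ0 := psi_nonneg hα hβ x t
  have hE := Real.exp_pos t
  have e3 : -(B * (Real.exp t - 1)) ≤ Real.exp t * (v x t + psi α β x t) := by nlinarith
  have e4 : -(B * (1 - Real.exp (-t))) ≤ v x t + psi α β x t := by
    have : -(B * (1 - Real.exp (-t))) = Real.exp (-t) * -(B * (Real.exp t - 1)) := by
      have : Real.exp (-t) * Real.exp t = 1 := by rw [← Real.exp_add]; simp
      linear_combination B * this
    rw [this]
    have h5 := mul_le_mul_of_nonneg_left e3 (Real.exp_pos (-t)).le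
    rwa [← mul_assoc (Real.exp (-t)), ← Real.exp_add, neg_add_cancel, Real.exp_zero, one_mul] at h5
  refine le_trans ?_ e4
  have : Real.exp (-T) ≤ Real.exp (-t) := Real.exp_le_exp.2 (by linarith)
  nlinarith

/-- Nonnegativity of the concentration. -/
lemma nonneg (hα : 0 < α) (hβ : 0 < β) (h : HeatSys v w F) {p : ℝ → ℝ → ℝ}
    (hF : ∀ x t, F x t = p x t * (v x t + psi α β x t)) (hp : ∀ x t, 0 ≤ p x t ∧ p x t ≤ 1)
    (x : ℝ) {t : ℝ} (ht : 0 < t) : 0 ≤ v x t + psi α β x t := by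
  obtain ⟨C, hC⟩ := h.bdd t
  have hC0 : 0 ≤ C := (abs_nonneg _).trans (hC 0 t le_rfl).1
  set r := 1 - Real.exp (-t) with hr
  have hr0 : 0 ≤ r := by
    have : Real.exp (-t) ≤ 1 := Real.exp_le_one_iff.2 (by linarith)
    linarith
  have hr1 : r < 1 := by have := Real.exp_pos (-t); linarith
  have key : ∀ n : ℕ, ∀ y s, 0 < s → s ≤ t → -(C * r ^ n) ≤ v y s + psi α β y s := by
    intro n
    induction n with
    | zero =>
      intro y s hs hst
      have := (abs_le.1 (hC y s hst).1).1
      have := psi_nonneg hα hβ y s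
      simp only [pow_zero, mul_one]; linarith
    | succ n ih =>
      intro y s hs hst
      have := nonneg_step hα hβ h hF hp (by positivity) ih y hs hst
      rw [pow_succ]
      rw [← mul_assoc]; exact this
  have lim : Tendsto (fun n : ℕ => -(C * r ^ n)) atTop (𝓝 0) := by
    simpa using ((tendsto_pow_atTop_nhds_zero_of_lt_one hr0 hr1).const_mul C).neg
  exact le_of_tendsto' lim fun n => key n x t ht le_rfl

lemma nonpos (h : HeatSys v w F) (hF : ∀ x t, 0 < t → 0 ≤ F x t) (x : ℝ) {t : ℝ} (ht : 0 < t) :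
    v x t ≤ 0 := by
  refine le_of_tendsto (h.conv_tendsto x t) ?_
  filter_upwards [self_mem_nhdsWithin] with δ hδ
  have hδ : 0 < δ := hδ
  rw [h.duhamel_zero ht hδ]
  refine neg_nonpos.2 (setIntegral_nonneg measurableSet_Ioc fun s hs => integral_nonneg fun y => ?_)
  exact mul_nonneg (hk_nonneg _ _) (hF y s hs.1)

end HeatSys

/-- A heat system with a nonnegative sink controlled by a rate `q`. -/
structure PrecipSys (α β : ℝ) (u w F : ℝ → ℝ → ℝ) (q : ℝ → ℝ) : Prop where
  hα : 0 < α
  hβ : 0 < β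
  sys : HeatSys (fun x t => u x t - psi α β x t) w F
  u_nonneg : ∀ x t, 0 ≤ u x t
  u_le : ∀ x t, u x t ≤ psi α β x t
  u_even : ∀ x t, u (-x) t = u x t
  F_nonneg : ∀ x t, 0 ≤ F x t
  F_le : ∀ᵐ x, ∀ t, F x t ≤ q x * u x t
  F_eq : ∀ᵐ x, ∀ t, x ^ 2 / α ^ 2 < t → F x t = q x * u x t
  q_meas : Measurable q
  q_nonneg : ∀ x, 0 ≤ q x
  q_even : ∀ x, q (-x) = q x
  q_bdd : ∃ B, ∀ x, q x ≤ B

/-- A weak solution satisfying condition (P), normalised at nonpositive times. -/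
structure NormalSol (α β ustar : ℝ) (u p w : ℝ → ℝ → ℝ) (ps : ℝ → ℝ) : Prop
    extends PrecipSys α β u w (fun x t => p x t * u x t) ps where
  hu : 0 < ustar
  hsub : ustar < PsiP α β α
  ps_le : ∀ x, ps x ≤ 1
  p_range : ∀ x t, 0 ≤ p x t ∧ p x t ≤ 1
  p_le : ∀ᵐ x, ∀ t, p x t ≤ ps x
  p_eq : ∀ᵐ x, ∀ t, x ^ 2 / α ^ 2 < t → p x t = ps x
  p_zero : ∀ x t, (∃ ε > 0, ∀ s ∈ Ioc 0 t, u x s ≤ ustar - ε) → p x t = 0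
  p_one : ∀ x s t, 0 < s → s ≤ t → ustar < u x s → p x t = 1

lemma ae_abs {P : ℝ → Prop} (h : ∀ᵐ x ∂(volume.restrict (Ioi (0:ℝ))), P x) : ∀ᵐ x : ℝ, P |x| := by
  rw [ae_restrict_iff' measurableSet_Ioi] at h
  have h2 : ∀ᵐ x : ℝ, -x ∈ Ioi (0:ℝ) → P (-x) :=
    (Measure.measurePreserving_neg (volume : Measure ℝ)).quasiMeasurePreserving.ae h
  have h3 : ∀ᵐ x : ℝ, x ≠ 0 := by
    simp [ae_iff]
  filter_upwards [h, h2, h3] with x h1 h2 h3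
  rcases lt_or_gt_of_ne h3 with h4 | h4
  · rw [abs_of_neg h4]; exact h2 (by simpa using h4)
  · rw [abs_of_pos h4]; exact h1 h4

lemma apply_abs_of_even {f : ℝ → ℝ} (h : ∀ x, f (-x) = f x) (x : ℝ) : f |x| = f x := by
  rcases abs_choice x with h1 | h1 <;> rw [h1]
  exact h x

lemma exists_normalSol {α β ustar : ℝ} (hα : 0 < α) (hβ : 0 < β) (hu : 0 < ustar)
    (hsub : ustar < PsiP α β α) {u p : ℝ → ℝ → ℝ} (hsol : IsWeakSolution α β ustar u p)
    {pstar : ℝ → ℝ} (hP : CondP α p pstar) :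
    ∃ u' p' w' ps, NormalSol α β ustar u' p' w' ps ∧ (∀ x t, 0 < t → u' x t = u x t) ∧
      ∀ᵐ x ∂(volume.restrict (Ioi (0:ℝ))), ps x = pstar x := by
  obtain ⟨ue, pe, pm, ptri, pmono, w, ⟨r1, r2, r3, r4⟩, wf⟩ := hsol
  obtain ⟨psm, hps⟩ := hP
  have hrange : ∀ x, ∀ t ∈ Ici (0:ℝ), 0 ≤ p x t ∧ p x t ≤ 1 := by
    intro x t ht
    obtain ⟨a1, a2, a3⟩ := ptri x t ht
    rcases lt_trichotomy (sSup ((fun s => u x s) '' Icc 0 t)) ustar with h | h | h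
    · rw [a1 h]; norm_num
    · exact a2 h
    · rw [a3 h]; norm_num
  let v : ℝ → ℝ → ℝ := fun x t => u x (max t 0) - psi α β x (max t 0)
  let w' : ℝ → ℝ → ℝ := fun x t => w x (max t 0)
  let p' : ℝ → ℝ → ℝ := fun x t => if 0 < t then p x t else 0
  let u' : ℝ → ℝ → ℝ := fun x t => v x t + psi α β x t
  have hcm : Continuous fun q : ℝ × ℝ => (q.1, max q.2 0) := by fun_prop
  have hcm' : ∀ q : ℝ × ℝ, (q.1, max q.2 0) ∈ (univ : Set ℝ) ×ˢ Ici (0:ℝ) := fun q =>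
    ⟨mem_univ _, (le_max_right q.2 0 : (0:ℝ) ≤ max q.2 0)⟩
  have vc : Continuous fun q : ℝ × ℝ => v q.1 q.2 := r2.comp_continuous hcm hcm'
  have wc : Continuous fun q : ℝ × ℝ => w' q.1 q.2 := r3.comp_continuous hcm hcm'
  have p'r : ∀ x t, 0 ≤ p' x t ∧ p' x t ≤ 1 := fun x t => by
    simp only [p']; split_ifs with h
    · exact hrange x t h.le
    · norm_num
  have p'm : Measurable fun q : ℝ × ℝ => p' q.1 q.2 :=
    Measurable.ite (measurableSet_lt measurable_const measurable_snd) pm measurable_const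
  have u'm : Measurable fun q : ℝ × ℝ => u' q.1 q.2 := vc.measurable.add psi_measurable
  have bdd : ∀ T, ∃ C, ∀ x t, t ≤ T → |v x t| ≤ C ∧ |w' x t| ≤ C := fun T => by
    obtain ⟨C, hC⟩ := r4 (max T 1) (by positivity)
    exact ⟨C, fun x t ht => hC x (max t 0) ⟨le_max_right _ _, max_le_max ht (by norm_num)⟩⟩
  have hsys : HeatSys v w' (fun x t => p' x t * u' x t) := by
    refine ⟨vc, wc, fun t x => r1 (max t 0) (le_max_right t 0 : (0:ℝ) ≤ max t 0) x, p'm.mul u'm, fun T => ?_, ?_⟩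
    · obtain ⟨C, hC⟩ := bdd T
      refine ⟨C + PsiP α β α, fun x t ht => ?_⟩
      have hψ := PsiP_pos hα hβ α
      obtain ⟨b1, b2⟩ := hC x t ht
      refine ⟨by linarith, by linarith, ?_⟩
      rw [abs_mul, abs_of_nonneg (p'r x t).1]
      refine (mul_le_of_le_one_left (abs_nonneg _) (p'r x t).2).trans ?_
      exact (abs_add_le _ _).trans (add_le_add b1 (psi_abs_le hα hβ x t))
    · intro T hT φ φt φx hφ
      have := wf T hT φ φt φx hφ
      have e1 : (∫ t in Ioc (0:ℝ) T, ∫ x : ℝ, φt x t * v x t)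
          = ∫ t in Ioc (0:ℝ) T, ∫ x : ℝ, φt x t * (u x t - psi α β x t) :=
        setIntegral_congr_fun measurableSet_Ioc fun t ht => by
          simp only [v, max_eq_left ht.1.le]
      have e2 : (∫ t in Ioc (0:ℝ) T, ∫ x : ℝ, (φx x t * w' x t + p' x t * u' x t * φ x t))
          = ∫ t in Ioc (0:ℝ) T, ∫ x : ℝ, (φx x t * w x t + p x t * u x t * φ x t) :=
        setIntegral_congr_fun measurableSet_Ioc fun t ht => by
          simp only [w', p', u', v, max_eq_left ht.1.le, if_pos ht.1, sub_add_cancel]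
      rw [e1, e2, this]
  have hv0 : ∀ x t, t ≤ 0 → v x t = 0 := fun x t ht => by
    have := hsys.initial_zero x
    simp only [v, max_eq_right ht] at this ⊢
    simpa using this
  have u'0 : ∀ x t, t ≤ 0 → u' x t = 0 := fun x t ht => by
    simp only [u', hv0 x t ht, psi_of_nonpos ht, add_zero]
  have u'p : ∀ x t, 0 < t → u' x t = u x t := fun x t ht => by
    simp only [u', v, max_eq_left ht.le, sub_add_cancel]
  have ux0 : ∀ x, u x 0 = 0 := fun x => by
    have := hv0 x 0 le_rfl
    simp only [v, max_self, psi_of_nonpos le_rfl, sub_zero] at this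
    exact this
  have unn : ∀ x t, 0 ≤ u' x t := fun x t => by
    rcases le_or_gt t 0 with h | h
    · rw [u'0 x t h]
    · exact HeatSys.nonneg hα hβ hsys (fun _ _ => rfl) p'r x h
  have Fnn : ∀ x t, 0 ≤ p' x t * u' x t := fun x t => mul_nonneg (p'r x t).1 (unn x t)
  have ule : ∀ x t, u' x t ≤ psi α β x t := fun x t => by
    rcases le_or_gt t 0 with h | h
    · rw [u'0 x t h]; exact psi_nonneg hα hβ _ _
    · have := hsys.nonpos (fun x t _ => Fnn x t) x h
      simp only [u']; linarith
  let ps : ℝ → ℝ := fun x => max 0 (min 1 (pstar |x|))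
  have hps1 : ∀ᵐ x : ℝ, ∀ t, x ^ 2 / α ^ 2 < t → p' x t = ps x := by
    filter_upwards [ae_abs hps] with x hx t ht
    have ht0 : 0 < t := lt_of_le_of_lt (by positivity) ht
    rw [sq_abs] at hx
    have e := hx t ht
    rw [apply_abs_of_even (f := fun y => p y t) (fun y => pe y t)] at e
    obtain ⟨e1, e2⟩ := hrange x t ht0.le
    simp only [p', if_pos ht0, ps, ← e, min_eq_right e2, max_eq_right e1]
  have hps2 : ∀ᵐ x : ℝ, ∀ t, p' x t ≤ ps x := by
    filter_upwards [hps1] with x hx t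
    rcases le_or_gt t 0 with h | h
    · simp only [p', if_neg h.not_gt]; exact le_max_left _ _
    · have h2 : x ^ 2 / α ^ 2 < max t (x ^ 2 / α ^ 2 + 1) := lt_of_lt_of_le (by linarith) (le_max_right _ _)
      rw [← hx _ h2]
      have h3 : 0 < max t (x ^ 2 / α ^ 2 + 1) := h.trans_le (le_max_left _ _)
      simp only [p', if_pos h, if_pos h3]
      exact pmono x h.le h3.le (le_max_left _ _)
  have sup_u : ∀ x s, 0 ≤ s → u x s = u' x s := fun x s hs => by
    rcases hs.eq_or_lt with h | h
    · rw [← h, ux0, u'0 x 0 le_rfl]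
    · rw [u'p x s h]
  refine ⟨u', p', w', ps, ⟨⟨hα, hβ, ?_, unn, ule, ?_, Fnn, ?_, ?_, ?_, ?_, ?_, ⟨1, ?_⟩⟩, hu, hsub, ?_,
    p'r, hps2, hps1, ?_, ?_⟩, u'p, ?_⟩
  · have : (fun x t => u' x t - psi α β x t) = v := by
      funext x t; simp only [u', add_sub_cancel_right]
    rw [this]; exact hsys
  · intro x t
    simp only [u', v, ue, psi_even]
  · filter_upwards [hps2] with x hx t using mul_le_mul_of_nonneg_right (hx t) (unn x t)
  · filter_upwards [hps1] with x hx t ht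
    rw [hx t ht]
  · exact measurable_const.max (measurable_const.min (psm.comp measurable_abs))
  · intro x; exact le_max_left _ _
  · intro x; simp only [ps, abs_neg]
  · intro x; exact max_le zero_le_one (min_le_left _ _)
  · intro x; exact max_le zero_le_one (min_le_left _ _)
  · rintro x t ⟨ε, hε, h⟩
    simp only [p']
    split_ifs with ht
    · refine (ptri x t ht.le).1 (lt_of_le_of_lt (csSup_le ((nonempty_Icc.2 ht.le).image _)
        (a := max 0 (ustar - ε)) ?_) (max_lt hu (by linarith)))
      rintro _ ⟨s, hs, rfl⟩
      simp only
      rw [sup_u x s hs.1]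
      rcases hs.1.eq_or_lt with h1 | h1
      · rw [← h1, u'0 x 0 le_rfl]; exact le_max_left _ _
      · exact (h s ⟨h1, hs.2⟩).trans (le_max_right _ _)
    · rfl
  · intro x s t hs hst h
    have ht : 0 < t := hs.trans_le hst
    simp only [p', if_pos ht]
    refine (ptri x t ht.le).2.2 (lt_of_lt_of_le h ?_)
    refine le_csSup ⟨PsiP α β α, ?_⟩ ⟨s, ⟨hs.le, hst⟩, (u'p x s hs).symm⟩
    rintro _ ⟨s, hs, rfl⟩
    simp only
    rw [sup_u x s hs.1]
    exact (ule x s).trans (psi_le hα hβ x s)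
  · have h1 : ∀ᵐ x ∂(volume.restrict (Ioi (0:ℝ))), ∀ t, x ^ 2 / α ^ 2 < t → p' x t = ps x :=
      ae_restrict_of_ae hps1
    filter_upwards [h1, hps, ae_restrict_mem measurableSet_Ioi] with x h1 h2 h3
    have ht0 : 0 < x ^ 2 / α ^ 2 + 1 := by positivity
    have e1 := h1 (x ^ 2 / α ^ 2 + 1) (by linarith)
    have e2 := h2 (x ^ 2 / α ^ 2 + 1) (by linarith)
    rw [← e1, ← e2]
    simp only [p', if_pos ht0]

lemma ae_mul_left {P : ℝ → Prop} (h : ∀ᵐ x : ℝ, P x) {l : ℝ} (hl : l ≠ 0) : ∀ᵐ x : ℝ, P (l * x) := by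
  have hq : Measure.QuasiMeasurePreserving (fun x : ℝ => l * x) volume volume := by
    refine ⟨measurable_const_mul l, ?_⟩
    rw [Real.map_volume_mul_left hl]
    exact Measure.smul_absolutelyContinuous
  exact hq.ae h

lemma hk_shift_le {R τ x : ℝ} (hτ : 0 < τ) (hx : |x| ≤ R) (y : ℝ) :
    hk (x - y) τ ≤ Real.sqrt 2 * Real.exp (R ^ 2 / (4 * τ)) * hk y (2 * τ) := by
  have hpi := Real.pi_pos
  unfold hk
  have h2 : (Real.sqrt (4 * Real.pi * τ))⁻¹ = Real.sqrt 2 * (Real.sqrt (4 * Real.pi * (2 * τ)))⁻¹ := by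
    rw [show 4 * Real.pi * (2 * τ) = 2 * (4 * Real.pi * τ) by ring,
      Real.sqrt_mul (by norm_num : (0:ℝ) ≤ 2), mul_inv, ← mul_assoc,
      mul_inv_cancel₀ (by positivity), one_mul]
  have h3 : Real.exp (-(x - y) ^ 2 / (4 * τ))
      ≤ Real.exp (R ^ 2 / (4 * τ)) * Real.exp (-y ^ 2 / (4 * (2 * τ))) := by
    rw [← Real.exp_add]
    refine Real.exp_le_exp.2 ?_
    rw [show R ^ 2 / (4 * τ) + -y ^ 2 / (4 * (2 * τ)) = (R ^ 2 - y ^ 2 / 2) / (4 * τ) by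
      field_simp; ring]
    gcongr
    have : x ^ 2 ≤ R ^ 2 := by rw [← sq_abs x]; gcongr
    nlinarith [sq_nonneg (2 * x - y)]
  rw [h2]
  calc _ ≤ Real.sqrt 2 * (Real.sqrt (4 * Real.pi * (2 * τ)))⁻¹
        * (Real.exp (R ^ 2 / (4 * τ)) * Real.exp (-y ^ 2 / (4 * (2 * τ)))) := by gcongr
    _ = _ := by ring

lemma inv_sqrt_one_sub_le {τ : ℝ} (h0 : 0 ≤ τ) (h1 : τ ≤ 1 / 2) :
    1 ≤ (Real.sqrt (1 - τ))⁻¹ ∧ (Real.sqrt (1 - τ))⁻¹ ≤ 1 + 2 * τ := by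
  have hs : 0 < Real.sqrt (1 - τ) := Real.sqrt_pos.2 (by linarith)
  have hs1 : Real.sqrt (1 - τ) ≤ 1 := Real.sqrt_le_one.2 (by linarith)
  refine ⟨(one_le_inv₀ hs).2 hs1, inv_le_of_inv_le₀ (by positivity) ?_⟩
  have h2 : 1 - τ ≤ Real.sqrt (1 - τ) := by
    nlinarith [Real.sq_sqrt (by linarith : 0 ≤ 1 - τ)]
  refine le_trans ?_ h2
  rw [inv_le_iff_one_le_mul₀ (by positivity)]
  nlinarith

/-- Mismatch between `ψ` and its caloric continuation. -/
lemma psi_sub_conv_le {α β : ℝ} (hα : 0 < α) (hβ : 0 < β) (x : ℝ) {τ : ℝ} (h0 : 0 < τ) (h1 : τ ≤ 1 / 2) :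
    psi α β x 1 - ∫ y, hk (x - y) τ * psi α β y (1 - τ)
      ≤ psiC α β * (2 * hkMoment + 2 * |x|) * Real.sqrt τ := by
  have hC := psiC_pos hα hβ
  obtain ⟨r1, r2⟩ := inv_sqrt_one_sub_le h0.le h1
  set r := (Real.sqrt (1 - τ))⁻¹ with hr
  have pt : ∀ y, psi α β x 1 - psi α β y (1 - τ) ≤ psiC α β * (2 * |x - y| + 2 * τ * |x|) := by
    intro y
    rw [psi_eq one_pos, psi_eq (by linarith : 0 < 1 - τ), Real.sqrt_one, div_one]
    refine (le_abs_self _).trans ((PsiP_lipschitz hα hβ _ _).trans ?_)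
    refine mul_le_mul_of_nonneg_left ?_ hC.le
    have e : |x| - |y| / Real.sqrt (1 - τ) = (|x| - |y|) * r - |x| * (r - 1) := by
      rw [hr]; ring
    rw [e]
    calc |(|x| - |y|) * r - |x| * (r - 1)| ≤ |(|x| - |y|) * r| + |(|x| * (r - 1))| := abs_sub _ _
      _ = |(|x| - |y|)| * r + |x| * (r - 1) := by
        rw [abs_mul, abs_mul, abs_of_nonneg (by linarith : 0 ≤ r), abs_of_nonneg (by linarith : 0 ≤ r - 1),
          abs_abs]
      _ ≤ |x - y| * 2 + |x| * (2 * τ) := by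
        refine add_le_add (mul_le_mul (abs_abs_sub_abs_le_abs_sub x y) (by linarith) (by linarith)
          (abs_nonneg _)) (mul_le_mul_of_nonneg_left (by linarith) (abs_nonneg _))
      _ = _ := by ring
  have i1 := hk_mul_integrable h0 x (psi_slice_continuous (α := α) (β := β) (1 - τ)).aestronglyMeasurable
    (psi_abs_le hα hβ · (1 - τ))
  have i0 := hk_sub_integrable h0 x
  have i2 := hk_abs_integrable x h0
  have e1 : psi α β x 1 - ∫ y, hk (x - y) τ * psi α β y (1 - τ)
      = ∫ y, (hk (x - y) τ * psi α β x 1 - hk (x - y) τ * psi α β y (1 - τ)) := by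
    rw [integral_sub (i0.mul_const _) i1, integral_mul_const, hk_sub_integral h0, one_mul]
  have hsq : τ ≤ Real.sqrt τ := by
    rw [Real.le_sqrt h0.le h0.le]; nlinarith
  rw [e1]
  calc _ ≤ ∫ y, (2 * psiC α β * (hk (x - y) τ * |x - y|) + hk (x - y) τ * (2 * psiC α β * τ * |x|)) := by
        refine integral_mono ((i0.mul_const _).sub i1) ((i2.const_mul _).add (i0.mul_const _)) fun y => ?_
        simp only
        have := mul_le_mul_of_nonneg_left (pt y) (hk_nonneg (x - y) τ)
        linarith
    _ = 2 * psiC α β * (hkMoment * Real.sqrt τ) + 2 * psiC α β * τ * |x| := by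
        rw [integral_add (i2.const_mul _) (i0.mul_const _), integral_const_mul, hk_abs_integral x h0,
          integral_mul_const, hk_sub_integral h0, one_mul]
    _ ≤ 2 * psiC α β * (hkMoment * Real.sqrt τ) + 2 * psiC α β * Real.sqrt τ * |x| := by gcongr
    _ = _ := by ring

/-- Locally uniform convergence of Gaussian averages. -/
lemma conv_tendstoUniformlyOn {ι : Type*} {L : Filter ι} [L.IsCountablyGenerated] {g : ι → ℝ → ℝ} {g₀ : ℝ → ℝ}
    {C τ : ℝ} (hτ : 0 < τ) (hm : ∀ i, AEStronglyMeasurable (g i)) (hC : ∀ᶠ i in L, ∀ y, |g i y| ≤ C)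
    (hm0 : AEStronglyMeasurable g₀) (hC0 : ∀ y, |g₀ y| ≤ C)
    (hlim : ∀ᵐ y, Tendsto (fun i => g i y) L (𝓝 (g₀ y))) (R : ℝ) :
    ∀ ε > 0, ∀ᶠ i in L, ∀ x, |x| ≤ R →
      |(∫ y, hk (x - y) τ * g i y) - ∫ y, hk (x - y) τ * g₀ y| ≤ ε := by
  set K := Real.sqrt 2 * Real.exp (R ^ 2 / (4 * τ)) with hK
  have hK0 : 0 ≤ K := by positivity
  have h2 : 0 < 2 * τ := by positivity
  have hitg := (hk_integrable h2).const_mul K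
  have T : Tendsto (fun i => ∫ y, K * hk y (2 * τ) * |g i y - g₀ y|) L
      (𝓝 (∫ y, K * hk y (2 * τ) * 0)) := by
    refine tendsto_integral_filter_of_dominated_convergence (fun y => K * hk y (2 * τ) * (2 * C)) ?_ ?_
      (hitg.mul_const _) ?_
    · exact Eventually.of_forall fun i => hitg.aestronglyMeasurable.mul
        ((hm i).sub hm0).norm
    · filter_upwards [hC] with i hi
      refine Eventually.of_forall fun y => ?_
      rw [norm_mul, Real.norm_eq_abs, Real.norm_eq_abs, abs_abs,
        abs_of_nonneg (mul_nonneg hK0 (hk_nonneg _ _))]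
      refine mul_le_mul_of_nonneg_left ?_ (mul_nonneg hK0 (hk_nonneg _ _))
      calc |g i y - g₀ y| ≤ |g i y| + |g₀ y| := abs_sub _ _
        _ ≤ _ := by linarith [hi y, hC0 y]
    · filter_upwards [hlim] with y hy
      refine tendsto_const_nhds.mul ?_
      have := (hy.sub_const (g₀ y)).abs
      simpa using this
  simp only [mul_zero, integral_zero] at T
  intro ε hε
  filter_upwards [T.eventually (gt_mem_nhds hε), hC] with i hi hCi x hx
  rw [← integral_sub (hk_mul_integrable hτ x (hm i) hCi) (hk_mul_integrable hτ x hm0 hC0)]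
  refine (norm_integral_le_of_norm_le (f := fun y => hk (x - y) τ * g i y - hk (x - y) τ * g₀ y) (g := fun y => K * hk y (2 * τ) * |g i y - g₀ y|) ?_ ?_).trans hi.le
  · refine (hitg.mul_const (2 * C)).mono' (hitg.aestronglyMeasurable.mul ((hm i).sub hm0).norm) ?_
    refine Eventually.of_forall fun y => ?_
    rw [norm_mul, Real.norm_eq_abs, Real.norm_eq_abs, abs_abs,
      abs_of_nonneg (mul_nonneg hK0 (hk_nonneg _ _))]
    refine mul_le_mul_of_nonneg_left ?_ (mul_nonneg hK0 (hk_nonneg _ _))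
    calc |g i y - g₀ y| ≤ |g i y| + |g₀ y| := abs_sub _ _
      _ ≤ _ := by linarith [hCi y, hC0 y]
  · refine Eventually.of_forall fun y => ?_
    rw [← mul_sub, norm_mul, Real.norm_eq_abs, Real.norm_eq_abs, abs_of_nonneg (hk_nonneg _ _)]
    exact mul_le_mul_of_nonneg_right (hk_shift_le hτ hx y) (abs_nonneg _)

namespace PrecipSys
variable {α β : ℝ} {u w F : ℝ → ℝ → ℝ} {q : ℝ → ℝ}

/-- Parabolic rescaling. -/
lemma scale (h : PrecipSys α β u w F q) {l : ℝ} (hl : 0 < l) :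
    PrecipSys α β (fun x t => u (l * x) (l ^ 2 * t)) (fun x t => l * w (l * x) (l ^ 2 * t))
      (fun x t => l ^ 2 * F (l * x) (l ^ 2 * t)) (fun x => l ^ 2 * q (l * x)) := by
  have hl2 : 0 < l ^ 2 := by positivity
  refine ⟨h.hα, h.hβ, ?_, fun x t => h.u_nonneg _ _, fun x t => ?_, fun x t => ?_, fun x t => ?_, ?_, ?_,
    ?_, fun x => ?_, fun x => ?_, ?_⟩
  · have := h.sys.scale hl
    simp only [psi_scale hl] at this
    exact this
  · rw [← psi_scale hl]; exact h.u_le _ _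
  · rw [mul_neg]; exact h.u_even _ _
  · exact mul_nonneg hl2.le (h.F_nonneg _ _)
  · filter_upwards [ae_mul_left h.F_le hl.ne'] with x hx t
    rw [mul_assoc]
    exact mul_le_mul_of_nonneg_left (hx _) hl2.le
  · filter_upwards [ae_mul_left h.F_eq hl.ne'] with x hx t ht
    rw [hx _ ?_, mul_assoc]
    rw [mul_pow, mul_div_assoc]
    exact mul_lt_mul_of_pos_left ht hl2
  · exact (h.q_meas.comp (measurable_const_mul l)).const_mul _
  · exact mul_nonneg hl2.le (h.q_nonneg _)
  · rw [mul_neg, h.q_even]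
  · obtain ⟨B, hB⟩ := h.q_bdd
    exact ⟨l ^ 2 * B, fun x => mul_le_mul_of_nonneg_left (hB _) hl2.le⟩

lemma u_slice_continuous (h : PrecipSys α β u w F q) (t : ℝ) : Continuous fun x => u x t := by
  have := (h.sys.slice_continuous t).add (psi_slice_continuous (α := α) (β := β) t)
  refine this.congr fun x => ?_
  simp

lemma u_slice_aesm (h : PrecipSys α β u w F q) (t : ℝ) : AEStronglyMeasurable fun x => u x t :=
  (h.u_slice_continuous t).aestronglyMeasurable

lemma u_measurable (h : PrecipSys α β u w F q) : Measurable fun q : ℝ × ℝ => u q.1 q.2 := by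
  have e : (fun q : ℝ × ℝ => u q.1 q.2)
      = fun q => (u q.1 q.2 - psi α β q.1 q.2) + psi α β q.1 q.2 := by ext q; ring
  rw [e]
  exact h.sys.v_cont.measurable.add psi_measurable

lemma u_le_const (h : PrecipSys α β u w F q) (x t : ℝ) : u x t ≤ PsiP α β α :=
  (h.u_le x t).trans (psi_le h.hα h.hβ x t)

lemma u_abs_le (h : PrecipSys α β u w F q) (x t : ℝ) : |u x t| ≤ PsiP α β α := by
  rw [abs_of_nonneg (h.u_nonneg x t)]; exact h.u_le_const x t

lemma v_abs_le (h : PrecipSys α β u w F q) (x t : ℝ) : |u x t - psi α β x t| ≤ PsiP α β α := by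
  have := h.u_le x t; have := h.u_nonneg x t; have := psi_le h.hα h.hβ x t
  rw [abs_le]; constructor <;> linarith [psi_nonneg h.hα h.hβ x t]

lemma F_bdd (h : PrecipSys α β u w F q) (T : ℝ) : ∃ C, 0 ≤ C ∧ ∀ x t, t ≤ T → |F x t| ≤ C := by
  obtain ⟨C, hC⟩ := h.sys.bdd T
  exact ⟨C, (abs_nonneg _).trans (hC 0 T le_rfl).2.2, fun x t ht => (hC x t ht).2.2⟩

lemma conv_tendsto_time (h : PrecipSys α β u w F q) (x t : ℝ) {τ : ℝ} (h0 : 0 < τ) :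
    Tendsto (fun δ => ∫ y, hk (x - y) (τ + δ) * (u y t - psi α β y t)) (𝓝[>] 0)
      (𝓝 (∫ y, hk (x - y) τ * (u y t - psi α β y t))) := by
  refine tendsto_integral_filter_of_dominated_convergence
    (fun y => hkDom τ (2 * τ) (x - y) * PsiP α β α) ?_ ?_
    (((hkDom_integrable τ (by positivity : 0 < 2 * τ)).comp_sub_left x).mul_const _) ?_
  · filter_upwards [self_mem_nhdsWithin] with δ hδ
    have hδ : 0 < δ := hδ
    exact (hk_mul_integrable (by linarith) x (h.sys.slice_aesm (t))
      (fun y => h.v_abs_le y (t))).aestronglyMeasurable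
  · filter_upwards [Ioo_mem_nhdsGT h0] with δ hδ
    refine Eventually.of_forall fun y => ?_
    rw [norm_mul, Real.norm_eq_abs, Real.norm_eq_abs]
    exact mul_le_mul (hk_bounds h0 (by linarith [hδ.1]) (by linarith [hδ.2])).1 (h.v_abs_le _ _)
      (abs_nonneg _) (hkDom_nonneg h0 _ _)
  · refine Eventually.of_forall fun y => Tendsto.mul_const _ ?_
    have : ContinuousAt (fun δ => hk (x - y) (τ + δ)) 0 := by
      have h2 : ContinuousAt (fun s => hk (x - y) s) (τ + 0) := by
        rw [add_zero]; exact (hk_hasDerivAt_time _ h0).continuousAt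
      exact ContinuousAt.comp (f := fun δ => τ + δ) h2 (by fun_prop)
    have := this.tendsto
    rw [add_zero] at this
    exact this.mono_left nhdsWithin_le_nhds

/-- Comparison from above with the heat flow started shortly before. -/
lemma upper (h : PrecipSys α β u w F q) (x : ℝ) {τ : ℝ} (h0 : 0 < τ) (h1 : τ ≤ 1 / 2) :
    u x 1 ≤ (∫ y, hk (x - y) τ * u y (1 - τ)) + psiC α β * (2 * hkMoment + 2 * |x|) * Real.sqrt τ := by
  have e : u x 1 - psi α β x 1 ≤ ∫ y, hk (x - y) τ * (u y (1 - τ) - psi α β y (1 - τ)) := by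
    have T1 := h.sys.conv_tendsto x 1
    have T2 := h.conv_tendsto_time x (1 - τ) h0
    refine le_of_tendsto_of_tendsto T1 T2 ?_
    filter_upwards [self_mem_nhdsWithin] with δ hδ
    have hδ : 0 < δ := hδ
    have := h.sys.duhamel_between (t₁ := 1 - τ) (t₂ := 1) (by linarith) (by linarith) hδ x
    rw [show 1 - (1 - τ) + δ = τ + δ by ring] at this
    have hn : 0 ≤ ∫ s in Ioc (1 - τ) 1, ∫ y, hk (x - y) (1 + δ - s) * F y s :=
      setIntegral_nonneg measurableSet_Ioc fun s hs => integral_nonneg fun y =>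
        mul_nonneg (hk_nonneg _ _) (h.F_nonneg _ _)
    linarith
  have e2 := psi_sub_conv_le h.hα h.hβ x h0 h1
  have i1 := hk_mul_integrable h0 x (h.u_slice_aesm (1 - τ)) (h.u_abs_le · (1 - τ))
  have i2 := hk_mul_integrable h0 x (psi_slice_continuous (α := α) (β := β) (1 - τ)).aestronglyMeasurable
    (psi_abs_le h.hα h.hβ · (1 - τ))
  have e3 : ∫ y, hk (x - y) τ * (u y (1 - τ) - psi α β y (1 - τ))
      = (∫ y, hk (x - y) τ * u y (1 - τ)) - ∫ y, hk (x - y) τ * psi α β y (1 - τ) := by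
    rw [← integral_sub i1 i2]; congr 1; ext y; ring
  linarith

lemma F_space_integrableOn (h : PrecipSys α β u w F q) (R s : ℝ) : IntegrableOn (fun y => F y s) (Icc (-R) R) := by
  obtain ⟨C, _, hC⟩ := h.F_bdd s
  refine Integrable.mono' (g := fun _ => C) (integrableOn_const (by simp))
    (h.sys.F_meas.comp (by fun_prop : Measurable fun y : ℝ => (y, s))).aestronglyMeasurable ?_
  exact Eventually.of_forall fun y => hC y s le_rfl

lemma F_mass_measurable (h : PrecipSys α β u w F q) (R : ℝ) :
    Measurable fun s => ∫ y in Icc (-R) R, F y s := by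
  have hm : Measurable fun q : ℝ × ℝ => F q.2 q.1 := h.sys.F_meas.comp measurable_swap
  exact (hm.stronglyMeasurable.integral_prod_right' (ν := volume.restrict (Icc (-R) R))).measurable

lemma F_mass_integrableOn (h : PrecipSys α β u w F q) (R T : ℝ) :
    IntegrableOn (fun s => ∫ y in Icc (-R) R, F y s) (Ioc 0 T) := by
  obtain ⟨C, _, hC⟩ := h.F_bdd T
  refine Integrable.mono' (g := fun _ => C * (volume (Icc (-R) R)).toReal) (integrableOn_const (by simp))
    (h.F_mass_measurable R).aestronglyMeasurable ?_
  filter_upwards [ae_restrict_mem measurableSet_Ioc] with s hs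
  exact norm_setIntegral_le_of_norm_le_const (by simp) fun y _ => hC y s hs.2

/-- The total reaction in a bounded window up to time one is bounded. -/
lemma mass_bound (h : PrecipSys α β u w F q) (R : ℝ) :
    ∫ s in Ioc (0:ℝ) 1, ∫ y in Icc (-R) R, F y s
      ≤ PsiP α β α * (Real.sqrt (8 * Real.pi) * Real.exp (R ^ 2 / 4)) := by
  have hpi := Real.pi_pos
  have hd := h.sys.duhamel_zero one_pos one_pos 0
  have hb := conv_abs_le (f := fun y => u y 1 - psi α β y 1) one_pos 0 (h.v_abs_le · 1)
  rw [hd, abs_neg] at hb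
  set c := (Real.sqrt (8 * Real.pi) * Real.exp (R ^ 2 / 4)) with hc
  have hc0 : 0 < c := by positivity
  obtain ⟨C, hC0, hC⟩ := h.F_bdd 1
  have key : ∀ s ∈ Ioc (0:ℝ) 1, ∫ y in Icc (-R) R, F y s ≤ c * ∫ y, hk (0 - y) (1 + 1 - s) * F y s := by
    intro s hs
    have hσ : 0 < 1 + 1 - s := by linarith [hs.2]
    have hms : Measurable fun y => F y s := h.sys.F_meas.comp (by fun_prop : Measurable fun y : ℝ => (y, s))
    have hi := hk_mul_integrable hσ 0 hms.aestronglyMeasurable fun y => hC y s hs.2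
    calc ∫ y in Icc (-R) R, F y s ≤ ∫ y in Icc (-R) R, c * (hk (0 - y) (1 + 1 - s) * F y s) := by
          refine setIntegral_mono_on (h.F_space_integrableOn R s) (hi.const_mul c).integrableOn
            measurableSet_Icc fun y hy => ?_
          have h1 : 1 ≤ c * hk (0 - y) (1 + 1 - s) := by
            rw [hc]; unfold hk
            have hy2 : y ^ 2 ≤ R ^ 2 := sq_le_sq' hy.1 hy.2
            have a1 : Real.exp (-(R ^ 2 / 4)) ≤ Real.exp (-(0 - y) ^ 2 / (4 * (1 + 1 - s))) := by
              refine Real.exp_le_exp.2 ?_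
              rw [neg_div, neg_le_neg_iff, zero_sub, neg_sq, div_le_div_iff₀ (by positivity) (by norm_num)]
              nlinarith [hs.2, sq_nonneg y]
            have a2 : (Real.sqrt (8 * Real.pi))⁻¹ ≤ (Real.sqrt (4 * Real.pi * (1 + 1 - s)))⁻¹ := by
              refine inv_anti₀ (by positivity) (Real.sqrt_le_sqrt ?_)
              nlinarith [hs.1]
            calc (1:ℝ) = Real.sqrt (8 * Real.pi) * Real.exp (R ^ 2 / 4)
                  * ((Real.sqrt (8 * Real.pi))⁻¹ * Real.exp (-(R ^ 2 / 4))) := by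
                  rw [Real.exp_neg]
                  have : Real.sqrt (8 * Real.pi) ≠ 0 := by positivity
                  field_simp
              _ ≤ _ := by gcongr
          have := mul_le_mul_of_nonneg_right h1 (h.F_nonneg y s)
          linarith
      _ ≤ ∫ y, c * (hk (0 - y) (1 + 1 - s) * F y s) :=
          setIntegral_le_integral (hi.const_mul c) (Eventually.of_forall fun y =>
            mul_nonneg hc0.le (mul_nonneg (hk_nonneg _ _) (h.F_nonneg _ _)))
      _ = _ := integral_const_mul _ _
  calc _ ≤ ∫ s in Ioc (0:ℝ) 1, c * ∫ y, hk (0 - y) (1 + 1 - s) * F y s :=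
        setIntegral_mono_on (h.F_mass_integrableOn R 1)
          ((HeatSys.conv_time_integrable h.sys.F_meas 0 (by norm_num) fun y s hs => hC y s hs.2).const_mul c)
          measurableSet_Ioc key
    _ = c * ∫ s in Ioc (0:ℝ) 1, ∫ y, hk (0 - y) (1 + 1 - s) * F y s := integral_const_mul _ _
    _ ≤ c * PsiP α β α := mul_le_mul_of_nonneg_left ((le_abs_self _).trans hb) hc0.le
    _ = _ := mul_comm _ _

lemma integral_inv_sqrt {τ δ : ℝ} (h0 : 0 < τ) (hδ : 0 < δ) :
    IntegrableOn (fun s => (Real.sqrt (1 + δ - s))⁻¹) (Ioc (1 - τ) 1) ∧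
    ∫ s in Ioc (1 - τ) 1, (Real.sqrt (1 + δ - s))⁻¹ ≤ 2 * Real.sqrt (τ + δ) := by
  have hc : ContinuousOn (fun s : ℝ => (Real.sqrt (1 + δ - s))⁻¹) (uIcc (1 - τ) 1) := by
    refine ContinuousOn.inv₀ (by fun_prop) fun s hs => ?_
    rw [uIcc_of_le (by linarith)] at hs
    exact (Real.sqrt_pos.2 (by linarith [hs.2])).ne'
  have hi := hc.intervalIntegrable (μ := volume)
  refine ⟨(intervalIntegrable_iff_integrableOn_Ioc_of_le (by linarith)).1 hi, ?_⟩
  rw [← intervalIntegral.integral_of_le (by linarith), intervalIntegral.integral_eq_sub_of_hasDerivAt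
    (f := fun s => -(2 * Real.sqrt (1 + δ - s))) ?_ hi]
  · rw [show 1 + δ - (1 - τ) = τ + δ by ring]
    have := Real.sqrt_nonneg (1 + δ - 1)
    linarith
  · intro s hs
    rw [uIcc_of_le (by linarith)] at hs
    have hp : 0 < 1 + δ - s := by linarith [hs.2]
    have h1 : HasDerivAt (fun s => 1 + δ - s) (-1) s := (hasDerivAt_id s).const_sub (1 + δ)
    have h2 := ((h1.sqrt hp.ne').const_mul 2).neg
    refine h2.congr_deriv ?_
    have := Real.sqrt_pos.2 hp
    field_simp

/-- Comparison from below with the heat flow started shortly before. -/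
lemma lower (h : PrecipSys α β u w F q) {a x M : ℝ} (ha : 0 < a) (hx : a ≤ x) {τ : ℝ} (h0 : 0 < τ)
    (h1 : τ ≤ 1 / 2) (hqi : IntegrableOn q (Ioi (a / 2))) (hq : ∫ y in Ioi (a / 2), q y ≤ M) :
    (∫ y, hk (x - y) τ * u y (1 - τ))
      - (4 * PsiP α β α * M + 16 / a ^ 2
        * (PsiP α β α * (Real.sqrt (8 * Real.pi) * Real.exp ((a / 2) ^ 2 / 4)))) * Real.sqrt (2 * τ) ≤ u x 1 := by
  have hΨ := PsiP_pos h.hα h.hβ α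
  set K := PsiP α β α * (Real.sqrt (8 * Real.pi) * Real.exp ((a / 2) ^ 2 / 4)) with hK
  obtain ⟨C, hC0, hC⟩ := h.F_bdd 1
  have q0 := h.q_nonneg
  have hqi' : IntegrableOn q (Iio (-(a / 2))) := by
    have := hqi.comp_neg
    simp only [h.q_even] at this
    simpa using this
  have hqe : ∫ y in Iio (-(a / 2)), q y = ∫ y in Ioi (a / 2), q y := by
    have := integral_comp_neg_Iic (-(a / 2)) q
    rw [neg_neg] at this
    rw [← this, integral_Iic_eq_integral_Iio]
    simp only [h.q_even]
  have hcompl : (Icc (-(a / 2)) (a / 2))ᶜ = Iio (-(a / 2)) ∪ Ioi (a / 2) := by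
    ext y; simp only [mem_compl_iff, mem_Icc, mem_union, mem_Iio, mem_Ioi, not_and_or, not_le]
  have hqc : IntegrableOn q (Icc (-(a / 2)) (a / 2))ᶜ := by
    rw [hcompl]; exact hqi'.union hqi
  have hqm : ∫ y in (Icc (-(a / 2)) (a / 2))ᶜ, q y ≤ 2 * M := by
    rw [hcompl, setIntegral_union (by
      rw [Set.disjoint_left]; intro y hy hy'
      simp only [mem_Iio, mem_Ioi] at hy hy'
      linarith) measurableSet_Ioi hqi' hqi, hqe]
    linarith
  have slice : ∀ δ > 0, δ ≤ τ → ∀ s ∈ Ioc (1 - τ) 1, ∫ y, hk (x - y) (1 + δ - s) * F y s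
      ≤ PsiP α β α * (2 * M) * (Real.sqrt (1 + δ - s))⁻¹
        + 16 / a ^ 2 * Real.sqrt (2 * τ) * ∫ y in Icc (-(a / 2)) (a / 2), F y s := by
    intro δ hδ hδτ s hs
    have hσ : 0 < 1 + δ - s := by linarith [hs.2]
    have hms : Measurable fun y => F y s := h.sys.F_meas.comp (by fun_prop : Measurable fun y : ℝ => (y, s))
    have hi := hk_mul_integrable hσ x hms.aestronglyMeasurable fun y => hC y s hs.2
    rw [← integral_add_compl (measurableSet_Icc (a := -(a / 2)) (b := a / 2)) hi, add_comm]
    refine add_le_add ?_ ?_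
    · calc _ ≤ ∫ y in (Icc (-(a / 2)) (a / 2))ᶜ, (Real.sqrt (1 + δ - s))⁻¹ * PsiP α β α * q y := by
            refine integral_mono_ae hi.integrableOn (hqc.const_mul _) (ae_restrict_of_ae ?_)
            filter_upwards [h.F_le] with y hy
            calc hk (x - y) (1 + δ - s) * F y s ≤ (Real.sqrt (1 + δ - s))⁻¹ * (q y * PsiP α β α) := by
                  refine mul_le_mul (hk_le _ hσ) ((hy s).trans ?_) (h.F_nonneg _ _) (by positivity)
                  exact mul_le_mul_of_nonneg_left (h.u_le_const _ _) (q0 y)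
              _ = _ := by ring
        _ = (Real.sqrt (1 + δ - s))⁻¹ * PsiP α β α * ∫ y in (Icc (-(a / 2)) (a / 2))ᶜ, q y :=
            integral_const_mul _ _
        _ ≤ (Real.sqrt (1 + δ - s))⁻¹ * PsiP α β α * (2 * M) := by gcongr
        _ = _ := by ring
    · rw [← integral_const_mul]
      refine setIntegral_mono_on hi.integrableOn ((h.F_space_integrableOn (a / 2) s).const_mul _)
        measurableSet_Icc fun y hy => ?_
      refine mul_le_mul_of_nonneg_right ?_ (h.F_nonneg _ _)
      have hz : a / 2 ≤ x - y := by linarith [hy.2]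
      refine (hk_le' (by linarith : x - y ≠ 0) hσ).trans ?_
      rw [div_mul_eq_mul_div, div_le_div_iff₀ (by nlinarith) (by positivity)]
      have e1 : Real.sqrt (1 + δ - s) ≤ Real.sqrt (2 * τ) := Real.sqrt_le_sqrt (by linarith [hs.1])
      have e2 : a ^ 2 ≤ 4 * (x - y) ^ 2 := by nlinarith
      calc 4 * Real.sqrt (1 + δ - s) * a ^ 2 ≤ 4 * Real.sqrt (2 * τ) * (4 * (x - y) ^ 2) := by gcongr
        _ = _ := by ring
  have total : ∀ δ > 0, δ ≤ τ → ∫ s in Ioc (1 - τ) 1, ∫ y, hk (x - y) (1 + δ - s) * F y s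
      ≤ (4 * PsiP α β α * M + 16 / a ^ 2 * K) * Real.sqrt (2 * τ) := by
    intro δ hδ hδτ
    obtain ⟨i1, i2⟩ := integral_inv_sqrt h0 hδ
    have hsub : Ioc (1 - τ) 1 ⊆ Ioc (0:ℝ) 1 := Ioc_subset_Ioc_left (by linarith)
    have i3 := (h.F_mass_integrableOn (a / 2) 1).mono_set hsub
    have hadd : IntegrableOn (fun s => PsiP α β α * (2 * M) * (Real.sqrt (1 + δ - s))⁻¹
        + 16 / a ^ 2 * Real.sqrt (2 * τ) * ∫ y in Icc (-(a / 2)) (a / 2), F y s) (Ioc (1 - τ) 1) :=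
      (i1.const_mul _).add (i3.const_mul _)
    have hM : 0 ≤ M := (setIntegral_nonneg measurableSet_Ioi fun y _ => q0 y).trans hq
    calc _ ≤ ∫ s in Ioc (1 - τ) 1, (PsiP α β α * (2 * M) * (Real.sqrt (1 + δ - s))⁻¹
        + 16 / a ^ 2 * Real.sqrt (2 * τ) * ∫ y in Icc (-(a / 2)) (a / 2), F y s) :=
          setIntegral_mono_on (HeatSys.conv_time_integrable h.sys.F_meas x (by linarith)
            fun y s hs => hC y s hs.2) hadd measurableSet_Ioc (slice δ hδ hδτ)
      _ = PsiP α β α * (2 * M) * (∫ s in Ioc (1 - τ) 1, (Real.sqrt (1 + δ - s))⁻¹)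
        + 16 / a ^ 2 * Real.sqrt (2 * τ) * ∫ s in Ioc (1 - τ) 1, ∫ y in Icc (-(a / 2)) (a / 2), F y s := by
          rw [integral_add (i1.const_mul _) (i3.const_mul _), integral_const_mul, integral_const_mul]
      _ ≤ PsiP α β α * (2 * M) * (2 * Real.sqrt (2 * τ)) + 16 / a ^ 2 * Real.sqrt (2 * τ) * K := by
          have e1 : Real.sqrt (τ + δ) ≤ Real.sqrt (2 * τ) := Real.sqrt_le_sqrt (by linarith)
          have e2 : ∫ s in Ioc (1 - τ) 1, ∫ y in Icc (-(a / 2)) (a / 2), F y s ≤ K :=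
            (setIntegral_mono_set (h.F_mass_integrableOn (a / 2) 1) (Eventually.of_forall fun s =>
              setIntegral_nonneg measurableSet_Icc fun y _ => h.F_nonneg y s)
              (Eventually.of_forall hsub)).trans (h.mass_bound (a / 2))
          gcongr
          linarith
      _ = _ := by ring
  have i1 := hk_mul_integrable h0 x (h.u_slice_aesm (1 - τ)) (h.u_abs_le · (1 - τ))
  have i2 := hk_mul_integrable h0 x (psi_slice_continuous (α := α) (β := β) (1 - τ)).aestronglyMeasurable
    (psi_abs_le h.hα h.hβ · (1 - τ))
  have e3 : ∫ y, hk (x - y) τ * (u y (1 - τ) - psi α β y (1 - τ))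
      = (∫ y, hk (x - y) τ * u y (1 - τ)) - ∫ y, hk (x - y) τ * psi α β y (1 - τ) := by
    rw [← integral_sub i1 i2]; congr 1; ext y; ring
  have e4 := hk_conv_psi_le h.hα h.hβ x (by linarith : 0 < 1 - τ) h0
  rw [sub_add_cancel] at e4
  have T1 := h.sys.conv_tendsto x 1
  have T2 : Tendsto (fun δ => ∫ y, hk (x - y) (τ + δ) * (u y (1 - τ) - psi α β y (1 - τ))) (𝓝[>] 0)
      (𝓝 (∫ y, hk (x - y) τ * (u y (1 - τ) - psi α β y (1 - τ)))) := h.conv_tendsto_time x (1 - τ) h0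
  have e5 : (∫ y, hk (x - y) τ * (u y (1 - τ) - psi α β y (1 - τ)))
      - (4 * PsiP α β α * M + 16 / a ^ 2 * K) * Real.sqrt (2 * τ) ≤ u x 1 - psi α β x 1 := by
    refine le_of_tendsto_of_tendsto (T2.sub_const _) T1 ?_
    filter_upwards [Ioc_mem_nhdsGT h0] with δ hδ
    have := h.sys.duhamel_between (t₁ := 1 - τ) (t₂ := 1) (by linarith) (by linarith) hδ.1 x
    rw [show 1 - (1 - τ) + δ = τ + δ by ring] at this
    have := total δ hδ.1 hδ.2
    linarith
  linarith

end PrecipSys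

/-- A nonnegative bump of unit mass in time, with its derivative. -/
structure TimeBump (t₀ t₁ : ℝ) (χ χ' : ℝ → ℝ) : Prop where
  pos : 0 < t₀
  lt : t₀ < t₁
  deriv : ∀ t, HasDerivAt χ (χ' t) t
  cont : Continuous χ'
  nonneg : ∀ t, 0 ≤ χ t
  pos_of_mem : ∀ t ∈ Ioo t₀ t₁, 0 < χ t
  zero : ∀ t, t ∉ Ioo t₀ t₁ → χ t = 0
  zero' : ∀ t, t ∉ Ioo t₀ t₁ → χ' t = 0
  int : ∫ t in Ioc 0 t₁, χ t = 1

lemma hasDerivAt_max_sq (y : ℝ) : HasDerivAt (fun y : ℝ => (max 0 y) ^ 2) (2 * max 0 y) y := by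
  rcases lt_trichotomy y 0 with h | rfl | h
  · rw [max_eq_left h.le, mul_zero]
    refine (hasDerivAt_const y (0:ℝ)).congr_of_eventuallyEq ?_
    filter_upwards [Iio_mem_nhds h] with z hz
    rw [max_eq_left (le_of_lt hz)]; norm_num
  · rw [max_self, mul_zero, hasDerivAt_iff_isLittleO]
    simp only [max_self, sub_zero, smul_zero, ne_eq, OfNat.ofNat_ne_zero, not_false_eq_true, zero_pow]
    refine Asymptotics.IsBigO.trans_isLittleO (g := fun y : ℝ => y ^ 2) ?_ ?_
    · refine Asymptotics.IsBigO.of_bound 1 (Eventually.of_forall fun z => ?_)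
      rw [one_mul, Real.norm_eq_abs, Real.norm_eq_abs, abs_of_nonneg (sq_nonneg _), abs_of_nonneg (sq_nonneg _)]
      exact sq_le_sq.2 (by rw [abs_of_nonneg (le_max_left 0 z)]; exact max_le (abs_nonneg _) (le_abs_self _))
    · have := Asymptotics.isLittleO_pow_pow (𝕜 := ℝ) (show 1 < 2 by norm_num)
      simpa using this
  · rw [max_eq_right h.le]
    have h2 : HasDerivAt (fun z : ℝ => z ^ 2) (2 * y) y := by simpa using hasDerivAt_pow 2 y
    refine h2.congr_of_eventuallyEq ?_
    filter_upwards [Ioi_mem_nhds h] with z hz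
    rw [max_eq_right (le_of_lt hz)]

lemma exists_timeBump {t₀ t₁ : ℝ} (h0 : 0 < t₀) (h1 : t₀ < t₁) : ∃ χ χ', TimeBump t₀ t₁ χ χ' := by
  set m : ℝ → ℝ := fun t => (t - t₀) * (t₁ - t) with hm
  have hm1 : ∀ t, HasDerivAt m (t₀ + t₁ - 2 * t) t := fun t =>
    (((hasDerivAt_id t).sub_const t₀).mul ((hasDerivAt_id t).const_sub t₁)).congr_deriv (by simp; ring)
  have hmc : Continuous m := by fun_prop
  have hneg : ∀ t, t ∉ Ioo t₀ t₁ → max 0 (m t) = 0 := by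
    intro t ht
    refine max_eq_left ?_
    by_cases h : t₀ < t
    · have : t₁ ≤ t := by by_contra h2; exact ht ⟨h, not_le.1 h2⟩
      simp only [hm]; nlinarith
    · simp only [hm]; nlinarith
  have hpos : ∀ t ∈ Ioo t₀ t₁, 0 < max 0 (m t) := fun t ht =>
    lt_max_of_lt_right (mul_pos (sub_pos.2 ht.1) (sub_pos.2 ht.2))
  have hc : Continuous fun t => (max 0 (m t)) ^ 2 := (continuous_const.max hmc).pow 2
  set I := ∫ t in Ioc 0 t₁, (max 0 (m t)) ^ 2 with hI
  have hI0 : 0 < I := by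
    rw [hI, ← intervalIntegral.integral_of_le (by linarith)]
    refine intervalIntegral.integral_pos (h0.trans h1) hc.continuousOn (fun _ _ => sq_nonneg _)
      ⟨(t₀ + t₁) / 2, ⟨by linarith, by linarith⟩, pow_pos (hpos _ ⟨by linarith, by linarith⟩) 2⟩
  refine ⟨fun t => (max 0 (m t)) ^ 2 / I, fun t => 2 * max 0 (m t) * (t₀ + t₁ - 2 * t) / I, h0, h1,
    fun t => ?_, ?_, fun t => by positivity, fun t ht => div_pos (pow_pos (hpos t ht) 2) hI0, fun t ht => ?_,
    fun t ht => ?_, ?_⟩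
  · exact ((hasDerivAt_max_sq (m t)).comp t (hm1 t)).div_const I
  · fun_prop
  · simp only [hneg t ht]; simp
  · simp only [hneg t ht]; simp
  · rw [integral_div, div_self hI0.ne']

/-- Weighted time average over `(0, T]`. -/
def timeAvg (T : ℝ) (k : ℝ → ℝ) (g : ℝ → ℝ → ℝ) (x : ℝ) : ℝ := ∫ t in Ioc 0 T, k t * g x t

namespace TimeBump
variable {t₀ t₁ : ℝ} {χ χ' : ℝ → ℝ}

lemma pos₁ (hb : TimeBump t₀ t₁ χ χ') : 0 < t₁ := hb.pos.trans hb.lt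

lemma continuous (hb : TimeBump t₀ t₁ χ χ') : Continuous χ :=
  continuous_iff_continuousAt.2 fun x => (hb.deriv x).continuousAt

lemma aesm (hb : TimeBump t₀ t₁ χ χ') : AEStronglyMeasurable χ (volume.restrict (Ioc 0 t₁)) :=
  hb.continuous.aestronglyMeasurable

lemma aesm' (hb : TimeBump t₀ t₁ χ χ') : AEStronglyMeasurable χ' (volume.restrict (Ioc 0 t₁)) :=
  hb.cont.aestronglyMeasurable

lemma integrableOn (hb : TimeBump t₀ t₁ χ χ') : IntegrableOn χ (Ioc 0 t₁) :=
  (hb.continuous.integrableOn_Icc (a := 0) (b := t₁)).mono_set Ioc_subset_Icc_self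

lemma integrableOn' (hb : TimeBump t₀ t₁ χ χ') : IntegrableOn χ' (Ioc 0 t₁) :=
  (hb.cont.integrableOn_Icc (a := 0) (b := t₁)).mono_set Ioc_subset_Icc_self

lemma exists_bound (hb : TimeBump t₀ t₁ χ χ') : ∃ K, ∀ t ∈ Ioc 0 t₁, |χ t| ≤ K ∧ |χ' t| ≤ K := by
  obtain ⟨K, hK⟩ := (isCompact_Icc (a := (0:ℝ)) (b := t₁)).exists_bound_of_continuousOn
    hb.continuous.continuousOn
  obtain ⟨K', hK'⟩ := (isCompact_Icc (a := (0:ℝ)) (b := t₁)).exists_bound_of_continuousOn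
    hb.cont.continuousOn
  exact ⟨max K K', fun t ht => ⟨(hK t ⟨ht.1.le, ht.2⟩).trans (le_max_left _ _),
    (hK' t ⟨ht.1.le, ht.2⟩).trans (le_max_right _ _)⟩⟩

lemma end_zero (hb : TimeBump t₀ t₁ χ χ') : χ t₁ = 0 := hb.zero _ fun h => lt_irrefl _ h.2

end TimeBump

namespace PrecipSys
variable {α β : ℝ} {u w F : ℝ → ℝ → ℝ} {q : ℝ → ℝ} {t₀ t₁ : ℝ} {χ χ' : ℝ → ℝ}

lemma avg_integrable (h : PrecipSys α β u w F q) {T : ℝ} {k : ℝ → ℝ} (hk : IntegrableOn k (Ioc 0 T)) (x : ℝ) :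
    IntegrableOn (fun t => k t * u x t) (Ioc 0 T) := by
  refine hk.mul_bdd (c := PsiP α β α) ?_ (Eventually.of_forall fun t => h.u_abs_le x t)
  exact (h.u_measurable.comp (by fun_prop : Measurable fun t : ℝ => (x, t))).aestronglyMeasurable

lemma v_avg_integrable (h : PrecipSys α β u w F q) {T : ℝ} {k : ℝ → ℝ} (hk : IntegrableOn k (Ioc 0 T)) (x : ℝ) :
    IntegrableOn (fun t => k t * (u x t - psi α β x t)) (Ioc 0 T) := by
  refine hk.mul_bdd (c := PsiP α β α) ?_ (Eventually.of_forall fun t => h.v_abs_le x t)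
  exact (h.sys.v_cont.comp (by fun_prop : Continuous fun t : ℝ => (x, t))).aestronglyMeasurable

lemma avg_nonneg (h : PrecipSys α β u w F q) (hb : TimeBump t₀ t₁ χ χ') (x : ℝ) : 0 ≤ timeAvg t₁ χ u x :=
  setIntegral_nonneg measurableSet_Ioc fun t _ => mul_nonneg (hb.nonneg t) (h.u_nonneg x t)

lemma avg_le (h : PrecipSys α β u w F q) (hb : TimeBump t₀ t₁ χ χ') (x : ℝ) :
    timeAvg t₁ χ u x ≤ PsiP α β α := by
  calc timeAvg t₁ χ u x ≤ ∫ t in Ioc 0 t₁, χ t * PsiP α β α :=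
        setIntegral_mono_on (h.avg_integrable hb.integrableOn x) (hb.integrableOn.mul_const _)
          measurableSet_Ioc fun t _ => mul_le_mul_of_nonneg_left (h.u_le_const x t) (hb.nonneg t)
    _ = _ := by rw [integral_mul_const, hb.int, one_mul]

lemma avg_even (h : PrecipSys α β u w F q) (x : ℝ) : timeAvg t₁ χ u (-x) = timeAvg t₁ χ u x := by
  simp only [timeAvg, h.u_even]

/-- Inside the parabola the average of `u` differs from that of `u - ψ` by a constant. -/
lemma avg_eq (h : PrecipSys α β u w F q) (hb : TimeBump t₀ t₁ χ χ') {x : ℝ} (hx : |x| ≤ α * Real.sqrt t₀) :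
    timeAvg t₁ χ u x = timeAvg t₁ χ (fun x t => u x t - psi α β x t) x + PsiP α β α := by
  have : ∀ t ∈ Ioc 0 t₁, χ t * u x t = χ t * (u x t - psi α β x t) + χ t * PsiP α β α := by
    intro t ht
    by_cases hm : t ∈ Ioo t₀ t₁
    · rw [psi_eq ht.1, PsiP_of_le]
      · ring
      · rw [div_le_iff₀ (Real.sqrt_pos.2 ht.1)]
        exact hx.trans (mul_le_mul_of_nonneg_left (Real.sqrt_le_sqrt hm.1.le) h.hα.le)
    · simp only [hb.zero t hm, zero_mul, add_zero]
  unfold timeAvg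
  rw [setIntegral_congr_fun measurableSet_Ioc this,
    integral_add (h.v_avg_integrable hb.integrableOn x) (hb.integrableOn.mul_const _), integral_mul_const,
    hb.int, one_mul]

lemma v_avg_hasDerivAt (h : PrecipSys α β u w F q) (hb : TimeBump t₀ t₁ χ χ') (x : ℝ) :
    HasDerivAt (timeAvg t₁ χ fun x t => u x t - psi α β x t) (timeAvg t₁ χ w x) x := by
  obtain ⟨C, hC⟩ := h.sys.bdd t₁
  obtain ⟨K, hK⟩ := hb.exists_bound
  exact HeatSys.timeAvg_hasDerivAt hb.aesm (fun t ht => (hK t ht).1) h.sys.v_cont h.sys.w_cont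
    (fun x t ht => ⟨(hC x t ht).1, (hC x t ht).2.1⟩) h.sys.deriv x

lemma avg_hasDerivAt (h : PrecipSys α β u w F q) (hb : TimeBump t₀ t₁ χ χ') {x : ℝ}
    (hx : |x| < α * Real.sqrt t₀) : HasDerivAt (timeAvg t₁ χ u) (timeAvg t₁ χ w x) x := by
  refine ((h.v_avg_hasDerivAt hb x).add_const (PsiP α β α)).congr_of_eventuallyEq ?_
  filter_upwards [(isOpen_lt continuous_abs continuous_const).mem_nhds hx] with y hy
  exact h.avg_eq hb (le_of_lt hy)

lemma flux_continuous (h : PrecipSys α β u w F q) (hb : TimeBump t₀ t₁ χ χ') :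
    Continuous (timeAvg t₁ χ w) := by
  obtain ⟨C, hC⟩ := h.sys.bdd t₁
  obtain ⟨K, hK⟩ := hb.exists_bound
  exact HeatSys.timeAvg_continuous hb.aesm (fun t ht => (hK t ht).1) h.sys.w_cont
    (fun x t ht => (hC x t ht).2.1)

lemma flux_zero (h : PrecipSys α β u w F q) (hb : TimeBump t₀ t₁ χ χ') : timeAvg t₁ χ w 0 = 0 := by
  have h0 : |(0:ℝ)| < α * Real.sqrt t₀ := by
    rw [abs_zero]; exact mul_pos h.hα (Real.sqrt_pos.2 hb.pos)
  have h1 := h.avg_hasDerivAt hb h0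
  have h2 : HasDerivAt (fun x => timeAvg t₁ χ u (-x)) (-timeAvg t₁ χ w 0) 0 := by
    have h3 : HasDerivAt (timeAvg t₁ χ u) (timeAvg t₁ χ w 0) (-0) := by rw [neg_zero]; exact h1
    exact (h3.comp (0:ℝ) (hasDerivAt_neg 0)).congr_deriv (by ring)
  simp only [h.avg_even] at h2
  have := h1.unique h2
  linarith

lemma vdot_continuous (h : PrecipSys α β u w F q) (hb : TimeBump t₀ t₁ χ χ') :
    Continuous (timeAvg t₁ χ' fun x t => u x t - psi α β x t) := by
  obtain ⟨C, hC⟩ := h.sys.bdd t₁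
  obtain ⟨K, hK⟩ := hb.exists_bound
  exact HeatSys.timeAvg_continuous hb.aesm' (fun t ht => (hK t ht).2) h.sys.v_cont
    (fun x t ht => (hC x t ht).1)

lemma avg_continuous (h : PrecipSys α β u w F q) (hb : TimeBump t₀ t₁ χ χ') :
    Continuous fun x => timeAvg t₁ χ u x := by
  refine continuous_of_dominated (bound := fun t => |χ t| * PsiP α β α) (fun x => ?_) (fun x => ?_) ?_ ?_
  · exact (h.avg_integrable hb.integrableOn x).aestronglyMeasurable
  · refine Eventually.of_forall fun t => ?_
    rw [norm_mul]
    exact mul_le_mul_of_nonneg_left (h.u_abs_le x t) (norm_nonneg _)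
  · exact hb.integrableOn.norm.mul_const _
  · exact Eventually.of_forall fun t => continuous_const.mul (h.u_slice_continuous t)

lemma vdot_le (h : PrecipSys α β u w F q) (hb : TimeBump t₀ t₁ χ χ') (x : ℝ) :
    |timeAvg t₁ χ' (fun x t => u x t - psi α β x t) x| ≤ PsiP α β α * ∫ t in Ioc 0 t₁, |χ' t| := by
  rw [← integral_const_mul]
  refine norm_integral_le_of_norm_le (f := fun t => χ' t * (u x t - psi α β x t))
    (hb.integrableOn'.norm.const_mul _) (Eventually.of_forall fun t => ?_)
  rw [norm_mul, mul_comm]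
  exact mul_le_mul_of_nonneg_right (h.v_abs_le x t) (norm_nonneg _)

lemma q_avg_intervalIntegrable (h : PrecipSys α β u w F q) (hb : TimeBump t₀ t₁ χ χ') (a b : ℝ) :
    IntervalIntegrable (fun x => q x * timeAvg t₁ χ u x) volume a b := by
  obtain ⟨B, hB⟩ := h.q_bdd
  have hi := intervalIntegrable_iff.1 ((h.avg_continuous hb).intervalIntegrable (μ := volume) a b)
  refine intervalIntegrable_iff.2 (hi.bdd_mul (c := B) h.q_meas.aestronglyMeasurable ?_)
  exact Eventually.of_forall fun x => by
    rw [Real.norm_eq_abs, abs_of_nonneg (h.q_nonneg x)]; exact hB x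

/-- Flux balance inside the parabola. -/
lemma flux_sub (h : PrecipSys α β u w F q) (hb : TimeBump t₀ t₁ χ χ') {x₁ x₂ : ℝ} (h12 : x₁ ≤ x₂)
    (h1 : -(α * Real.sqrt t₀) < x₁) (h2 : x₂ < α * Real.sqrt t₀) :
    timeAvg t₁ χ w x₂ - timeAvg t₁ χ w x₁
      = ∫ x in x₁..x₂, (q x * timeAvg t₁ χ u x
          - timeAvg t₁ χ' (fun x t => u x t - psi α β x t) x) := by
  refine (h.sys.flux_balance hb.pos₁ hb.deriv hb.cont hb.end_zero h12).trans ?_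
  refine intervalIntegral.integral_congr_ae ?_
  filter_upwards [h.F_eq] with x hx hm
  rw [uIoc_of_le h12] at hm
  have hx2 : |x| < α * Real.sqrt t₀ := abs_lt.2 ⟨by linarith [hm.1], by linarith [hm.2]⟩
  congr 1
  unfold timeAvg
  rw [← integral_const_mul]
  refine setIntegral_congr_fun measurableSet_Ioc fun t _ => ?_
  by_cases ht : t ∈ Ioo t₀ t₁
  · rw [hx t ?_]
    · ring
    · rw [div_lt_iff₀ (pow_pos h.hα 2), ← sq_abs]
      calc |x| ^ 2 < (α * Real.sqrt t₀) ^ 2 := by gcongr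
        _ = t₀ * α ^ 2 := by rw [mul_pow, Real.sq_sqrt hb.pos.le]; ring
        _ ≤ t * α ^ 2 := by have := ht.1; gcongr
  · simp only [hb.zero t ht, zero_mul, mul_zero]

/-- Constants controlling fluxes on `[0, r]`. -/
def fluxBound (α β t₀ t₁ : ℝ) (χ' : ℝ → ℝ) (r : ℝ) : ℝ :=
  2 * PsiP α β α / (α * Real.sqrt t₀ - r)
    + PsiP α β α * (∫ t in Ioc 0 t₁, |χ' t|) * (α * Real.sqrt t₀)

lemma vdot_const_nonneg (h : PrecipSys α β u w F q) : 0 ≤ PsiP α β α * ∫ t in Ioc 0 t₁, |χ' t| :=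
  mul_nonneg (PsiP_pos h.hα h.hβ α).le (setIntegral_nonneg measurableSet_Ioc fun _ _ => abs_nonneg _)

lemma flux_sub_ge (h : PrecipSys α β u w F q) (hb : TimeBump t₀ t₁ χ χ') {x₁ x₂ : ℝ} (h12 : x₁ ≤ x₂)
    (h1 : 0 ≤ x₁) (h2 : x₂ < α * Real.sqrt t₀) :
    -(PsiP α β α * (∫ t in Ioc 0 t₁, |χ' t|) * (x₂ - x₁)) ≤ timeAvg t₁ χ w x₂ - timeAvg t₁ χ w x₁ := by
  rw [h.flux_sub hb h12 (by linarith) h2]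
  set B := PsiP α β α * ∫ t in Ioc 0 t₁, |χ' t| with hB
  calc -(B * (x₂ - x₁)) = ∫ x in x₁..x₂, -B := by
        rw [intervalIntegral.integral_const, smul_eq_mul]; ring
    _ ≤ _ := by
        refine intervalIntegral.integral_mono_on h12 (by simp)
          ((h.q_avg_intervalIntegrable hb _ _).sub ((h.vdot_continuous hb).intervalIntegrable _ _))
          fun x _ => ?_
        have := (abs_le.1 (h.vdot_le hb x)).2
        have := mul_nonneg (h.q_nonneg x) (h.avg_nonneg hb x)
        linarith

lemma flux_abs_le (h : PrecipSys α β u w F q) (hb : TimeBump t₀ t₁ χ χ') {r x : ℝ}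
    (hr : r < α * Real.sqrt t₀) (h0 : 0 ≤ x) (hx : x ≤ r) :
    |timeAvg t₁ χ w x| ≤ fluxBound α β t₀ t₁ χ' r := by
  set r₀ := α * Real.sqrt t₀ with hr0
  set B := PsiP α β α * ∫ t in Ioc 0 t₁, |χ' t| with hB
  have hB0 : 0 ≤ B := h.vdot_const_nonneg
  have hΨ := PsiP_pos h.hα h.hβ α
  have hfb : fluxBound α β t₀ t₁ χ' r = 2 * PsiP α β α / (r₀ - r) + B * r₀ := rfl
  have hlow := h.flux_sub_ge hb h0 le_rfl (by linarith)
  rw [h.flux_zero hb, sub_zero, sub_zero] at hlow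
  have hpos : 0 ≤ 2 * PsiP α β α / (r₀ - r) := div_nonneg (by linarith) (by linarith)
  rw [hfb, abs_le]
  refine ⟨by nlinarith, ?_⟩
  set r' := (r + r₀) / 2 with hr'
  have hxr : x < r' := by rw [hr']; linarith
  obtain ⟨c, hc, hce⟩ := exists_hasDerivAt_eq_slope (timeAvg t₁ χ u) (timeAvg t₁ χ w) hxr
    (h.avg_continuous hb).continuousOn fun y hy => h.avg_hasDerivAt hb (abs_lt.2
      ⟨by linarith [hy.1], by linarith [hy.2]⟩)
  have h3 := h.flux_sub_ge hb hc.1.le h0 (by linarith [hc.2])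
  have h4 : timeAvg t₁ χ w c ≤ 2 * PsiP α β α / (r₀ - r) := by
    rw [hce, div_le_div_iff₀ (by linarith) (by linarith)]
    have a1 := h.avg_le hb r'
    have a2 := h.avg_nonneg hb x
    have : (timeAvg t₁ χ u r' - timeAvg t₁ χ u x) * (r₀ - r) ≤ PsiP α β α * (r₀ - r) :=
      mul_le_mul_of_nonneg_right (by linarith) (by linarith)
    have : r₀ - r ≤ 2 * (r' - x) := by linarith
    nlinarith
  have h5 : B * (c - x) ≤ B * r₀ := mul_le_mul_of_nonneg_left (by linarith [hc.2]) hB0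
  linarith

lemma avg_lipschitz (h : PrecipSys α β u w F q) (hb : TimeBump t₀ t₁ χ χ') {r x y : ℝ}
    (hr : r < α * Real.sqrt t₀) (hx : x ∈ Icc 0 r) (hy : y ∈ Icc 0 r) :
    |timeAvg t₁ χ u x - timeAvg t₁ χ u y| ≤ fluxBound α β t₀ t₁ χ' r * |x - y| := by
  refine (convex_Icc (0:ℝ) r).norm_image_sub_le_of_norm_hasDerivWithin_le
    (fun z hz => (h.avg_hasDerivAt hb (abs_lt.2 ⟨?_, ?_⟩)).hasDerivWithinAt)
    (fun z hz => h.flux_abs_le hb hr hz.1 hz.2) hy hx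
  · have := mul_pos h.hα (Real.sqrt_pos.2 hb.pos); linarith [hz.1]
  · linarith [hz.2]

lemma q_avg_integral_le (h : PrecipSys α β u w F q) (hb : TimeBump t₀ t₁ χ χ') {r x₁ x₂ : ℝ}
    (hr : r < α * Real.sqrt t₀) (h1 : 0 ≤ x₁) (h12 : x₁ ≤ x₂) (h2 : x₂ ≤ r) :
    ∫ x in x₁..x₂, q x * timeAvg t₁ χ u x ≤ 3 * fluxBound α β t₀ t₁ χ' r := by
  have hf := h.flux_sub hb h12 (by linarith) (by linarith)
  have hvi := (h.vdot_continuous hb).intervalIntegrable (μ := volume) x₁ x₂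
  rw [intervalIntegral.integral_sub (h.q_avg_intervalIntegrable hb _ _) hvi] at hf
  have b1 := (abs_le.1 (h.flux_abs_le hb hr h1 (h12.trans h2))).1
  have b2 := (abs_le.1 (h.flux_abs_le hb hr (h1.trans h12) h2)).2
  set B := PsiP α β α * ∫ t in Ioc 0 t₁, |χ' t| with hB
  have hB0 : 0 ≤ B := h.vdot_const_nonneg
  have hΨ := PsiP_pos h.hα h.hβ α
  have hfb : fluxBound α β t₀ t₁ χ' r = 2 * PsiP α β α / (α * Real.sqrt t₀ - r) + B * (α * Real.sqrt t₀) := rfl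
  have hpos : 0 ≤ 2 * PsiP α β α / (α * Real.sqrt t₀ - r) := div_nonneg (by linarith) (by linarith)
  have b3 : ∫ x in x₁..x₂, timeAvg t₁ χ' (fun x t => u x t - psi α β x t) x ≤ B * (x₂ - x₁) := by
    calc _ ≤ ∫ x in x₁..x₂, B := intervalIntegral.integral_mono_on h12 hvi (by simp)
          fun x _ => (abs_le.1 (h.vdot_le hb x)).2
      _ = _ := by rw [intervalIntegral.integral_const, smul_eq_mul]; ring
  have b4 : B * (x₂ - x₁) ≤ B * (α * Real.sqrt t₀) := mul_le_mul_of_nonneg_left (by linarith) hB0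
  linarith

end PrecipSys

/-- A normalised solution whose parabolic rescalings converge almost everywhere to `V`. -/
structure LimSol (α β ustar : ℝ) (u p w : ℝ → ℝ → ℝ) (ps V : ℝ → ℝ) : Prop
    extends NormalSol α β ustar u p w ps where
  V_meas : Measurable V
  V_nonneg : ∀ η, 0 ≤ V η
  V_le : ∀ η, V η ≤ PsiP α β |η|
  V_even : ∀ η, V (-η) = V η
  lim : ∀ᵐ η, Tendsto (fun l => u (l * η) (l ^ 2)) atTop (𝓝 (V η))

lemma PsiP_measurable {α β : ℝ} : Measurable (PsiP α β) := PsiP_continuous.measurable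

lemma NormalSol.exists_limSol {α β ustar : ℝ} {u p w : ℝ → ℝ → ℝ} {ps V₀ : ℝ → ℝ}
    (h : NormalSol α β ustar u p w ps)
    (hV : ∀ᵐ η ∂(volume.restrict (Ici (0:ℝ))), Tendsto (fun t => u (η * Real.sqrt t) t) atTop (𝓝 (V₀ η))) :
    ∃ V, LimSol α β ustar u p w ps V ∧ ∀ᵐ η ∂(volume.restrict (Ici (0:ℝ))), V η = V₀ η := by
  set V : ℝ → ℝ := fun η =>
    max 0 (min (PsiP α β |η|) (limsup (fun n : ℕ => u (n * η) ((n:ℝ) ^ 2)) atTop)) with hVd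
  have hm : Measurable V := by
    refine measurable_const.max ((PsiP_measurable.comp measurable_abs).min (Measurable.limsup fun n => ?_))
    exact h.u_measurable.comp (by fun_prop : Measurable fun η : ℝ => ((n:ℝ) * η, (n:ℝ) ^ 2))
  have key : ∀ η, 0 ≤ η → Tendsto (fun t => u (η * Real.sqrt t) t) atTop (𝓝 (V₀ η)) →
      V η = V₀ η ∧ Tendsto (fun l => u (l * η) (l ^ 2)) atTop (𝓝 (V η)) := by
    intro η hη ht
    have h1 : Tendsto (fun l => u (l * η) (l ^ 2)) atTop (𝓝 (V₀ η)) := by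
      refine (ht.comp (tendsto_pow_atTop (two_ne_zero))).congr' ?_
      filter_upwards [eventually_ge_atTop (0:ℝ)] with l hl
      simp only [Function.comp_apply]
      rw [Real.sqrt_sq hl, mul_comm]
    have h2 : Tendsto (fun n : ℕ => u (n * η) ((n:ℝ) ^ 2)) atTop (𝓝 (V₀ η)) :=
      h1.comp tendsto_natCast_atTop_atTop
    have h3 : 0 ≤ V₀ η := ge_of_tendsto' h1 fun l => h.u_nonneg _ _
    have h4 : V₀ η ≤ PsiP α β |η| := by
      refine le_of_tendsto h1 ?_
      filter_upwards [eventually_gt_atTop (0:ℝ)] with l hl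
      refine (h.u_le _ _).trans (le_of_eq ?_)
      rw [psi_eq (by positivity), Real.sqrt_sq hl.le, abs_mul, abs_of_pos hl, mul_div_cancel_left₀ _ hl.ne']
    have h5 : V η = V₀ η := by
      simp only [hVd]
      rw [h2.limsup_eq, min_eq_right h4, max_eq_right h3]
    exact ⟨h5, by rw [h5]; exact h1⟩
  have heven : ∀ η, V (-η) = V η := by
    intro η
    simp only [hVd, abs_neg, mul_neg, h.u_even]
  refine ⟨V, ⟨h, hm, fun η => le_max_left _ _, fun η => max_le (PsiP_pos h.hα h.hβ _).le (min_le_left _ _),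
    heven, ?_⟩, ?_⟩
  · have h1 : ∀ᵐ x ∂(volume.restrict (Ioi (0:ℝ))), Tendsto (fun l => u (l * x) (l ^ 2)) atTop (𝓝 (V x)) := by
      have := ae_mono (Measure.restrict_mono Ioi_subset_Ici_self le_rfl) hV
      filter_upwards [this, ae_restrict_mem measurableSet_Ioi] with x hx hx0
      exact (key x (le_of_lt hx0) hx).2
    filter_upwards [ae_abs h1] with x hx
    have e1 : V |x| = V x := apply_abs_of_even heven x
    rw [e1] at hx
    refine hx.congr fun l => ?_
    rcases abs_choice x with h2 | h2 <;> rw [h2]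
    rw [mul_neg, h.u_even]
  · filter_upwards [hV, ae_restrict_mem measurableSet_Ici] with x hx hx0
    exact (key x hx0 hx).1

/-- Null sets are transported by `t ↦ x / √t`. -/
lemma ae_div_sqrt {P : ℝ → Prop} (h : ∀ᵐ η, P η) {x : ℝ} (hx : 0 < x) :
    ∀ᵐ t ∂(volume.restrict (Ioi (0:ℝ))), P (x / Real.sqrt t) := by
  rw [ae_restrict_iff' measurableSet_Ioi, ae_iff]
  have h0 : volume ({η | ¬ P η} ∩ Ioi 0) = 0 := measure_mono_null inter_subset_left (ae_iff.1 h)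
  have hd : DifferentiableOn ℝ (fun y : ℝ => x ^ 2 / y ^ 2) ({η | ¬ P η} ∩ Ioi 0) := by
    intro y hy
    have : y ≠ 0 := ne_of_gt hy.2
    have h1 : DifferentiableAt ℝ (fun y : ℝ => y ^ 2) y := by fun_prop
    exact ((differentiableAt_const (x ^ 2)).div h1 (pow_ne_zero 2 this)).differentiableWithinAt
  refine measure_mono_null ?_
    (addHaar_image_eq_zero_of_differentiableOn_of_addHaar_eq_zero volume hd h0)
  intro t ht
  simp only [mem_ofPred_eq, Classical.not_imp, mem_Ioi] at ht
  have hs := Real.sqrt_pos.2 ht.1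
  refine ⟨x / Real.sqrt t, ⟨ht.2, div_pos hx hs⟩, ?_⟩
  simp only
  rw [div_pow, Real.sq_sqrt ht.1.le]
  field_simp

namespace LimSol
variable {α β ustar : ℝ} {u p w : ℝ → ℝ → ℝ} {ps V : ℝ → ℝ}

lemma V_le_const (h : LimSol α β ustar u p w ps V) (η : ℝ) : V η ≤ PsiP α β α :=
  (h.V_le η).trans (PsiP_le h.hα h.hβ _)

lemma V_abs_le (h : LimSol α β ustar u p w ps V) (η : ℝ) : |V η| ≤ PsiP α β α := by
  rw [abs_of_nonneg (h.V_nonneg η)]; exact h.V_le_const η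

/-- Convergence at other times follows by rescaling. -/
lemma tendsto_of_good {y s : ℝ} (hs : 0 < s)
    (hg : Tendsto (fun l => u (l * (y / Real.sqrt s)) (l ^ 2)) atTop (𝓝 (V (y / Real.sqrt s)))) :
    Tendsto (fun l => u (l * y) (l ^ 2 * s)) atTop (𝓝 (V (y / Real.sqrt s))) := by
  have hq := Real.sqrt_pos.2 hs
  refine (hg.comp (tendsto_id.atTop_mul_const hq)).congr fun l => ?_
  simp only [Function.comp_apply, id]
  rw [mul_pow, Real.sq_sqrt hs.le]
  congr 1
  field_simp

lemma tendsto_slice (h : LimSol α β ustar u p w ps V) {s : ℝ} (hs : 0 < s) :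
    ∀ᵐ y, Tendsto (fun l => u (l * y) (l ^ 2 * s)) atTop (𝓝 (V (y / Real.sqrt s))) := by
  have := ae_mul_left h.lim (inv_ne_zero (Real.sqrt_pos.2 hs).ne')
  filter_upwards [this] with y hy
  rw [inv_mul_eq_div] at hy
  exact tendsto_of_good hs hy

lemma avg_tendsto (h : LimSol α β ustar u p w ps V) {T : ℝ} {k : ℝ → ℝ} (hk : IntegrableOn k (Ioc 0 T)) {x : ℝ}
    (hx : 0 < x) : Tendsto (fun l => timeAvg T k (fun x t => u (l * x) (l ^ 2 * t)) x) atTop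
      (𝓝 (∫ t in Ioc 0 T, k t * V (x / Real.sqrt t))) := by
  refine tendsto_integral_filter_of_dominated_convergence (fun t => |k t| * PsiP α β α) ?_ ?_
    (hk.norm.mul_const _) ?_
  · filter_upwards [eventually_gt_atTop (0:ℝ)] with l hl
    exact ((h.toPrecipSys.scale hl).avg_integrable hk x).aestronglyMeasurable
  · filter_upwards with l
    filter_upwards with t
    rw [norm_mul]
    exact mul_le_mul_of_nonneg_left (h.u_abs_le _ _) (norm_nonneg _)
  · have := ae_mono (Measure.restrict_mono (Ioc_subset_Ioi_self : Ioc 0 T ⊆ Ioi 0) le_rfl) (ae_div_sqrt h.lim hx)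
    filter_upwards [this, ae_restrict_mem measurableSet_Ioc] with t ht h0
    exact (tendsto_of_good h0.1 ht).const_mul _

/-- Behind a region where `u` stays below threshold there is no precipitate. -/
lemma p_eventually_zero (h : LimSol α β ustar u p w ps V) {a ε Λ : ℝ} (ha : 0 < a) (hε : 0 < ε)
    (hlt : ∀ l ≥ Λ, ∀ η ≥ a, u (l * η) (l ^ 2) ≤ ustar - ε) :
    ∃ X > 0, ∀ x ≥ X, ∀ t ≤ x ^ 2 / a ^ 2, p x t = 0 := by
  set M := max Λ 1 with hM
  have hM0 : 0 < M := lt_of_lt_of_le one_pos (le_max_right _ _)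
  obtain ⟨X, hX⟩ := eventually_atTop.1
    ((PsiP_tendsto (α := α) (β := β)).eventually (gt_mem_nhds (half_pos h.hu)))
  refine ⟨max 1 (M * max X 0), lt_of_lt_of_le one_pos (le_max_left _ _), fun x hx t ht => ?_⟩
  have hx0 : 0 < x := lt_of_lt_of_le one_pos ((le_max_left _ _).trans hx)
  refine h.p_zero x t ⟨min ε (ustar / 2), lt_min hε (half_pos h.hu), fun s hs => ?_⟩
  have hsq := Real.sqrt_pos.2 hs.1
  by_cases hsM : M ≤ Real.sqrt s
  · have := hlt (Real.sqrt s) ((le_max_left _ _).trans hsM) (x / Real.sqrt s) ?_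
    · rw [mul_div_cancel₀ _ hsq.ne', Real.sq_sqrt hs.1.le] at this
      linarith [min_le_left ε (ustar / 2)]
    · rw [ge_iff_le, le_div_iff₀ hsq]
      have h1 : Real.sqrt s ≤ x / a := by
        rw [Real.sqrt_le_left (by positivity), div_pow]; exact hs.2.trans ht
      calc a * Real.sqrt s ≤ a * (x / a) := by gcongr
        _ = x := by field_simp
  · have h1 : X ≤ x / Real.sqrt s := by
      rw [le_div_iff₀ hsq]
      calc X * Real.sqrt s ≤ max X 0 * Real.sqrt s := by gcongr; exact le_max_left _ _
        _ ≤ max X 0 * M := by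
            have := le_max_right X 0
            gcongr; exact (not_le.1 hsM).le
        _ ≤ x := by rw [mul_comm]; exact (le_max_right _ _).trans hx
    have h2 := h.u_le x s
    rw [psi_eq hs.1, abs_of_pos hx0] at h2
    linarith [hX _ h1, min_le_right ε (ustar / 2)]

lemma ps_eventually_zero (h : LimSol α β ustar u p w ps V) {a ε Λ : ℝ} (ha : 0 < a) (haα : a < α) (hε : 0 < ε)
    (hlt : ∀ l ≥ Λ, ∀ η ≥ a, u (l * η) (l ^ 2) ≤ ustar - ε) :
    ∃ X > 0, ∀ᵐ x, X ≤ x → ps x = 0 := by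
  obtain ⟨X, hX0, hX⟩ := h.p_eventually_zero ha hε hlt
  refine ⟨X, hX0, ?_⟩
  filter_upwards [h.p_eq] with x hx hxX
  have hx0 : 0 < x := hX0.trans_le hxX
  rw [← hx (x ^ 2 / a ^ 2) (by gcongr)]
  exact hX x hxX _ le_rfl

/-- Precipitation is complete near the origin. -/
lemma ps_near_zero (h : LimSol α β ustar u p w ps V) : ∃ r > 0, ∀ᵐ x, x ∈ Ioo 0 r → ps x = 1 := by
  obtain ⟨C, hC0, hC⟩ := h.toPrecipSys.F_bdd 1
  set d := PsiP α β α - ustar with hd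
  have hd0 : 0 < d := sub_pos.2 h.hsub
  have hα := h.hα
  set s₀ := min 1 (d / (2 * (C + 1))) with hs0
  have hs0' : 0 < s₀ := lt_min one_pos (by positivity)
  refine ⟨α * Real.sqrt s₀, mul_pos hα (Real.sqrt_pos.2 hs0'), ?_⟩
  filter_upwards [h.p_eq] with x hx hxr
  have hx0 := hxr.1
  set s := x ^ 2 / α ^ 2 with hs
  have hsp : 0 < s := by positivity
  have hss : s ≤ s₀ := by
    rw [hs, div_le_iff₀ (by positivity)]
    calc x ^ 2 ≤ (α * Real.sqrt s₀) ^ 2 := by have := hxr.2; gcongr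
      _ = _ := by rw [mul_pow, Real.sq_sqrt hs0'.le]; ring
  have h1 := h.sys.abs_le_mul_time hC x hsp (hss.trans (min_le_left _ _))
  have h2 : C * s ≤ d / 2 := by
    have : s ≤ d / (2 * (C + 1)) := hss.trans (min_le_right _ _)
    rw [le_div_iff₀ (by positivity)] at this
    nlinarith
  have h3 : psi α β x s = PsiP α β α := by
    rw [psi_eq hsp, PsiP_of_le]
    rw [abs_of_pos hx0, hs, Real.sqrt_div (by positivity), Real.sqrt_sq hx0.le, Real.sqrt_sq hα.le]
    field_simp
    exact le_rfl
  have h4 : ustar < u x s := by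
    have := (abs_le.1 h1).1
    rw [h3] at this
    linarith
  rw [← hx (s + 1) (by linarith)]
  exact h.p_one x s _ hsp (by linarith) h4

end LimSol

/-- Similarity averages of the solution, of the (weighted) flux, of the source and the error. -/
def simS (T : ℝ) (χ : ℝ → ℝ) (v : ℝ → ℝ → ℝ) (x : ℝ) : ℝ := ∫ t in Ioc 0 T, χ t * v (x * Real.sqrt t) t

def simE (T : ℝ) (χ : ℝ → ℝ) (w : ℝ → ℝ → ℝ) (x : ℝ) : ℝ :=
  Real.exp (x ^ 2 / 4) * ∫ t in Ioc 0 T, t * χ t / Real.sqrt t * w (x * Real.sqrt t) t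

def simN (T : ℝ) (χ : ℝ → ℝ) (F : ℝ → ℝ → ℝ) (x : ℝ) : ℝ := ∫ t in Ioc 0 T, t * χ t * F (x * Real.sqrt t) t

def simR (T : ℝ) (χ χ' : ℝ → ℝ) (v : ℝ → ℝ → ℝ) (x : ℝ) : ℝ :=
  ∫ t in Ioc 0 T, (χ t + t * χ' t) * v (x * Real.sqrt t) t

lemma TimeBump.integral_weight {t₀ t₁ : ℝ} {χ χ' : ℝ → ℝ} (hb : TimeBump t₀ t₁ χ χ') :
    ∫ t in Ioc 0 t₁, (χ t + t * χ' t) = 0 := by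
  have hd : ∀ t, HasDerivAt (fun t => t * χ t) (χ t + t * χ' t) t := fun t =>
    ((hasDerivAt_id t).mul (hb.deriv t)).congr_deriv (by simp)
  have hc : Continuous fun t => χ t + t * χ' t := hb.continuous.add (continuous_id.mul hb.cont)
  rw [← intervalIntegral.integral_of_le hb.pos₁.le, intervalIntegral.integral_eq_sub_of_hasDerivAt
    (fun t _ => hd t) (hc.intervalIntegrable _ _), hb.end_zero]
  ring

lemma TimeBump.weight_integrableOn {t₀ t₁ : ℝ} {χ χ' : ℝ → ℝ} (hb : TimeBump t₀ t₁ χ χ') :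
    IntegrableOn (fun t => χ t + t * χ' t) (Ioc 0 t₁) := by
  have hc : Continuous fun t => χ t + t * χ' t := hb.continuous.add (continuous_id.mul hb.cont)
  exact (hc.integrableOn_Icc (a := 0) (b := t₁)).mono_set Ioc_subset_Icc_self

namespace PrecipSys
variable {α β : ℝ} {u w F : ℝ → ℝ → ℝ} {q : ℝ → ℝ} {t₀ t₁ : ℝ} {χ χ' : ℝ → ℝ}

lemma simS_hasDerivAt (h : PrecipSys α β u w F q) (hb : TimeBump t₀ t₁ χ χ') (x : ℝ) :
    HasDerivAt (simS t₁ χ fun x t => u x t - psi α β x t)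
      (Real.exp (-x ^ 2 / 4) * simE t₁ χ w x) x := by
  have := h.sys.similarityAvg_hasDerivAt hb.pos hb.lt (ϑ := fun t => t * χ t)
    (continuous_id.mul hb.continuous) (fun t ht => by
      simp only [hb.zero t fun h => not_lt_of_ge ht h.1, mul_zero]) x
  refine (this.congr_of_eventuallyEq (Eventually.of_forall fun y => ?_)).congr_deriv ?_
  · refine setIntegral_congr_fun measurableSet_Ioc fun t ht => ?_
    have : t ≠ 0 := ht.1.ne'
    simp only
    rw [mul_div_cancel_left₀ _ this]
  · unfold simE
    rw [← mul_assoc, ← Real.exp_add, neg_div, neg_add_cancel, Real.exp_zero, one_mul]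

lemma simE_sub (h : PrecipSys α β u w F q) (hb : TimeBump t₀ t₁ χ χ') {a b : ℝ} (hab : a ≤ b) :
    simE t₁ χ w b - simE t₁ χ w a = ∫ x in a..b, Real.exp (x ^ 2 / 4) *
      (simN t₁ χ F x - simR t₁ χ χ' (fun x t => u x t - psi α β x t) x) := by
  have hd : ∀ t, HasDerivAt (fun t => t * χ t) (χ t + t * χ' t) t := fun t =>
    ((hasDerivAt_id t).mul (hb.deriv t)).congr_deriv (by simp)
  exact h.sys.similarity_balance hb.pos hb.lt hd (hb.continuous.add (continuous_id.mul hb.cont))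
    (fun t ht => by simp only [hb.zero t fun h => not_lt_of_ge ht h.1, mul_zero])
    (by simp only [hb.end_zero, mul_zero]) hab

lemma simN_nonneg (h : PrecipSys α β u w F q) (hb : TimeBump t₀ t₁ χ χ') (x : ℝ) : 0 ≤ simN t₁ χ F x :=
  setIntegral_nonneg measurableSet_Ioc fun t ht =>
    mul_nonneg (mul_nonneg ht.1.le (hb.nonneg t)) (h.F_nonneg _ _)

lemma simN_measurable (h : PrecipSys α β u w F q) (hb : TimeBump t₀ t₁ χ χ') : Measurable (simN t₁ χ F) := by
  have hm : Measurable fun z : ℝ × ℝ => z.2 * χ z.2 * F (z.1 * Real.sqrt z.2) z.2 := by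
    have := hb.continuous.measurable
    refine Measurable.mul (by fun_prop) ?_
    exact h.sys.F_meas.comp (by fun_prop : Measurable fun z : ℝ × ℝ => (z.1 * Real.sqrt z.2, z.2))
  exact (hm.stronglyMeasurable.integral_prod_right' (ν := volume.restrict (Ioc 0 t₁))).measurable

lemma simN_bdd (h : PrecipSys α β u w F q) (hb : TimeBump t₀ t₁ χ χ') : ∃ C, ∀ x, |simN t₁ χ F x| ≤ C := by
  obtain ⟨C, hC0, hC⟩ := h.F_bdd t₁
  obtain ⟨K, hK⟩ := hb.exists_bound
  refine ⟨t₁ * K * C * (volume (Ioc 0 t₁)).toReal, fun x =>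
    norm_setIntegral_le_of_norm_le_const (f := fun t => t * χ t * F (x * Real.sqrt t) t)
      measure_Ioc_lt_top fun t ht => ?_⟩
  rw [norm_mul, norm_mul, Real.norm_eq_abs t, abs_of_pos ht.1]
  have h1 := (hK t ht).1
  have h2 := hC (x * Real.sqrt t) t ht.2
  have h3 := ht.1.le
  have h4 := ht.2
  have h5 := hb.pos₁.le
  have h6 : 0 ≤ t₁ * K := mul_nonneg h5 ((abs_nonneg _).trans h1)
  simp only [Real.norm_eq_abs]
  gcongr

lemma exp_simN_intervalIntegrable (h : PrecipSys α β u w F q) (hb : TimeBump t₀ t₁ χ χ') (a b : ℝ) :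
    IntervalIntegrable (fun x => Real.exp (x ^ 2 / 4) * simN t₁ χ F x) volume a b := by
  obtain ⟨C, hC⟩ := h.simN_bdd hb
  have hc : Continuous fun x : ℝ => Real.exp (x ^ 2 / 4) := by fun_prop
  have hi := intervalIntegrable_iff.1 (hc.intervalIntegrable (μ := volume) a b)
  exact intervalIntegrable_iff.2 (hi.mul_bdd (c := C) (h.simN_measurable hb).aestronglyMeasurable
    (Eventually.of_forall hC))

lemma simR_continuous (h : PrecipSys α β u w F q) (hb : TimeBump t₀ t₁ χ χ') :
    Continuous (simR t₁ χ χ' fun x t => u x t - psi α β x t) := by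
  refine continuous_of_dominated (bound := fun t => |χ t + t * χ' t| * PsiP α β α) (fun x => ?_)
    (fun x => Eventually.of_forall fun t => ?_) (hb.weight_integrableOn.norm.mul_const _)
    (Eventually.of_forall fun t => ?_)
  · refine AEStronglyMeasurable.mul hb.weight_integrableOn.aestronglyMeasurable ?_
    exact (h.sys.v_cont.comp (by fun_prop : Continuous fun t : ℝ => (x * Real.sqrt t, t))).aestronglyMeasurable
  · rw [norm_mul]
    exact mul_le_mul_of_nonneg_left (h.v_abs_le _ _) (norm_nonneg _)
  · exact continuous_const.mul
      (h.sys.v_cont.comp (by fun_prop : Continuous fun x : ℝ => (x * Real.sqrt t, t)))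

lemma simR_abs_le (h : PrecipSys α β u w F q) (hb : TimeBump t₀ t₁ χ χ') (x : ℝ) :
    |simR t₁ χ χ' (fun x t => u x t - psi α β x t) x| ≤ ∫ t in Ioc 0 t₁, |χ t + t * χ' t| * PsiP α β α := by
  refine norm_integral_le_of_norm_le
    (f := fun t => (χ t + t * χ' t) * (u (x * Real.sqrt t) t - psi α β (x * Real.sqrt t) t))
    (hb.weight_integrableOn.norm.mul_const _) (Eventually.of_forall fun t => ?_)
  rw [norm_mul]
  exact mul_le_mul_of_nonneg_left (h.v_abs_le _ _) (norm_nonneg _)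

/-- Increments of the weighted flux up to the error term. -/
lemma simE_sub_error (h : PrecipSys α β u w F q) (hb : TimeBump t₀ t₁ χ χ') {A B a b : ℝ} (hA : A ≤ a)
    (hab : a ≤ b) (hB : b ≤ B) :
    |simE t₁ χ w b - simE t₁ χ w a - ∫ x in a..b, Real.exp (x ^ 2 / 4) * simN t₁ χ F x|
      ≤ ∫ x in A..B, Real.exp (x ^ 2 / 4) * |simR t₁ χ χ' (fun x t => u x t - psi α β x t) x| := by
  have hc : Continuous fun x : ℝ => Real.exp (x ^ 2 / 4) *
      simR t₁ χ χ' (fun x t => u x t - psi α β x t) x :=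
    Continuous.mul (by fun_prop) (h.simR_continuous hb)
  have hca : Continuous fun x : ℝ => Real.exp (x ^ 2 / 4) *
      |simR t₁ χ χ' (fun x t => u x t - psi α β x t) x| :=
    Continuous.mul (by fun_prop) (h.simR_continuous hb).abs
  rw [h.simE_sub hb hab]
  simp only [mul_sub]
  rw [intervalIntegral.integral_sub (h.exp_simN_intervalIntegrable hb a b) (hc.intervalIntegrable _ _),
    sub_sub_cancel_left, abs_neg]
  refine (intervalIntegral.abs_integral_le_integral_abs hab).trans ?_
  simp only [abs_mul, abs_of_pos (Real.exp_pos _)]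
  exact intervalIntegral.integral_mono_interval hA hab hB
    (Eventually.of_forall fun x => mul_nonneg (Real.exp_pos _).le (abs_nonneg _)) (hca.intervalIntegrable _ _)

lemma simE_continuous (h : PrecipSys α β u w F q) (hb : TimeBump t₀ t₁ χ χ') : Continuous (simE t₁ χ w) := by
  have hi : ∀ a b, IntervalIntegrable (fun x => Real.exp (x ^ 2 / 4) *
      (simN t₁ χ F x - simR t₁ χ χ' (fun x t => u x t - psi α β x t) x)) volume a b := fun a b => by
    simp only [mul_sub]
    refine (h.exp_simN_intervalIntegrable hb a b).sub (Continuous.intervalIntegrable ?_ _ _)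
    exact Continuous.mul (by fun_prop) (h.simR_continuous hb)
  refine ((intervalIntegral.continuous_primitive hi 0).add (continuous_const (y := simE t₁ χ w 0))).congr
    fun x => ?_
  rw [Pi.add_apply]
  rcases le_total 0 x with hx | hx
  · rw [← h.simE_sub hb hx]; ring
  · rw [intervalIntegral.integral_symm, ← h.simE_sub hb hx]; ring

lemma simS_sub_le (h : PrecipSys α β u w F q) (hb : TimeBump t₀ t₁ χ χ') {a b e : ℝ} (hab : a ≤ b)
    (he : ∀ x ∈ Icc a b, simE t₁ χ w x ≤ e) :
    simS t₁ χ (fun x t => u x t - psi α β x t) b - simS t₁ χ (fun x t => u x t - psi α β x t) a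
      ≤ e * (gtail a - gtail b) := by
  have hd : ∀ x, HasDerivAt (fun x => simS t₁ χ (fun x t => u x t - psi α β x t) x + e * gtail x)
      (Real.exp (-x ^ 2 / 4) * simE t₁ χ w x + e * -Real.exp (-x ^ 2 / 4)) x := fun x =>
    (h.simS_hasDerivAt hb x).add ((gtail_hasDerivAt x).const_mul e)
  have := (convex_Icc a b).image_sub_le_mul_sub_of_deriv_le
    (fun x _ => (hd x).continuousAt.continuousWithinAt) (fun x _ => (hd x).differentiableAt.differentiableWithinAt)
    (C := 0) (fun x hx => by
      rw [(hd x).deriv]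
      have := he x (interior_subset hx)
      have := mul_le_mul_of_nonneg_left this (Real.exp_pos (-x ^ 2 / 4)).le
      linarith) a (left_mem_Icc.2 hab) b (right_mem_Icc.2 hab) hab
  linarith

lemma le_simS_sub (h : PrecipSys α β u w F q) (hb : TimeBump t₀ t₁ χ χ') {a b e : ℝ} (hab : a ≤ b)
    (he : ∀ x ∈ Icc a b, e ≤ simE t₁ χ w x) :
    e * (gtail a - gtail b) ≤ simS t₁ χ (fun x t => u x t - psi α β x t) b
      - simS t₁ χ (fun x t => u x t - psi α β x t) a := by
  have hd : ∀ x, HasDerivAt (fun x => simS t₁ χ (fun x t => u x t - psi α β x t) x + e * gtail x)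
      (Real.exp (-x ^ 2 / 4) * simE t₁ χ w x + e * -Real.exp (-x ^ 2 / 4)) x := fun x =>
    (h.simS_hasDerivAt hb x).add ((gtail_hasDerivAt x).const_mul e)
  have := (convex_Icc a b).mul_sub_le_image_sub_of_le_deriv
    (fun x _ => (hd x).continuousAt.continuousWithinAt) (fun x _ => (hd x).differentiableAt.differentiableWithinAt)
    (C := 0) (fun x hx => by
      rw [(hd x).deriv]
      have := he x (interior_subset hx)
      have := mul_le_mul_of_nonneg_left this (Real.exp_pos (-x ^ 2 / 4)).le
      linarith) a (left_mem_Icc.2 hab) b (right_mem_Icc.2 hab) hab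
  linarith

end PrecipSys

namespace LimSol
variable {α β ustar : ℝ} {u p w : ℝ → ℝ → ℝ} {ps V : ℝ → ℝ} {t₀ t₁ : ℝ} {χ χ' : ℝ → ℝ}

lemma sys_scale (h : LimSol α β ustar u p w ps V) {l : ℝ} (hl : 0 < l) :
    PrecipSys α β (fun x t => u (l * x) (l ^ 2 * t)) (fun x t => l * w (l * x) (l ^ 2 * t))
      (fun x t => l ^ 2 * (p (l * x) (l ^ 2 * t) * u (l * x) (l ^ 2 * t))) (fun x => l ^ 2 * ps (l * x)) :=
  h.toPrecipSys.scale hl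

/-- Similarity averages with any weight converge at good points. -/
lemma sim_tendsto (h : LimSol α β ustar u p w ps V) {k : ℝ → ℝ} {T : ℝ} (hk : IntegrableOn k (Ioc 0 T)) {x : ℝ}
    (hx : 0 < x) (hg : Tendsto (fun l => u (l * x) (l ^ 2)) atTop (𝓝 (V x))) :
    Tendsto (fun l => ∫ t in Ioc 0 T, k t * (u (l * (x * Real.sqrt t)) (l ^ 2 * t) - psi α β (x * Real.sqrt t) t))
      atTop (𝓝 ((∫ t in Ioc 0 T, k t) * (V x - PsiP α β x))) := by
  rw [← integral_mul_const]
  refine tendsto_integral_filter_of_dominated_convergence (fun t => |k t| * PsiP α β α) ?_ ?_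
    (hk.norm.mul_const _) ?_
  · filter_upwards [eventually_gt_atTop (0:ℝ)] with l hl
    refine hk.aestronglyMeasurable.mul ?_
    exact ((h.sys_scale hl).sys.v_cont.comp
      (by fun_prop : Continuous fun t : ℝ => (x * Real.sqrt t, t))).aestronglyMeasurable
  · filter_upwards [eventually_gt_atTop (0:ℝ)] with l hl
    filter_upwards with t
    rw [norm_mul]
    exact mul_le_mul_of_nonneg_left ((h.sys_scale hl).v_abs_le _ _) (norm_nonneg _)
  · filter_upwards [ae_restrict_mem measurableSet_Ioc] with t ht
    have hs := Real.sqrt_pos.2 ht.1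
    have e : x * Real.sqrt t / Real.sqrt t = x := mul_div_cancel_right₀ _ hs.ne'
    have := tendsto_of_good (u := u) (V := V) (y := x * Real.sqrt t) ht.1 (by rw [e]; exact hg)
    rw [e] at this
    have e2 : psi α β (x * Real.sqrt t) t = PsiP α β x := by
      rw [psi_eq ht.1, abs_of_pos (by positivity), e]
    rw [e2]
    exact (this.sub_const _).const_mul _

lemma simS_tendsto (h : LimSol α β ustar u p w ps V) (hb : TimeBump t₀ t₁ χ χ') {x : ℝ} (hx : 0 < x)
    (hg : Tendsto (fun l => u (l * x) (l ^ 2)) atTop (𝓝 (V x))) :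
    Tendsto (fun l => simS t₁ χ (fun x t => u (l * x) (l ^ 2 * t) - psi α β x t) x) atTop
      (𝓝 (V x - PsiP α β x)) := by
  have := h.sim_tendsto hb.integrableOn hx hg
  rwa [hb.int, one_mul] at this

lemma simR_error_tendsto (h : LimSol α β ustar u p w ps V) (hb : TimeBump t₀ t₁ χ χ') {A B : ℝ} (hA : 0 ≤ A)
    (hAB : A ≤ B) : Tendsto (fun l => ∫ x in A..B, Real.exp (x ^ 2 / 4) *
      |simR t₁ χ χ' (fun x t => u (l * x) (l ^ 2 * t) - psi α β x t) x|) atTop (𝓝 0) := by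
  have e : (0:ℝ) = ∫ x in A..B, (0:ℝ) := by simp
  conv => rhs; rw [e]
  have hc : Continuous fun x : ℝ => Real.exp (x ^ 2 / 4) := by fun_prop
  refine intervalIntegral.tendsto_integral_filter_of_dominated_convergence
    (fun x => Real.exp (x ^ 2 / 4) * ∫ t in Ioc 0 t₁, |χ t + t * χ' t| * PsiP α β α) ?_ ?_
    ((hc.mul continuous_const).intervalIntegrable _ _) ?_
  · filter_upwards [eventually_gt_atTop (0:ℝ)] with l hl
    exact (hc.mul ((h.sys_scale hl).simR_continuous hb).abs).aestronglyMeasurable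
  · filter_upwards [eventually_gt_atTop (0:ℝ)] with l hl
    refine Eventually.of_forall fun x _ => ?_
    rw [norm_mul, norm_abs_eq_norm, Real.norm_eq_abs, abs_of_pos (Real.exp_pos _)]
    exact mul_le_mul_of_nonneg_left ((h.sys_scale hl).simR_abs_le hb x) (Real.exp_pos _).le
  · filter_upwards [h.lim] with x hg hx
    rw [uIoc_of_le hAB] at hx
    have := h.sim_tendsto hb.weight_integrableOn (hA.trans_lt hx.1) hg
    rw [hb.integral_weight, zero_mul] at this
    have := (this.abs).const_mul (Real.exp (x ^ 2 / 4))
    rwa [abs_zero, mul_zero] at this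

/-- The limit of `u - ψ` is convex as a function of `∫ exp (-s²/4)`. -/
lemma slope_le (h : LimSol α β ustar u p w ps V) {a b c : ℝ} (ha : 0 < a) (hab : a < b) (hbc : b < c)
    (ga : Tendsto (fun l => u (l * a) (l ^ 2)) atTop (𝓝 (V a)))
    (gb : Tendsto (fun l => u (l * b) (l ^ 2)) atTop (𝓝 (V b)))
    (gc : Tendsto (fun l => u (l * c) (l ^ 2)) atTop (𝓝 (V c))) :
    ((V b - PsiP α β b) - (V a - PsiP α β a)) * (gtail b - gtail c)
      ≤ ((V c - PsiP α β c) - (V b - PsiP α β b)) * (gtail a - gtail b) := by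
  obtain ⟨χ, χ', hb⟩ := exists_timeBump (t₀ := 1) (t₁ := 2) one_pos (by norm_num)
  have Ta := h.simS_tendsto hb ha ga
  have Tb := h.simS_tendsto hb (ha.trans hab) gb
  have Tc := h.simS_tendsto hb (ha.trans (hab.trans hbc)) gc
  have Tr := h.simR_error_tendsto hb ha.le (hab.trans hbc).le
  have g1 : 0 < gtail a - gtail b := sub_pos.2 (gtail_strictAnti hab)
  have g2 : 0 < gtail b - gtail c := sub_pos.2 (gtail_strictAnti hbc)
  have T1 := (Tb.sub Ta).mul_const (gtail b - gtail c)
  have T2 := ((Tc.sub Tb).mul_const (gtail a - gtail b)).add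
    (Tr.mul_const (2 * (gtail a - gtail b) * (gtail b - gtail c)))
  rw [zero_mul, add_zero] at T2
  refine le_of_tendsto_of_tendsto T1 T2 ?_
  filter_upwards [eventually_gt_atTop (0:ℝ)] with l hl
  have H := h.sys_scale hl
  set E := simE 2 χ (fun x t => l * w (l * x) (l ^ 2 * t)) with hE
  set ρ := ∫ x in a..c, Real.exp (x ^ 2 / 4) *
      |simR 2 χ χ' (fun x t => u (l * x) (l ^ 2 * t) - psi α β x t) x| with hρ
  have mono : ∀ x y, a ≤ x → x ≤ y → y ≤ c → E x ≤ E y + ρ := by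
    intro x y h1 h2 h3
    have r1 := (abs_le.1 (H.simE_sub_error hb h1 h2 h3)).1
    have r2 : 0 ≤ ∫ x in x..y, Real.exp (x ^ 2 / 4) *
        simN 2 χ (fun x t => l ^ 2 * (p (l * x) (l ^ 2 * t) * u (l * x) (l ^ 2 * t))) x :=
      intervalIntegral.integral_nonneg h2 fun z _ => mul_nonneg (Real.exp_pos _).le (H.simN_nonneg hb z)
    linarith
  have q1 := H.simS_sub_le hb hab.le (e := E b + ρ) fun x hx => mono x b hx.1 hx.2 hbc.le
  have q2 := H.le_simS_sub hb hbc.le (e := E b - ρ) fun x hx => by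
    have := mono b x hab.le hx.1 hx.2; linarith
  have := mul_le_mul_of_nonneg_right q1 g2.le
  have := mul_le_mul_of_nonneg_right q2 g1.le
  linarith

/-- Where there is no source in the limit, `V - Ψ` is affine in `∫ exp (-s²/4)`. -/
lemma slope_ge (h : LimSol α β ustar u p w ps V) {a b c : ℝ} (ha : 0 < a) (hab : a < b) (hbc : b < c)
    (ga : Tendsto (fun l => u (l * a) (l ^ 2)) atTop (𝓝 (V a)))
    (gb : Tendsto (fun l => u (l * b) (l ^ 2)) atTop (𝓝 (V b)))
    (gc : Tendsto (fun l => u (l * c) (l ^ 2)) atTop (𝓝 (V c)))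
    (hp : ∃ X, ∀ x ≥ X, ∀ t ≤ x ^ 2 / a ^ 2, p x t = 0) :
    ((V c - PsiP α β c) - (V b - PsiP α β b)) * (gtail a - gtail b)
      ≤ ((V b - PsiP α β b) - (V a - PsiP α β a)) * (gtail b - gtail c) := by
  obtain ⟨χ, χ', hb⟩ := exists_timeBump (t₀ := 1) (t₁ := 2) one_pos (by norm_num)
  obtain ⟨X, hX⟩ := hp
  have Ta := h.simS_tendsto hb ha ga
  have Tb := h.simS_tendsto hb (ha.trans hab) gb
  have Tc := h.simS_tendsto hb (ha.trans (hab.trans hbc)) gc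
  have Tr := h.simR_error_tendsto hb ha.le (hab.trans hbc).le
  have g1 : 0 < gtail a - gtail b := sub_pos.2 (gtail_strictAnti hab)
  have g2 : 0 < gtail b - gtail c := sub_pos.2 (gtail_strictAnti hbc)
  have T1 := (Tc.sub Tb).mul_const (gtail a - gtail b)
  have T2 := ((Tb.sub Ta).mul_const (gtail b - gtail c)).add
    (Tr.mul_const (2 * (gtail a - gtail b) * (gtail b - gtail c)))
  rw [zero_mul, add_zero] at T2
  refine le_of_tendsto_of_tendsto T1 T2 ?_
  filter_upwards [eventually_gt_atTop (0:ℝ), eventually_ge_atTop (X / a)] with l hl hlX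
  have H := h.sys_scale hl
  set E := simE 2 χ (fun x t => l * w (l * x) (l ^ 2 * t)) with hE
  set ρ := ∫ x in a..c, Real.exp (x ^ 2 / 4) *
      |simR 2 χ χ' (fun x t => u (l * x) (l ^ 2 * t) - psi α β x t) x| with hρ
  have hN : ∀ x, a ≤ x →
      simN 2 χ (fun x t => l ^ 2 * (p (l * x) (l ^ 2 * t) * u (l * x) (l ^ 2 * t))) x = 0 := by
    intro x hx
    refine setIntegral_eq_zero_of_forall_eq_zero fun t ht => ?_
    by_cases hm : t ∈ Ioo (1:ℝ) 2
    · have hs1 : 1 ≤ Real.sqrt t := Real.one_le_sqrt.2 hm.1.le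
      have hX1 : X ≤ l * (x * Real.sqrt t) := by
        rw [div_le_iff₀ ha] at hlX
        calc X ≤ l * a := hlX
          _ ≤ l * (x * Real.sqrt t) := by
              gcongr; nlinarith
      have hz : p (l * (x * Real.sqrt t)) (l ^ 2 * t) = 0 := by
        refine hX _ hX1 _ ?_
        rw [le_div_iff₀ (by positivity)]
        calc l ^ 2 * t * a ^ 2 ≤ l ^ 2 * t * x ^ 2 := by
              have := ht.1.le
              gcongr
          _ = (l * (x * Real.sqrt t)) ^ 2 := by rw [mul_pow, mul_pow, Real.sq_sqrt ht.1.le]; ring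
      simp only [hz, zero_mul, mul_zero]
    · rw [hb.zero t hm, mul_zero, zero_mul]
  have anti : ∀ x y, a ≤ x → x ≤ y → y ≤ c → E y ≤ E x + ρ := by
    intro x y h1 h2 h3
    have r1 := (abs_le.1 (H.simE_sub_error hb h1 h2 h3)).2
    have r2 : ∫ x in x..y, Real.exp (x ^ 2 / 4) *
        simN 2 χ (fun x t => l ^ 2 * (p (l * x) (l ^ 2 * t) * u (l * x) (l ^ 2 * t))) x = 0 := by
      refine intervalIntegral.integral_zero_ae (Eventually.of_forall fun z hzm => ?_)
      rw [uIoc_of_le h2] at hzm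
      rw [hN z (h1.trans hzm.1.le), mul_zero]
    rw [r2] at r1
    linarith
  have q1 := H.le_simS_sub hb hab.le (e := E b - ρ) fun x hx => by
    have := anti x b hx.1 hx.2 hbc.le; linarith
  have q2 := H.simS_sub_le hb hbc.le (e := E b + ρ) fun x hx => anti b x hab.le hx.1 hx.2
  have := mul_le_mul_of_nonneg_right q1 g2.le
  have := mul_le_mul_of_nonneg_right q2 g1.le
  linarith

end LimSol

lemma exists_mem_Ioo_of_ae {P : ℝ → Prop} (h : ∀ᵐ x, P x) {a b : ℝ} (hab : a < b) : ∃ x ∈ Ioo a b, P x := by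
  by_contra! hc
  have : volume (Ioo a b) = 0 := measure_mono_null (fun x hx => hc x hx) (ae_iff.1 h)
  rw [Real.volume_Ioo, ENNReal.ofReal_eq_zero] at this
  linarith

lemma frequently_left_of_ae {P : ℝ → Prop} (h : ∀ᵐ x, P x) (a : ℝ) : ∃ᶠ x in 𝓝[<] a, P x := by
  intro hc
  obtain ⟨b, hb, hs⟩ := mem_nhdsLT_iff_exists_Ioo_subset.1 hc
  obtain ⟨x, hx, hP⟩ := exists_mem_Ioo_of_ae h hb
  exact hs hx hP

lemma frequently_atTop_of_ae {P : ℝ → Prop} (h : ∀ᵐ x, P x) : ∃ᶠ x in atTop, P x := by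
  intro hc
  obtain ⟨a, ha⟩ := eventually_atTop.1 hc
  obtain ⟨x, hx, hP⟩ := exists_mem_Ioo_of_ae h (lt_add_one a)
  exact ha x hx.1.le hP

lemma ae_inv_sq {P : ℝ → Prop} {a b : ℝ} (ha : 0 < a) (h : ∀ᵐ t, t ∈ Ioo a b → P t) :
    ∀ᵐ η, 0 < η → 1 / η ^ 2 ∈ Ioo a b → P (1 / η ^ 2) := by
  rw [ae_iff]
  set N := {t | ¬ (t ∈ Ioo a b → P t)} ∩ Ioi 0
  have h0 : volume N = 0 := measure_mono_null inter_subset_left (ae_iff.1 h)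
  have hd : DifferentiableOn ℝ (fun t : ℝ => 1 / Real.sqrt t) N := by
    intro y hy
    have hy0 : (0:ℝ) < y := hy.2
    exact ((differentiableAt_const (1:ℝ)).div (differentiableAt_id.sqrt hy0.ne')
      (Real.sqrt_pos.2 hy0).ne').differentiableWithinAt
  refine measure_mono_null ?_
    (addHaar_image_eq_zero_of_differentiableOn_of_addHaar_eq_zero volume hd h0)
  intro η hη
  simp only [mem_ofPred_eq, Classical.not_imp] at hη
  refine ⟨1 / η ^ 2, ⟨?_, ?_⟩, ?_⟩
  · simp only [mem_ofPred_eq, Classical.not_imp]; exact hη.2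
  · exact ha.trans hη.2.1.1
  · simp only
    rw [Real.sqrt_div zero_le_one, Real.sqrt_one, Real.sqrt_sq hη.1.le, one_div_one_div]

namespace LimSol
variable {α β ustar : ℝ} {u p w : ℝ → ℝ → ℝ} {ps V : ℝ → ℝ} {t₀ t₁ : ℝ} {χ χ' : ℝ → ℝ}

/-- Comparison with the driving profile further out. -/
lemma decay (h : LimSol α β ustar u p w ps V) {a b : ℝ} (ha : 0 < a) (hab : a < b)
    (ga : Tendsto (fun l => u (l * a) (l ^ 2)) atTop (𝓝 (V a)))
    (gb : Tendsto (fun l => u (l * b) (l ^ 2)) atTop (𝓝 (V b))) :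
    (V b - PsiP α β b) * gtail a ≤ (V a - PsiP α β a) * gtail b := by
  have T1 : Tendsto (fun c => ((V b - PsiP α β b) - (V a - PsiP α β a)) * (gtail b - gtail c)) atTop
      (𝓝 (((V b - PsiP α β b) - (V a - PsiP α β a)) * (gtail b - 0))) :=
    (gtail_tendsto.const_sub _).const_mul _
  rw [sub_zero] at T1
  have := le_of_tendsto_of_frequently (b := -(V b - PsiP α β b) * (gtail a - gtail b)) T1 ?_
  · linarith
  · refine ((frequently_atTop_of_ae h.lim).and_eventually (eventually_gt_atTop b)).mono fun c hc => ?_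
    refine (h.slope_le ha hab hc.2 ga gb hc.1).trans ?_
    have h1 := h.V_le c
    rw [abs_of_pos (ha.trans (hab.trans hc.2))] at h1
    have h2 : 0 ≤ gtail a - gtail b := sub_nonneg.2 (gtail_strictAnti hab).le
    nlinarith

lemma upper_unif (h : LimSol α β ustar u p w ps V) {τ : ℝ} (h0 : 0 < τ) (h1 : τ ≤ 1 / 2) (R : ℝ) {ε : ℝ}
    (hε : 0 < ε) : ∀ᶠ l in atTop, ∀ x, |x| ≤ R → u (l * x) (l ^ 2)
      ≤ (∫ y, hk (x - y) τ * V (y / Real.sqrt (1 - τ))) + psiC α β * (2 * hkMoment + 2 * R) * Real.sqrt τ + ε := by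
  have hc := conv_tendstoUniformlyOn (L := atTop) (g := fun (l : ℝ) y => u (l * y) (l ^ 2 * (1 - τ)))
    (g₀ := fun y => V (y / Real.sqrt (1 - τ))) h0 (fun l => ?_) (C := PsiP α β α)
    (Eventually.of_forall fun l y => h.u_abs_le _ _) ?_ (fun y => h.V_abs_le _) (h.tendsto_slice (by linarith)) R
    ε hε
  · filter_upwards [hc, eventually_gt_atTop (0:ℝ)] with l hl hl0 x hx
    have := (h.sys_scale hl0).upper x h0 h1
    rw [mul_one] at this
    have h2 := (abs_le.1 (hl x hx)).2
    have h3 : psiC α β * (2 * hkMoment + 2 * |x|) * Real.sqrt τ ≤ psiC α β * (2 * hkMoment + 2 * R) * Real.sqrt τ := by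
      have := psiC_pos h.hα h.hβ
      gcongr
    linarith
  · exact (h.u_measurable.comp (by fun_prop : Measurable fun y : ℝ => (l * y, l ^ 2 * (1 - τ)))).aestronglyMeasurable
  · exact (h.V_meas.comp (by fun_prop)).aestronglyMeasurable

lemma u_le_PsiP (h : LimSol α β ustar u p w ps V) {l : ℝ} (hl : 0 < l) {x : ℝ} (hx : 0 ≤ x) :
    u (l * x) (l ^ 2) ≤ PsiP α β x := by
  refine (h.u_le _ _).trans (le_of_eq ?_)
  rw [psi_eq (by positivity), Real.sqrt_sq hl.le, abs_mul, abs_of_pos hl, mul_div_cancel_left₀ _ hl.ne',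
    abs_of_nonneg hx]

/-- The limit does not vanish identically inside the parabola. -/
lemma nontrivial (h : LimSol α β ustar u p w ps V) : ¬ ∀ᵐ η, η ∈ Ioo 0 α → V η = 0 := by
  intro hz
  have hα := h.hα
  have hC := psiC_pos h.hα h.hβ
  have hout : ∀ᵐ η, α < η → V η = 0 := by
    filter_upwards [h.lim] with b gb hb
    have T1 : Tendsto (fun a => psiC α β * gtail b * (gtail a - gtail α) - V b * gtail a) (𝓝[<] α)
        (𝓝 (psiC α β * gtail b * (gtail α - gtail α) - V b * gtail α)) :=
      (((gtail_continuous.tendsto α).sub_const _).const_mul _ |>.sub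
        ((gtail_continuous.tendsto α).const_mul _)).mono_left nhdsWithin_le_nhds
    have := ge_of_tendsto_of_frequently (b := 0) T1 ?_
    · have := gtail_pos α
      have := h.V_nonneg b
      nlinarith
    · refine ((frequently_left_of_ae (h.lim.and hz) α).and_eventually
        (Ioo_mem_nhdsLT hα)).mono fun a ha => ?_
      have hd := h.decay ha.2.1 (ha.2.2.trans hb) ha.1.1 gb
      rw [ha.1.2 ha.2, PsiP_of_le ha.2.2.le, PsiP_of_ge hb.le, PsiP_of_ge le_rfl] at hd
      linarith
  have hpos : ∀ᵐ η, 0 < η → V η = 0 := by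
    have hne : ∀ᵐ η : ℝ, η ≠ α := by simp [ae_iff]
    filter_upwards [hz, hout, hne] with η h1 h2 h3 h0
    rcases lt_or_gt_of_ne h3 with h4 | h4
    · exact h1 ⟨h0, h4⟩
    · exact h2 h4
  have hall : ∀ᵐ η, V η = 0 := by
    have := ae_abs ((ae_restrict_iff' measurableSet_Ioi).2 hpos)
    filter_upwards [this] with η hη
    rwa [apply_abs_of_even h.V_even] at hη
  obtain ⟨R, hR⟩ := eventually_atTop.1
    ((PsiP_tendsto (α := α) (β := β)).eventually (gt_mem_nhds (half_pos h.hu)))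
  have hsmall : ∀ᶠ l in atTop, ∀ η ≥ 0, u (l * η) (l ^ 2) ≤ ustar - ustar / 2 := by
    set K := psiC α β * (2 * hkMoment + 2 * max R 0) with hK
    have hK0 : 0 ≤ K := by
      have := hkMoment_nonneg
      have := le_max_right R 0
      positivity
    have hu := h.hu
    set δ := ustar / (4 * (K + 1)) with hδ
    have hδ0 : 0 < δ := by positivity
    set τ := min (1 / 2) (δ ^ 2) with hτ
    have hτ0 : 0 < τ := lt_min (by norm_num) (by positivity)
    have hsq : K * Real.sqrt τ ≤ ustar / 4 := by
      have : Real.sqrt τ ≤ δ := by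
        rw [Real.sqrt_le_left hδ0.le]; exact min_le_right _ _
      calc K * Real.sqrt τ ≤ (K + 1) * δ := by gcongr; linarith
        _ = _ := by rw [hδ]; field_simp
    have hi : ∀ x : ℝ, ∫ y, hk (x - y) τ * V (y / Real.sqrt (1 - τ)) = 0 := by
      intro x
      have hs : (Real.sqrt (1 - τ))⁻¹ ≠ 0 :=
        inv_ne_zero (Real.sqrt_pos.2 (by linarith [min_le_left (1/2) (δ ^ 2)])).ne'
      refine integral_eq_zero_of_ae ?_
      filter_upwards [ae_mul_left hall hs] with y hy
      rw [div_eq_inv_mul, hy, mul_zero]; rfl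
    filter_upwards [h.upper_unif hτ0 (min_le_left _ _) (max R 0) (by positivity : 0 < ustar / 4),
      eventually_gt_atTop (0:ℝ)] with l hl hl0 η hη
    by_cases hηR : η ≤ max R 0
    · have := hl η (by rwa [abs_of_nonneg hη])
      rw [hi] at this
      linarith
    · have h1 := h.u_le_PsiP hl0 hη
      have h2 := hR η ((le_max_left _ _).trans (not_le.1 hηR).le)
      linarith
  obtain ⟨Λ, hΛ⟩ := eventually_atTop.1 hsmall
  have hu := h.hu
  obtain ⟨a, ha, ga⟩ := exists_mem_Ioo_of_ae (h.lim.and hall) (show (0:ℝ) < α / 2 by linarith)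
  obtain ⟨b, hb, gb⟩ := exists_mem_Ioo_of_ae (h.lim.and hall) (show α / 2 < α by linarith)
  obtain ⟨c, hc, gc⟩ := exists_mem_Ioo_of_ae (h.lim.and hall) (lt_add_one α)
  obtain ⟨X, -, hX⟩ := h.p_eventually_zero (a := a) (ε := ustar / 2) (Λ := Λ) ha.1 (by linarith)
    fun l hl η hη => hΛ l hl η (ha.1.le.trans hη)
  have := h.slope_ge ha.1 (ha.2.trans hb.1) (hb.2.trans hc.1) ga.1 gb.1 gc.1 ⟨X, hX⟩
  rw [ga.2, gb.2, gc.2, PsiP_of_le (by linarith [ha.2] : a ≤ α), PsiP_of_le hb.2.le, PsiP_of_ge hc.1.le,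
    PsiP_of_ge le_rfl] at this
  have g1 : 0 < gtail a - gtail b := sub_pos.2 (gtail_strictAnti (ha.2.trans hb.1))
  have g2 : 0 < gtail α - gtail c := sub_pos.2 (gtail_strictAnti hc.1)
  have := mul_pos (mul_pos hC g2) g1
  nlinarith

lemma exists_bump_pos (h : LimSol α β ustar u p w ps V) : ∃ t₀ t₁ χ χ', TimeBump t₀ t₁ χ χ' ∧
    1 < α * Real.sqrt t₀ ∧ 0 < ∫ t in Ioc 0 t₁, χ t * V (1 / Real.sqrt t) := by
  by_contra! hc
  refine h.nontrivial ?_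
  have hα := h.hα
  have key : ∀ n : ℕ, ∀ᵐ η, 0 < η → 1 / η ^ 2 ∈ Ioo (1 / α ^ 2 + 1 / ((n:ℝ) + 1)) (1 / α ^ 2 + 1 / ((n:ℝ) + 1) + n + 1) →
      V (1 / Real.sqrt (1 / η ^ 2)) = 0 := by
    intro n
    set t₀ := 1 / α ^ 2 + 1 / ((n:ℝ) + 1) with ht0
    have ht0' : 0 < t₀ := by positivity
    refine ae_inv_sq ht0' (P := fun t => V (1 / Real.sqrt t) = 0) ?_
    obtain ⟨χ, χ', hb⟩ := exists_timeBump ht0' (show t₀ < t₀ + n + 1 by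
      have : (0:ℝ) ≤ n := n.cast_nonneg
      linarith)
    have h1 : 1 < α * Real.sqrt t₀ := by
      rw [← div_lt_iff₀' hα]
      refine Real.lt_sqrt_of_sq_lt ?_
      rw [div_pow, one_pow, ht0]
      have : 0 < 1 / ((n:ℝ) + 1) := by positivity
      linarith
    have h2 := hc _ _ χ χ' hb h1
    have hnn : ∀ t, 0 ≤ χ t * V (1 / Real.sqrt t) := fun t => mul_nonneg (hb.nonneg t) (h.V_nonneg _)
    have hi : IntegrableOn (fun t => χ t * V (1 / Real.sqrt t)) (Ioc 0 (t₀ + n + 1)) := by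
      refine hb.integrableOn.mul_bdd (c := PsiP α β α) ?_ (Eventually.of_forall fun t => h.V_abs_le _)
      exact (h.V_meas.comp (by fun_prop : Measurable fun t : ℝ => 1 / Real.sqrt t)).aestronglyMeasurable
    have h3 := (setIntegral_eq_zero_iff_of_nonneg_ae (Eventually.of_forall hnn) hi).1
      (le_antisymm h2 (setIntegral_nonneg measurableSet_Ioc fun t _ => hnn t))
    rw [EventuallyEq, ae_restrict_iff' measurableSet_Ioc] at h3
    filter_upwards [h3] with t ht hm
    have := ht ⟨ht0'.trans hm.1, hm.2.le⟩
    exact (mul_eq_zero.1 this).resolve_left (hb.pos_of_mem t hm).ne'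
  filter_upwards [ae_all_iff.2 key] with η hη hm
  have hs : 1 / α ^ 2 < 1 / η ^ 2 := by
    have := hm.1; have := hm.2
    gcongr
  obtain ⟨n, hn⟩ := exists_nat_gt (max (1 / (1 / η ^ 2 - 1 / α ^ 2)) (1 / η ^ 2))
  have hn1 := (le_max_left _ _).trans_lt hn
  have hn2 := (le_max_right _ _).trans_lt hn
  have := hη n hm.1 ⟨?_, ?_⟩
  · rwa [Real.sqrt_div zero_le_one, Real.sqrt_one, Real.sqrt_sq hm.1.le, one_div_one_div] at this
  · have : 1 / ((n:ℝ) + 1) < 1 / η ^ 2 - 1 / α ^ 2 := by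
      rw [div_lt_iff₀ (by positivity)]
      rw [div_lt_iff₀ (by linarith)] at hn1
      nlinarith
    linarith
  · have : 0 < 1 / α ^ 2 + 1 / ((n:ℝ) + 1) := by positivity
    linarith

end LimSol

/-- A dyadic mass bound yields an integrable tail. -/
lemma tail_of_dyadic {f : ℝ → ℝ} {Λ C θ : ℝ} (hΛ : 0 < Λ) (hθ : 1 < θ) (hC : 0 ≤ C) (hf : ∀ x, 0 ≤ f x)
    (hi : ∀ a b, IntervalIntegrable f volume a b) (hd : ∀ l ≥ Λ, ∫ x in l..(θ * l), f x ≤ C / l) :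
    ∀ l ≥ Λ, IntegrableOn f (Ioi l) ∧ ∫ x in Ioi l, f x ≤ C * θ / (θ - 1) / l := by
  have hθ0 : 0 < θ := by linarith
  have hθ1 : 0 < θ - 1 := by linarith
  have key : ∀ n : ℕ, ∀ l ≥ Λ, ∫ x in l..(θ ^ n * l), f x ≤ C * θ / (θ - 1) / l := by
    intro n
    induction n with
    | zero =>
      intro l hl
      have : 0 < l := hΛ.trans_le hl
      simp only [pow_zero, one_mul, intervalIntegral.integral_same]
      positivity
    | succ n ih =>
      intro l hl
      have hl0 : 0 < l := hΛ.trans_le hl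
      have h1 := hd l hl
      have h2 := ih (θ * l) (hl.le.trans (by nlinarith))
      rw [show θ ^ n * (θ * l) = θ ^ (n + 1) * l by ring] at h2
      rw [← intervalIntegral.integral_add_adjacent_intervals (hi l (θ * l)) (hi _ _)]
      have : C / l + C * θ / (θ - 1) / (θ * l) = C * θ / (θ - 1) / l := by field_simp; ring
      linarith
  intro l hl
  have hl0 : 0 < l := hΛ.trans_le hl
  have hb : Tendsto (fun n : ℕ => θ ^ n * l) atTop atTop :=
    (tendsto_pow_atTop_atTop_of_one_lt hθ).atTop_mul_const hl0
  have hI : IntegrableOn f (Ioi l) := by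
    refine integrableOn_Ioi_of_intervalIntegral_norm_bounded (C * θ / (θ - 1) / l) l (fun n => (hi _ _).1) hb
      (Eventually.of_forall fun n => ?_)
    simp only [Real.norm_eq_abs, abs_of_nonneg (hf _)]
    exact key n l hl
  exact ⟨hI, le_of_tendsto' (intervalIntegral_tendsto_integral_Ioi l hI hb) fun n => key n l hl⟩

namespace LimSol
variable {α β ustar : ℝ} {u p w : ℝ → ℝ → ℝ} {ps V : ℝ → ℝ} {t₀ t₁ : ℝ} {χ χ' : ℝ → ℝ}

lemma ps_intervalIntegrable (h : LimSol α β ustar u p w ps V) (a b : ℝ) : IntervalIntegrable ps volume a b := by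
  refine intervalIntegrable_iff.2 ⟨h.q_meas.aestronglyMeasurable, ?_⟩
  refine HasFiniteIntegral.restrict_of_bounded (C := 1) (by rw [uIoc]; exact measure_Ioc_lt_top) ?_
  refine Eventually.of_forall fun x => ?_
  rw [Real.norm_eq_abs, abs_of_nonneg (h.q_nonneg x)]; exact h.ps_le x

lemma ps_integral_rescale {ps : ℝ → ℝ} {l : ℝ} (a b : ℝ) :
    ∫ x in a..b, l ^ 2 * ps (l * x) = l * ∫ x in (l * a)..(l * b), ps x := by
  rw [intervalIntegral.integral_const_mul, ← intervalIntegral.mul_integral_comp_mul_left]; ring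

lemma fluxBound_nonneg (h : LimSol α β ustar u p w ps V) (hb : TimeBump t₀ t₁ χ χ') {r : ℝ} (h0 : 0 ≤ r)
    (hr : r < α * Real.sqrt t₀) : 0 ≤ PrecipSys.fluxBound α β t₀ t₁ χ' r :=
  (abs_nonneg _).trans (h.flux_abs_le hb hr le_rfl h0)

/-- Near any point inside the parabola the averages are close to a constant. -/
lemma avg_near (h : LimSol α β ustar u p w ps V) (hb : TimeBump t₀ t₁ χ χ') {r R : ℝ} (h1 : 1 ≤ r) (hrR : r ≤ R)
    (hR : R < α * Real.sqrt t₀) {ε : ℝ} (hε : 0 < ε) : ∀ᶠ l in atTop, ∀ x ∈ Icc 1 r,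
      |timeAvg t₁ χ (fun x t => u (l * x) (l ^ 2 * t)) x - ∫ t in Ioc 0 t₁, χ t * V (1 / Real.sqrt t)|
        ≤ PrecipSys.fluxBound α β t₀ t₁ χ' R * (r - 1) + ε := by
  have hK := h.fluxBound_nonneg hb (by linarith) hR
  have hT := h.avg_tendsto hb.integrableOn one_pos
  filter_upwards [eventually_gt_atTop (0:ℝ), hT.eventually (Metric.ball_mem_nhds _ hε)] with l hl hv x hx
  have e1 := (h.sys_scale hl).avg_lipschitz hb hR (x := x) (y := 1) ⟨by linarith [hx.1], hx.2.trans hrR⟩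
    ⟨zero_le_one, h1.trans hrR⟩
  rw [Real.dist_eq] at hv
  rw [abs_of_nonneg (sub_nonneg.2 hx.1)] at e1
  have e2 := mul_le_mul_of_nonneg_left (sub_le_sub_right hx.2 1) hK
  have e3 := abs_sub_le (timeAvg t₁ χ (fun x t => u (l * x) (l ^ 2 * t)) x)
    (timeAvg t₁ χ (fun x t => u (l * x) (l ^ 2 * t)) 1) (∫ t in Ioc 0 t₁, χ t * V (1 / Real.sqrt t))
  linarith

lemma tail_bound (h : LimSol α β ustar u p w ps V) : ∃ C ≥ 0, ∃ Λ > 0, ∀ l ≥ Λ,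
    IntegrableOn ps (Ioi l) ∧ ∫ x in Ioi l, ps x ≤ C / l := by
  obtain ⟨t₀, t₁, χ, χ', hb, h1, hv⟩ := h.exists_bump_pos
  set v := ∫ t in Ioc 0 t₁, χ t * V (1 / Real.sqrt t) with hvdef
  set R := (1 + α * Real.sqrt t₀) / 2 with hRd
  have hR : R < α * Real.sqrt t₀ := by linarith
  have hR1 : 1 < R := by linarith
  set K := PrecipSys.fluxBound α β t₀ t₁ χ' R with hKd
  have hK : 0 ≤ K := h.fluxBound_nonneg hb (by linarith) hR
  set r := min R (1 + v / (4 * (K + 1))) with hr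
  have hr1 : 1 < r := lt_min hR1 (by have : 0 < v / (4 * (K + 1)) := by positivity
                                     linarith)
  have hKr : K * (r - 1) ≤ v / 4 := by
    have h2 : r - 1 ≤ v / (4 * (K + 1)) := by linarith [min_le_right R (1 + v / (4 * (K + 1)))]
    calc K * (r - 1) ≤ (K + 1) * (v / (4 * (K + 1))) := by
          apply mul_le_mul (by linarith) h2 (by linarith) (by linarith)
      _ = v / 4 := by field_simp
  obtain ⟨Λ, hΛ⟩ := eventually_atTop.1 (h.avg_near hb hr1.le (min_le_left _ _) hR (show 0 < v / 4 by linarith))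
  have hd : ∀ l ≥ max Λ 1, ∫ x in l..(r * l), ps x ≤ (6 * K / v) / l := by
    intro l hl
    have hl0 : 0 < l := lt_of_lt_of_le one_pos ((le_max_right _ _).trans hl)
    have hA := hΛ l ((le_max_left _ _).trans hl)
    have e1 := (h.sys_scale hl0).q_avg_integral_le hb hR zero_le_one hr1.le (min_le_left _ _)
    have e2 : (v / 2) * ∫ x in (1:ℝ)..r, l ^ 2 * ps (l * x)
        ≤ ∫ x in (1:ℝ)..r, l ^ 2 * ps (l * x) * timeAvg t₁ χ (fun x t => u (l * x) (l ^ 2 * t)) x := by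
      rw [← intervalIntegral.integral_const_mul]
      refine intervalIntegral.integral_mono_on hr1.le ?_ ((h.sys_scale hl0).q_avg_intervalIntegrable hb 1 r)
        fun x hx => ?_
      · have := ((h.ps_intervalIntegrable (l * 1) (l * r)).comp_mul_left (c := l))
        rw [mul_div_cancel_left₀ _ hl0.ne', mul_div_cancel_left₀ _ hl0.ne'] at this
        exact (this.const_mul _).const_mul _
      · have := (abs_le.1 (hA x hx)).1
        rw [mul_comm]
        refine mul_le_mul_of_nonneg_left ?_ (mul_nonneg (sq_nonneg _) (h.q_nonneg _))
        linarith
    rw [ps_integral_rescale, mul_one, mul_comm l r] at e2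
    rw [div_div, le_div_iff₀ (by positivity)]
    nlinarith
  refine ⟨6 * K / v * r / (r - 1), ?_, max Λ 1, lt_of_lt_of_le one_pos (le_max_right _ _),
    tail_of_dyadic (lt_of_lt_of_le one_pos (le_max_right _ _)) hr1 (by positivity) h.q_nonneg
      h.ps_intervalIntegrable hd⟩
  have : 0 < r - 1 := by linarith
  positivity

end LimSol

lemma exists_tendsto_of_near {f : ℝ → ℝ} (h : ∀ ε > 0, ∃ m, ∀ᶠ x in atTop, |f x - m| ≤ ε) :
    ∃ c, Tendsto f atTop (𝓝 c) := by
  refine cauchy_map_iff_exists_tendsto.1 (Metric.cauchy_iff.2 ⟨inferInstance, fun ε hε => ?_⟩)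
  obtain ⟨m, hm⟩ := h (ε / 3) (by positivity)
  refine ⟨Metric.closedBall m (ε / 3), ?_, fun x hx y hy => ?_⟩
  · rw [mem_map]
    filter_upwards [hm] with x hx
    rwa [mem_preimage, Metric.mem_closedBall, Real.dist_eq]
  · rw [Metric.mem_closedBall] at hx hy
    have := dist_triangle_right x y m
    linarith

lemma telescope_le {f : ℝ → ℝ} {Λ c θ : ℝ} (hΛ : 0 < Λ) (hθ : 1 < θ) (hf : Tendsto f atTop (𝓝 0))
    (hd : ∀ l ≥ Λ, l * (f l - f (θ * l)) ≤ c) : ∀ l ≥ Λ, l * f l ≤ c * θ / (θ - 1) := by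
  have hθ0 : 0 < θ := by linarith
  have hθ1 : 0 < θ - 1 := by linarith
  set g : ℝ → ℝ := fun l => f l - c * θ / (θ - 1) / l with hg
  have key : ∀ n : ℕ, ∀ l ≥ Λ, g l ≤ g (θ ^ n * l) := by
    intro n
    induction n with
    | zero => intro l _; simp
    | succ n ih =>
      intro l hl
      have hl0 : 0 < l := hΛ.trans_le hl
      have h2 := ih (θ * l) (hl.le.trans (by nlinarith))
      rw [show θ ^ n * (θ * l) = θ ^ (n + 1) * l by ring] at h2
      refine le_trans ?_ h2
      have h1 := hd l hl
      rw [← le_div_iff₀' hl0] at h1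
      have : c * θ / (θ - 1) / l - c * θ / (θ - 1) / (θ * l) = c / l := by field_simp
      simp only [hg]
      linarith
  intro l hl
  have hl0 : 0 < l := hΛ.trans_le hl
  have hb : Tendsto (fun n : ℕ => θ ^ n * l) atTop atTop :=
    (tendsto_pow_atTop_atTop_of_one_lt hθ).atTop_mul_const hl0
  have hgt : Tendsto g atTop (𝓝 (0 - 0)) := hf.sub (tendsto_const_nhds.div_atTop tendsto_id)
  rw [sub_zero] at hgt
  have := ge_of_tendsto' (hgt.comp hb) fun n => key n l hl
  simp only [hg] at this
  rw [← le_div_iff₀' hl0]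
  linarith

lemma continuous_moving_integral {f : ℝ → ℝ} (hf : ∀ a b, IntervalIntegrable f volume a b) (θ : ℝ) :
    Continuous fun σ => ∫ x in σ..(θ * σ), f x := by
  have hc := intervalIntegral.continuous_primitive hf 0
  refine ((hc.comp (continuous_const_mul θ)).sub hc).congr fun σ => ?_
  exact intervalIntegral.integral_interval_sub_left (hf _ _) (hf _ _)

namespace PrecipSys
variable {α β : ℝ} {u w F : ℝ → ℝ → ℝ} {q : ℝ → ℝ} {t₀ t₁ : ℝ} {χ χ' : ℝ → ℝ}

lemma flux_average (h : PrecipSys α β u w F q) (hb : TimeBump t₀ t₁ χ χ') {θ : ℝ} (h1 : 1 ≤ θ)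
    (h2 : θ * θ < α * Real.sqrt t₀) :
    ∫ σ in (1:ℝ)..θ, ∫ x in σ..(θ * σ), q x * timeAvg t₁ χ u x
      = (timeAvg t₁ χ u (θ * θ) - timeAvg t₁ χ u θ) / θ - (timeAvg t₁ χ u θ - timeAvg t₁ χ u 1)
        + ∫ σ in (1:ℝ)..θ, ∫ x in σ..(θ * σ), timeAvg t₁ χ' (fun x t => u x t - psi α β x t) x := by
  have hD := h.flux_continuous hb
  have hB := h.vdot_continuous hb
  have hθ : 0 < θ := by linarith
  have hθθ : θ ≤ θ * θ := by nlinarith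
  have e1 : ∀ σ ∈ uIcc 1 θ, ∫ x in σ..(θ * σ), q x * timeAvg t₁ χ u x
      = (timeAvg t₁ χ w (θ * σ) - timeAvg t₁ χ w σ)
        + ∫ x in σ..(θ * σ), timeAvg t₁ χ' (fun x t => u x t - psi α β x t) x := by
    intro σ hσ
    rw [uIcc_of_le h1] at hσ
    have h3 : θ * σ ≤ θ * θ := mul_le_mul_of_nonneg_left hσ.2 hθ.le
    have h0 := hσ.1
    rw [h.flux_sub hb (show σ ≤ θ * σ by nlinarith) (by linarith) (by linarith),
      intervalIntegral.integral_sub (h.q_avg_intervalIntegrable hb _ _) (hB.intervalIntegrable _ _)]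
    ring
  rw [intervalIntegral.integral_congr e1, intervalIntegral.integral_add
    (Continuous.intervalIntegrable (by fun_prop) _ _)
    ((continuous_moving_integral (fun a b => hB.intervalIntegrable a b) θ).intervalIntegrable _ _),
    intervalIntegral.integral_sub (Continuous.intervalIntegrable (by fun_prop) _ _) (hD.intervalIntegrable _ _)]
  have ft : ∀ a b, 0 ≤ a → a ≤ b → b < α * Real.sqrt t₀ →
      ∫ x in a..b, timeAvg t₁ χ w x = timeAvg t₁ χ u b - timeAvg t₁ χ u a := by
    intro a b h0 hab hbr
    refine intervalIntegral.integral_eq_sub_of_hasDerivAt (fun x hx => ?_) (hD.intervalIntegrable _ _)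
    rw [uIcc_of_le hab] at hx
    exact h.avg_hasDerivAt hb (abs_lt.2 ⟨by linarith [hx.1], by linarith [hx.2]⟩)
  rw [intervalIntegral.integral_comp_mul_left (fun x => timeAvg t₁ χ w x) hθ.ne', mul_one,
    ft _ _ hθ.le hθθ h2, ft _ _ zero_le_one h1 (by linarith), smul_eq_mul]
  ring

end PrecipSys

namespace LimSol
variable {α β ustar : ℝ} {u p w : ℝ → ℝ → ℝ} {ps V : ℝ → ℝ} {t₀ t₁ : ℝ} {χ χ' : ℝ → ℝ}

lemma flux_average_tendsto (h : LimSol α β ustar u p w ps V) (hb : TimeBump t₀ t₁ χ χ') {θ : ℝ} (h1 : 1 ≤ θ)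
    (h2 : θ * θ < α * Real.sqrt t₀) : ∃ L, Tendsto (fun l => ∫ σ in (1:ℝ)..θ, ∫ x in σ..(θ * σ),
      l ^ 2 * ps (l * x) * timeAvg t₁ χ (fun x t => u (l * x) (l ^ 2 * t)) x) atTop (𝓝 L) := by
  have hθ : 0 < θ := by linarith
  have hA : ∀ x : ℝ, 0 < x → ∃ c, Tendsto (fun l => timeAvg t₁ χ (fun x t => u (l * x) (l ^ 2 * t)) x) atTop (𝓝 c) :=
    fun x hx => ⟨_, h.avg_tendsto hb.integrableOn hx⟩
  have hB : ∀ x : ℝ, 0 < x → Tendsto (fun l => timeAvg t₁ χ' (fun x t => u (l * x) (l ^ 2 * t) - psi α β x t) x)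
      atTop (𝓝 ((∫ t in Ioc 0 t₁, χ' t * V (x / Real.sqrt t)) - ∫ t in Ioc 0 t₁, χ' t * psi α β x t)) := by
    intro x hx
    refine ((h.avg_tendsto hb.integrableOn' hx).sub_const _).congr' ?_
    filter_upwards [eventually_gt_atTop (0:ℝ)] with l hl
    rw [timeAvg, timeAvg, ← integral_sub ((h.sys_scale hl).avg_integrable hb.integrableOn' x)]
    · simp only [mul_sub]
    · refine hb.integrableOn'.mul_bdd (c := PsiP α β α) ?_ (Eventually.of_forall fun t => psi_abs_le h.hα h.hβ x t)
      exact (psi_measurable.comp (by fun_prop : Measurable fun t : ℝ => (x, t))).aestronglyMeasurable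
  obtain ⟨a, ha⟩ := hA (θ * θ) (by positivity)
  obtain ⟨b, hb'⟩ := hA θ hθ
  obtain ⟨c, hc⟩ := hA 1 one_pos
  set Bd := PsiP α β α * ∫ t in Ioc 0 t₁, |χ' t| with hBd
  have hBd0 : 0 ≤ Bd := h.toPrecipSys.vdot_const_nonneg
  have hB1 : ∀ σ : ℝ, 0 < σ → Tendsto (fun l => ∫ x in σ..(θ * σ),
      timeAvg t₁ χ' (fun x t => u (l * x) (l ^ 2 * t) - psi α β x t) x) atTop
      (𝓝 (∫ x in σ..(θ * σ), ((∫ t in Ioc 0 t₁, χ' t * V (x / Real.sqrt t)) - ∫ t in Ioc 0 t₁, χ' t * psi α β x t))) := by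
    intro σ hσ
    refine intervalIntegral.tendsto_integral_filter_of_dominated_convergence (fun _ => Bd) ?_ ?_ (by simp) ?_
    · filter_upwards [eventually_gt_atTop (0:ℝ)] with l hl
      exact ((h.sys_scale hl).vdot_continuous hb).aestronglyMeasurable
    · filter_upwards [eventually_gt_atTop (0:ℝ)] with l hl
      exact Eventually.of_forall fun x _ => (h.sys_scale hl).vdot_le hb x
    · refine Eventually.of_forall fun x hx => hB x ?_
      rw [uIoc_of_le (by nlinarith)] at hx
      exact hσ.trans hx.1
  have hB2 := intervalIntegral.tendsto_integral_filter_of_dominated_convergence (μ := volume) (a := 1) (b := θ) (l := atTop)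
    (F := fun (l σ : ℝ) => ∫ x in σ..(θ * σ), timeAvg t₁ χ' (fun x t => u (l * x) (l ^ 2 * t) - psi α β x t) x)
    (f := fun σ => (∫ x in σ..(θ * σ), ((∫ t in Ioc 0 t₁, χ' t * V (x / Real.sqrt t)) - ∫ t in Ioc 0 t₁, χ' t * psi α β x t)))
    (fun σ => Bd * (θ * θ)) ?_ ?_ (by simp) ?_
  · refine ⟨_, ((((ha.sub hb').div_const θ).sub (hb'.sub hc)).add hB2).congr' ?_⟩
    filter_upwards [eventually_gt_atTop (0:ℝ)] with l hl
    exact ((h.sys_scale hl).flux_average hb h1 h2).symm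
  · filter_upwards [eventually_gt_atTop (0:ℝ)] with l hl
    exact (continuous_moving_integral
      (fun a b => ((h.sys_scale hl).vdot_continuous hb).intervalIntegrable a b) θ).aestronglyMeasurable
  · filter_upwards [eventually_gt_atTop (0:ℝ)] with l hl
    refine Eventually.of_forall fun σ hσ => ?_
    rw [uIoc_of_le h1] at hσ
    refine (intervalIntegral.norm_integral_le_of_norm_le_const (C := Bd)
      fun x _ => (h.sys_scale hl).vdot_le hb x).trans ?_
    have : 0 ≤ θ * σ - σ := by nlinarith [hσ.1]
    rw [abs_of_nonneg this]
    refine mul_le_mul_of_nonneg_left ?_ hBd0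
    nlinarith [hσ.1, hσ.2]
  · refine Eventually.of_forall fun σ hσ => ?_
    rw [uIoc_of_le h1] at hσ
    exact hB1 σ (by linarith [hσ.1])

end LimSol

/-- Mass of `f` beyond `x`. -/
def tailMass (f : ℝ → ℝ) (x : ℝ) : ℝ := ∫ y in Ioi x, f y

lemma tailMass_sub {f : ℝ → ℝ} {a b : ℝ} (hf : IntegrableOn f (Ioi a)) (hab : a ≤ b) :
    tailMass f a - tailMass f b = ∫ x in a..b, f x := by
  rw [tailMass, tailMass, ← intervalIntegral.integral_interval_add_Ioi hf (hf.mono_set (Ioi_subset_Ioi hab))]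
  ring

lemma tailMass_nonneg {f : ℝ → ℝ} (hf : ∀ x, 0 ≤ f x) (a : ℝ) : 0 ≤ tailMass f a :=
  integral_nonneg hf

lemma tailMass_anti {f : ℝ → ℝ} {a b : ℝ} (h0 : ∀ x, 0 ≤ f x) (hf : IntegrableOn f (Ioi a)) (hab : a ≤ b) :
    tailMass f b ≤ tailMass f a := by
  have := tailMass_sub hf hab
  have := intervalIntegral.integral_nonneg_of_forall (μ := volume) hab h0
  linarith

namespace LimSol
variable {α β ustar : ℝ} {u p w : ℝ → ℝ → ℝ} {ps V : ℝ → ℝ} {t₀ t₁ : ℝ} {χ χ' : ℝ → ℝ}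

lemma ps_scaled_intervalIntegrable (h : LimSol α β ustar u p w ps V) {l : ℝ} (hl : 0 < l) (a b : ℝ) :
    IntervalIntegrable (fun x => l ^ 2 * ps (l * x)) volume a b := by
  have := (h.ps_intervalIntegrable (l * a) (l * b)).comp_mul_left (c := l)
  rw [mul_div_cancel_left₀ _ hl.ne', mul_div_cancel_left₀ _ hl.ne'] at this
  exact this.const_mul _

lemma tailMass_continuousOn (h : LimSol α β ustar u p w ps V) {a : ℝ} (hi : IntegrableOn ps (Ioi a)) :
    ContinuousOn (tailMass ps) (Ici a) := by
  have hc := intervalIntegral.continuous_primitive h.ps_intervalIntegrable a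
  refine (continuous_const (y := tailMass ps a) |>.sub hc).continuousOn.congr fun x hx => ?_
  have := tailMass_sub hi hx
  simp only [Pi.sub_apply]
  linarith

/-- Averaged masses on geometric intervals are comparable to the averaged fluxes. -/
lemma mass_average (h : LimSol α β ustar u p w ps V) (hb : TimeBump t₀ t₁ χ χ') {θ v ε l : ℝ} (h1 : 1 ≤ θ) (hl : 0 < l)
    (hA : ∀ x ∈ Icc 1 (θ * θ), |timeAvg t₁ χ (fun x t => u (l * x) (l ^ 2 * t)) x - v| ≤ ε) :
    (v - ε) * (∫ σ in (1:ℝ)..θ, ∫ x in σ..(θ * σ), l ^ 2 * ps (l * x)) ≤ (∫ σ in (1:ℝ)..θ, ∫ x in σ..(θ * σ),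
      l ^ 2 * ps (l * x) * timeAvg t₁ χ (fun x t => u (l * x) (l ^ 2 * t)) x) ∧
    (∫ σ in (1:ℝ)..θ, ∫ x in σ..(θ * σ),
      l ^ 2 * ps (l * x) * timeAvg t₁ χ (fun x t => u (l * x) (l ^ 2 * t)) x)
      ≤ (v + ε) * (∫ σ in (1:ℝ)..θ, ∫ x in σ..(θ * σ), l ^ 2 * ps (l * x)) := by
  have hq := h.ps_scaled_intervalIntegrable hl
  have hqA := (h.sys_scale hl).q_avg_intervalIntegrable hb
  have c1 := continuous_moving_integral hq θ
  have c2 := continuous_moving_integral hqA θ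
  have hin : ∀ σ ∈ Icc 1 θ, ∀ x ∈ Icc σ (θ * σ), x ∈ Icc 1 (θ * θ) := fun σ hσ x hx =>
    ⟨hσ.1.trans hx.1, hx.2.trans (mul_le_mul_of_nonneg_left hσ.2 (by linarith))⟩
  have hn : ∀ x, 0 ≤ l ^ 2 * ps (l * x) := fun x => mul_nonneg (sq_nonneg _) (h.q_nonneg _)
  constructor
  · rw [← intervalIntegral.integral_const_mul]
    refine intervalIntegral.integral_mono_on h1 ((c1.const_mul _).intervalIntegrable _ _)
      (c2.intervalIntegrable _ _) fun σ hσ => ?_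
    rw [← intervalIntegral.integral_const_mul]
    refine intervalIntegral.integral_mono_on (by nlinarith [hσ.1]) ((hq _ _).const_mul _) (hqA _ _) fun x hx => ?_
    have := (abs_le.1 (hA x (hin σ hσ x hx))).1
    rw [mul_comm]
    exact mul_le_mul_of_nonneg_left (by linarith) (hn x)
  · rw [← intervalIntegral.integral_const_mul]
    refine intervalIntegral.integral_mono_on h1 
      (c2.intervalIntegrable _ _) ((c1.const_mul _).intervalIntegrable _ _) fun σ hσ => ?_
    rw [← intervalIntegral.integral_const_mul]
    refine intervalIntegral.integral_mono_on (by nlinarith [hσ.1]) (hqA _ _) ((hq _ _).const_mul _) fun x hx => ?_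
    have := (abs_le.1 (hA x (hin σ hσ x hx))).2
    rw [mul_comm (v + ε)]
    exact mul_le_mul_of_nonneg_left (by linarith) (hn x)

lemma mass_average_eq (h : LimSol α β ustar u p w ps V) {θ l : ℝ} (h1 : 1 ≤ θ) (hl : 0 < l)
    (hi : IntegrableOn ps (Ioi l)) : (∫ σ in (1:ℝ)..θ, ∫ x in σ..(θ * σ), l ^ 2 * ps (l * x))
      = l * ((∫ σ in (1:ℝ)..θ, tailMass ps (l * σ)) - ∫ σ in (1:ℝ)..θ, tailMass ps (θ * l * σ)) := by
  have hθ : 0 < θ := by linarith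
  have hc := h.tailMass_continuousOn hi
  have ii : ∀ k : ℝ, l ≤ k → IntervalIntegrable (fun σ => tailMass ps (k * σ)) volume 1 θ := by
    intro k hk
    refine (hc.comp (by fun_prop) fun σ hσ => ?_).intervalIntegrable
    rw [uIcc_of_le h1] at hσ
    exact hk.trans (le_mul_of_one_le_right (hl.le.trans hk) hσ.1)
  rw [← intervalIntegral.integral_sub (ii l le_rfl) (ii (θ * l) (by nlinarith)), ← intervalIntegral.integral_const_mul]
  refine intervalIntegral.integral_congr fun σ hσ => ?_
  rw [uIcc_of_le h1] at hσ
  have h3 : l ≤ l * σ := by nlinarith [hσ.1]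
  rw [ps_integral_rescale, show θ * l * σ = l * (θ * σ) by ring,
    tailMass_sub (hi.mono_set (Ioi_subset_Ioi h3)) (by nlinarith [hσ.1])]

lemma exists_gamma (h : LimSol α β ustar u p w ps V) :
    ∃ γ, 0 ≤ γ ∧ Tendsto (fun x => x * tailMass ps x) atTop (𝓝 γ) := by
  suffices hs : ∃ γ, Tendsto (fun x => x * tailMass ps x) atTop (𝓝 γ) by
    obtain ⟨γ, hγ⟩ := hs
    refine ⟨γ, ge_of_tendsto hγ ?_, hγ⟩
    filter_upwards [eventually_ge_atTop (0:ℝ)] with x hx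
    exact mul_nonneg hx (tailMass_nonneg h.q_nonneg x)
  obtain ⟨C, hC, Λ, hΛ, hQ⟩ := h.tail_bound
  obtain ⟨t₀, t₁, χ, χ', hb, h1, hv⟩ := h.exists_bump_pos
  set v := ∫ t in Ioc 0 t₁, χ t * V (1 / Real.sqrt t) with hvdef
  set R := (1 + α * Real.sqrt t₀) / 2 with hRd
  have hR : R < α * Real.sqrt t₀ := by linarith
  have hR1 : 1 < R := by linarith
  set K := PrecipSys.fluxBound α β t₀ t₁ χ' R with hKd
  have hK : 0 ≤ K := h.fluxBound_nonneg hb (by linarith) hR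
  refine exists_tendsto_of_near fun ε hε => ?_
  set e : ℝ → ℝ := fun θ => (K + 1) * (θ * θ - 1) with he
  set ρ : ℝ → ℝ := fun θ => θ * (v + e θ) / (v - e θ) with hρ
  have hec : Tendsto e (𝓝 1) (𝓝 0) := by
    have : Continuous e := by fun_prop
    exact (this.tendsto' 1 0 (by simp [he]))
  have hρc : Tendsto (fun θ => (ρ θ - 1) * C) (𝓝 1) (𝓝 0) := by
    have t1 : Tendsto ρ (𝓝 1) (𝓝 (1 * (v + 0) / (v - 0))) :=
      (tendsto_id.mul (hec.const_add v)).div (hec.const_sub v) (by simp [hv.ne'])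
    have := (t1.sub_const 1).mul_const C
    rwa [add_zero, sub_zero, one_mul, div_self hv.ne', sub_self, zero_mul] at this
  have hθc : Tendsto (fun θ : ℝ => θ * θ) (𝓝 1) (𝓝 1) := by
    have : Continuous fun θ : ℝ => θ * θ := by fun_prop
    exact this.tendsto' 1 1 (by simp)
  obtain ⟨θ, hθ, he1, hρ1, hθR⟩ : ∃ θ : ℝ, 1 < θ ∧ e θ < v / 2 ∧ (ρ θ - 1) * C < ε / 2 ∧ θ * θ < R := by
    have h2 : ∀ᶠ θ in 𝓝[>] (1:ℝ), 1 < θ ∧ e θ < v / 2 ∧ (ρ θ - 1) * C < ε / 2 ∧ θ * θ < R := by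
      filter_upwards [self_mem_nhdsWithin, nhdsWithin_le_nhds (hec.eventually (gt_mem_nhds (half_pos hv))),
        nhdsWithin_le_nhds (hρc.eventually (gt_mem_nhds (half_pos hε))),
        nhdsWithin_le_nhds (hθc.eventually (gt_mem_nhds hR1))] with θ a b c d
      exact ⟨a, b, c, d⟩
    exact h2.exists
  have hθ0 : 0 < θ := by linarith
  have hθ1 : 0 < θ - 1 := by linarith
  have hθ2 : 1 < θ * θ := by nlinarith
  have he0 : 0 ≤ e θ := by simp only [he]; nlinarith
  obtain ⟨L, hL⟩ := h.flux_average_tendsto hb hθ.le (hθR.trans hR)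
  set κ := θ / (θ - 1) with hκ
  have hκ0 : 0 < κ := by positivity
  have hm : 0 < v - e θ := by linarith
  have hp : 0 < v + e θ := by linarith
  -- the tolerance for the averaged flux
  obtain ⟨δ, hδ, hδε⟩ : ∃ δ > 0, 2 * δ * (θ * κ / ((v - e θ) * (θ - 1))) ≤ ε / 2 := by
    set D := θ * κ / ((v - e θ) * (θ - 1)) with hD
    have hD0 : 0 < D := by positivity
    exact ⟨ε / (4 * D), by positivity, le_of_eq (by field_simp; norm_num)⟩
  have hav := h.avg_near hb hθ2.le hθR.le hR (show 0 < θ * θ - 1 by linarith)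
  obtain ⟨Λ', hΛ'⟩ := eventually_atTop.1 (hav.and (hL.eventually (Metric.ball_mem_nhds _ hδ)))
  set M := max Λ (max Λ' 1) with hM
  have hM0 : 0 < M := lt_of_lt_of_le one_pos ((le_max_right _ _).trans (le_max_right _ _))
  set Rf : ℝ → ℝ := fun l => ∫ σ in (1:ℝ)..θ, tailMass ps (l * σ) with hRf
  have hRb : ∀ l ≥ M, (θ - 1) * tailMass ps (θ * l) ≤ Rf l ∧ Rf l ≤ (θ - 1) * tailMass ps l := by
    intro l hl
    have hl0 : 0 < l := hM0.trans_le hl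
    have hi := (hQ l ((le_max_left _ _).trans hl)).1
    have ii : IntervalIntegrable (fun σ => tailMass ps (l * σ)) volume 1 θ := by
      refine ((h.tailMass_continuousOn hi).comp (by fun_prop) fun σ hσ => ?_).intervalIntegrable
      rw [uIcc_of_le hθ.le] at hσ
      exact le_mul_of_one_le_right hl0.le hσ.1
    have c : ∀ c : ℝ, (θ - 1) * c = ∫ σ in (1:ℝ)..θ, c := fun c => by
      rw [intervalIntegral.integral_const, smul_eq_mul]
    rw [c, c]
    constructor
    · refine intervalIntegral.integral_mono_on hθ.le (by simp) ii fun σ hσ => ?_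
      refine tailMass_anti h.q_nonneg (hi.mono_set (Ioi_subset_Ioi ?_)) ?_
      · nlinarith [hσ.1]
      · nlinarith [hσ.2]
    · refine intervalIntegral.integral_mono_on hθ.le ii (by simp) fun σ hσ => ?_
      exact tailMass_anti h.q_nonneg hi (by nlinarith [hσ.1])
  have hRt : Tendsto Rf atTop (𝓝 0) := by
    have t1 : Tendsto (fun l : ℝ => (θ - 1) * (C / l)) atTop (𝓝 ((θ - 1) * 0)) :=
      (tendsto_const_nhds.div_atTop tendsto_id).const_mul _
    rw [mul_zero] at t1
    refine tendsto_of_tendsto_of_tendsto_of_le_of_le' tendsto_const_nhds t1 ?_ ?_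
    · filter_upwards [eventually_ge_atTop M] with l hl
      exact (mul_nonneg hθ1.le (tailMass_nonneg h.q_nonneg _)).trans (hRb l hl).1
    · filter_upwards [eventually_ge_atTop M] with l hl
      exact (hRb l hl).2.trans (mul_le_mul_of_nonneg_left (hQ l ((le_max_left _ _).trans hl)).2 hθ1.le)
  have hR2 : ∀ l ≥ M, (L - δ) / (v + e θ) ≤ l * (Rf l - Rf (θ * l)) ∧ l * (Rf l - Rf (θ * l)) ≤ (L + δ) / (v - e θ) := by
    intro l hl
    have hl0 : 0 < l := hM0.trans_le hl
    have hi := (hQ l ((le_max_left _ _).trans hl)).1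
    obtain ⟨a1, a2⟩ := hΛ' l (((le_max_left _ _).trans (le_max_right _ _)).trans hl)
    rw [Real.dist_eq] at a2
    obtain ⟨a3, a4⟩ := abs_lt.1 a2
    have hm' := h.mass_average hb (v := v) (ε := e θ) hθ.le hl0 fun x hx => (a1 x hx).trans (le_of_eq (by simp only [he]; ring))
    rw [h.mass_average_eq hθ.le hl0 hi] at hm'
    change (v - e θ) * (l * (Rf l - Rf (θ * l))) ≤ _ ∧ _ ≤ (v + e θ) * (l * (Rf l - Rf (θ * l))) at hm'
    rw [div_le_iff₀' hp, le_div_iff₀' hm]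
    constructor <;> linarith [hm'.1, hm'.2]
  have hup := telescope_le hM0 hθ hRt fun l hl => (hR2 l hl).2
  have hlo := telescope_le (f := fun l => - Rf l) (c := -((L - δ) / (v + e θ))) hM0 hθ (by simpa using hRt.neg) fun l hl => by
    have := (hR2 l hl).1
    linarith
  set lo := (L - δ) / (v + e θ) * κ / (θ - 1) with hlod
  have hQlo : ∀ l ≥ M, lo ≤ l * tailMass ps l := by
    intro l hl
    have hl0 : 0 < l := hM0.trans_le hl
    have b1 := hlo l hl
    have b2 := (hRb l hl).2
    rw [hlod, div_le_iff₀ hθ1]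
    have b3 := mul_le_mul_of_nonneg_left b2 hl0.le
    have b4 : -((L - δ) / (v + e θ)) * θ / (θ - 1) = - ((L - δ) / (v + e θ) * κ) := by rw [hκ]; ring
    rw [b4] at b1
    linarith
  have hQhi : ∀ l ≥ θ * M, l * tailMass ps l ≤ θ * ((L + δ) / (v - e θ) * κ / (θ - 1)) := by
    intro l hl
    have hl1 : l / θ ≥ M := by rw [ge_iff_le, le_div_iff₀ hθ0]; linarith
    have hl0 : 0 < l / θ := hM0.trans_le hl1
    have b1 := hup _ hl1
    have b2 := (hRb _ hl1).1
    rw [mul_div_cancel₀ _ hθ0.ne'] at b2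
    have b3 := mul_le_mul_of_nonneg_left b2 hl0.le
    have b4 : (L + δ) / (v - e θ) * θ / (θ - 1) = (L + δ) / (v - e θ) * κ := by rw [hκ]; ring
    rw [b4] at b1
    have b5 : l * tailMass ps l = θ * ((l / θ * ((θ - 1) * tailMass ps l)) / (θ - 1)) := by field_simp
    rw [b5]
    have := b3.trans b1
    gcongr
  have hloC : lo ≤ C := by
    refine (hQlo M le_rfl).trans ?_
    have := (hQ M (le_max_left _ _)).2
    rwa [le_div_iff₀ hM0, mul_comm] at this
  have hρ0 : 0 ≤ ρ θ - 1 := by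
    rw [sub_nonneg, one_le_div hm]; nlinarith
  have hdiff : θ * ((L + δ) / (v - e θ) * κ / (θ - 1)) - lo
      = (ρ θ - 1) * lo + 2 * δ * (θ * κ / ((v - e θ) * (θ - 1))) := by
    rw [hlod]; simp only [hρ]; field_simp; ring
  refine ⟨lo, ?_⟩
  filter_upwards [eventually_ge_atTop (θ * M)] with l hl
  have c1 := hQlo l (by nlinarith)
  have c2 := hQhi l hl
  have c3 := mul_le_mul_of_nonneg_left hloC hρ0
  rw [abs_of_nonneg (by linarith)]
  linarith

end LimSol

/-- Integration by parts against a primitive of an integrable function. -/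
lemma integral_mul_primitive {P P' f : ℝ → ℝ} {a b : ℝ} (hP : ∀ x, HasDerivAt P (P' x) x) (hP' : Continuous P')
    (hf : IntervalIntegrable f volume a b) :
    ∫ x in a..b, P x * f x = P b * (∫ x in a..b, f x) - ∫ x in a..b, P' x * ∫ y in a..x, f y := by
  have hc : a ∈ uIcc a b := left_mem_uIcc
  have hF := hf.absolutelyContinuousOnInterval_intervalIntegral hc
  have hcd : ContDiff ℝ 1 P := by
    rw [contDiff_one_iff_deriv]
    refine ⟨fun x => (hP x).differentiableAt, ?_⟩
    have : deriv P = P' := funext fun x => (hP x).deriv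
    rwa [this]
  have hPa : AbsolutelyContinuousOnInterval P a b := hcd.contDiffOn.absolutelyContinuousOnInterval
  have h := hPa.integral_mul_deriv_eq_deriv_mul hF
  have e1 : ∫ x in a..b, P x * deriv (fun x => ∫ y in a..x, f y) x = ∫ x in a..b, P x * f x := by
    refine intervalIntegral.integral_congr_ae ?_
    filter_upwards [hf.ae_hasDerivAt_integral] with x hx hxm
    rw [(hx (uIoc_subset_uIcc hxm) a hc).deriv]
  have e2 : ∫ x in a..b, deriv P x * (∫ y in a..x, f y) = ∫ x in a..b, P' x * ∫ y in a..x, f y :=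
    intervalIntegral.integral_congr fun x _ => by simp only [(hP x).deriv]
  rw [e1, e2] at h
  rw [h]
  simp

/-- Nonnegative densities whose primitives converge converge weakly. -/
lemma weak_tendsto {n : ℝ → ℝ → ℝ} {ν : ℝ → ℝ} {a b : ℝ} (hab : a ≤ b)
    (h0 : ∀ᶠ l in atTop, ∀ x ∈ Icc a b, 0 ≤ n l x) (hi : ∀ᶠ l in atTop, IntervalIntegrable (n l) volume a b)
    (hν0 : ∀ x ∈ Icc a b, 0 ≤ ν x) (hν : IntervalIntegrable ν volume a b)
    (hlim : ∀ c ∈ Icc a b, Tendsto (fun l => ∫ x in a..c, n l x) atTop (𝓝 (∫ x in a..c, ν x)))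
    {g : ℝ → ℝ} (hg : ContinuousOn g (Icc a b)) :
    Tendsto (fun l => ∫ x in a..b, g x * n l x) atTop (𝓝 (∫ x in a..b, g x * ν x)) := by
  set m := ∫ x in a..b, ν x with hm
  have hm0 : 0 ≤ m := intervalIntegral.integral_nonneg hab hν0
  have hbb := hlim b ⟨hab, le_rfl⟩
  have hle : ∀ᶠ l in atTop, ∫ x in a..b, n l x ≤ m + 1 := by
    filter_upwards [hbb.eventually (Metric.ball_mem_nhds _ one_pos)] with l hl
    rw [Real.dist_eq] at hl
    have := (abs_lt.1 hl).2
    linarith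
  have hpoly : ∀ P P' : ℝ → ℝ, (∀ x, HasDerivAt P (P' x) x) → Continuous P' →
      Tendsto (fun l => ∫ x in a..b, P x * n l x) atTop (𝓝 (∫ x in a..b, P x * ν x)) := by
    intro P P' hP hP'
    rw [integral_mul_primitive hP hP' hν]
    have : Tendsto (fun l => P b * (∫ x in a..b, n l x) - ∫ x in a..b, P' x * ∫ y in a..x, n l y) atTop
        (𝓝 (P b * (∫ x in a..b, ν x) - ∫ x in a..b, P' x * ∫ y in a..x, ν y)) := by
      refine (hbb.const_mul _).sub ?_
      obtain ⟨C, hC⟩ := isCompact_Icc.exists_bound_of_continuousOn (s := Icc a b) hP'.continuousOn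
      refine intervalIntegral.tendsto_integral_filter_of_dominated_convergence (fun _ => C * (m + 1)) ?_ ?_
        intervalIntegrable_const ?_
      · filter_upwards [hi] with l hl
        have h1 := intervalIntegral.continuousOn_primitive_interval' hl left_mem_uIcc
        exact ((hP'.continuousOn.mul h1).mono uIoc_subset_uIcc).aestronglyMeasurable measurableSet_uIoc
      · filter_upwards [hi, h0, hle] with l hl hl0 hll
        refine ae_of_all _ fun x hx => ?_
        rw [uIoc_of_le hab] at hx
        have hx' : x ∈ Icc a b := ⟨hx.1.le, hx.2⟩
        have p0 : 0 ≤ ∫ y in a..x, n l y :=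
          intervalIntegral.integral_nonneg hx'.1 fun y hy => hl0 y ⟨hy.1, hy.2.trans hx'.2⟩
        have p1 : ∫ y in a..x, n l y ≤ ∫ y in a..b, n l y := by
          have hs1 : IntervalIntegrable (n l) volume a x := hl.mono_set (by
            rw [uIcc_of_le hx'.1, uIcc_of_le hab]; exact Icc_subset_Icc_right hx'.2)
          have hs2 : IntervalIntegrable (n l) volume x b := hl.mono_set (by
            rw [uIcc_of_le hx'.2, uIcc_of_le hab]; exact Icc_subset_Icc_left hx'.1)
          have := intervalIntegral.integral_add_adjacent_intervals hs1 hs2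
          have p2 : 0 ≤ ∫ y in x..b, n l y :=
            intervalIntegral.integral_nonneg hx'.2 fun y hy => hl0 y ⟨hx'.1.trans hy.1, hy.2⟩
          linarith
        rw [norm_mul, Real.norm_eq_abs (∫ y in a..x, n l y), abs_of_nonneg p0]
        exact mul_le_mul (hC x hx') (p1.trans hll) p0 ((norm_nonneg _).trans (hC x hx'))
      · refine ae_of_all _ fun x hx => ?_
        rw [uIoc_of_le hab] at hx
        exact (hlim x ⟨hx.1.le, hx.2⟩).const_mul _
    refine this.congr' ?_
    filter_upwards [hi] with l hl
    rw [integral_mul_primitive hP hP' hl]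
  rw [Metric.tendsto_nhds]
  intro ε hε
  set δ := ε / (4 * (m + 1)) with hδ
  have hδ0 : 0 < δ := by positivity
  obtain ⟨P, hP⟩ := exists_polynomial_near_of_continuousOn a b g hg δ hδ0
  have hPl := hpoly (fun x => P.eval x) (fun x => P.derivative.eval x) (fun x => P.hasDerivAt x)
    P.derivative.continuous
  have near : ∀ f : ℝ → ℝ, IntervalIntegrable f volume a b → (∀ x ∈ Icc a b, 0 ≤ f x) → ∫ x in a..b, f x ≤ m + 1 →
      |(∫ x in a..b, g x * f x) - ∫ x in a..b, P.eval x * f x| ≤ ε / 4 := by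
    intro f hf hf0 hfm
    have hg' : ContinuousOn g (uIcc a b) := by rwa [uIcc_of_le hab]
    rw [← intervalIntegral.integral_sub (hf.continuousOn_mul hg') (hf.continuousOn_mul P.continuous.continuousOn)]
    have h1 : ‖∫ x in a..b, (g x * f x - P.eval x * f x)‖ ≤ ∫ x in a..b, δ * f x := by
      refine intervalIntegral.norm_integral_le_of_norm_le hab (ae_of_all _ fun x hx => ?_) (hf.const_mul _)
      have hx' : x ∈ Icc a b := ⟨hx.1.le, hx.2⟩
      rw [← sub_mul, norm_mul, Real.norm_eq_abs, Real.norm_eq_abs, abs_of_nonneg (hf0 x hx'), abs_sub_comm]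
      exact mul_le_mul_of_nonneg_right (hP x hx').le (hf0 x hx')
    rw [intervalIntegral.integral_const_mul] at h1
    refine h1.trans ?_
    calc δ * ∫ x in a..b, f x ≤ δ * (m + 1) := mul_le_mul_of_nonneg_left hfm hδ0.le
      _ = ε / 4 := by rw [hδ]; field_simp
  have nν := near ν hν hν0 (by linarith)
  filter_upwards [hPl.eventually (Metric.ball_mem_nhds _ (by positivity : (0:ℝ) < ε / 4)), h0, hi, hle] with l hl hl0 hli hll
  have nl := near (n l) hli hl0 hll
  rw [Real.dist_eq] at hl ⊢
  rw [abs_lt] at *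
  rw [abs_le] at nν nl
  constructor <;> linarith [nν.1, nν.2, nl.1, nl.2, hl.1, hl.2]

lemma integral_inv_sq {a b : ℝ} (ha : 0 < a) (hab : a ≤ b) : ∫ x in a..b, 1 / x ^ 2 = 1 / a - 1 / b := by
  have h : ∀ x ∈ uIcc a b, HasDerivAt (fun x : ℝ => -(1 / x)) (1 / x ^ 2) x := by
    intro x hx
    rw [uIcc_of_le hab] at hx
    have : x ≠ 0 := (ha.trans_le hx.1).ne'
    simp only [one_div]
    exact (hasDerivAt_inv this).neg.congr_deriv (by simp)
  rw [intervalIntegral.integral_eq_sub_of_hasDerivAt h]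
  · ring
  · refine ContinuousOn.intervalIntegrable fun x hx => ?_
    rw [uIcc_of_le hab] at hx
    have : x ≠ 0 := (ha.trans_le hx.1).ne'
    exact (continuousAt_const.div (continuousAt_id.pow 2) (pow_ne_zero _ this)).continuousWithinAt

namespace LimSol
variable {α β ustar : ℝ} {u p w : ℝ → ℝ → ℝ} {ps V : ℝ → ℝ} {t₀ t₁ : ℝ} {χ χ' : ℝ → ℝ}

lemma ps_integrableOn (h : LimSol α β ustar u p w ps V) (a : ℝ) : IntegrableOn ps (Ioi a) := by
  obtain ⟨C, -, Λ, -, hC⟩ := h.tail_bound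
  have h1 := (hC (max Λ a) (le_max_left _ _)).1
  have h2 := (intervalIntegrable_iff_integrableOn_Ioc_of_le (le_max_right Λ a)).1 (h.ps_intervalIntegrable a (max Λ a))
  rw [← Ioc_union_Ioi_eq_Ioi (le_max_right Λ a)]
  exact h2.union h1

/-- Interval masses of the rescaled precipitation density. -/
lemma mass_tendsto (h : LimSol α β ustar u p w ps V) {γ : ℝ} (hγ : Tendsto (fun x => x * tailMass ps x) atTop (𝓝 γ))
    {a b : ℝ} (ha : 0 < a) (hab : a ≤ b) :
    Tendsto (fun l => ∫ x in a..b, l ^ 2 * ps (l * x)) atTop (𝓝 (∫ x in a..b, γ / x ^ 2)) := by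
  have e : ∫ x in a..b, γ / x ^ 2 = γ * (1 / a) - γ * (1 / b) := by
    rw [← mul_sub, ← integral_inv_sq ha hab, ← intervalIntegral.integral_const_mul]
    exact intervalIntegral.integral_congr fun x _ => by simp only [mul_one_div]
  rw [e]
  have hs : ∀ c, 0 < c → Tendsto (fun l => l * tailMass ps (l * c)) atTop (𝓝 (γ * (1 / c))) := by
    intro c hc
    refine ((hγ.comp (tendsto_id.atTop_mul_const hc)).mul_const (1 / c)).congr fun l => ?_
    simp only [Function.comp_apply, id]
    field_simp
  refine ((hs a ha).sub (hs b (ha.trans_le hab))).congr' ?_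
  filter_upwards [eventually_ge_atTop (0:ℝ)] with l hl
  rw [ps_integral_rescale, ← tailMass_sub (h.ps_integrableOn _) (mul_le_mul_of_nonneg_left hab hl)]
  ring

/-- The averaged second moment has the same limit as the rescaled tail. -/
lemma moment_tendsto (h : LimSol α β ustar u p w ps V) {γ : ℝ} (hγ : Tendsto (fun x => x * tailMass ps x) atTop (𝓝 γ)) :
    Tendsto (fun x => (1 / x) * ∫ ξ in (0:ℝ)..x, ξ ^ 2 * ps ξ) atTop (𝓝 γ) := by
  have hi := h.ps_integrableOn 0
  have hQc := h.tailMass_continuousOn hi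
  obtain ⟨C, hC0, Λ, hΛ, hC⟩ := h.tail_bound
  have hq0 := tailMass_nonneg (f := ps) h.q_nonneg
  set K := max C (Λ * tailMass ps 0) with hK
  have hgb : ∀ x, 0 ≤ x → x * tailMass ps x ≤ K := by
    intro x hx
    rcases le_total Λ x with hx1 | hx1
    · refine le_trans ?_ (le_max_left _ _)
      have := (hC x hx1).2
      rw [le_div_iff₀ (hΛ.trans_le hx1)] at this
      rw [mul_comm]; exact this
    · exact (mul_le_mul hx1 (tailMass_anti h.q_nonneg hi hx) (hq0 _) hΛ.le).trans (le_max_right _ _)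
  have hav : Tendsto (fun x => ∫ σ in (0:ℝ)..1, (x * σ) * tailMass ps (x * σ)) atTop (𝓝 (∫ σ in (0:ℝ)..1, γ)) := by
    refine intervalIntegral.tendsto_integral_filter_of_dominated_convergence (fun _ => K) ?_ ?_
      intervalIntegrable_const ?_
    · filter_upwards [eventually_ge_atTop (0:ℝ)] with x hx
      have : ContinuousOn (fun σ => (x * σ) * tailMass ps (x * σ)) (Ici 0) :=
        (by fun_prop : Continuous fun σ => x * σ).continuousOn.mul
          (hQc.comp (by fun_prop : Continuous fun σ => x * σ).continuousOn fun σ hσ => mul_nonneg hx hσ)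
      rw [uIoc_of_le zero_le_one]
      exact (this.mono fun y hy => hy.1.le).aestronglyMeasurable measurableSet_Ioc
    · filter_upwards [eventually_ge_atTop (0:ℝ)] with x hx
      refine ae_of_all _ fun σ hσ => ?_
      rw [uIoc_of_le zero_le_one] at hσ
      have := mul_nonneg hx hσ.1.le
      rw [Real.norm_eq_abs, abs_of_nonneg (mul_nonneg this (hq0 _))]
      exact hgb _ this
    · refine ae_of_all _ fun σ hσ => ?_
      rw [uIoc_of_le zero_le_one] at hσ
      exact hγ.comp (tendsto_id.atTop_mul_const hσ.1)
  have := (hav.const_mul 2).sub hγ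
  simp only [intervalIntegral.integral_const, sub_zero, one_smul] at this
  rw [show 2 * γ - γ = γ by ring] at this
  refine this.congr' ?_
  filter_upwards [eventually_gt_atTop (0:ℝ)] with x hx
  have hp := integral_mul_primitive (P := fun ξ => ξ ^ 2) (P' := fun ξ => 2 * ξ) (fun ξ => by
    simpa using hasDerivAt_pow 2 ξ) (by fun_prop) (h.ps_intervalIntegrable 0 x)
  have hF : ∀ y, 0 ≤ y → ∫ s in (0:ℝ)..y, ps s = tailMass ps 0 - tailMass ps y := fun y hy => (tailMass_sub hi hy).symm
  have e1 : ∫ ξ in (0:ℝ)..x, 2 * ξ * ∫ y in (0:ℝ)..ξ, ps y =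
      tailMass ps 0 * x ^ 2 - 2 * ∫ ξ in (0:ℝ)..x, ξ * tailMass ps ξ := by
    have hitg : IntervalIntegrable (fun ξ => ξ * tailMass ps ξ) volume 0 x := by
      refine ContinuousOn.intervalIntegrable ?_
      rw [uIcc_of_le hx.le]
      exact continuousOn_id.mul (hQc.mono fun y hy => hy.1)
    have : ∫ ξ in (0:ℝ)..x, 2 * ξ * ∫ y in (0:ℝ)..ξ, ps y =
        ∫ ξ in (0:ℝ)..x, ((2 * tailMass ps 0) * ξ - 2 * (ξ * tailMass ps ξ)) := by
      refine intervalIntegral.integral_congr fun ξ hξ => ?_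
      rw [uIcc_of_le hx.le] at hξ
      simp only [hF ξ hξ.1]
      ring
    rw [this, intervalIntegral.integral_sub ((by fun_prop : Continuous fun ξ : ℝ => (2 * tailMass ps 0) * ξ).intervalIntegrable _ _)
      (hitg.const_mul _), intervalIntegral.integral_const_mul, intervalIntegral.integral_const_mul, integral_id]
    ring
  have e2 : ∫ σ in (0:ℝ)..1, (x * σ) * tailMass ps (x * σ) = (1 / x) * ∫ ξ in (0:ℝ)..x, ξ * tailMass ps ξ := by
    rw [intervalIntegral.integral_comp_mul_left (fun ξ => ξ * tailMass ps ξ) hx.ne']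
    simp
  rw [hp, e1, hF x hx.le, e2]
  field_simp
  ring

end LimSol

namespace LimSol
variable {α β ustar : ℝ} {u p w : ℝ → ℝ → ℝ} {ps V : ℝ → ℝ} {t₀ t₁ : ℝ} {χ χ' : ℝ → ℝ}

lemma lower_unif (h : LimSol α β ustar u p w ps V) {a : ℝ} (ha : 0 < a) : ∃ K, 0 ≤ K ∧ ∀ τ, 0 < τ → τ ≤ 1 / 2 →
    ∀ R, ∀ ε > 0, ∀ᶠ l in atTop, ∀ x ∈ Icc a R,
      (∫ y, hk (x - y) τ * V (y / Real.sqrt (1 - τ))) - K * Real.sqrt τ - ε ≤ u (l * x) (l ^ 2) := by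
  obtain ⟨C, hC0, Λ, hΛ, hC⟩ := h.tail_bound
  set M := C / (a / 2) with hM
  have hM0 : 0 ≤ M := by positivity
  have hΨ := PsiP_pos h.hα h.hβ α
  set K := 4 * PsiP α β α * M + 16 / a ^ 2
        * (PsiP α β α * (Real.sqrt (8 * Real.pi) * Real.exp ((a / 2) ^ 2 / 4))) with hK
  refine ⟨K * Real.sqrt 2, by positivity, fun τ h0 h1 R ε hε => ?_⟩
  have hc := conv_tendstoUniformlyOn (L := atTop) (g := fun (l : ℝ) y => u (l * y) (l ^ 2 * (1 - τ)))
    (g₀ := fun y => V (y / Real.sqrt (1 - τ))) h0 (fun l => ?_) (C := PsiP α β α)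
    (Eventually.of_forall fun l y => h.u_abs_le _ _) ?_ (fun y => h.V_abs_le _) (h.tendsto_slice (by linarith)) R
    ε hε
  · filter_upwards [hc, eventually_gt_atTop (0:ℝ), eventually_ge_atTop (Λ / (a / 2))] with l hl hl0 hlΛ x hx
    have hm : ∫ y in Ioi (a / 2), l ^ 2 * ps (l * y) ≤ M := by
      rw [integral_const_mul, integral_comp_mul_left_Ioi ps (a / 2) hl0]
      rw [div_le_iff₀ (by positivity)] at hlΛ
      have := (hC _ hlΛ).2
      calc l ^ 2 * (l⁻¹ • ∫ y in Ioi (l * (a / 2)), ps y) = l * ∫ y in Ioi (l * (a / 2)), ps y := by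
            rw [smul_eq_mul]; field_simp
        _ ≤ l * (C / (l * (a / 2))) := mul_le_mul_of_nonneg_left this hl0.le
        _ = M := by rw [hM]; field_simp
    have hi : IntegrableOn (fun y => l ^ 2 * ps (l * y)) (Ioi (a / 2)) := by
      have := (integrableOn_Ioi_comp_mul_left_iff ps (a / 2) hl0).2 (h.ps_integrableOn _)
      exact this.const_mul _
    have := (h.sys_scale hl0).lower ha hx.1 h0 h1 hi hm
    rw [mul_one, ← hK, Real.sqrt_mul zero_le_two, ← mul_assoc] at this
    have h2 := (abs_le.1 (hl x (by rw [abs_of_pos (ha.trans_le hx.1)]; exact hx.2))).1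
    linarith
  · exact (h.u_measurable.comp (by fun_prop : Measurable fun y : ℝ => (l * y, l ^ 2 * (1 - τ)))).aestronglyMeasurable
  · exact (h.V_meas.comp (by fun_prop)).aestronglyMeasurable

/-- Locally uniform approximation away from the origin. -/
lemma near_unif (h : LimSol α β ustar u p w ps V) {a : ℝ} (ha : 0 < a) (R : ℝ) {ε : ℝ} (hε : 0 < ε) :
    ∃ g : ℝ → ℝ, ∀ᶠ l in atTop, ∀ x ∈ Icc a R, |u (l * x) (l ^ 2) - g x| ≤ ε := by
  obtain ⟨K, hK0, hK⟩ := h.lower_unif ha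
  set K' := psiC α β * (2 * hkMoment + 2 * |R|) with hK'
  have hK'0 : 0 ≤ K' := by
    have := psiC_pos h.hα h.hβ
    have := hkMoment_nonneg
    positivity
  set δ := ε / (2 * (K + K' + 1)) with hδ
  have hδ0 : 0 < δ := by positivity
  set τ := min (1 / 2) (δ ^ 2) with hτ
  have h0 : 0 < τ := lt_min (by norm_num) (by positivity)
  have h1 : τ ≤ 1 / 2 := min_le_left _ _
  have hs : Real.sqrt τ ≤ δ := by
    rw [← Real.sqrt_sq hδ0.le]
    exact Real.sqrt_le_sqrt (min_le_right _ _)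
  have hs2 : (K + K') * Real.sqrt τ ≤ ε / 2 := by
    calc (K + K') * Real.sqrt τ ≤ (K + K' + 1) * δ :=
          mul_le_mul (by linarith) hs (Real.sqrt_nonneg _) (by linarith)
      _ = ε / 2 := by rw [hδ]; field_simp
  have hKs : K * Real.sqrt τ ≤ (K + K') * Real.sqrt τ :=
    mul_le_mul_of_nonneg_right (by linarith) (Real.sqrt_nonneg _)
  have hKs' : K' * Real.sqrt τ ≤ (K + K') * Real.sqrt τ :=
    mul_le_mul_of_nonneg_right (by linarith) (Real.sqrt_nonneg _)
  refine ⟨fun x => ∫ y, hk (x - y) τ * V (y / Real.sqrt (1 - τ)), ?_⟩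
  filter_upwards [hK τ h0 h1 R (ε / 2) (by positivity), h.upper_unif h0 h1 |R| (ε := ε / 2) (by positivity)]
    with l hl1 hl2 x hx
  have e1 := hl1 x hx
  have e2 := hl2 x (by rw [abs_of_pos (ha.trans_le hx.1)]; exact hx.2.trans (le_abs_self _))
  rw [abs_le]
  constructor <;> linarith

end LimSol

/-- A normalised solution whose parabolic rescalings converge locally uniformly away from the origin. -/
structure UnifSol (α β ustar : ℝ) (u p w : ℝ → ℝ → ℝ) (ps V : ℝ → ℝ) : Prop
    extends LimSol α β ustar u p w ps V where
  V_zero : V 0 = 0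
  unif : ∀ a > 0, ∀ R, ∀ ε > 0, ∀ᶠ l in atTop, ∀ x ∈ Icc a R, |u (l * x) (l ^ 2) - V x| ≤ ε

lemma LimSol.exists_unifSol {α β ustar : ℝ} {u p w : ℝ → ℝ → ℝ} {ps V₀ : ℝ → ℝ}
    (h : LimSol α β ustar u p w ps V₀) : ∃ V, UnifSol α β ustar u p w ps V ∧ ∀ᵐ η, V η = V₀ η := by
  have hpt : ∀ x, 0 < x → ∃ y, Tendsto (fun l => u (l * x) (l ^ 2)) atTop (𝓝 y) := by
    intro x hx
    refine cauchy_map_iff_exists_tendsto.1 (Metric.cauchy_iff.2 ⟨inferInstance, fun ε hε => ?_⟩)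
    obtain ⟨g, hg⟩ := h.near_unif hx x (ε := ε / 4) (by positivity)
    refine ⟨_, image_mem_map hg, ?_⟩
    rintro _ ⟨l, hl, rfl⟩ _ ⟨l', hl', rfl⟩
    have e1 := abs_le.1 (hl x ⟨le_rfl, le_rfl⟩)
    have e2 := abs_le.1 (hl' x ⟨le_rfl, le_rfl⟩)
    rw [Real.dist_eq, abs_lt]
    constructor <;> linarith [e1.1, e1.2, e2.1, e2.2]
  set V : ℝ → ℝ := fun x => if x = 0 then 0 else limUnder atTop (fun l => u (l * |x|) (l ^ 2)) with hV
  have hVlim : ∀ x, x ≠ 0 → Tendsto (fun l => u (l * x) (l ^ 2)) atTop (𝓝 (V x)) := by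
    intro x hx
    have h1 := (hpt |x| (abs_pos.2 hx))
    have h2 := tendsto_nhds_limUnder h1
    simp only [hV, if_neg hx]
    refine h2.congr fun l => ?_
    rcases abs_choice x with h2 | h2 <;> rw [h2]
    rw [mul_neg, h.u_even]
  have hV0 : V 0 = 0 := by simp [hV]
  have heven : ∀ x, V (-x) = V x := by intro x; simp [hV]
  have hunif : ∀ a > 0, ∀ R, ∀ ε > 0, ∀ᶠ l in atTop, ∀ x ∈ Icc a R, |u (l * x) (l ^ 2) - V x| ≤ ε := by
    intro a ha R ε hε
    obtain ⟨g, hg⟩ := h.near_unif ha R (ε := ε / 2) (by positivity)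
    filter_upwards [hg] with l hl x hx
    have e1 := abs_le.1 (hl x hx)
    have e2 : |V x - g x| ≤ ε / 2 := by
      refine le_of_tendsto ((hVlim x (ha.trans_le hx.1).ne').sub_const (g x)).abs ?_
      filter_upwards [hg] with l' hl' using hl' x hx
    have e3 := abs_le.1 e2
    rw [abs_le]
    constructor <;> linarith [e1.1, e1.2, e3.1, e3.2]
  have hae : ∀ᵐ η, V η = V₀ η := by
    filter_upwards [h.lim, (measure_eq_zero_iff_ae_notMem.1 (measure_singleton (μ := volume) (0:ℝ)))] with η h1 h2
    exact tendsto_nhds_unique (hVlim η h2) h1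
  have hmeas : Measurable V := by
    have hd : V = fun x => if x = 0 then 0 else limsup (fun n : ℕ => u (n * x) ((n:ℝ) ^ 2)) atTop := by
      funext x
      by_cases hx : x = 0
      · simp [hV, hx]
      · rw [if_neg hx]
        exact ((hVlim x hx).comp tendsto_natCast_atTop_atTop).limsup_eq.symm
    rw [hd]
    refine Measurable.ite (measurableSet_singleton 0) measurable_const (Measurable.limsup fun n => ?_)
    exact h.u_measurable.comp (by fun_prop : Measurable fun η : ℝ => ((n:ℝ) * η, (n:ℝ) ^ 2))
  have hnn : ∀ η, 0 ≤ V η := by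
    intro η
    by_cases hη : η = 0
    · rw [hη, hV0]
    · exact ge_of_tendsto' (hVlim η hη) fun l => h.u_nonneg _ _
  have hle : ∀ η, V η ≤ PsiP α β |η| := by
    intro η
    by_cases hη : η = 0
    · rw [hη, hV0]; exact (PsiP_pos h.hα h.hβ _).le
    · have t := hVlim |η| (abs_ne_zero.2 hη)
      rw [show V |η| = V η from apply_abs_of_even heven η] at t
      refine le_of_tendsto t ?_
      filter_upwards [eventually_gt_atTop (0:ℝ)] with l hl using h.u_le_PsiP hl (abs_nonneg _)
  refine ⟨V, ⟨⟨h.toNormalSol, hmeas, hnn, hle, heven, ?_⟩, hV0, hunif⟩, hae⟩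
  filter_upwards [(measure_eq_zero_iff_ae_notMem.1 (measure_singleton (μ := volume) (0:ℝ)))] with η h2
  exact hVlim η h2

namespace UnifSol
variable {α β ustar : ℝ} {u p w : ℝ → ℝ → ℝ} {ps V : ℝ → ℝ} {t₀ t₁ : ℝ} {χ χ' : ℝ → ℝ}

lemma good (h : UnifSol α β ustar u p w ps V) {x : ℝ} (hx : 0 < x) :
    Tendsto (fun l => u (l * x) (l ^ 2)) atTop (𝓝 (V x)) := by
  rw [Metric.tendsto_nhds]
  intro ε hε
  filter_upwards [h.unif x hx x (ε / 2) (by positivity)] with l hl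
  rw [Real.dist_eq]
  linarith [hl x ⟨le_rfl, le_rfl⟩]

lemma V_continuousOn (h : UnifSol α β ustar u p w ps V) : ContinuousOn V (Ioi 0) := by
  intro x hx
  have hx : 0 < x := hx
  refine ContinuousAt.continuousWithinAt ?_
  have hU : TendstoUniformlyOn (fun (l : ℝ) y => u (l * y) (l ^ 2)) V atTop (Icc (x / 2) (2 * x)) := by
    rw [Metric.tendstoUniformlyOn_iff]
    intro ε hε
    filter_upwards [h.unif (x / 2) (by positivity) (2 * x) (ε / 2) (by positivity)] with l hl y hy
    rw [dist_comm, Real.dist_eq]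
    linarith [hl y hy]
  have hc : ContinuousOn V (Icc (x / 2) (2 * x)) := by
    refine hU.continuousOn (Frequently.of_forall fun l => ?_)
    exact ((h.u_slice_continuous (l ^ 2)).comp (continuous_const_mul l)).continuousOn
  exact hc.continuousAt (Icc_mem_nhds (by linarith) (by linarith))

/-- Uniform convergence of rescaled solutions along similarity variables. -/
lemma unif_time (h : UnifSol α β ustar u p w ps V) (hb : TimeBump t₀ t₁ χ χ') {a R ε : ℝ} (ha : 0 < a) (hε : 0 < ε) :
    ∀ᶠ l in atTop, ∀ x ∈ Icc a R, ∀ t ≥ t₀, |u (l * (x * Real.sqrt t)) (l ^ 2 * t) - V x| ≤ ε := by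
  have hs := Real.sqrt_pos.2 hb.pos
  obtain ⟨Λ, hΛ⟩ := eventually_atTop.1 (h.unif a ha R ε hε)
  filter_upwards [eventually_ge_atTop (Λ / Real.sqrt t₀), eventually_ge_atTop (0:ℝ)] with l hl hl0 x hx t ht
  have h1 : Λ ≤ l * Real.sqrt t := by
    rw [div_le_iff₀ hs] at hl
    exact hl.trans (mul_le_mul_of_nonneg_left (Real.sqrt_le_sqrt ht) hl0)
  have := hΛ _ h1 x hx
  rwa [mul_pow, Real.sq_sqrt (hb.pos.le.trans ht), mul_assoc, mul_comm (Real.sqrt t)] at this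

end UnifSol

namespace UnifSol
variable {α β ustar : ℝ} {u p w : ℝ → ℝ → ℝ} {ps V : ℝ → ℝ} {t₀ t₁ : ℝ} {χ χ' : ℝ → ℝ}

lemma V_outer_le (h : UnifSol α β ustar u p w ps V) {x : ℝ} (hx : α ≤ x) : V x * gtail α ≤ V α * gtail x := by
  rcases hx.eq_or_lt with rfl | hx
  · exact le_rfl
  have := h.decay h.hα hx (h.good h.hα) (h.good (h.hα.trans hx))
  rw [PsiP_of_ge hx.le, PsiP_of_ge le_rfl] at this
  nlinarith

lemma V_alpha_le (h : UnifSol α β ustar u p w ps V) : V α ≤ ustar := by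
  by_contra! hlt
  have hα := h.hα
  have hc : ContinuousAt V α := h.V_continuousOn.continuousAt (Ioi_mem_nhds hα)
  obtain ⟨a, ha, haV⟩ := ((hc.eventually (lt_mem_nhds hlt)).filter_mono (nhdsWithin_le_nhds (s := Ioi α))).and
    self_mem_nhdsWithin |>.exists
  have haV : α < a := haV
  have ha0 : 0 < a := hα.trans haV
  obtain ⟨Λ, hΛ⟩ := eventually_atTop.1 ((h.good ha0).eventually (lt_mem_nhds ha))
  set X := max (Λ * a) 1 with hX
  have hone : ∀ᵐ x, X ≤ x → ps x = 1 := by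
    filter_upwards [h.p_eq] with x hx hxX
    have hx0 : 0 < x := lt_of_lt_of_le one_pos ((le_max_right _ _).trans hxX)
    have h1 : Λ ≤ x / a := by
      rw [le_div_iff₀ ha0]; exact (le_max_left _ _).trans hxX
    have h2 := hΛ _ h1
    rw [div_mul_cancel₀ _ ha0.ne', div_pow] at h2
    have h3 : x ^ 2 / a ^ 2 < x ^ 2 / α ^ 2 := by gcongr
    rw [← hx (x ^ 2 / α ^ 2 + 1) (by linarith)]
    exact h.p_one x _ _ (by positivity) (by linarith) h2
  have hi := h.ps_integrableOn X
  have : IntegrableOn (fun _ : ℝ => (1:ℝ)) (Ioi X) := by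
    refine hi.congr ?_
    rw [EventuallyEq, ae_restrict_iff' measurableSet_Ioi]
    filter_upwards [hone] with x hx hxX using hx (le_of_lt hxX)
  rw [integrableOn_const_iff] at this
  simp at this

lemma eventually_lt (h : UnifSol α β ustar u p w ps V) {a : ℝ} (ha : 0 < a) (hα : a ≤ α) {c : ℝ}
    (hc : ∀ x ∈ Icc a α, V x ≤ c) {ε : ℝ} (hε : 0 < ε) :
    ∃ Λ, ∀ l ≥ Λ, ∀ η ≥ a, u (l * η) (l ^ 2) ≤ c + ε := by
  have hc0 : 0 ≤ c := (h.V_nonneg α).trans (hc α ⟨hα, le_rfl⟩)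
  obtain ⟨R, hR⟩ := (((PsiP_tendsto (α := α) (β := β)).eventually (gt_mem_nhds hε)).and
    (eventually_ge_atTop a)).exists
  obtain ⟨Λ, hΛ⟩ := eventually_atTop.1 (h.unif a ha R ε hε)
  have hgα := gtail_pos α
  refine ⟨max Λ 1, fun l hl η hη => ?_⟩
  have hl0 : 0 < l := lt_of_lt_of_le one_pos ((le_max_right _ _).trans hl)
  rcases le_total η R with h1 | h1
  · have h2 := (abs_le.1 (hΛ l ((le_max_left _ _).trans hl) η ⟨hη, h1⟩)).2
    have h3 : V η ≤ c := by
      rcases le_total η α with h4 | h4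
      · exact hc η ⟨hη, h4⟩
      · have h5 := h.V_outer_le h4
        have h6 : gtail η ≤ gtail α := gtail_strictAnti.antitone h4
        have h7 := hc α ⟨hα, le_rfl⟩
        have h8 := h.V_nonneg α
        have : V η * gtail α ≤ c * gtail α := by nlinarith
        exact le_of_mul_le_mul_right this hgα
    linarith
  · have h2 := h.u_le_PsiP hl0 (ha.le.trans hη)
    have h3 := PsiP_antitone h.hα h.hβ h1
    linarith [hR.1]

/-- Ahead of the parabola there is eventually no precipitate. -/
lemma p_zero_outer (h : UnifSol α β ustar u p w ps V) {a : ℝ} (ha : α < a) :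
    ∃ X, ∀ x ≥ X, ∀ t ≤ x ^ 2 / a ^ 2, p x t = 0 := by
  have hα := h.hα
  have hgα := gtail_pos α
  have ha0 := hα.trans ha
  set c := ustar * gtail a / gtail α with hc
  have hcl : c < ustar := by
    rw [hc, div_lt_iff₀ hgα]
    exact mul_lt_mul_of_pos_left (gtail_strictAnti ha) h.hu
  obtain ⟨R, hR⟩ := (((PsiP_tendsto (α := α) (β := β)).eventually (gt_mem_nhds h.hu)).and
    (eventually_ge_atTop a)).exists
  set ε := min ((ustar - c) / 2) (ustar - PsiP α β R) with hεd
  have hε : 0 < ε := lt_min (by linarith) (by linarith [hR.1])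
  obtain ⟨Λ, hΛ⟩ := eventually_atTop.1 (h.unif a ha0 R ((ustar - c) / 2) (by linarith))
  obtain ⟨X, -, hX⟩ := h.p_eventually_zero (Λ := max Λ 1) ha0 hε fun l hl η hη => by
    have hl0 : 0 < l := lt_of_lt_of_le one_pos ((le_max_right _ _).trans hl)
    rcases le_total η R with h1 | h1
    · have h2 := (abs_le.1 (hΛ l ((le_max_left _ _).trans hl) η ⟨hη, h1⟩)).2
      have h3 : V η ≤ c := by
        rw [hc, le_div_iff₀ hgα]
        refine (h.V_outer_le (ha.le.trans hη)).trans ?_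
        exact mul_le_mul h.V_alpha_le (gtail_strictAnti.antitone hη) (gtail_nonneg _) h.hu.le
      have := min_le_left ((ustar - c) / 2) (ustar - PsiP α β R)
      linarith
    · have h2 := h.u_le_PsiP hl0 (ha0.le.trans hη)
      have h3 := PsiP_antitone h.hα h.hβ h1
      have := min_le_right ((ustar - c) / 2) (ustar - PsiP α β R)
      linarith
  exact ⟨X, hX⟩

/-- The profile beyond the parabola. -/
lemma V_outer (h : UnifSol α β ustar u p w ps V) {x : ℝ} (hx : α ≤ x) : V x * gtail α = V α * gtail x := by
  have hα := h.hα
  refine le_antisymm (h.V_outer_le hx) ?_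
  have aux : ∀ a b, α < a → a < b → V a * gtail b ≤ V b * gtail a := by
    intro a b ha hab
    have ha0 := hα.trans ha
    have hb0 := ha0.trans hab
    have key : ∀ c, b < c → ((V c - PsiP α β c) - (V b - PsiP α β b)) * (gtail a - gtail b)
      ≤ ((V b - PsiP α β b) - (V a - PsiP α β a)) * (gtail b - gtail c) := fun c hc =>
      h.slope_ge ha0 hab hc (h.good ha0) (h.good hb0) (h.good (hb0.trans hc)) (h.p_zero_outer ha)
    have T : Tendsto (fun c => ((V b - PsiP α β b) - (V a - PsiP α β a)) * (gtail b - gtail c)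
        + PsiP α β c * (gtail a - gtail b)) atTop
        (𝓝 (((V b - PsiP α β b) - (V a - PsiP α β a)) * (gtail b - 0) + 0 * (gtail a - gtail b))) :=
      ((tendsto_const_nhds.sub gtail_tendsto).const_mul _).add (PsiP_tendsto.mul_const _)
    have hg : 0 < gtail a - gtail b := sub_pos.2 (gtail_strictAnti hab)
    have := ge_of_tendsto T (b := -(V b - PsiP α β b) * (gtail a - gtail b)) (by
      filter_upwards [eventually_gt_atTop b] with c hc
      have k := key c hc
      have := h.V_nonneg c
      nlinarith)
    rw [PsiP_of_ge ha.le, PsiP_of_ge (ha.trans hab).le] at this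
    nlinarith
  rcases hx.eq_or_lt with rfl | hx
  · exact le_rfl
  have T : Tendsto (fun a => V a * gtail x) (𝓝[>] α) (𝓝 (V α * gtail x)) :=
    ((h.V_continuousOn.continuousAt (Ioi_mem_nhds hα)).tendsto.mono_left nhdsWithin_le_nhds).mul_const _
  have T2 : Tendsto (fun a => V x * gtail a) (𝓝[>] α) (𝓝 (V x * gtail α)) :=
    ((gtail_continuous.tendsto α).mono_left nhdsWithin_le_nhds).const_mul _
  refine le_of_tendsto_of_tendsto T T2 ?_
  filter_upwards [Ioo_mem_nhdsGT hx] with a ha using aux a x ha.1 ha.2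

lemma V_alpha_eq (h : UnifSol α β ustar u p w ps V) {γ : ℝ} (hγ : Tendsto (fun x => x * tailMass ps x) atTop (𝓝 γ))
    (h0 : γ ≠ 0) : V α = ustar := by
  have hα := h.hα
  refine le_antisymm h.V_alpha_le (not_lt.1 fun hlt => h0 ?_)
  have hc : ContinuousAt V α := h.V_continuousOn.continuousAt (Ioi_mem_nhds hα)
  set c := (V α + ustar) / 2 with hcd
  obtain ⟨d, hd0, hd⟩ := Metric.eventually_nhds_iff.1 (hc.eventually (gt_mem_nhds (by linarith : V α < c)))
  set a := max (α - d / 2) (α / 2) with had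
  have haα : a < α := max_lt (by linarith) (by linarith)
  have ha : 0 < a := (half_pos hα).trans_le (le_max_right _ _)
  obtain ⟨Λ, hΛ⟩ := h.eventually_lt ha haα.le (c := c) (fun x hx => by
    refine (hd ?_).le
    rw [Real.dist_eq, abs_sub_comm, abs_of_nonneg (by linarith [hx.2])]
    have := (le_max_left (α - d / 2) (α / 2)).trans hx.1
    linarith) (ε := (ustar - V α) / 4) (by linarith)
  obtain ⟨X, hX0, hX⟩ := h.ps_eventually_zero ha haα (ε := (ustar - V α) / 4) (Λ := Λ) (by linarith) fun l hl η hη =>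
    (hΛ l hl η hη).trans (by linarith)
  refine tendsto_nhds_unique hγ (tendsto_const_nhds.congr' ?_)
  filter_upwards [eventually_ge_atTop X] with x hx
  have : tailMass ps x = 0 := by
    rw [tailMass, setIntegral_congr_ae (g := fun _ => 0) measurableSet_Ioi]
    · simp
    · filter_upwards [hX] with y hy hyx using hy (hx.trans (le_of_lt hyx))
  rw [this, mul_zero]

lemma avg_zero_le (h : UnifSol α β ustar u p w ps V) (hb : TimeBump t₀ t₁ χ χ') {δ : ℝ} (hδ : 0 < δ) :
    ∀ᶠ l in atTop, timeAvg t₁ χ (fun x t => u (l * x) (l ^ 2 * t)) 0 ≤ δ := by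
  have hα := h.hα
  set r := α * Real.sqrt t₀ / 2 with hr
  have hs := Real.sqrt_pos.2 hb.pos
  have hr0 : 0 < r := by positivity
  have hr1 : r < α * Real.sqrt t₀ := by linarith [mul_pos hα hs]
  set L := PrecipSys.fluxBound α β t₀ t₁ χ' r with hL
  have hL0 : 0 ≤ L := h.fluxBound_nonneg hb hr0.le hr1
  set m := min r (δ / (2 * (L + 1))) with hm
  have hm0 : 0 < m := lt_min hr0 (by positivity)
  obtain ⟨r₀, hr₀, hone⟩ := h.ps_near_zero
  filter_upwards [eventually_gt_atTop (6 * L / (δ * r₀)), eventually_ge_atTop (r₀ / m), eventually_gt_atTop (0:ℝ)]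
    with l hl1 hl2 hl0
  by_contra! hgt
  have hsys := h.sys_scale hl0
  have hlow : ∀ x ∈ Icc 0 m, δ / 2 ≤ timeAvg t₁ χ (fun x t => u (l * x) (l ^ 2 * t)) x := by
    intro x hx
    have := hsys.avg_lipschitz hb hr1 (x := x) (y := 0) ⟨hx.1, hx.2.trans (min_le_left _ _)⟩ ⟨le_rfl, hr0.le⟩
    rw [sub_zero, abs_of_nonneg hx.1] at this
    have h2 : L * x ≤ δ / 2 := by
      calc L * x ≤ (L + 1) * (δ / (2 * (L + 1))) :=
            mul_le_mul (by linarith) (hx.2.trans (min_le_right _ _)) hx.1 (by linarith)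
        _ = δ / 2 := by field_simp
    linarith [(abs_le.1 this).1]
  have hup := hsys.q_avg_integral_le hb hr1 le_rfl hm0.le (min_le_left _ _)
  have hq := h.ps_scaled_intervalIntegrable hl0 0 m
  have hge : (δ / 2) * ∫ x in (0:ℝ)..m, l ^ 2 * ps (l * x) ≤ 3 * L := by
    refine le_trans ?_ hup
    rw [← intervalIntegral.integral_const_mul]
    refine intervalIntegral.integral_mono_on hm0.le (hq.const_mul _) (hsys.q_avg_intervalIntegrable hb _ _) fun x hx => ?_
    rw [mul_comm]
    exact mul_le_mul_of_nonneg_left (hlow x hx) (mul_nonneg (sq_nonneg _) (h.q_nonneg _))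
  rw [LimSol.ps_integral_rescale, mul_zero] at hge
  have hle : r₀ ≤ ∫ x in (0:ℝ)..l * m, ps x := by
    rw [div_le_iff₀ hm0] at hl2
    have h1 : ∫ x in (0:ℝ)..r₀, ps x = r₀ := by
      rw [intervalIntegral.integral_congr_ae (g := fun _ => 1)]
      · simp
      · rw [uIoc_of_le hr₀.le]
        filter_upwards [hone, (measure_eq_zero_iff_ae_notMem.1 (measure_singleton (μ := volume) r₀))] with x hx hne hxm
        exact hx ⟨hxm.1, lt_of_le_of_ne hxm.2 hne⟩
    rw [← intervalIntegral.integral_add_adjacent_intervals (h.ps_intervalIntegrable 0 r₀)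
      (h.ps_intervalIntegrable r₀ (l * m)), h1]
    have := intervalIntegral.integral_nonneg_of_forall (μ := volume) hl2 h.q_nonneg
    linarith
  rw [div_lt_iff₀ (by positivity)] at hl1
  have : (δ / 2) * (l * r₀) ≤ (δ / 2) * (l * ∫ x in (0:ℝ)..l * m, ps x) := by gcongr
  nlinarith

/-- The profile takes arbitrarily small values near the origin. -/
lemma exists_small (h : UnifSol α β ustar u p w ps V) {ε : ℝ} (hε : 0 < ε) : ∃ x ∈ Ioo 0 ε, V x ≤ ε := by
  have hα := h.hα
  obtain ⟨χ, χ', hb⟩ := exists_timeBump (t₀ := 1) (t₁ := 2) (by norm_num) (by norm_num)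
  set r := α * Real.sqrt 1 / 2 with hr
  have hs : Real.sqrt 1 = 1 := Real.sqrt_one
  have hr0 : 0 < r := by rw [hr, hs]; linarith
  have hr1 : r < α * Real.sqrt 1 := by rw [hr, hs]; linarith
  set L := PrecipSys.fluxBound α β 1 2 χ' r with hL
  have hL0 : 0 ≤ L := h.fluxBound_nonneg hb hr0.le hr1
  set x := min r (min (ε / 2) (ε / (4 * (L + 1)))) with hx
  have hx0 : 0 < x := lt_min hr0 (lt_min (by positivity) (by positivity))
  have hxr : x ≤ r := min_le_left _ _
  have hxε : x ≤ ε / 2 := (min_le_right _ _).trans (min_le_left _ _)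
  have hLx : L * x ≤ ε / 4 := by
    calc L * x ≤ (L + 1) * (ε / (4 * (L + 1))) :=
          mul_le_mul (by linarith) ((min_le_right _ _).trans (min_le_right _ _)) hx0.le (by linarith)
      _ = ε / 4 := by field_simp
  have hA : ∫ t in Ioc 0 2, χ t * V (x / Real.sqrt t) ≤ ε / 2 := by
    refine le_of_tendsto (h.avg_tendsto hb.integrableOn hx0) ?_
    filter_upwards [h.avg_zero_le hb (δ := ε / 4) (by positivity), eventually_gt_atTop (0:ℝ)] with l hl hl0
    have := (h.sys_scale hl0).avg_lipschitz hb hr1 (x := x) (y := 0) ⟨hx0.le, hxr⟩ ⟨le_rfl, hr0.le⟩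
    rw [sub_zero, abs_of_pos hx0] at this
    linarith [(abs_le.1 this).2]
  by_contra! hbig
  have hge : ε ≤ ∫ t in Ioc 0 2, χ t * V (x / Real.sqrt t) := by
    calc ε = ∫ t in Ioc (0:ℝ) 2, χ t * ε := by rw [integral_mul_const, hb.int, one_mul]
      _ ≤ _ := by
        refine setIntegral_mono_on (hb.integrableOn.mul_const _) ?_ measurableSet_Ioc fun t ht => ?_
        · refine hb.integrableOn.mul_bdd (c := PsiP α β α) ?_ (ae_of_all _ fun t => h.V_abs_le _)
          exact (h.V_meas.comp (by fun_prop)).aestronglyMeasurable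
        · by_cases hm : t ∈ Ioo (1:ℝ) 2
          · refine mul_le_mul_of_nonneg_left (hbig _ ⟨by have := Real.sqrt_pos.2 ht.1; positivity, ?_⟩).le (hb.nonneg t)
            have h1 : 1 ≤ Real.sqrt t := by rw [← Real.sqrt_one]; exact Real.sqrt_le_sqrt hm.1.le
            have := div_le_self hx0.le h1
            linarith
          · rw [hb.zero t hm]; simp
  linarith

lemma V_inner_le (h : UnifSol α β ustar u p w ps V) {b : ℝ} (hb : 0 < b) (hbα : b < α) :
    V b * (gtail 0 - gtail α) ≤ V α * (gtail 0 - gtail b) := by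
  have key : ∀ a, 0 < a → a < b → (V b - V a) * (gtail b - gtail α) ≤ (V α - V b) * (gtail a - gtail b) := by
    intro a ha hab
    have := h.slope_le ha hab hbα (h.good ha) (h.good hb) (h.good h.hα)
    rw [PsiP_of_le (hab.trans hbα).le, PsiP_of_le hbα.le] at this
    nlinarith
  choose x hx using fun n : ℕ => h.exists_small (ε := 1 / ((n:ℝ) + 1)) (by positivity)
  have hx0 : Tendsto x atTop (𝓝 0) :=
    squeeze_zero (fun n => (hx n).1.1.le) (fun n => (hx n).1.2.le) tendsto_one_div_add_atTop_nhds_zero_nat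
  have hV0 : Tendsto (fun n => V (x n)) atTop (𝓝 0) :=
    squeeze_zero (fun n => h.V_nonneg _) (fun n => (hx n).2) tendsto_one_div_add_atTop_nhds_zero_nat
  have T1 : Tendsto (fun n => (V b - V (x n)) * (gtail b - gtail α)) atTop (𝓝 ((V b - 0) * (gtail b - gtail α))) :=
    (tendsto_const_nhds.sub hV0).mul_const _
  have T2 : Tendsto (fun n => (V α - V b) * (gtail (x n) - gtail b)) atTop (𝓝 ((V α - V b) * (gtail 0 - gtail b))) :=
    (((gtail_continuous.tendsto 0).comp hx0).sub_const _).const_mul _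
  have := le_of_tendsto_of_tendsto T1 T2 (by
    filter_upwards [hx0.eventually (gt_mem_nhds hb)] with n hn using key _ (hx n).1.1 hn)
  nlinarith

lemma V_alpha_pos (h : UnifSol α β ustar u p w ps V) : 0 < V α := by
  refine lt_of_le_of_ne (h.V_nonneg _) fun h0 => h.nontrivial (ae_of_all _ fun x hx => ?_)
  have h1 := h.V_inner_le hx.1 hx.2
  rw [← h0, zero_mul] at h1
  have h2 : 0 < gtail 0 - gtail α := sub_pos.2 (gtail_strictAnti h.hα)
  exact le_antisymm (nonpos_of_mul_nonpos_left h1 h2) (h.V_nonneg _)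

/-- Linear bound at the origin. -/
lemma V_le_mul (h : UnifSol α β ustar u p w ps V) : ∃ C ≥ 0, ∀ x ≥ 0, V x ≤ C * x := by
  have hα := h.hα
  have h2 : 0 < gtail 0 - gtail α := sub_pos.2 (gtail_strictAnti h.hα)
  have hΨ := PsiP_pos h.hα h.hβ α
  have hVα := h.V_nonneg α
  refine ⟨V α / (gtail 0 - gtail α) + PsiP α β α / α, by positivity, fun x hx => ?_⟩
  have n1 : 0 ≤ V α / (gtail 0 - gtail α) * x := by positivity
  have n2 : 0 ≤ PsiP α β α / α * x := by positivity
  rw [add_mul]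
  rcases hx.eq_or_lt with rfl | hx0
  · rw [h.V_zero]; linarith
  rcases lt_or_ge x α with h1 | h1
  · have h3 := h.V_inner_le hx0 h1
    have h4 : gtail 0 - gtail x ≤ x := by
      have := gtail_lipschitz 0 x
      have h5 := le_abs_self (gtail 0 - gtail x)
      rw [zero_sub, abs_neg, abs_of_pos hx0] at this
      linarith
    have : V x ≤ V α / (gtail 0 - gtail α) * x := by
      rw [div_mul_eq_mul_div, le_div_iff₀ h2]
      exact h3.trans (mul_le_mul_of_nonneg_left h4 hVα)
    linarith
  · have : PsiP α β α ≤ PsiP α β α / α * x := by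
      rw [div_mul_eq_mul_div, le_div_iff₀ hα]
      exact mul_le_mul_of_nonneg_left h1 hΨ.le
    linarith [h.V_le_const x]

end UnifSol

lemma ae_mul_sqrt {P : ℝ → Prop} (h : ∀ᵐ η, P η) {x : ℝ} (hx : 0 < x) :
    ∀ᵐ t ∂(volume.restrict (Ioi (0:ℝ))), P (x * Real.sqrt t) := by
  rw [ae_restrict_iff' measurableSet_Ioi, ae_iff]
  have h0 : volume {η | ¬ P η} = 0 := ae_iff.1 h
  have hd : DifferentiableOn ℝ (fun y : ℝ => y ^ 2 / x ^ 2) {η | ¬ P η} := by fun_prop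
  refine measure_mono_null ?_
    (addHaar_image_eq_zero_of_differentiableOn_of_addHaar_eq_zero volume hd h0)
  intro t ht
  simp only [mem_ofPred_eq, Classical.not_imp, mem_Ioi] at ht
  refine ⟨x * Real.sqrt t, ht.2, ?_⟩
  simp only
  rw [mul_pow, Real.sq_sqrt ht.1.le]
  field_simp

namespace TimeBump
variable {t₀ t₁ : ℝ} {χ χ' : ℝ → ℝ} {q : ℝ → ℝ} {B : ℝ}

lemma density_integrable (hb : TimeBump t₀ t₁ χ χ') (hq : Measurable q) (h0 : ∀ x, 0 ≤ q x) (hB : ∀ x, q x ≤ B) (x : ℝ) :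
    IntegrableOn (fun t => t * χ t * q (x * Real.sqrt t)) (Ioc 0 t₁) := by
  have hc : Continuous fun t => t * χ t := continuous_id.mul hb.continuous
  refine ((hc.integrableOn_Icc (a := 0) (b := t₁)).mono_set Ioc_subset_Icc_self).mul_bdd (c := B) ?_
    (ae_of_all _ fun t => ?_)
  · exact (hq.comp (by fun_prop)).aestronglyMeasurable
  · rw [Real.norm_eq_abs, abs_of_nonneg (h0 _)]; exact hB _

lemma density_nonneg (hb : TimeBump t₀ t₁ χ χ') (h0 : ∀ x, 0 ≤ q x) (x : ℝ) : 0 ≤ simN t₁ χ (fun x _ => q x) x :=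
  setIntegral_nonneg measurableSet_Ioc fun t ht => mul_nonneg (mul_nonneg ht.1.le (hb.nonneg t)) (h0 _)

lemma density_prod_integrable (hb : TimeBump t₀ t₁ χ χ') (hq : Measurable q) (h0 : ∀ x, 0 ≤ q x) (hB : ∀ x, q x ≤ B)
    (a b : ℝ) : Integrable (Function.uncurry fun x t => t * χ t * q (x * Real.sqrt t))
      ((volume.restrict (Ioc a b)).prod (volume.restrict (Ioc 0 t₁))) := by
  have hc : Continuous fun t => t * χ t := continuous_id.mul hb.continuous
  have h1 : Integrable (fun t => t * χ t) (volume.restrict (Ioc 0 t₁)) :=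
    (hc.integrableOn_Icc (a := 0) (b := t₁)).mono_set Ioc_subset_Icc_self
  have h2 : Integrable (fun _ : ℝ => (1:ℝ)) (volume.restrict (Ioc a b)) := by
    simp
  have := h2.mul_prod h1
  simp only [one_mul] at this
  refine (this.mul_bdd (c := B) (g := fun z : ℝ × ℝ => q (z.1 * Real.sqrt z.2)) ?_ (ae_of_all _ fun t => ?_))
  · exact (hq.comp (by fun_prop)).aestronglyMeasurable
  · rw [Real.norm_eq_abs, abs_of_nonneg (h0 _)]; exact hB _

lemma density_intervalIntegrable (hb : TimeBump t₀ t₁ χ χ') (hq : Measurable q) (h0 : ∀ x, 0 ≤ q x) (hB : ∀ x, q x ≤ B)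
    {a b : ℝ} (hab : a ≤ b) : IntervalIntegrable (simN t₁ χ (fun x _ => q x)) volume a b := by
  rw [intervalIntegrable_iff_integrableOn_Ioc_of_le hab]
  exact (hb.density_prod_integrable hq h0 hB a b).integral_prod_left

lemma density_integral (hb : TimeBump t₀ t₁ χ χ') (hq : Measurable q) (h0 : ∀ x, 0 ≤ q x) (hB : ∀ x, q x ≤ B)
    {a b : ℝ} (hab : a ≤ b) : ∫ x in a..b, simN t₁ χ (fun x _ => q x) x =
      ∫ t in Ioc 0 t₁, χ t * (Real.sqrt t * ∫ x in (a * Real.sqrt t)..(b * Real.sqrt t), q x) := by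
  rw [intervalIntegral.integral_of_le hab]
  simp only [simN]
  rw [integral_integral_swap (hb.density_prod_integrable hq h0 hB a b)]
  refine setIntegral_congr_fun measurableSet_Ioc fun t ht => ?_
  have hs := Real.sqrt_pos.2 ht.1
  rw [integral_const_mul, ← intervalIntegral.integral_of_le hab, intervalIntegral.integral_comp_mul_right q hs.ne',
    smul_eq_mul]
  nth_rewrite 1 [← Real.mul_self_sqrt ht.1.le]
  field_simp

end TimeBump

namespace PrecipSys
variable {α β : ℝ} {u w F : ℝ → ℝ → ℝ} {q : ℝ → ℝ} {t₀ t₁ : ℝ} {χ χ' : ℝ → ℝ}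

lemma simN_integrable (h : PrecipSys α β u w F q) (hb : TimeBump t₀ t₁ χ χ') (x : ℝ) :
    IntegrableOn (fun t => t * χ t * F (x * Real.sqrt t) t) (Ioc 0 t₁) := by
  obtain ⟨C, hC0, hC⟩ := h.F_bdd t₁
  have hc : Continuous fun t => t * χ t := continuous_id.mul hb.continuous
  refine ((hc.integrableOn_Icc (a := 0) (b := t₁)).mono_set Ioc_subset_Icc_self).mul_bdd (c := C) ?_ ?_
  · exact (h.sys.F_meas.comp (by fun_prop : Measurable fun t : ℝ => (x * Real.sqrt t, t))).aestronglyMeasurable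
  · filter_upwards [ae_restrict_mem measurableSet_Ioc] with t ht using hC _ _ ht.2

lemma simN_le (h : PrecipSys α β u w F q) (hb : TimeBump t₀ t₁ χ χ') {x : ℝ} (hx : 0 < x) :
    simN t₁ χ F x ≤ PsiP α β α * simN t₁ χ (fun x _ => q x) x := by
  obtain ⟨B, hB⟩ := h.q_bdd
  simp only [simN]
  rw [← integral_const_mul]
  refine integral_mono_ae (h.simN_integrable hb x) ((hb.density_integrable h.q_meas h.q_nonneg hB x).const_mul _) ?_
  have := ae_mono (Measure.restrict_mono (Ioc_subset_Ioi_self : Ioc 0 t₁ ⊆ Ioi 0) le_rfl) (ae_mul_sqrt h.F_le hx)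
  filter_upwards [this, ae_restrict_mem measurableSet_Ioc] with t ht htm
  have h1 : F (x * Real.sqrt t) t ≤ q (x * Real.sqrt t) * PsiP α β α :=
    (ht t).trans (mul_le_mul_of_nonneg_left (h.u_le_const _ _) (h.q_nonneg _))
  calc _ ≤ t * χ t * (q (x * Real.sqrt t) * PsiP α β α) :=
        mul_le_mul_of_nonneg_left h1 (mul_nonneg htm.1.le (hb.nonneg t))
    _ = _ := by ring

lemma simN_near (h : PrecipSys α β u w F q) (hb : TimeBump t₀ t₁ χ χ') {x v ε : ℝ} (hx : 0 < x) (hxα : x < α)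
    (hv : ∀ t ≥ t₀, |u (x * Real.sqrt t) t - v| ≤ ε) :
    |simN t₁ χ F x - v * simN t₁ χ (fun x _ => q x) x| ≤ ε * simN t₁ χ (fun x _ => q x) x := by
  obtain ⟨B, hB⟩ := h.q_bdd
  have hq := hb.density_integrable h.q_meas h.q_nonneg hB x
  have hα := h.hα
  simp only [simN]
  rw [← integral_const_mul, ← integral_const_mul, ← integral_sub (h.simN_integrable hb x) (hq.const_mul _)]
  refine norm_integral_le_of_norm_le (f := fun t => t * χ t * F (x * Real.sqrt t) t - v * (t * χ t * q (x * Real.sqrt t)))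
    (hq.const_mul ε) ?_
  have := ae_mono (Measure.restrict_mono (Ioc_subset_Ioi_self : Ioc 0 t₁ ⊆ Ioi 0) le_rfl) (ae_mul_sqrt h.F_eq hx)
  filter_upwards [this, ae_restrict_mem measurableSet_Ioc] with t ht htm
  by_cases hm : t ∈ Ioo t₀ t₁
  · have h1 : (x * Real.sqrt t) ^ 2 / α ^ 2 < t := by
      rw [mul_pow, Real.sq_sqrt htm.1.le, div_lt_iff₀ (by positivity), mul_comm]
      have := htm.1
      gcongr
    rw [ht t h1, show t * χ t * (q (x * Real.sqrt t) * u (x * Real.sqrt t) t) - v * (t * χ t * q (x * Real.sqrt t))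
      = (u (x * Real.sqrt t) t - v) * (t * χ t * q (x * Real.sqrt t)) by ring, norm_mul, Real.norm_eq_abs,
      Real.norm_eq_abs, abs_of_nonneg (mul_nonneg (mul_nonneg htm.1.le (hb.nonneg t)) (h.q_nonneg _))]
    exact mul_le_mul_of_nonneg_right (hv t hm.1.le) (mul_nonneg (mul_nonneg htm.1.le (hb.nonneg t)) (h.q_nonneg _))
  · rw [hb.zero t hm]; simp

end PrecipSys

namespace LimSol
variable {α β ustar : ℝ} {u p w : ℝ → ℝ → ℝ} {ps V : ℝ → ℝ} {t₀ t₁ : ℝ} {χ χ' : ℝ → ℝ}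

lemma ps_scaled_le (h : LimSol α β ustar u p w ps V) (l x : ℝ) : l ^ 2 * ps (l * x) ≤ l ^ 2 := by
  have := mul_le_mul_of_nonneg_left (h.ps_le (l * x)) (sq_nonneg l)
  linarith

lemma ps_scaled_nonneg (h : LimSol α β ustar u p w ps V) (l x : ℝ) : 0 ≤ l ^ 2 * ps (l * x) :=
  mul_nonneg (sq_nonneg _) (h.q_nonneg _)

lemma ps_scaled_measurable (h : LimSol α β ustar u p w ps V) (l : ℝ) : Measurable fun x => l ^ 2 * ps (l * x) :=
  (h.q_meas.comp (by fun_prop)).const_mul _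

lemma density_intervalIntegrable (h : LimSol α β ustar u p w ps V) (hb : TimeBump t₀ t₁ χ χ') (l : ℝ) {a b : ℝ}
    (hab : a ≤ b) : IntervalIntegrable (simN t₁ χ (fun x _ => l ^ 2 * ps (l * x))) volume a b :=
  hb.density_intervalIntegrable (h.ps_scaled_measurable l) (h.ps_scaled_nonneg l) (h.ps_scaled_le l) hab

lemma density_tendsto (h : LimSol α β ustar u p w ps V) (hb : TimeBump t₀ t₁ χ χ') {γ : ℝ}
    (hγ : Tendsto (fun x => x * tailMass ps x) atTop (𝓝 γ)) {a b : ℝ} (ha : 0 < a) (hab : a ≤ b) :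
    Tendsto (fun l => ∫ x in a..b, simN t₁ χ (fun x _ => l ^ 2 * ps (l * x)) x) atTop
      (𝓝 (∫ x in a..b, γ / x ^ 2)) := by
  obtain ⟨C, hC0, Λ, hΛ, hC⟩ := h.tail_bound
  have hs0 := Real.sqrt_pos.2 hb.pos
  have lim : ∫ x in a..b, γ / x ^ 2 = ∫ t in Ioc 0 t₁, χ t * ∫ x in a..b, γ / x ^ 2 := by
    rw [integral_mul_const, hb.int, one_mul]
  rw [lim]
  have e : ∀ l, ∫ x in a..b, simN t₁ χ (fun x _ => l ^ 2 * ps (l * x)) x = ∫ t in Ioc 0 t₁,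
      χ t * (Real.sqrt t * ∫ x in (a * Real.sqrt t)..(b * Real.sqrt t), l ^ 2 * ps (l * x)) := fun l =>
    hb.density_integral (h.ps_scaled_measurable l) (h.ps_scaled_nonneg l) (h.ps_scaled_le l) hab
  simp only [e]
  have einv : ∀ s, 0 < s → s * ∫ x in (a * s)..(b * s), γ / x ^ 2 = ∫ x in a..b, γ / x ^ 2 := by
    intro s hs
    have := intervalIntegral.integral_comp_mul_right (fun x => γ / x ^ 2) (a := a) (b := b) hs.ne'
    rw [smul_eq_mul, eq_inv_mul_iff_mul_eq₀ hs.ne'] at this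
    rw [← this, ← mul_assoc, ← intervalIntegral.integral_const_mul]
    refine intervalIntegral.integral_congr fun x _ => ?_
    field_simp
  refine tendsto_integral_filter_of_dominated_convergence (fun t => |χ t| * (C / a)) ?_ ?_
    (hb.integrableOn.norm.mul_const _) ?_
  · refine Eventually.of_forall fun l => ?_
    have hii : ∀ a b, IntervalIntegrable (fun x => l ^ 2 * ps (l * x)) volume a b := fun a b =>
      intervalIntegrable_iff.2 (Measure.integrableOn_of_bounded (M := l ^ 2) (s := uIoc a b)
      (by simp [uIoc]) (h.ps_scaled_measurable l).aestronglyMeasurable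
      (ae_of_all _ fun x => by rw [Real.norm_eq_abs, abs_of_nonneg (h.ps_scaled_nonneg l x)]; exact h.ps_scaled_le l x))
    have hcI := intervalIntegral.continuous_primitive hii 0
    have : (fun t => χ t * (Real.sqrt t * ∫ x in (a * Real.sqrt t)..(b * Real.sqrt t), l ^ 2 * ps (l * x))) =
        fun t => χ t * (Real.sqrt t * ((∫ x in (0:ℝ)..(b * Real.sqrt t), l ^ 2 * ps (l * x))
          - ∫ x in (0:ℝ)..(a * Real.sqrt t), l ^ 2 * ps (l * x))) := by
      funext t
      rw [intervalIntegral.integral_interval_sub_left (hii _ _) (hii _ _)]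
    rw [this]
    have c1 := hb.continuous
    have c2 : Continuous fun t => ∫ x in (0:ℝ)..(b * Real.sqrt t), l ^ 2 * ps (l * x) :=
      hcI.comp (by fun_prop : Continuous fun t => b * Real.sqrt t)
    have c3 : Continuous fun t => ∫ x in (0:ℝ)..(a * Real.sqrt t), l ^ 2 * ps (l * x) :=
      hcI.comp (by fun_prop : Continuous fun t => a * Real.sqrt t)
    exact (c1.mul (Real.continuous_sqrt.mul (c2.sub c3))).aestronglyMeasurable
  · filter_upwards [eventually_ge_atTop (Λ / (a * Real.sqrt t₀)), eventually_gt_atTop (0:ℝ)] with l hl hl0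
    filter_upwards [ae_restrict_mem measurableSet_Ioc] with t ht
    by_cases hm : t ∈ Ioo t₀ t₁
    · rw [norm_mul, Real.norm_eq_abs, Real.norm_eq_abs]
      have hs := Real.sqrt_pos.2 ht.1
      have hab' : l * (a * Real.sqrt t) ≤ l * (b * Real.sqrt t) := by gcongr
      rw [ps_integral_rescale, ← tailMass_sub (h.ps_integrableOn _) hab']
      have n1 := tailMass_nonneg (f := ps) h.q_nonneg (l * (b * Real.sqrt t))
      have n2 := tailMass_anti h.q_nonneg (h.ps_integrableOn _) hab'
      have hΛl : Λ ≤ l * (a * Real.sqrt t) := by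
        rw [div_le_iff₀ (by positivity)] at hl
        refine hl.trans ?_
        have := Real.sqrt_le_sqrt hm.1.le
        gcongr
      have n3 := (hC _ hΛl).2
      rw [abs_of_nonneg (mul_nonneg hs.le (mul_nonneg hl0.le (sub_nonneg.2 n2)))]
      refine mul_le_mul_of_nonneg_left ?_ (abs_nonneg _)
      calc Real.sqrt t * (l * (tailMass ps (l * (a * Real.sqrt t)) - tailMass ps (l * (b * Real.sqrt t))))
          ≤ Real.sqrt t * (l * (C / (l * (a * Real.sqrt t)))) := by
            gcongr
            exact (sub_le_self _ n1).trans n3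
        _ = C / a := by field_simp
    · rw [hb.zero t hm]; simp
  · filter_upwards [ae_restrict_mem measurableSet_Ioc] with t ht
    have hs := Real.sqrt_pos.2 ht.1
    refine Tendsto.const_mul _ ?_
    rw [← einv _ hs]
    exact (h.mass_tendsto hγ (mul_pos ha hs) (mul_le_mul_of_nonneg_right hab hs.le)).const_mul _

end LimSol

lemma exp_sq_le {x R : ℝ} (h0 : 0 ≤ x) (h : x ≤ R) : Real.exp (x ^ 2 / 4) ≤ Real.exp (R ^ 2 / 4) := by
  gcongr

namespace UnifSol
variable {α β ustar : ℝ} {u p w : ℝ → ℝ → ℝ} {ps V : ℝ → ℝ} {t₀ t₁ : ℝ} {χ χ' : ℝ → ℝ} {γ : ℝ}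

/-- Similarity average of the rescaled source. -/
def srcAvg (u p : ℝ → ℝ → ℝ) (T : ℝ) (χ : ℝ → ℝ) (l : ℝ) : ℝ → ℝ :=
  simN T χ (fun x t => l ^ 2 * (p (l * x) (l ^ 2 * t) * u (l * x) (l ^ 2 * t)))

lemma src_inner (h : UnifSol α β ustar u p w ps V) (hb : TimeBump t₀ t₁ χ χ')
    (hγ : Tendsto (fun x => x * tailMass ps x) atTop (𝓝 γ)) (hγ0 : 0 ≤ γ) {a b : ℝ} (ha : 0 < a) (hab : a ≤ b)
    (hbα : b ≤ α) :
    Tendsto (fun l => ∫ x in a..b, Real.exp (x ^ 2 / 4) * srcAvg u p t₁ χ l x) atTop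
      (𝓝 (∫ x in a..b, Real.exp (x ^ 2 / 4) * V x * (γ / x ^ 2))) := by
  have hce : Continuous fun x : ℝ => Real.exp (x ^ 2 / 4) := by fun_prop
  have hcV : ContinuousOn V (Icc a b) := h.V_continuousOn.mono fun x hx => ha.trans_le hx.1
  have hw : ∀ {g : ℝ → ℝ}, ContinuousOn g (Icc a b) → Tendsto (fun l => ∫ x in a..b, g x *
      simN t₁ χ (fun x _ => l ^ 2 * ps (l * x)) x) atTop (𝓝 (∫ x in a..b, g x * (γ / x ^ 2))) := by
    intro g hg
    refine weak_tendsto hab ?_ ?_ ?_ ?_ ?_ hg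
    · exact Eventually.of_forall fun l x _ => hb.density_nonneg (h.ps_scaled_nonneg l) x
    · exact Eventually.of_forall fun l => h.density_intervalIntegrable hb l hab
    · intro x _; positivity
    · refine ContinuousOn.intervalIntegrable ?_
      rw [uIcc_of_le hab]
      refine continuousOn_const.div (by fun_prop) fun x hx => ?_
      have := ha.trans_le hx.1
      positivity
    · intro c hc
      exact h.density_tendsto hb hγ ha hc.1
  have hgV : ContinuousOn (fun x => Real.exp (x ^ 2 / 4) * V x) (Icc a b) := hce.continuousOn.mul hcV
  have T1 := hw hgV
  have T2 := hw hce.continuousOn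
  set K := ∫ x in a..b, Real.exp (x ^ 2 / 4) * (γ / x ^ 2) with hK
  have hK0 : 0 ≤ K := intervalIntegral.integral_nonneg hab fun x _ => by positivity
  rw [Metric.tendsto_atTop']
  suffices H : ∀ ε > 0, ∀ᶠ l in atTop, dist (∫ x in a..b, Real.exp (x ^ 2 / 4) * srcAvg u p t₁ χ l x)
      (∫ x in a..b, Real.exp (x ^ 2 / 4) * V x * (γ / x ^ 2)) < ε by
    intro ε hε
    obtain ⟨N, hN⟩ := eventually_atTop.1 (H ε hε)
    exact ⟨N, fun n hn => hN n hn.le⟩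
  intro ε hε
  have hδ : 0 < ε / (2 * (K + 1)) := by positivity
  filter_upwards [h.unif_time hb (R := b) ha hδ, T1.eventually (Metric.ball_mem_nhds _ (half_pos hε)),
    T2.eventually (gt_mem_nhds (lt_add_one K)), eventually_gt_atTop (0:ℝ)] with l hu h1 h2 hl
  have H := h.sys_scale hl
  have i1 : IntervalIntegrable (fun x => Real.exp (x ^ 2 / 4) * srcAvg u p t₁ χ l x) volume a b :=
    H.exp_simN_intervalIntegrable hb a b
  have i2 : ∀ {g : ℝ → ℝ}, ContinuousOn g (Icc a b) → IntervalIntegrable (fun x => g x *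
      simN t₁ χ (fun x _ => l ^ 2 * ps (l * x)) x) volume a b := by
    intro g hg
    exact (h.density_intervalIntegrable hb l hab).continuousOn_mul (by rwa [uIcc_of_le hab])
  have hd : |(∫ x in a..b, Real.exp (x ^ 2 / 4) * srcAvg u p t₁ χ l x) - ∫ x in a..b, Real.exp (x ^ 2 / 4) * V x *
      simN t₁ χ (fun x _ => l ^ 2 * ps (l * x)) x| ≤ ε / (2 * (K + 1)) * ∫ x in a..b, Real.exp (x ^ 2 / 4) *
      simN t₁ χ (fun x _ => l ^ 2 * ps (l * x)) x := by
    rw [← intervalIntegral.integral_sub i1 (i2 hgV), ← intervalIntegral.integral_const_mul]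
    rw [← Real.norm_eq_abs]
    refine intervalIntegral.norm_integral_le_of_norm_le hab ?_ ((i2 hce.continuousOn).const_mul _)
    filter_upwards [measure_eq_zero_iff_ae_notMem.1 (measure_singleton (μ := volume) α)] with x hxα hx
    have hx0 := ha.trans hx.1
    have hlt : x < α := lt_of_le_of_ne (hx.2.trans hbα) hxα
    have := H.simN_near hb hx0 hlt (hu x ⟨hx.1.le, hx.2⟩)
    rw [mul_assoc, ← mul_sub, norm_mul, Real.norm_eq_abs, abs_of_pos (Real.exp_pos _), mul_left_comm]
    exact mul_le_mul_of_nonneg_left this (Real.exp_pos _).le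
  rw [Real.dist_eq] at h1 ⊢
  have h3 : ε / (2 * (K + 1)) * (∫ x in a..b, Real.exp (x ^ 2 / 4) *
      simN t₁ χ (fun x _ => l ^ 2 * ps (l * x)) x) < ε / 2 := by
    calc _ < ε / (2 * (K + 1)) * (K + 1) := mul_lt_mul_of_pos_left h2 hδ
      _ = ε / 2 := by field_simp
  have h4 := abs_sub_le (∫ x in a..b, Real.exp (x ^ 2 / 4) * srcAvg u p t₁ χ l x) (∫ x in a..b, Real.exp (x ^ 2 / 4) * V x *
      simN t₁ χ (fun x _ => l ^ 2 * ps (l * x)) x) (∫ x in a..b, Real.exp (x ^ 2 / 4) * V x * (γ / x ^ 2))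
  linarith

lemma src_zero (h : UnifSol α β ustar u p w ps V) (hb : TimeBump t₀ t₁ χ χ') {a : ℝ} (ha : α < a) :
    ∀ᶠ l in atTop, ∀ x ≥ a, srcAvg u p t₁ χ l x = 0 := by
  obtain ⟨X, hX⟩ := h.p_zero_outer ha
  have ha0 := h.hα.trans ha
  have hs0 := Real.sqrt_pos.2 hb.pos
  filter_upwards [eventually_gt_atTop (0:ℝ), eventually_ge_atTop (X / (a * Real.sqrt t₀))] with l hl hlX x hx
  refine setIntegral_eq_zero_of_forall_eq_zero fun t ht => ?_
  by_cases hm : t ∈ Ioo t₀ t₁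
  · have hX1 : X ≤ l * (x * Real.sqrt t) := by
      rw [div_le_iff₀ (by positivity)] at hlX
      have := Real.sqrt_le_sqrt hm.1.le
      have hx0 : 0 ≤ x := ha0.le.trans hx
      exact hlX.trans (by gcongr)
    have hz : p (l * (x * Real.sqrt t)) (l ^ 2 * t) = 0 := by
      refine hX _ hX1 _ ?_
      rw [le_div_iff₀ (by positivity)]
      calc l ^ 2 * t * a ^ 2 ≤ l ^ 2 * t * x ^ 2 := by
            have := ht.1.le
            gcongr
        _ = (l * (x * Real.sqrt t)) ^ 2 := by rw [mul_pow, mul_pow, Real.sq_sqrt ht.1.le]; ring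
    simp only [hz, zero_mul, mul_zero]
  · rw [hb.zero t hm, mul_zero, zero_mul]

lemma src_outer (h : UnifSol α β ustar u p w ps V) (hb : TimeBump t₀ t₁ χ χ')
    (hγ : Tendsto (fun x => x * tailMass ps x) atTop (𝓝 γ)) {d : ℝ} (hd : α ≤ d) :
    Tendsto (fun l => ∫ x in α..d, Real.exp (x ^ 2 / 4) * srcAvg u p t₁ χ l x) atTop (𝓝 0) := by
  rcases hd.eq_or_lt with rfl | hd
  · simp
  have hα := h.hα
  have P0 := PsiP_pos h.hα h.hβ α
  set K := Real.exp (d ^ 2 / 4) * PsiP α β α with hK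
  have hK0 : 0 < K := by positivity
  rw [Metric.tendsto_atTop']
  suffices H : ∀ ε > 0, ∀ᶠ l in atTop, dist (∫ x in α..d, Real.exp (x ^ 2 / 4) * srcAvg u p t₁ χ l x) 0 < ε by
    intro ε hε
    obtain ⟨N, hN⟩ := eventually_atTop.1 (H ε hε)
    exact ⟨N, fun n hn => hN n hn.le⟩
  intro ε hε
  obtain ⟨a, haα, had, hae⟩ : ∃ a, α < a ∧ a ≤ d ∧ K * ∫ x in α..a, γ / x ^ 2 < ε := by
    have hc : Tendsto (fun a => K * (γ * (1 / α - 1 / a))) (𝓝 α) (𝓝 (K * (γ * (1 / α - 1 / α)))) := by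
      refine ((tendsto_const_nhds.sub ?_).const_mul _).const_mul _
      exact tendsto_const_nhds.div tendsto_id hα.ne'
    rw [sub_self, mul_zero, mul_zero] at hc
    have h1 := (hc.eventually (gt_mem_nhds hε)).filter_mono (nhdsWithin_le_nhds (s := Ioi α))
    obtain ⟨a, ⟨h2, h3⟩⟩ := (h1.and (Ioc_mem_nhdsGT hd)).exists
    refine ⟨a, h3.1, h3.2, ?_⟩
    rw [show (fun x : ℝ => γ / x ^ 2) = fun x => γ * (1 / x ^ 2) by funext x; ring, intervalIntegral.integral_const_mul,
      integral_inv_sq hα h3.1.le]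
    exact h2
  have T := (h.density_tendsto hb hγ hα haα.le).const_mul K
  filter_upwards [h.src_zero hb haα, T.eventually (gt_mem_nhds hae), eventually_gt_atTop (0:ℝ)] with l h0 h1 hl
  have H := h.sys_scale hl
  have i1 : ∀ a b, IntervalIntegrable (fun x => Real.exp (x ^ 2 / 4) * srcAvg u p t₁ χ l x) volume a b :=
    H.exp_simN_intervalIntegrable hb
  have e : ∫ x in a..d, Real.exp (x ^ 2 / 4) * srcAvg u p t₁ χ l x = 0 := by
    refine intervalIntegral.integral_zero_ae (Eventually.of_forall fun z hzm => ?_)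
    rw [uIoc_of_le had] at hzm
    rw [h0 z hzm.1.le, mul_zero]
  have n0 : 0 ≤ ∫ x in α..a, Real.exp (x ^ 2 / 4) * srcAvg u p t₁ χ l x :=
    intervalIntegral.integral_nonneg haα.le fun x _ => mul_nonneg (Real.exp_pos _).le (H.simN_nonneg hb x)
  rw [← intervalIntegral.integral_add_adjacent_intervals (i1 α a) (i1 a d), e, add_zero, Real.dist_eq, sub_zero, abs_of_nonneg n0]
  refine lt_of_le_of_lt ?_ h1
  rw [← intervalIntegral.integral_const_mul]
  refine intervalIntegral.integral_mono_on haα.le (i1 _ _) ((h.density_intervalIntegrable hb l haα.le).const_mul _) ?_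
  intro x hx
  rw [hK, mul_assoc]
  refine mul_le_mul (exp_sq_le (hα.le.trans hx.1) (hx.2.trans had)) (H.simN_le hb (hα.trans_le hx.1))
    (H.simN_nonneg hb x) (Real.exp_pos _).le

/-- Accumulated limiting source. -/
def srcInt (α γ : ℝ) (V : ℝ → ℝ) (a s : ℝ) : ℝ := ∫ x in a..(min s α), Real.exp (x ^ 2 / 4) * V x * (γ / x ^ 2)

lemma src_tendsto (h : UnifSol α β ustar u p w ps V) (hb : TimeBump t₀ t₁ χ χ')
    (hγ : Tendsto (fun x => x * tailMass ps x) atTop (𝓝 γ)) (hγ0 : 0 ≤ γ) {a s : ℝ} (ha : 0 < a) (haα : a ≤ α)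
    (has : a ≤ s) :
    Tendsto (fun l => ∫ x in a..s, Real.exp (x ^ 2 / 4) * srcAvg u p t₁ χ l x) atTop (𝓝 (srcInt α γ V a s)) := by
  rcases le_total s α with hs | hs
  · rw [srcInt, min_eq_left hs]
    exact h.src_inner hb hγ hγ0 ha has hs
  · rw [srcInt, min_eq_right hs]
    have := (h.src_inner hb hγ hγ0 ha haα le_rfl).add (h.src_outer hb hγ hs)
    rw [add_zero] at this
    refine this.congr' ?_
    filter_upwards [eventually_gt_atTop (0:ℝ)] with l hl
    exact intervalIntegral.integral_add_adjacent_intervals ((h.sys_scale hl).exp_simN_intervalIntegrable hb _ _)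
      ((h.sys_scale hl).exp_simN_intervalIntegrable hb _ _)

lemma src_integrand_continuousOn (h : UnifSol α β ustar u p w ps V) :
    ContinuousOn (fun x => Real.exp (x ^ 2 / 4) * V x * (γ / x ^ 2)) (Ioi 0) := by
  refine ((by fun_prop : Continuous fun x : ℝ => Real.exp (x ^ 2 / 4)).continuousOn.mul h.V_continuousOn).mul ?_
  refine continuousOn_const.div (by fun_prop) fun x hx => ?_
  have : 0 < x := hx
  positivity

lemma srcInt_continuousOn (h : UnifSol α β ustar u p w ps V) {a b : ℝ} (ha : 0 < a) (haα : a ≤ α) :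
    ContinuousOn (srcInt α γ V a) (Icc a b) := by
  have h1 : ContinuousOn (fun s => ∫ x in a..s, Real.exp (x ^ 2 / 4) * V x * (γ / x ^ 2)) (Icc a α) := by
    have := intervalIntegral.continuousOn_primitive_interval (μ := volume) (a := a) (b := α)
      (f := fun x => Real.exp (x ^ 2 / 4) * V x * (γ / x ^ 2))
    rw [uIcc_of_le haα] at this
    refine this (ContinuousOn.integrableOn_Icc ?_)
    exact h.src_integrand_continuousOn.mono fun x hx => ha.trans_le hx.1
  exact h1.comp (by fun_prop : Continuous fun s => min s α).continuousOn fun s hs => ⟨le_min hs.1 haα, min_le_right _ _⟩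

/-- Integral form of the limiting equation. -/
lemma V_integral_eq (h : UnifSol α β ustar u p w ps V)
    (hγ : Tendsto (fun x => x * tailMass ps x) atTop (𝓝 γ)) (hγ0 : 0 ≤ γ) {a b : ℝ} (ha : 0 < a) (haα : a ≤ α)
    (hab : a < b) : ∃ E, ∀ x ∈ Icc a b, (V x - PsiP α β x) - (V a - PsiP α β a) =
      ∫ s in a..x, Real.exp (-s ^ 2 / 4) * (E + srcInt α γ V a s) := by
  obtain ⟨χ, χ', hb⟩ := exists_timeBump (t₀ := 1) (t₁ := 2) one_pos (by norm_num)
  have Tr := h.simR_error_tendsto hb ha.le hab.le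
  set E := fun l => simE 2 χ (fun x t => l * w (l * x) (l ^ 2 * t)) with hE
  set S := fun l => simS 2 χ (fun x t => u (l * x) (l ^ 2 * t) - psi α β x t) with hS
  set ρ := fun l => ∫ x in a..b, Real.exp (x ^ 2 / 4) *
      |simR 2 χ χ' (fun x t => u (l * x) (l ^ 2 * t) - psi α β x t) x| with hρ
  have err : ∀ᶠ l in atTop, ∀ s ∈ Icc a b,
      |E l s - E l a - ∫ x in a..s, Real.exp (x ^ 2 / 4) * srcAvg u p 2 χ l x| ≤ ρ l := by
    filter_upwards [eventually_gt_atTop (0:ℝ)] with l hl s hs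
    exact (h.sys_scale hl).simE_sub_error hb le_rfl hs.1 hs.2
  have TE : ∀ s ∈ Icc a b, Tendsto (fun l => E l s - E l a) atTop (𝓝 (srcInt α γ V a s)) := by
    intro s hs
    have T1 : Tendsto (fun l => E l s - E l a - ∫ x in a..s, Real.exp (x ^ 2 / 4) * srcAvg u p 2 χ l x) atTop (𝓝 0) :=
      squeeze_zero_norm' (err.mono fun l hl => hl s hs) Tr
    have := T1.add (h.src_tendsto hb hγ hγ0 ha haα hs.1)
    simpa using this
  have bd : ∀ᶠ l in atTop, ∀ s ∈ Icc a b, |E l s - E l a| ≤ srcInt α γ V a b + 2 := by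
    filter_upwards [err, (h.src_tendsto hb hγ hγ0 ha haα hab.le).eventually (gt_mem_nhds (lt_add_one _)),
      Tr.eventually (gt_mem_nhds one_pos), eventually_gt_atTop (0:ℝ)] with l h1 h2 h3 hl s hs
    have H := h.sys_scale hl
    have n0 : ∀ x, 0 ≤ Real.exp (x ^ 2 / 4) * srcAvg u p 2 χ l x := fun x =>
      mul_nonneg (Real.exp_pos _).le (H.simN_nonneg hb x)
    have n1 : 0 ≤ ∫ x in a..s, Real.exp (x ^ 2 / 4) * srcAvg u p 2 χ l x :=
      intervalIntegral.integral_nonneg hs.1 fun x _ => n0 x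
    have n2 : ∫ x in a..s, Real.exp (x ^ 2 / 4) * srcAvg u p 2 χ l x
        ≤ ∫ x in a..b, Real.exp (x ^ 2 / 4) * srcAvg u p 2 χ l x :=
      intervalIntegral.integral_mono_interval le_rfl hs.1 hs.2 (ae_of_all _ n0)
        (H.exp_simN_intervalIntegrable hb a b)
    have h4 := abs_le.1 (h1 s hs)
    have h5 : ρ l < 1 := h3
    rw [abs_le]
    constructor <;> linarith
  have hcE : ∀ᶠ l in atTop, Continuous (E l) := by
    filter_upwards [eventually_gt_atTop (0:ℝ)] with l hl using (h.sys_scale hl).simE_continuous hb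
  have TI : ∀ x ∈ Icc a b, Tendsto (fun l => ∫ s in a..x, Real.exp (-s ^ 2 / 4) * (E l s - E l a)) atTop
      (𝓝 (∫ s in a..x, Real.exp (-s ^ 2 / 4) * srcInt α γ V a s)) := by
    intro x hx
    refine intervalIntegral.tendsto_integral_filter_of_dominated_convergence
      (fun s => Real.exp (-s ^ 2 / 4) * (srcInt α γ V a b + 2)) ?_ ?_
      ((gexp_continuous.mul continuous_const).intervalIntegrable _ _) ?_
    · filter_upwards [hcE] with l hl
      exact (gexp_continuous.mul (hl.sub continuous_const)).aestronglyMeasurable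
    · filter_upwards [bd] with l hl
      refine Eventually.of_forall fun s hs => ?_
      rw [uIoc_of_le hx.1] at hs
      rw [norm_mul, Real.norm_eq_abs, abs_of_pos (Real.exp_pos _)]
      exact mul_le_mul_of_nonneg_left (hl s ⟨hs.1.le, hs.2.trans hx.2⟩) (Real.exp_pos _).le
    · refine Eventually.of_forall fun s hs => ?_
      rw [uIoc_of_le hx.1] at hs
      exact (TE s ⟨hs.1.le, hs.2.trans hx.2⟩).const_mul _
  have TS : ∀ x ∈ Icc a b, Tendsto (fun l => S l x) atTop (𝓝 (V x - PsiP α β x)) := fun x hx =>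
    h.simS_tendsto hb (ha.trans_le hx.1) (h.good (ha.trans_le hx.1))
  have gi : ∀ x, ∫ s in a..x, Real.exp (-s ^ 2 / 4) = gtail a - gtail x := by
    intro x
    have := intervalIntegral.integral_eq_sub_of_hasDerivAt (a := a) (b := x) (fun s _ => gtail_hasDerivAt s)
      (gexp_continuous.neg.intervalIntegrable _ _)
    rw [intervalIntegral.integral_neg] at this
    linarith
  have id : ∀ᶠ l in atTop, ∀ x, S l x - S l a - ∫ s in a..x, Real.exp (-s ^ 2 / 4) * (E l s - E l a) =
      E l a * (gtail a - gtail x) := by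
    filter_upwards [eventually_gt_atTop (0:ℝ), hcE] with l hl hc x
    have := intervalIntegral.integral_eq_sub_of_hasDerivAt (a := a) (b := x)
      (fun s _ => (h.sys_scale hl).simS_hasDerivAt hb s) ((gexp_continuous.mul hc).intervalIntegrable _ _)
    have i1 : IntervalIntegrable (fun s => E l a * Real.exp (-s ^ 2 / 4)) volume a x :=
      (gexp_continuous.const_mul _).intervalIntegrable _ _
    have i2 : IntervalIntegrable (fun s => Real.exp (-s ^ 2 / 4) * (E l s - E l a)) volume a x :=
      (gexp_continuous.mul (hc.sub continuous_const)).intervalIntegrable _ _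
    rw [← gi, ← intervalIntegral.integral_const_mul, sub_eq_iff_eq_add, ← intervalIntegral.integral_add i1 i2, ← this]
    refine intervalIntegral.integral_congr fun s _ => ?_
    simp only [hE]
    ring
  have TD : ∀ x ∈ Icc a b, Tendsto (fun l => E l a * (gtail a - gtail x)) atTop
      (𝓝 (V x - PsiP α β x - (V a - PsiP α β a) - ∫ s in a..x, Real.exp (-s ^ 2 / 4) * srcInt α γ V a s)) := by
    intro x hx
    refine (((TS x hx).sub (TS a ⟨le_rfl, hab.le⟩)).sub (TI x hx)).congr' ?_
    filter_upwards [id] with l hl using hl x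
  have g0 : 0 < gtail a - gtail b := sub_pos.2 (gtail_strictAnti hab)
  obtain ⟨e, he⟩ : ∃ e, Tendsto (fun l => E l a) atTop (𝓝 e) := by
    have := (TD b ⟨hab.le, le_rfl⟩).mul_const (gtail a - gtail b)⁻¹
    simp only [mul_assoc, mul_inv_cancel₀ g0.ne', mul_one] at this
    exact ⟨_, this⟩
  refine ⟨e, fun x hx => ?_⟩
  have := tendsto_nhds_unique (TD x hx) (he.mul_const _)
  rw [sub_eq_iff_eq_add] at this
  have i1 : IntervalIntegrable (fun s => e * Real.exp (-s ^ 2 / 4)) volume a x :=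
    (gexp_continuous.const_mul _).intervalIntegrable _ _
  have i2 : IntervalIntegrable (fun s => Real.exp (-s ^ 2 / 4) * srcInt α γ V a s) volume a x := by
    refine ContinuousOn.intervalIntegrable ?_
    rw [uIcc_of_le hx.1]
    exact gexp_continuous.continuousOn.mul (h.srcInt_continuousOn ha haα)
  rw [this, ← gi, ← intervalIntegral.integral_const_mul, ← intervalIntegral.integral_add i1 i2]
  refine intervalIntegral.integral_congr fun s _ => ?_
  ring

end UnifSol

/-- Power series with real coefficients. -/
def powSer (d : ℕ → ℝ) (z : ℝ) : ℝ := ∑' n, d n * z ^ n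

/-- Coefficients dominated by those of the exponential. -/
def ExpBdd (d : ℕ → ℝ) : Prop := ∀ n, |d n| ≤ 1 / (n.factorial : ℝ)

namespace ExpBdd
variable {d : ℕ → ℝ}

lemma summable (hd : ExpBdd d) (z : ℝ) : Summable fun n => d n * z ^ n := by
  refine Summable.of_norm_bounded (Real.summable_pow_div_factorial |z|) fun n => ?_
  rw [norm_mul, norm_pow, Real.norm_eq_abs, Real.norm_eq_abs]
  calc |d n| * |z| ^ n ≤ 1 / (n.factorial : ℝ) * |z| ^ n := mul_le_mul_of_nonneg_right (hd n) (by positivity)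
    _ = _ := by ring

lemma hasSum (hd : ExpBdd d) (z : ℝ) : HasSum (fun n => d n * z ^ n) (powSer d z) := (hd.summable z).hasSum

lemma shift (hd : ExpBdd d) : ExpBdd fun n => (n + 1 : ℝ) * d (n + 1) := by
  intro n
  have := hd (n + 1)
  rw [abs_mul, abs_of_pos (by positivity : (0:ℝ) < n + 1)]
  rw [Nat.factorial_succ] at this
  push_cast at this
  calc (n + 1 : ℝ) * |d (n + 1)| ≤ (n + 1) * (1 / ((n + 1) * n.factorial)) := by gcongr
    _ = _ := by field_simp

lemma hasDerivAt (hd : ExpBdd d) (z : ℝ) :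
    HasDerivAt (powSer d) (powSer (fun n => (n + 1 : ℝ) * d (n + 1)) z) z := by
  set R := |z| + 1 with hR
  have hs : Summable fun n : ℕ => R ^ (n - 1) / ((n - 1).factorial : ℝ) :=
    (summable_nat_add_iff 1).1 (Real.summable_pow_div_factorial R)
  have key := hasDerivAt_tsum_of_isPreconnected (𝕜 := ℝ) (F := ℝ) (g := fun n y => d n * y ^ n)
    (g' := fun n y => d n * (n * y ^ (n - 1))) (t := Metric.ball 0 R) (y₀ := 0) (y := z) hs Metric.isOpen_ball
    (convex_ball _ _).isPreconnected (fun n y _ => (hasDerivAt_pow n y).const_mul _) ?_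
    (Metric.mem_ball_self (by positivity)) (hd.summable 0) (by simp [hR])
  · refine key.congr_deriv ?_
    have hs' : Summable fun n => d n * (n * z ^ (n - 1)) := by
      refine (summable_nat_add_iff 1).1 ((hd.shift.summable z).congr fun n => ?_)
      simp
      ring
    rw [hs'.tsum_eq_zero_add, powSer]
    simp only [Nat.cast_zero, zero_mul, mul_zero, zero_add, Nat.add_sub_cancel]
    refine tsum_congr fun n => ?_
    push_cast
    ring
  · intro n y hy
    rw [mem_ball_zero_iff, Real.norm_eq_abs] at hy
    rcases n with _ | n
    · simp
    · have := hd.shift n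
      have e : d (n + 1) * (((n + 1 : ℕ) : ℝ) * y ^ (n + 1 - 1)) = ((n + 1 : ℝ) * d (n + 1)) * y ^ n := by
        push_cast
        ring
      rw [e, norm_mul, norm_pow, Real.norm_eq_abs, Real.norm_eq_abs, Nat.add_sub_cancel]
      calc _ ≤ 1 / (n.factorial : ℝ) * R ^ n := by gcongr
        _ = _ := by ring

lemma hasSum_mul (hd : ExpBdd d) (z : ℝ) :
    HasSum (fun n : ℕ => (n : ℝ) * d n * z ^ n) (z * powSer (fun n => (n + 1 : ℝ) * d (n + 1)) z) := by
  rw [← hasSum_nat_add_iff' 1]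
  simp only [Finset.range_one, Finset.sum_singleton, Nat.cast_zero, zero_mul, sub_zero]
  refine ((hd.shift.hasSum z).mul_left z).congr_fun fun n => ?_
  push_cast
  ring

end ExpBdd

/-- Taylor coefficients of Kummer's function. -/
def kummerC (a b : ℝ) (n : ℕ) : ℝ :=
  Polynomial.eval a (ascPochhammer ℝ n) / Polynomial.eval b (ascPochhammer ℝ n) / (n.factorial : ℝ)

lemma kummerM_eq (a b z : ℝ) : kummerM a b z = powSer (kummerC a b) z := by
  simp only [kummerM, powSer, kummerC]
  refine tsum_congr fun n => ?_
  ring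

lemma pochhammer_eval_succ (a : ℝ) (n : ℕ) : Polynomial.eval a (ascPochhammer ℝ (n + 1)) =
    Polynomial.eval a (ascPochhammer ℝ n) * (a + n) := ascPochhammer_succ_eval n a

lemma pochhammer_eval_le {a b : ℝ} (ha : 0 < a) (hab : a ≤ b) (n : ℕ) :
    Polynomial.eval a (ascPochhammer ℝ n) ≤ Polynomial.eval b (ascPochhammer ℝ n) := by
  induction n with
  | zero => simp
  | succ n ih =>
    rw [pochhammer_eval_succ, pochhammer_eval_succ]
    exact mul_le_mul ih (by linarith) (by positivity) (ascPochhammer_pos n b (ha.trans_le hab)).le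

lemma kummerC_expBdd {a b : ℝ} (ha : 0 < a) (hab : a ≤ b) : ExpBdd (kummerC a b) := by
  intro n
  have h1 := ascPochhammer_pos n a ha
  have h2 := ascPochhammer_pos n b (ha.trans_le hab)
  rw [kummerC, abs_of_nonneg (by positivity)]
  have := (div_le_one h2).2 (pochhammer_eval_le ha hab n)
  gcongr

lemma pochhammer_shift (a : ℝ) (n : ℕ) : Polynomial.eval a (ascPochhammer ℝ n) * (a + n) =
    a * Polynomial.eval (a + 1) (ascPochhammer ℝ n) := by
  induction n with
  | zero => simp
  | succ n ih =>
    rw [pochhammer_eval_succ, pochhammer_eval_succ, ih]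
    push_cast
    ring

/-- Derivative of Kummer's function as a power series. -/
def kummerD (a b z : ℝ) : ℝ := powSer (fun n => (n + 1 : ℝ) * kummerC a b (n + 1)) z

lemma kummerM_hasDerivAt {a b : ℝ} (ha : 0 < a) (hab : a ≤ b) (z : ℝ) :
    HasDerivAt (kummerM a b) (kummerD a b z) z := by
  have := (kummerC_expBdd ha hab).hasDerivAt z
  rwa [show powSer (kummerC a b) = kummerM a b from funext fun z => (kummerM_eq a b z).symm] at this

lemma kummerM_zero (a b : ℝ) : kummerM a b 0 = 1 := by
  rw [kummerM_eq, powSer, tsum_eq_single 0 fun n hn => by simp [hn]]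
  simp [kummerC]

lemma kummer_contiguous_left {a b : ℝ} (ha : 0 < a) (hab : a + 1 ≤ b) (z : ℝ) :
    a * kummerM a b z + z * kummerD a b z = a * kummerM (a + 1) b z := by
  have hM := kummerC_expBdd ha (by linarith : a ≤ b)
  have hN := kummerC_expBdd (by linarith : 0 < a + 1) hab
  have h1 := ((hM.hasSum z).mul_left a).add (hM.hasSum_mul z)
  have h2 := (hN.hasSum z).mul_left a
  rw [kummerM_eq, kummerM_eq, kummerD]
  refine h1.unique (h2.congr_fun fun n => ?_)
  have := pochhammer_shift a n
  simp only [kummerC]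
  linear_combination (1 / Polynomial.eval b (ascPochhammer ℝ n) / (n.factorial : ℝ) * z ^ n) * this

lemma kummer_contiguous_right {a b : ℝ} (ha : 0 < a) (hab : a + 1 ≤ b) (z : ℝ) :
    z * kummerD (a + 1) b z + (b - a - 1 - z) * kummerM (a + 1) b z = (b - a - 1) * kummerM a b z := by
  have hM := kummerC_expBdd ha (by linarith : a ≤ b)
  have hN := kummerC_expBdd (by linarith : 0 < a + 1) hab
  have h1 := (((hN.hasSum z).mul_left (b - a - 1)).add (hN.hasSum_mul z)).sub ((hM.hasSum z).mul_left (b - a - 1))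
  have h2 := (hN.hasSum z).mul_left z
  have h3 : HasSum (fun n : ℕ => (b - a - 1) * (kummerC (a + 1) b n * z ^ n) + n * kummerC (a + 1) b n * z ^ n -
      (b - a - 1) * (kummerC a b n * z ^ n)) (z * powSer (kummerC (a + 1) b) z) := by
    rw [← hasSum_nat_add_iff' 1]
    simp only [Finset.range_one, Finset.sum_singleton, Nat.cast_zero, zero_mul, pow_zero, mul_one, add_zero]
    have e0 : kummerC (a + 1) b 0 = kummerC a b 0 := by simp [kummerC]
    rw [e0, sub_self, sub_zero]
    refine h2.congr_fun fun n => ?_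
    have hb := ascPochhammer_pos n b (by linarith)
    have hbn : b + n ≠ 0 := by
      have : (0:ℝ) ≤ n := n.cast_nonneg
      linarith
    have hf : (n.factorial : ℝ) ≠ 0 := by positivity
    have hs := pochhammer_shift a n
    simp only [kummerC, pochhammer_eval_succ, hs, Nat.factorial_succ]
    push_cast
    field_simp
    ring
  rw [kummerM_eq, kummerM_eq, kummerD]
  have := h1.unique h3
  linarith

lemma kappaOf_ge {γ : ℝ} (hγ : 0 ≤ γ) : 1 ≤ kappaOf γ := by
  have : 1 ≤ Real.sqrt (4 * γ + 1) := Real.one_le_sqrt.2 (by linarith)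
  rw [kappaOf]
  linarith

lemma kappaOf_mul {γ : ℝ} (hγ : 0 ≤ γ) : kappaOf γ * (kappaOf γ - 1) = γ := by
  have := Real.sq_sqrt (by linarith : 0 ≤ 4 * γ + 1)
  rw [kappaOf]
  linarith

/-- The regular solution of the inner profile equation. -/
def kumY (κ η : ℝ) : ℝ := η ^ κ * kummerM (κ / 2) (κ + 1 / 2) (-η ^ 2 / 4)

/-- The flux of `kumY`. -/
def kumP (κ η : ℝ) : ℝ := Real.exp (η ^ 2 / 4) * (κ * η ^ (κ - 1) * kummerM (κ / 2 + 1) (κ + 1 / 2) (-η ^ 2 / 4))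

lemma hasDerivAt_neg_sq_div (η : ℝ) : HasDerivAt (fun η : ℝ => -η ^ 2 / 4) (-η / 2) η :=
  ((hasDerivAt_pow 2 η).neg.div_const 4).congr_deriv (by simp; ring)

lemma kumY_hasDerivAt {κ η : ℝ} (hκ : 1 ≤ κ) (hη : 0 < η) :
    HasDerivAt (kumY κ) (Real.exp (-η ^ 2 / 4) * kumP κ η) η := by
  have h1 := Real.hasDerivAt_rpow_const (x := η) (p := κ) (Or.inl hη.ne')
  have h2 : HasDerivAt (fun η => kummerM (κ / 2) (κ + 1 / 2) (-η ^ 2 / 4))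
      (kummerD (κ / 2) (κ + 1 / 2) (-η ^ 2 / 4) * (-η / 2)) η :=
    HasDerivAt.comp η (h₂ := kummerM (κ / 2) (κ + 1 / 2)) (kummerM_hasDerivAt (by linarith) (by linarith) _)
    (hasDerivAt_neg_sq_div η)
  have h3 := kummer_contiguous_left (a := κ / 2) (b := κ + 1 / 2) (by linarith) (by linarith) (-η ^ 2 / 4)
  refine (h1.mul h2).congr_deriv ?_
  have he : Real.exp (-η ^ 2 / 4) * Real.exp (η ^ 2 / 4) = 1 := by rw [← Real.exp_add]; ring_nf; exact Real.exp_zero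
  rw [kumP, ← mul_assoc (Real.exp (-η ^ 2 / 4)), he, one_mul, Real.rpow_sub_one hη.ne']
  generalize kummerM (κ / 2) (κ + 1 / 2) (-η ^ 2 / 4) = A at h3 ⊢
  generalize kummerM (κ / 2 + 1) (κ + 1 / 2) (-η ^ 2 / 4) = B at h3 ⊢
  generalize kummerD (κ / 2) (κ + 1 / 2) (-η ^ 2 / 4) = C at h3 ⊢
  field_simp
  linear_combination (4:ℝ) * h3

lemma kumP_hasDerivAt {κ η : ℝ} (hκ : 1 ≤ κ) (hη : 0 < η) :
    HasDerivAt (kumP κ) (Real.exp (η ^ 2 / 4) * kumY κ η * (κ * (κ - 1) / η ^ 2)) η := by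
  have h0 : HasDerivAt (fun η : ℝ => Real.exp (η ^ 2 / 4)) (Real.exp (η ^ 2 / 4) * (η / 2)) η :=
    (((hasDerivAt_pow 2 η).div_const 4).exp).congr_deriv (by simp; ring)
  have h1 := (Real.hasDerivAt_rpow_const (x := η) (p := κ - 1) (Or.inl hη.ne')).const_mul κ
  have h2 : HasDerivAt (fun η => kummerM (κ / 2 + 1) (κ + 1 / 2) (-η ^ 2 / 4))
      (kummerD (κ / 2 + 1) (κ + 1 / 2) (-η ^ 2 / 4) * (-η / 2)) η :=
    HasDerivAt.comp η (h₂ := kummerM (κ / 2 + 1) (κ + 1 / 2)) (kummerM_hasDerivAt (by linarith) (by linarith) _)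
    (hasDerivAt_neg_sq_div η)
  have h3 := kummer_contiguous_right (a := κ / 2) (b := κ + 1 / 2) (by linarith) (by linarith) (-η ^ 2 / 4)
  refine (h0.mul (h1.fun_mul h2)).congr_deriv ?_
  rw [kumY, Real.rpow_sub_one hη.ne' (κ - 1), Real.rpow_sub_one hη.ne' κ]
  generalize kummerM (κ / 2) (κ + 1 / 2) (-η ^ 2 / 4) = A at h3 ⊢
  generalize kummerM (κ / 2 + 1) (κ + 1 / 2) (-η ^ 2 / 4) = B at h3 ⊢
  generalize kummerD (κ / 2 + 1) (κ + 1 / 2) (-η ^ 2 / 4) = C at h3 ⊢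
  field_simp
  linear_combination (4:ℝ) * h3

lemma kumY_zero {κ : ℝ} (hκ : 1 ≤ κ) : kumY κ 0 = 0 := by
  rw [kumY, Real.zero_rpow (by linarith), zero_mul]

lemma kummer_inner_continuous {κ : ℝ} (hκ : 1 ≤ κ) :
    Continuous fun η : ℝ => kummerM (κ / 2) (κ + 1 / 2) (-η ^ 2 / 4) := by
  have : Continuous (kummerM (κ / 2) (κ + 1 / 2)) :=
    continuous_iff_continuousAt.2 fun z => (kummerM_hasDerivAt (by linarith) (by linarith) z).continuousAt
  exact this.comp (by fun_prop)

lemma kumY_continuousOn {κ : ℝ} (hκ : 1 ≤ κ) : Continuous (kumY κ) :=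
  (Real.continuous_rpow_const (by linarith)).mul (kummer_inner_continuous hκ)

/-- A maximum principle on `[0, α]`. -/
lemma max_principle {f P : ℝ → ℝ} {α γ : ℝ} (hγ : 0 ≤ γ) (hα : 0 < α) (hf : ContinuousOn f (Icc 0 α)) (h0 : f 0 ≤ 0)
    (h1 : f α ≤ 0) (hd : ∀ x ∈ Ioo 0 α, HasDerivAt f (Real.exp (-x ^ 2 / 4) * P x) x)
    (hP : ∀ x ∈ Ioo 0 α, HasDerivAt P (Real.exp (x ^ 2 / 4) * f x * (γ / x ^ 2)) x) :
    ∀ x ∈ Icc 0 α, f x ≤ 0 := by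
  obtain ⟨x₀, hx₀, hmax⟩ := isCompact_Icc.exists_isMaxOn (nonempty_Icc.2 hα.le) hf
  intro x hx
  refine (hmax hx).trans ?_
  by_contra! hpos
  have hI : x₀ ∈ Ioo 0 α := by
    refine ⟨lt_of_le_of_ne hx₀.1 ?_, lt_of_le_of_ne hx₀.2 ?_⟩
    · rintro rfl; linarith
    · rintro rfl; linarith
  have hP0 : P x₀ = 0 := by
    have := (hmax.isLocalMax (Icc_mem_nhds hI.1 hI.2)).hasDerivAt_eq_zero (hd x₀ hI)
    exact (mul_eq_zero.1 this).resolve_left (Real.exp_pos _).ne'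
  set S := Icc x₀ α ∩ f ⁻¹' Iic 0 with hS
  have hSc : IsCompact S := by
    have : IsClosed S := (hf.mono (Icc_subset_Icc_left hx₀.1)).preimage_isClosed_of_isClosed isClosed_Icc isClosed_Iic
    exact isCompact_Icc.of_isClosed_subset this inter_subset_left
  obtain ⟨x₁, hx₁, hmin⟩ := hSc.exists_isLeast ⟨α, ⟨hx₀.2, le_rfl⟩, h1⟩
  have h01 : x₀ < x₁ := lt_of_le_of_ne hx₁.1.1 (by rintro rfl; exact absurd hx₁.2 (not_le.2 hpos))
  have hfpos : ∀ y ∈ Ico x₀ x₁, 0 < f y := by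
    intro y hy
    by_contra! hle
    exact absurd (hmin ⟨⟨hy.1, (hy.2.trans_le hx₁.1.2).le⟩, hle⟩) (not_le.2 hy.2)
  have hin : ∀ y ∈ Ico x₀ x₁, y ∈ Ioo 0 α := fun y hy => ⟨hI.1.trans_le hy.1, hy.2.trans_le hx₁.1.2⟩
  have hPm : MonotoneOn P (Ico x₀ x₁) := by
    refine monotoneOn_of_hasDerivWithinAt_nonneg (convex_Ico _ _)
      (fun y hy => (hP y (hin y hy)).continuousAt.continuousWithinAt)
      (fun y hy => (hP y (hin y (interior_subset hy))).hasDerivWithinAt) ?_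
    intro y hy
    have := hfpos y (interior_subset hy)
    positivity
  have hfm : MonotoneOn f (Icc x₀ x₁) := by
    refine monotoneOn_of_hasDerivWithinAt_nonneg (f' := fun x => Real.exp (-x ^ 2 / 4) * P x) (convex_Icc _ _)
      (hf.mono (Icc_subset_Icc hx₀.1 hx₁.1.2)) ?_ ?_
    · intro y hy
      rw [interior_Icc] at hy
      exact (hd y (hin y ⟨hy.1.le, hy.2⟩)).hasDerivWithinAt
    · intro y hy
      rw [interior_Icc] at hy
      have := hPm ⟨le_rfl, h01⟩ ⟨hy.1.le, hy.2⟩ hy.1.le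
      rw [hP0] at this
      positivity
  have := hfm ⟨le_rfl, h01.le⟩ ⟨h01.le, le_rfl⟩ h01.le
  have h2 : f x₁ ≤ 0 := hx₁.2
  linarith

lemma kumY_pos {κ α : ℝ} (hκ : 1 ≤ κ) (hα : 0 < α) : 0 < kumY κ α := by
  by_contra! hle
  have key := max_principle (f := kumY κ) (P := kumP κ) (mul_nonneg (by linarith) (by linarith) : 0 ≤ κ * (κ - 1)) hα
    (kumY_continuousOn hκ).continuousOn (kumY_zero hκ).le hle (fun x hx => kumY_hasDerivAt hκ hx.1)
    (fun x hx => kumP_hasDerivAt hκ hx.1)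
  have hc := (kummer_inner_continuous hκ).tendsto 0
  have e : kummerM (κ / 2) (κ + 1 / 2) (-(0:ℝ) ^ 2 / 4) = 1 := by norm_num [kummerM_zero]
  rw [e] at hc
  have h1 := (hc.eventually (lt_mem_nhds one_pos)).filter_mono (nhdsWithin_le_nhds (s := Ioi 0))
  obtain ⟨x, hx, hxα⟩ := (h1.and (Ioc_mem_nhdsGT hα)).exists
  have : 0 < kumY κ x := mul_pos (Real.rpow_pos_of_pos hxα.1 _) hx
  linarith [key x ⟨hxα.1.le, hxα.2⟩]

namespace UnifSol
variable {α β ustar : ℝ} {u p w : ℝ → ℝ → ℝ} {ps V : ℝ → ℝ} {γ : ℝ}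

lemma V_sub_hasDerivAt (h : UnifSol α β ustar u p w ps V)
    (hγ : Tendsto (fun x => x * tailMass ps x) atTop (𝓝 γ)) (hγ0 : 0 ≤ γ) {a b : ℝ} (ha : 0 < a) (haα : a ≤ α)
    (hab : a < b) : ∃ E, ∀ x ∈ Ioo a b, HasDerivAt (fun x => V x - PsiP α β x)
      (Real.exp (-x ^ 2 / 4) * (E + srcInt α γ V a x)) x := by
  obtain ⟨E, hE⟩ := h.V_integral_eq hγ hγ0 ha haα hab
  refine ⟨E, fun x hx => ?_⟩
  have hc : ContinuousOn (fun s => Real.exp (-s ^ 2 / 4) * (E + srcInt α γ V a s)) (Icc a b) :=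
    gexp_continuous.continuousOn.mul (continuousOn_const.add (h.srcInt_continuousOn ha haα))
  have hnb : Icc a b ∈ 𝓝 x := Icc_mem_nhds hx.1 hx.2
  have h1 : HasDerivAt (fun x => ∫ s in a..x, Real.exp (-s ^ 2 / 4) * (E + srcInt α γ V a s))
      (Real.exp (-x ^ 2 / 4) * (E + srcInt α γ V a x)) x := by
    refine intervalIntegral.integral_hasDerivAt_right ?_ ?_ (hc.continuousAt hnb)
    · refine ContinuousOn.intervalIntegrable ?_
      rw [uIcc_of_le hx.1.le]
      exact hc.mono (Icc_subset_Icc_right hx.2.le)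
    · exact ⟨Icc a b, hnb, hc.aestronglyMeasurable measurableSet_Icc⟩
  refine (h1.add_const (V a - PsiP α β a)).congr_of_eventuallyEq ?_
  filter_upwards [hnb] with y hy
  rw [← hE y hy]
  ring

lemma V_ode (h : UnifSol α β ustar u p w ps V)
    (hγ : Tendsto (fun x => x * tailMass ps x) atTop (𝓝 γ)) (hγ0 : 0 ≤ γ) : ∃ P : ℝ → ℝ, ∀ x ∈ Ioo 0 α,
      HasDerivAt V (Real.exp (-x ^ 2 / 4) * P x) x ∧
      HasDerivAt P (Real.exp (x ^ 2 / 4) * V x * (γ / x ^ 2)) x := by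
  refine ⟨fun x => Real.exp (x ^ 2 / 4) * deriv V x, fun x hx => ?_⟩
  have hx2 : 0 < x / 2 := half_pos hx.1
  have hxα : x / 2 < α := (half_lt_self hx.1).trans hx.2
  obtain ⟨E, hE⟩ := h.V_sub_hasDerivAt hγ hγ0 hx2 hxα.le hxα
  have he : ∀ y : ℝ, Real.exp (-y ^ 2 / 4) * Real.exp (y ^ 2 / 4) = 1 := fun y => by
    rw [← Real.exp_add]; ring_nf; exact Real.exp_zero
  have hVd : ∀ y ∈ Ioo (x / 2) α, HasDerivAt V (Real.exp (-y ^ 2 / 4) * (E + srcInt α γ V (x / 2) y)) y := by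
    intro y hy
    refine ((hE y hy).add_const (PsiP α β α)).congr_of_eventuallyEq ?_
    filter_upwards [Iio_mem_nhds hy.2] with z hz
    rw [PsiP_of_le hz.le]
    ring
  have hxI : x ∈ Ioo (x / 2) α := ⟨half_lt_self hx.1, hx.2⟩
  constructor
  · have := hVd x hxI
    refine this.congr_deriv ?_
    beta_reduce
    rw [this.deriv, ← mul_assoc, he, one_mul]
  · have hc := h.src_integrand_continuousOn (γ := γ)
    have h1 : HasDerivAt (fun s => ∫ x in (x / 2)..s, Real.exp (x ^ 2 / 4) * V x * (γ / x ^ 2))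
        (Real.exp (x ^ 2 / 4) * V x * (γ / x ^ 2)) x := by
      refine intervalIntegral.integral_hasDerivAt_right ?_ ?_ (hc.continuousAt (Ioi_mem_nhds hx.1))
      · refine ContinuousOn.intervalIntegrable ?_
        rw [uIcc_of_le hxI.1.le]
        exact hc.mono fun z hz => hx2.trans_le hz.1
      · exact ⟨Ioi 0, Ioi_mem_nhds hx.1, hc.aestronglyMeasurable measurableSet_Ioi⟩
    refine (h1.const_add E).congr_of_eventuallyEq ?_
    filter_upwards [Ioo_mem_nhds hxI.1 hxI.2] with y hy
    rw [(hVd y hy).deriv, srcInt, min_eq_left hy.2.le, ← mul_assoc, mul_comm (Real.exp _), he, one_mul]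

lemma V_continuousOn_zero (h : UnifSol α β ustar u p w ps V) : ContinuousOn V (Ici 0) := by
  intro x hx
  rcases eq_or_lt_of_le (show 0 ≤ x from hx) with rfl | hx
  · obtain ⟨C, hC0, hC⟩ := h.V_le_mul
    rw [ContinuousWithinAt, h.V_zero]
    refine squeeze_zero' (g := fun x => C * x) (Eventually.of_forall fun x => h.V_nonneg x) ?_ ?_
    · filter_upwards [self_mem_nhdsWithin] with x hx using hC x hx
    · have : Tendsto (fun x => C * x) (𝓝 0) (𝓝 (C * 0)) := tendsto_id.const_mul C
      rw [mul_zero] at this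
      exact this.mono_left nhdsWithin_le_nhds
  · exact ((h.V_continuousOn.continuousAt (Ioi_mem_nhds hx))).continuousWithinAt

lemma V_inner (h : UnifSol α β ustar u p w ps V)
    (hγ : Tendsto (fun x => x * tailMass ps x) atTop (𝓝 γ)) (hγ0 : 0 ≤ γ) {x : ℝ} (hx : x ∈ Icc 0 α) :
    V x = V α / kumY (kappaOf γ) α * kumY (kappaOf γ) x := by
  obtain ⟨P, hP⟩ := h.V_ode hγ hγ0
  have hκ := kappaOf_ge hγ0
  have hY := kumY_pos hκ h.hα
  set k := V α / kumY (kappaOf γ) α with hk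
  have hkα : k * kumY (kappaOf γ) α = V α := div_mul_cancel₀ _ hY.ne'
  have hcY := (kumY_continuousOn hκ).continuousOn (s := Icc 0 α)
  have hcV : ContinuousOn V (Icc 0 α) := h.V_continuousOn_zero.mono fun x hx => hx.1
  have dY : ∀ x ∈ Ioo 0 α, HasDerivAt (fun x => k * kumY (kappaOf γ) x)
      (Real.exp (-x ^ 2 / 4) * (k * kumP (kappaOf γ) x)) x := fun x hx =>
    ((kumY_hasDerivAt hκ hx.1).const_mul k).congr_deriv (by ring)
  have dP : ∀ x ∈ Ioo 0 α, HasDerivAt (fun x => k * kumP (kappaOf γ) x)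
      (Real.exp (x ^ 2 / 4) * (k * kumY (kappaOf γ) x) * (γ / x ^ 2)) x := fun x hx =>
    ((kumP_hasDerivAt hκ hx.1).const_mul k).congr_deriv (by rw [kappaOf_mul hγ0]; ring)
  have m1 := max_principle (f := fun x => V x - k * kumY (kappaOf γ) x) (P := fun x => P x - k * kumP (kappaOf γ) x)
    hγ0 h.hα (hcV.sub (hcY.const_mul k)) (by simp [h.V_zero, kumY_zero hκ]) (by simp [hkα])
    (fun x hx => ((hP x hx).1.sub (dY x hx)).congr_deriv (by ring))
    (fun x hx => ((hP x hx).2.sub (dP x hx)).congr_deriv (by ring)) x hx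
  have m2 := max_principle (f := fun x => k * kumY (kappaOf γ) x - V x) (P := fun x => k * kumP (kappaOf γ) x - P x)
    hγ0 h.hα ((hcY.const_mul k).sub hcV) (by simp [h.V_zero, kumY_zero hκ]) (by simp [hkα])
    (fun x hx => ((dY x hx).sub (hP x hx).1).congr_deriv (by ring))
    (fun x hx => ((dP x hx).sub (hP x hx).2).congr_deriv (by ring)) x hx
  linarith

/-- Matching of the derivatives at `α`. -/
lemma V_alpha_eq_ustarGamma (h : UnifSol α β ustar u p w ps V)
    (hγ : Tendsto (fun x => x * tailMass ps x) atTop (𝓝 γ)) (hγ0 : 0 ≤ γ) : V α = ustarGamma α β γ := by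
  have hα := h.hα
  have hβ := h.hβ
  have hκ := kappaOf_ge hγ0
  have hY := kumY_pos hκ hα
  have hg := gtail_pos α
  obtain ⟨E, hE⟩ := h.V_sub_hasDerivAt hγ hγ0 (half_pos hα) (half_lt_self hα).le
    ((half_lt_self hα).trans (lt_add_one α))
  have hD := hE α ⟨half_lt_self hα, lt_add_one α⟩
  set D := Real.exp (-α ^ 2 / 4) * (E + srcInt α γ V (α / 2) α) with hDdef
  set k := V α / kumY (kappaOf γ) α with hk
  have left : D = k * (Real.exp (-α ^ 2 / 4) * kumP (kappaOf γ) α) := by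
    have h1 : HasDerivWithinAt (fun x => V x - PsiP α β x) (k * (Real.exp (-α ^ 2 / 4) * kumP (kappaOf γ) α))
        (Iic α) α := by
      refine (((kumY_hasDerivAt hκ hα).const_mul k).sub_const (PsiP α β α)).hasDerivWithinAt.congr_of_eventuallyEq ?_ ?_
      · filter_upwards [self_mem_nhdsWithin, nhdsWithin_le_nhds (Ioi_mem_nhds hα)] with x hx hx0
        rw [h.V_inner hγ hγ0 ⟨hx0.le, hx⟩, PsiP_of_le hx]
      · rw [div_mul_cancel₀ _ hY.ne']
    exact (uniqueDiffWithinAt_Iic α).eq_deriv _ hD.hasDerivWithinAt h1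
  have right : D = (V α / gtail α - psiC α β) * -Real.exp (-α ^ 2 / 4) := by
    have h1 : HasDerivWithinAt (fun x => V x - PsiP α β x) ((V α / gtail α - psiC α β) * -Real.exp (-α ^ 2 / 4))
        (Ici α) α := by
      have e : ∀ x ∈ Ici α, V x - PsiP α β x = (V α / gtail α - psiC α β) * gtail x := by
        intro x hx
        rw [PsiP_of_ge hx, eq_div_of_mul_eq hg.ne' (h.V_outer hx)]
        ring
      exact ((gtail_hasDerivAt α).const_mul _).hasDerivWithinAt.congr e (e α self_mem_Ici)
    exact (uniqueDiffWithinAt_Ici α).eq_deriv _ hD.hasDerivWithinAt h1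
  rw [left] at right
  have he : Real.exp (-α ^ 2 / 4) * Real.exp (α ^ 2 / 4) = 1 := by rw [← Real.exp_add]; ring_nf; exact Real.exp_zero
  have hpi := Real.sqrt_pos.2 Real.pi_pos
  have hM : 0 < kummerM (kappaOf γ / 2) (kappaOf γ + 1 / 2) (-α ^ 2 / 4) :=
    pos_of_mul_pos_right hY (Real.rpow_nonneg hα.le _)
  have hp := Real.rpow_pos_of_pos hα (kappaOf γ)
  have key : V α * (kappaOf γ * kummerM (kappaOf γ / 2 + 1) (kappaOf γ + 1 / 2) (-α ^ 2 / 4) /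
        (α * kummerM (kappaOf γ / 2) (kappaOf γ + 1 / 2) (-α ^ 2 / 4)) +
      Real.exp (-α ^ 2 / 4) / (Real.sqrt Real.pi * erfc (α / 2))) = α * β / 2 := by
    rw [erfc_half, mul_inv_cancel_left₀ hpi.ne', mul_add]
    have e1 : V α * (kappaOf γ * kummerM (kappaOf γ / 2 + 1) (kappaOf γ + 1 / 2) (-α ^ 2 / 4) /
        (α * kummerM (kappaOf γ / 2) (kappaOf γ + 1 / 2) (-α ^ 2 / 4))) =
        k * (Real.exp (-α ^ 2 / 4) * kumP (kappaOf γ) α) := by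
      rw [kumP, ← mul_assoc (Real.exp (-α ^ 2 / 4)), he, one_mul, hk, kumY, Real.rpow_sub_one hα.ne']
      field_simp
    have e2 : psiC α β * Real.exp (-α ^ 2 / 4) = α * β / 2 := by
      rw [psiC, mul_assoc, mul_comm (Real.exp _), he, mul_one]
    rw [e1, right, ← e2]
    ring
  have hne : α * β / 2 ≠ 0 := by positivity
  rw [ustarGamma, ← key, mul_inv_cancel_right₀]
  intro h0
  rw [h0, mul_zero] at key
  exact hne key.symm

lemma V_eq_Phi (h : UnifSol α β ustar u p w ps V)
    (hγ : Tendsto (fun x => x * tailMass ps x) atTop (𝓝 γ)) (hγ0 : 0 ≤ γ) {x : ℝ} (hx : 0 ≤ x) :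
    V x = Phi α β γ x := by
  rw [Phi, ← h.V_alpha_eq_ustarGamma hγ hγ0]
  split_ifs with hxα
  · rw [h.V_inner hγ hγ0 ⟨hx, hxα.le⟩, kumY, kumY]
    ring
  · have hpi := Real.sqrt_pos.2 Real.pi_pos
    have hg := gtail_pos α
    rw [eq_div_of_mul_eq hg.ne' (h.V_outer (not_lt.1 hxα)), erfc_half, erfc_half]
    field_simp

end UnifSol

namespace UnifSol
variable {α β ustar γ : ℝ} {u p w : ℝ → ℝ → ℝ} {ps V : ℝ → ℝ}

/-- The solution is uniformly small near the origin. -/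
lemma small_near_zero (h : UnifSol α β ustar u p w ps V) {ε : ℝ} (hε : 0 < ε) :
    ∃ a > 0, ∀ᶠ l in atTop, ∀ x ∈ Icc 0 a, u (l * x) (l ^ 2) ≤ ε ∧ V x ≤ ε := by
  obtain ⟨C, hC0, hC⟩ := h.V_le_mul
  have hM := hkMoment_nonneg
  have hP := psiC_pos h.hα h.hβ
  set K := 2 * C + 2 * C * hkMoment + psiC α β * (2 * hkMoment + 2) + 1 with hK
  have hK0 : 0 < K := by positivity
  set s := min (1 / 2) (ε / (4 * K)) with hs
  have hs0 : 0 < s := lt_min (by norm_num) (by positivity)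
  have hs1 : s ≤ 1 / 2 := min_le_left _ _
  have hKs : K * s ≤ ε / 4 := by
    calc K * s ≤ K * (ε / (4 * K)) := mul_le_mul_of_nonneg_left (min_le_right _ _) hK0.le
      _ = ε / 4 := by field_simp
  have hτ1 : s ^ 2 ≤ 1 / 2 := by nlinarith
  have hτ0 : 0 < s ^ 2 := by positivity
  have hq : 1 / 2 ≤ Real.sqrt (1 - s ^ 2) := by
    refine Real.le_sqrt_of_sq_le ?_
    nlinarith
  refine ⟨s, hs0, ?_⟩
  filter_upwards [h.upper_unif hτ0 hτ1 s (show 0 < ε / 4 by positivity)] with l hl x hx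
  have hCs : C * s ≤ K * s := by
    refine mul_le_mul_of_nonneg_right ?_ hs0.le
    have : 0 ≤ C + 2 * C * hkMoment + psiC α β * (2 * hkMoment + 2) + 1 := by positivity
    linarith
  constructor
  swap
  · have h1 := hC x hx.1
    have := mul_le_mul_of_nonneg_left hx.2 hC0
    linarith
  have h1 := hl x (by rw [abs_of_nonneg hx.1]; exact hx.2)
  rw [Real.sqrt_sq hs0.le] at h1
  have hVb : ∀ y, V (y / Real.sqrt (1 - s ^ 2)) ≤ 2 * C * (x + |x - y|) := by
    intro y
    have e : V (y / Real.sqrt (1 - s ^ 2)) = V |y / Real.sqrt (1 - s ^ 2)| := by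
      rcases abs_choice (y / Real.sqrt (1 - s ^ 2)) with e | e
      · rw [e]
      · rw [e, h.V_even]
    rw [e]
    refine (hC _ (abs_nonneg _)).trans ?_
    rw [abs_div, abs_of_nonneg (Real.sqrt_nonneg _)]
    have h2 : |y| / Real.sqrt (1 - s ^ 2) ≤ 2 * |y| := by
      rw [div_le_iff₀ (by linarith)]
      nlinarith [abs_nonneg y]
    have h3 : |y| ≤ x + |x - y| := by
      have := abs_sub_abs_le_abs_sub y x
      rw [abs_of_nonneg hx.1, abs_sub_comm y x] at this
      linarith
    calc C * (|y| / Real.sqrt (1 - s ^ 2)) ≤ C * (2 * (x + |x - y|)) :=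
          mul_le_mul_of_nonneg_left (by linarith) hC0
      _ = _ := by ring
  have i1 : Integrable fun y => hk (x - y) (s ^ 2) * (2 * C * x) := (hk_sub_integrable hτ0 x).mul_const _
  have i2 : Integrable fun y => 2 * C * (hk (x - y) (s ^ 2) * |x - y|) := (hk_abs_integrable x hτ0).const_mul _
  have h2 : ∫ y, hk (x - y) (s ^ 2) * V (y / Real.sqrt (1 - s ^ 2)) ≤ 2 * C * x + 2 * C * (hkMoment * s) := by
    calc ∫ y, hk (x - y) (s ^ 2) * V (y / Real.sqrt (1 - s ^ 2))
        ≤ ∫ y, (hk (x - y) (s ^ 2) * (2 * C * x) + 2 * C * (hk (x - y) (s ^ 2) * |x - y|)) := by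
          refine integral_mono_of_nonneg (ae_of_all _ fun y => mul_nonneg (hk_nonneg _ _) (h.V_nonneg _))
            (i1.add i2) (ae_of_all _ fun y => ?_)
          have := mul_le_mul_of_nonneg_left (hVb y) (hk_nonneg (x - y) (s ^ 2))
          beta_reduce
          linarith
      _ = _ := by
          rw [integral_add i1 i2, integral_mul_const, integral_const_mul, hk_sub_integral hτ0,
            hk_abs_integral x hτ0, Real.sqrt_sq hs0.le, one_mul]
  have h3 : 2 * C * x ≤ 2 * C * s := mul_le_mul_of_nonneg_left hx.2 (by positivity)
  have h4 : psiC α β * (2 * hkMoment + 2 * s) * s ≤ psiC α β * (2 * hkMoment + 2) * s := by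
    have : s ≤ 1 := by linarith
    gcongr
    linarith
  have h5 : K * s = 2 * C * s + 2 * C * (hkMoment * s) + psiC α β * (2 * hkMoment + 2) * s + s := by
    rw [hK]; ring
  linarith

lemma convUnif (h : UnifSol α β ustar u p w ps V) : ConvUnif u V := by
  intro ε hε
  obtain ⟨a, ha, hsm⟩ := h.small_near_zero (half_pos hε)
  obtain ⟨R, hR⟩ := (((PsiP_tendsto (α := α) (β := β)).eventually (gt_mem_nhds hε)).and
    (eventually_ge_atTop 0)).exists
  obtain ⟨Λ, hΛ⟩ := eventually_atTop.1 (hsm.and (h.unif a ha R (ε / 2) (half_pos hε)))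
  set L := max Λ 1 with hL
  have hL1 : 1 ≤ L := le_max_right _ _
  refine ⟨L ^ 2, fun t ht η hη => ?_⟩
  have ht0 : 0 < t := lt_of_lt_of_le (by positivity) ht
  set l := Real.sqrt t with hl
  have hlL : L ≤ l := Real.le_sqrt_of_sq_le ht
  have hl0 : 0 < l := Real.sqrt_pos.2 ht0
  have htl : t = l ^ 2 := (Real.sq_sqrt ht0.le).symm
  obtain ⟨k1, k2⟩ := hΛ l ((le_max_left _ _).trans hlL)
  rw [htl, mul_comm η l]
  have hu0 := h.u_nonneg (l * η) (l ^ 2)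
  have hV0 := h.V_nonneg η
  rcases le_total η a with h1 | h1
  · have := k1 η ⟨hη, h1⟩
    rw [abs_lt]
    constructor <;> linarith
  rcases le_total η R with h2 | h2
  · have := k2 η ⟨h1, h2⟩
    linarith
  · have h3 := h.u_le_PsiP hl0 hη
    have h4 := h.V_le η
    have h5 := PsiP_antitone h.hα h.hβ h2
    rw [abs_of_nonneg hη] at h4
    rw [abs_lt]
    constructor <;> linarith [hR.1]

end UnifSol

/-- identification of the limit profile: if `u(η√t, t)` converges
pointwise a.e. to some `V(η)`, then the averaged second moment and the tail functional
of `p*` converge to a common limit `γ`, `V = Φ_γ` a.e., and `u` converges uniformly to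
`Φ_γ`; moreover `Φ_γ(α) = u*` when `γ > 0` and `0 < Φ_γ(α) ≤ u*` when `γ = 0`. -/
theorem hhmo_limit_profile (α β ustar : ℝ) (hα : 0 < α) (hβ : 0 < β)
    (hu : 0 < ustar) (hsub : ustar < PsiP α β α)
    (u p : ℝ → ℝ → ℝ) (hsol : IsWeakSolution α β ustar u p)
    (pstar : ℝ → ℝ) (hP : CondP α p pstar)
    (V : ℝ → ℝ)
    (hV : ∀ᵐ η ∂(volume.restrict (Set.Ici (0:ℝ))),
      Filter.Tendsto (fun t => u (η * Real.sqrt t) t) Filter.atTop (nhds (V η))) :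
    ∃ γ : ℝ, 0 ≤ γ ∧
      Filter.Tendsto (fun x : ℝ => (1 / x) * ∫ ξ in Set.Ioc (0:ℝ) x, ξ ^ 2 * pstar ξ)
        Filter.atTop (nhds γ) ∧
      Filter.Tendsto (fun x : ℝ => x * ∫ ξ in Set.Ioi x, pstar ξ)
        Filter.atTop (nhds γ) ∧
      (∀ᵐ η ∂(volume.restrict (Set.Ici (0:ℝ))), V η = Phi α β γ η) ∧
      ConvUnif u (Phi α β γ) ∧
      (0 < γ → Phi α β γ α = ustar) ∧
      (γ = 0 → 0 < Phi α β γ α ∧ Phi α β γ α ≤ ustar) := by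
  obtain ⟨u', p', w', ps, hN, huu, hps⟩ := exists_normalSol hα hβ hu hsub hsol hP
  have hV' : ∀ᵐ η ∂(volume.restrict (Ici (0 : ℝ))),
      Tendsto (fun t : ℝ => u' (η * Real.sqrt t) t) atTop (𝓝 (V η)) := by
    filter_upwards [hV] with η hη
    refine hη.congr' ?_
    filter_upwards [eventually_gt_atTop (0:ℝ)] with t ht using (huu _ t ht).symm
  obtain ⟨V₁, hL, hV₁⟩ := hN.exists_limSol hV'
  obtain ⟨V₂, hU, hV₂⟩ := hL.exists_unifSol
  obtain ⟨γ, hγ0, hγ⟩ := hL.exists_gamma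
  have hPhi : ∀ x, 0 ≤ x → V₂ x = Phi α β γ x := fun x hx => hU.V_eq_Phi hγ hγ0 hx
  refine ⟨γ, hγ0, ?_, ?_, ?_, ?_, ?_, ?_⟩
  · refine (hL.moment_tendsto hγ).congr' ?_
    filter_upwards [eventually_gt_atTop (0:ℝ)] with x hx
    rw [intervalIntegral.integral_of_le hx.le]
    congr 1
    refine integral_congr_ae ?_
    filter_upwards [ae_restrict_of_ae_restrict_of_subset Ioc_subset_Ioi_self hps] with y hy
    rw [hy]
  · refine hγ.congr' ?_
    filter_upwards [eventually_gt_atTop (0:ℝ)] with x hx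
    rw [tailMass]
    congr 1
    exact integral_congr_ae (ae_restrict_of_ae_restrict_of_subset (Ioi_subset_Ioi hx.le) hps)
  · filter_upwards [hV₁, ae_restrict_of_ae hV₂, ae_restrict_mem measurableSet_Ici] with η h1 h2 h3
    rw [← hPhi η h3, h2, h1]
  · intro ε hε
    obtain ⟨T, hT⟩ := hU.convUnif ε hε
    refine ⟨max T 1, fun t ht η hη => ?_⟩
    rw [← huu _ t (one_pos.trans_le ((le_max_right _ _).trans ht)), ← hPhi η hη]
    exact hT t ((le_max_left _ _).trans ht) η hη
  · intro h0
    rw [← hPhi α hα.le]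
    exact hU.V_alpha_eq hγ h0.ne'
  · intro _
    rw [← hPhi α hα.le]
    exact ⟨hU.V_alpha_pos, hU.V_alpha_le⟩

end
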